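/- Let k be a field of characteristic different from 2. Suppose that every central division k-algebra of exponent 2 has trivial genus, i.e., for every central division k-algebra D of exponent 2, any central division k-algebra of the same degree as D having the same maximal subfields as D is k-isomorphic to D. Then the same property holds over the rational function field k(x): for every central division k(x)-algebra D of exponent 2, any central division k(x)-algebra of the same degree as D having the same maximal subfields as D is k(x)-isomorphic to D. -/

import Mathlib

universe u v w

/-- `D` is a central division algebra of degree `n` over the field `K`. -/
def IsCentralDivisionAlgebraOfDegree (K : Type u) [Field K] (n : ℕ)
    (D : Type v) [DivisionRing D] [Algebra K D] : Prop :=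
  FiniteDimensional K D ∧ Subalgebra.center K D = ⊥ ∧ Module.finrank K D = n ^ 2

/-- Two central division `K`-algebras of degree `n` have the same maximal subfields:
a degree `n` field extension of `K` embeds into one iff it embeds into the other. -/
def SameMaximalSubfields (K : Type u) [Field K] (n : ℕ)
    (D : Type v) [DivisionRing D] [Algebra K D]
    (D' : Type w) [DivisionRing D'] [Algebra K D'] : Prop :=
  ∀ (F : Type u) [Field F] [Algebra K F], Module.finrank K F = n →
    (Nonempty (F →ₐ[K] D) ↔ Nonempty (F →ₐ[K] D'))

/-- Every central division `K`-algebra of exponent 2 (i.e. isomorphic to its opposite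
algebra) is determined up to `K`-isomorphism by its maximal subfields. -/
def HasTrivialGenusExpTwo (K : Type u) [Field K] : Prop :=
  ∀ (n : ℕ) (D : Type u) [DivisionRing D] [Algebra K D]
    (D' : Type u) [DivisionRing D'] [Algebra K D'],
    IsCentralDivisionAlgebraOfDegree K n D →
    Nonempty (D ≃ₐ[K] Dᵐᵒᵖ) →
    IsCentralDivisionAlgebraOfDegree K n D' →
    SameMaximalSubfields K n D D' →
    Nonempty (D ≃ₐ[K] D')

section
open TensorProduct

namespace SG

/-- every linear endomorphism of a central simple algebra is a sum of two-sided multiplications -/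
theorem mulLeftRight_surj (K A : Type*) [Field K] [Ring A] [Algebra K A] [IsSimpleRing A]
    [Algebra.IsCentral K A] [FiniteDimensional K A] :
    Function.Surjective (AlgHom.mulLeftRight K A) := by
  let : Module (A ⊗[K] Aᵐᵒᵖ) A := TensorProduct.Algebra.module
  have hsm : ∀ (a : A) (b : Aᵐᵒᵖ) (x : A), (a ⊗ₜ[K] b : A ⊗[K] Aᵐᵒᵖ) • x = a * x * b.unop := by
    intro a b x
    exact AlgHom.mulLeftRight_apply K A a b x
  have hsm' : ∀ (r : A ⊗[K] Aᵐᵒᵖ) (x : A), r • x = AlgHom.mulLeftRight K A r x := fun _ _ => rfl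
  have : IsSimpleModule (A ⊗[K] Aᵐᵒᵖ) A := by
    rw [isSimpleModule_iff_toSpanSingleton_surjective]
    refine ⟨inferInstance, fun m hm => ?_⟩
    have h1 : (1 : A) ∈ TwoSidedIdeal.span {m} := by
      have := (IsSimpleRing.simple (R := A)).eq_bot_or_eq_top (TwoSidedIdeal.span {m})
      rcases this with h | h
      · exfalso
        apply hm
        have : m ∈ TwoSidedIdeal.span {m} := TwoSidedIdeal.subset_span rfl
        rw [h] at this
        simpa using this
      · rw [h]; trivial
    have key : ∀ x ∈ TwoSidedIdeal.span {m}, ∃ r : A ⊗[K] Aᵐᵒᵖ, r • m = x := by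
      intro x hx
      induction hx using TwoSidedIdeal.span_induction with
      | mem x hx => exact ⟨1, by simp only [Set.mem_singleton_iff] at hx; rw [hx, one_smul]⟩
      | zero => exact ⟨0, by rw [hsm', map_zero]; rfl⟩
      | add x y _ _ hx hy =>
        obtain ⟨r, hr⟩ := hx
        obtain ⟨s, hs⟩ := hy
        exact ⟨r + s, by rw [add_smul, hr, hs]⟩
      | neg x _ hx =>
        obtain ⟨r, hr⟩ := hx
        exact ⟨-r, by rw [neg_smul, hr]⟩
      | left_absorb a x _ hx =>
        obtain ⟨r, hr⟩ := hx
        exact ⟨(a ⊗ₜ[K] 1) * r, by rw [mul_smul, hr, hsm]; simp⟩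
      | right_absorb b x _ hx =>
        obtain ⟨r, hr⟩ := hx
        exact ⟨(1 ⊗ₜ[K] (MulOpposite.op b)) * r, by rw [mul_smul, hr, hsm]; simp⟩
    intro x
    obtain ⟨r, hr⟩ := key 1 h1
    refine ⟨(x ⊗ₜ[K] 1) * r, ?_⟩
    simp only [LinearMap.toSpanSingleton_apply]
    rw [mul_smul, hr, hsm]; simp
  -- endomorphisms are scalars
  have hend : ∀ g : Module.End (A ⊗[K] Aᵐᵒᵖ) A, ∃ c : K, ∀ x, g x = c • x := by
    intro g
    have hl : ∀ x, g x = x * g 1 := by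
      intro x
      have := g.map_smul (x ⊗ₜ[K] 1 : A ⊗[K] Aᵐᵒᵖ) 1
      simpa [hsm] using this
    have hr : ∀ x, g x = g 1 * x := by
      intro x
      have := g.map_smul (1 ⊗ₜ[K] (MulOpposite.op x) : A ⊗[K] Aᵐᵒᵖ) 1
      simpa [hsm] using this
    have hc : g 1 ∈ Subalgebra.center K A := by
      rw [Subalgebra.mem_center_iff]
      intro b; rw [← hl, ← hr]
    have := Algebra.IsCentral.out (K := K) (D := A) hc
    rw [Algebra.mem_bot] at this
    obtain ⟨c, hc⟩ := this
    exact ⟨c, fun x => by rw [hr, ← hc, Algebra.smul_def]⟩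
  intro f
  let F : Module.End (Module.End (A ⊗[K] Aᵐᵒᵖ) A) A :=
    { toFun := f
      map_add' := f.map_add
      map_smul' := by
        intro g x
        obtain ⟨c, hc⟩ := hend g
        simp [hc] }
  obtain ⟨s, hs⟩ := Module.Finite.fg_top (R := K) (M := A)
  obtain ⟨r, hr⟩ := jacobson_density F s
  refine ⟨r, LinearMap.ext_on hs (fun m hm => ?_)⟩
  rw [← hsm']
  exact (hr m hm).symm

/-- Separation: images of independent elements stay independent after any central base change. -/
theorem linInd_of_hom {K A E B ι : Type*} [Field K] [Ring A] [Algebra K A] [IsSimpleRing A]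
    [Algebra.IsCentral K A] [FiniteDimensional K A] [Field E] [Algebra K E] [Ring B] [Nontrivial B]
    [Algebra K B] [Algebra E B] [IsScalarTower K E B]
    (Φ : A →ₐ[K] B) {v : ι → A} (hv : LinearIndependent K v) :
    LinearIndependent E (fun i => Φ (v i)) := by
  classical
  rw [linearIndependent_iff']
  intro s g hg i hi
  obtain ⟨f, hf⟩ : ∃ f : Module.End K A, ∀ j, f (v j) = if j = i then 1 else 0 := by
    obtain ⟨g, hg⟩ := LinearMap.exists_leftInverse_of_injective (Finsupp.linearCombination K v)
      (LinearMap.ker_eq_bot.mpr hv)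
    refine ⟨((Finsupp.lapply i).smulRight (1 : A)).comp g, fun j => ?_⟩
    have : g (v j) = Finsupp.single j 1 := by
      have := LinearMap.congr_fun hg (Finsupp.single j 1)
      simpa using this
    simp [this, Finsupp.single_apply]
  obtain ⟨r, hr⟩ := mulLeftRight_surj K A f
  -- transport operator to B
  have key : ∀ r : A ⊗[K] Aᵐᵒᵖ, ∃ T : B →ₗ[E] B, ∀ x, T (Φ x) = Φ (AlgHom.mulLeftRight K A r x) := by
    intro r
    induction r using TensorProduct.induction_on with
    | zero => exact ⟨0, by simp⟩
    | tmul a b =>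
      refine ⟨(LinearMap.mulRight E (Φ b.unop)).comp (LinearMap.mulLeft E (Φ a)), fun x => ?_⟩
      simp
    | add x y hx hy =>
      obtain ⟨T, hT⟩ := hx
      obtain ⟨S, hS⟩ := hy
      exact ⟨T + S, fun x => by simp [hT, hS]⟩
  obtain ⟨T, hT⟩ := key r
  have := congrArg T hg
  simp only [map_sum, map_smul, hT, hr, hf, map_zero] at this
  rw [Finset.sum_eq_single i] at this
  · simpa using this
  · intro b _ hb; simp [hb]
  · exact fun h => absurd hi h

end SG
end

section
open TensorProduct

namespace SG

theorem inj_of_basis {E V W ι : Type*} [Field E] [AddCommGroup V] [Module E V] [AddCommGroup W]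
    [Module E W] (f : V →ₗ[E] W) (b : Module.Basis ι E V)
    (h : LinearIndependent E (fun i => f (b i))) : Function.Injective f := by
  rw [injective_iff_map_eq_zero]
  intro x hx
  have h2 : Finsupp.linearCombination E (fun i => f (b i)) (b.repr x) = 0 := by
    rw [← hx]
    conv_rhs => rw [← b.linearCombination_repr x]
    rw [Finsupp.apply_linearCombination]; rfl
  have := (linearIndependent_iff.mp h) _ h2
  simpa using this

theorem algHom_inj {K A E B : Type*} [Field K] [Ring A] [Algebra K A] [IsSimpleRing A]
    [Algebra.IsCentral K A] [FiniteDimensional K A] [Field E] [Algebra K E]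
    [Ring B] [Nontrivial B] [Algebra E B] (q : (E ⊗[K] A) →ₐ[E] B) : Function.Injective q := by
  let : Algebra K B := Algebra.compHom B (algebraMap K E)
  have : IsScalarTower K E B := IsScalarTower.of_algebraMap_eq fun _ => rfl
  let Φ : A →ₐ[K] B :=
    (q.restrictScalars K).comp Algebra.TensorProduct.includeRight
  let b := Module.finBasis K A
  have hli := linInd_of_hom (E := E) Φ b.linearIndependent
  refine inj_of_basis q.toLinearMap (Algebra.TensorProduct.basis E b) ?_
  have : (fun i => q.toLinearMap (Algebra.TensorProduct.basis E b i)) = fun i => Φ (b i) := by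
    ext i; simp [Φ]
  rw [this]; exact hli

theorem tensor_simple (K A E : Type*) [Field K] [Ring A] [Algebra K A] [IsSimpleRing A]
    [Algebra.IsCentral K A] [FiniteDimensional K A] [Field E] [Algebra K E] :
    IsSimpleRing (E ⊗[K] A) := by
  classical
  have hnt : Nontrivial (E ⊗[K] A) := inferInstance
  refine ⟨⟨fun I => ?_⟩⟩
  by_cases hI : I = ⊤
  · exact Or.inr hI
  left
  have hB : Nontrivial I.ringCon.Quotient := by
    refine ⟨⟨I.ringCon.mk' 1, I.ringCon.mk' 0, fun h => hI ?_⟩⟩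
    have h1 : (1 : E ⊗[K] A) ∈ I := by
      rw [TwoSidedIdeal.mem_iff]
      exact (RingCon.eq _).mp h
    exact (TwoSidedIdeal.one_mem_iff I).mp h1
  let q : (E ⊗[K] A) →ₐ[E] I.ringCon.Quotient :=
    { I.ringCon.mk' with commutes' := fun r => rfl }
  have hq : Function.Injective q := algHom_inj q
  rw [eq_bot_iff]
  intro x hx
  have : q x = q 0 := by
    rw [TwoSidedIdeal.mem_iff] at hx
    exact (RingCon.eq _).mpr hx
  have := hq this
  rw [this]; exact TwoSidedIdeal.zero_mem _

section
variable {K A E : Type*} [Field K] [Ring A] [Algebra K A] [IsSimpleRing A]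
    [Algebra.IsCentral K A] [FiniteDimensional K A] [Field E] [Algebra K E] {n : ℕ}

/-- the isomorphism attached to a splitting -/
theorem exists_splitEquiv (hn : Module.finrank K A = n ^ 2)
    (Φ : A →ₐ[K] Matrix (Fin n) (Fin n) E) :
    ∃ e : (E ⊗[K] A) ≃ₐ[E] Matrix (Fin n) (Fin n) E, ∀ a, e (1 ⊗ₜ a) = Φ a := by
  have := tensor_simple K A E
  let f : (E ⊗[K] A) →ₐ[E] Matrix (Fin n) (Fin n) E :=
    Algebra.TensorProduct.lift (Algebra.ofId E _) Φ (fun x y => Algebra.commutes _ _)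
  have hn0 : n ≠ 0 := by
    rintro rfl
    have : 0 < Module.finrank K A := Module.finrank_pos
    omega
  have : Nonempty (Fin n) := ⟨⟨0, Nat.pos_of_ne_zero hn0⟩⟩
  have hinj : Function.Injective f := RingHom.injective f.toRingHom
  have hdim : Module.finrank E (E ⊗[K] A) = Module.finrank E (Matrix (Fin n) (Fin n) E) := by
    rw [Module.finrank_baseChange, hn, Module.finrank_matrix]; simp [sq]
  have hsurj : Function.Surjective f.toLinearMap :=
    (LinearMap.injective_iff_surjective_of_finrank_eq_finrank hdim).mp hinj
  refine ⟨AlgEquiv.ofBijective f ⟨hinj, hsurj⟩, fun a => ?_⟩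
  change f (1 ⊗ₜ[K] a) = Φ a
  exact (Algebra.TensorProduct.lift_tmul _ _ _ _ _).trans (by rw [map_one, one_mul])

/-- conjugacy of splittings -/
theorem split_conj (hn : Module.finrank K A = n ^ 2)
    (Φ Ψ : A →ₐ[K] Matrix (Fin n) (Fin n) E) :
    ∃ X : Matrix (Fin n) (Fin n) E, IsUnit X ∧ ∀ a, Ψ a * X = X * Φ a := by
  obtain ⟨e, he⟩ := exists_splitEquiv hn Φ
  obtain ⟨e', he'⟩ := exists_splitEquiv hn Ψ
  let g := (Matrix.toLinAlgEquiv' (R := E) (n := Fin n)).symm.trans ((e.symm.trans e').trans Matrix.toLinAlgEquiv')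
  obtain ⟨T, hT⟩ := g.eq_linearEquivConjAlgEquiv
  refine ⟨LinearMap.toMatrixAlgEquiv' (T : (Fin n → E) →ₗ[E] (Fin n → E)), ?_, fun a => ?_⟩
  · refine IsUnit.map _ ?_
    exact (LinearMap.GeneralLinearGroup.ofLinearEquiv T).isUnit
  · have h1 : g (Matrix.toLinAlgEquiv' (Φ a)) = Matrix.toLinAlgEquiv' (Ψ a) := by
      simp only [g, AlgEquiv.trans_apply, AlgEquiv.symm_apply_apply]
      rw [← he, ← he', AlgEquiv.symm_apply_apply]
    apply (Matrix.toLinAlgEquiv' (R := E) (n := Fin n)).injective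
    rw [map_mul, map_mul, ← h1, hT]
    refine LinearMap.ext fun v => ?_
    simp [LinearEquiv.conjAlgEquiv_apply]

theorem split_span (hn : Module.finrank K A = n ^ 2)
    (Φ : A →ₐ[K] Matrix (Fin n) (Fin n) E) : Submodule.span E (Set.range Φ) = ⊤ := by
  obtain ⟨e, he⟩ := exists_splitEquiv hn Φ
  rw [eq_top_iff]
  intro x _
  obtain ⟨y, rfl⟩ := e.surjective x
  induction y using TensorProduct.induction_on with
  | zero => simp
  | tmul r a =>
    have : e (r ⊗ₜ a) = r • Φ a := by
      rw [← he, ← map_smul]; simp [TensorProduct.smul_tmul']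
    rw [this]
    exact Submodule.smul_mem _ _ (Submodule.subset_span ⟨a, rfl⟩)
  | add x y hx hy => rw [map_add]; exact Submodule.add_mem _ (hx trivial) (hy trivial)

theorem split_comm (hn : Module.finrank K A = n ^ 2)
    (Φ : A →ₐ[K] Matrix (Fin n) (Fin n) E) (Y : Matrix (Fin n) (Fin n) E)
    (hY : ∀ a, Y * Φ a = Φ a * Y) : ∃ c : E, Y = c • 1 := by
  have h : ∀ Z : Matrix (Fin n) (Fin n) E, Y * Z = Z * Y := by
    intro Z
    have hZ : Z ∈ Submodule.span E (Set.range Φ) := by rw [split_span hn]; trivial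
    induction hZ using Submodule.span_induction with
    | mem x hx => obtain ⟨a, rfl⟩ := hx; exact hY a
    | zero => simp
    | add x y _ _ hx hy => rw [mul_add, add_mul, hx, hy]
    | smul r x _ hx => simp [hx]
  have hc : Y ∈ Subalgebra.center E (Matrix (Fin n) (Fin n) E) := by
    rw [Subalgebra.mem_center_iff]; exact fun Z => (h Z).symm
  rw [Matrix.subalgebraCenter_eq_scalarAlgHom_map] at hc
  obtain ⟨c, _, hc⟩ := hc
  refine ⟨c, ?_⟩
  rw [← hc]
  simp [Matrix.smul_one_eq_diagonal]
end

end SG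
end

section
open TensorProduct

namespace SG

section
variable {F R : Type*} [Field F] [Ring R] [Algebra F R] [IsSimpleRing R] [FiniteDimensional F R]

theorem exists_simple_ideal (F : Type*) [Field F] {R : Type*} [Ring R] [Algebra F R] [IsSimpleRing R]
    [FiniteDimensional F R] : ∃ S : Submodule R R, IsSimpleModule R S := by
  have : IsArtinianRing R := IsArtinianRing.of_finite F R
  obtain ⟨S, hS⟩ := IsAtomic.exists_atom (Submodule R R)
  exact ⟨S, isSimpleModule_iff_isAtom.mpr hS⟩

theorem iso_pow (F : Type*) [Field F] {R : Type*} [Ring R] [Algebra F R] [IsSimpleRing R]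
    [FiniteDimensional F R] (S : Submodule R R) [IsSimpleModule R S] (M : Type*) [AddCommGroup M] [Module F M]
    [Module R M] [IsScalarTower F R M] [FiniteDimensional F M] :
    ∃ a : ℕ, Nonempty (M ≃ₗ[R] (Fin a → S)) ∧ Module.finrank F M = a * Module.finrank F S := by
  have : IsArtinianRing R := IsArtinianRing.of_finite F R
  have : Module.Finite R M := Module.Finite.of_restrictScalars_finite F R M
  have h : IsIsotypicOfType R M S := by
    intro m hm
    obtain ⟨I, ⟨e⟩⟩ := IsSemisimpleRing.exists_linearEquiv_ideal_of_isSimpleModule R m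
    have : IsSimpleModule R I := IsSimpleModule.congr e.symm
    obtain ⟨e'⟩ := IsSimpleRing.isIsotypic R R S I
    exact ⟨e.trans e'⟩
  obtain ⟨a, ⟨e⟩⟩ := h.linearEquiv_fun
  refine ⟨a, ⟨e⟩, ?_⟩
  rw [(e.restrictScalars F).finrank_eq, Module.finrank_pi_fintype]
  simp

theorem module_equiv_of_finrank (F : Type*) [Field F] {R : Type*} [Ring R] [Algebra F R] [IsSimpleRing R]
    [FiniteDimensional F R] (M N : Type*) [AddCommGroup M] [Module F M]
    [Module R M] [IsScalarTower F R M] [FiniteDimensional F M] [AddCommGroup N] [Module F N]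
    [Module R N] [IsScalarTower F R N] [FiniteDimensional F N]
    (h : Module.finrank F M = Module.finrank F N) : Nonempty (M ≃ₗ[R] N) := by
  obtain ⟨S, hS⟩ := exists_simple_ideal F (R := R)
  obtain ⟨a, ⟨e⟩, ha⟩ := iso_pow F S M
  obtain ⟨b, ⟨e'⟩, hb⟩ := iso_pow F S N
  have hpos : 0 < Module.finrank F S := by
    have := IsSimpleModule.nontrivial R S
    exact Module.finrank_pos
  have : a = b := by
    rw [ha, hb] at h
    exact Nat.eq_of_mul_eq_mul_right hpos h
  subst this
  exact ⟨e.trans e'.symm⟩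

end

/-- splitting over a ring homomorphism of fields -/
def Splits {K E : Type*} [Field K] [Field E] (i : K →+* E) (n : ℕ) (D : Type*) [Ring D]
    [Algebra K D] : Prop :=
  ∃ Φ : D →+* Matrix (Fin n) (Fin n) E, ∀ a, Φ (algebraMap K D a) = Matrix.scalar (Fin n) (i a)

theorem splits_algebraMap_iff {K E : Type*} [Field K] [Field E] [Algebra K E] (n : ℕ) (D : Type*) [Ring D]
    [Algebra K D] : Splits (algebraMap K E) n D ↔ Nonempty (D →ₐ[K] Matrix (Fin n) (Fin n) E) := by
  constructor
  · rintro ⟨Φ, h⟩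
    refine ⟨{ Φ with commutes' := fun a => ?_ }⟩
    change Φ _ = _
    rw [h]; rfl
  · rintro ⟨Φ⟩
    exact ⟨Φ.toRingHom, fun a => Φ.commutes a⟩

theorem Splits.comp {K E E' D : Type*} [Field K] [Field E] [Field E'] [Ring D] [Algebra K D]
    {i : K →+* E} {n : ℕ} (h : Splits i n D) (j : E →+* E') : Splits (j.comp i) n D := by
  obtain ⟨Φ, h⟩ := h
  refine ⟨j.mapMatrix.comp Φ, fun a => ?_⟩
  simp [h, Matrix.diagonal_map]

theorem Splits.of_eq {K E D : Type*} [Field K] [Field E] [Ring D] [Algebra K D]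
    {i j : K →+* E} {n : ℕ} (h : Splits i n D) (hij : i = j) : Splits j n D := hij ▸ h

/-- a representation on an `E`-space gives a splitting -/
theorem splits_of_end {K E V : Type*} [Field K] [Field E] [Algebra K E] {n : ℕ} {D : Type*} [Ring D]
    [Algebra K D] [AddCommGroup V] [Module E V] [FiniteDimensional E V] (hV : Module.finrank E V = n)
    (f : D →+* Module.End E V) (hf : ∀ a : K, f (algebraMap K D a) = algebraMap E _ (algebraMap K E a)) :
    Splits (algebraMap K E) n D := by
  let b := Module.finBasisOfFinrankEq E V hV
  refine ⟨(LinearMap.toMatrixAlgEquiv b).toAlgHom.toRingHom.comp f, fun a => ?_⟩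
  simp only [RingHom.comp_apply, hf]
  exact (LinearMap.toMatrixAlgEquiv b).commutes _

end SG
end

section
open TensorProduct

namespace SG

section
variable {K : Type*} [Field K]

theorem splits_of_embed {D F : Type*} [DivisionRing D] [Algebra K D]
    [FiniteDimensional K D] {n : ℕ} (hn : Module.finrank K D = n ^ 2) [Field F] [Algebra K F]
    (hF : Module.finrank K F = n) (f : F →ₐ[K] D) : Splits (algebraMap K F) n D := by
  let g : F →+* Dᵐᵒᵖ := f.toRingHom.toOpposite (fun x y => by
    change f x * f y = f y * f x
    rw [← map_mul, mul_comm, map_mul])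
  let : Module F D := Module.compHom D g
  have hsm : ∀ (x : F) (d : D), x • d = d * f x := fun _ _ => rfl
  have : IsScalarTower K F D := ⟨fun a x d => by
    rw [hsm, hsm, map_smul, Algebra.mul_smul_comm]⟩
  have : FiniteDimensional K F := FiniteDimensional.of_injective f.toLinearMap f.toRingHom.injective
  have : FiniteDimensional F D := Module.Finite.of_restrictScalars_finite K F D
  have hn0 : 0 < n := by rw [← hF]; exact Module.finrank_pos
  have hV : Module.finrank F D = n := by
    have := Module.finrank_mul_finrank K F D
    rw [hF, hn, sq] at this
    exact Nat.eq_of_mul_eq_mul_left hn0 this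
  let φ : D →+* Module.End F D :=
    { toFun := fun d => { toFun := fun x => d * x, map_add' := mul_add d, map_smul' := fun x y => by
                            simp [hsm, mul_assoc] }
      map_one' := by ext; simp
      map_mul' := fun x y => by ext; simp [mul_assoc]
      map_zero' := by ext; simp
      map_add' := fun x y => by ext; simp [add_mul] }
  refine splits_of_end hV φ (fun a => ?_)
  ext x
  change algebraMap K D a * x = (algebraMap K F a) • x
  rw [hsm, f.commutes, Algebra.commutes]

/-- a splitting field gives a `D`-vector space -/
theorem finrank_dvd_of_splits {D F : Type*} [DivisionRing D] [Algebra K D]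
    [FiniteDimensional K D] {n : ℕ} (hn : Module.finrank K D = n ^ 2) [Field F] [Algebra K F]
    [FiniteDimensional K F] (h : Splits (algebraMap K F) n D) : n ∣ Module.finrank K F := by
  obtain ⟨Φ⟩ := (splits_algebraMap_iff n D).mp h
  let V := Fin n → F
  let g : D →+* Module.End F V := (Matrix.toLinAlgEquiv' (R := F) (n := Fin n)).toAlgHom.toRingHom.comp Φ.toRingHom
  let : Module D V := Module.compHom V g
  have : IsScalarTower K D V := ⟨fun a d v => by
    change g (a • d) v = a • (g d v)
    have : g (a • d) = (algebraMap K F a) • g d := by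
      simp only [g, RingHom.comp_apply]
      change Matrix.toLinAlgEquiv' (Φ (a • d)) = _ • Matrix.toLinAlgEquiv' (Φ d)
      rw [map_smul, ← algebraMap_smul F a (Φ d), map_smul]
    rw [this, LinearMap.smul_apply, algebraMap_smul]⟩
  have h1 := Module.finrank_mul_finrank K D V
  have h2 : Module.finrank K V = n * Module.finrank K F := by
    rw [Module.finrank_pi_fintype]; simp
  have hn0 : 0 < n := by
    have : 0 < Module.finrank K D := Module.finrank_pos
    rcases Nat.eq_zero_or_pos n with h | h
    · subst h; omega
    · exact h
  rw [h2, hn, sq, mul_assoc] at h1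
  exact ⟨_, (Nat.eq_of_mul_eq_mul_left hn0 h1).symm⟩

theorem embed_of_splits {D F : Type*} [DivisionRing D] [Algebra K D]
    [FiniteDimensional K D] {n : ℕ} (hn : Module.finrank K D = n ^ 2) [Field F] [Algebra K F]
    (hF : Module.finrank K F = n) (h : Splits (algebraMap K F) n D) : Nonempty (F →ₐ[K] D) := by
  obtain ⟨Φ⟩ := (splits_algebraMap_iff n D).mp h
  have hn0 : 0 < n := by
    have : 0 < Module.finrank K D := Module.finrank_pos
    rcases Nat.eq_zero_or_pos n with h | h
    · subst h; omega
    · exact h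
  have : FiniteDimensional K F := FiniteDimensional.of_finrank_pos (by omega)
  let V := Fin n → F
  let v : V := fun _ => 1
  have hv : v ≠ 0 := fun h => one_ne_zero (congrFun h ⟨0, hn0⟩)
  let e : D →ₗ[K] V :=
    { toFun := fun d => (Φ d).mulVec v
      map_add' := fun x y => by rw [map_add, Matrix.add_mulVec]
      map_smul' := fun a x => by rw [map_smul, Matrix.smul_mulVec]; rfl }
  have hinj : Function.Injective e := by
    rw [injective_iff_map_eq_zero]
    intro d hd
    by_contra hd0
    apply hv
    have : (Φ d⁻¹).mulVec ((Φ d).mulVec v) = 0 := by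
      change (Φ d).mulVec v = 0 at hd
      rw [hd, Matrix.mulVec_zero]
    rwa [Matrix.mulVec_mulVec, ← map_mul, inv_mul_cancel₀ hd0, map_one, Matrix.one_mulVec] at this
  have hdim : Module.finrank K D = Module.finrank K V := by
    rw [Module.finrank_pi_fintype]; simp [hn, hF, sq]
  have hsurj := (LinearMap.injective_iff_surjective_of_finrank_eq_finrank hdim).mp hinj
  choose c hc using fun x : F => hsurj (x • v)
  have hc' : ∀ x, (Φ (c x)).mulVec v = x • v := hc
  have hmul : ∀ x y, c (x * y) = c y * c x := by
    intro x y
    apply hinj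
    change (Φ _).mulVec v = (Φ _).mulVec v
    rw [hc', map_mul, ← Matrix.mulVec_mulVec, hc', Matrix.mulVec_smul, hc', mul_smul]
  refine ⟨AlgHom.ofLinearMap
    { toFun := c
      map_add' := fun x y => hinj (by
        rw [map_add, hc, hc, hc, add_smul])
      map_smul' := fun a x => hinj (by
        rw [hc, map_smul, hc]; simp) } ?_ ?_⟩
  · apply hinj
    refine (hc' 1).trans ?_
    change _ = (Φ 1).mulVec v
    rw [map_one Φ, Matrix.one_mulVec, one_smul]
  · intro x y
    change c (x * y) = c x * c y
    rw [mul_comm, hmul]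

end

section
variable {K : Type*} [Field K] {A : Type*} [Ring A] [Algebra K A] [IsSimpleRing A]
    [Algebra.IsCentral K A] [FiniteDimensional K A] {n : ℕ}

/-- The simple ideal of `F ⊗ A` controls splitting. -/
theorem simple_dvd_of_splits {F F' : Type*} [Field F] [Algebra K F] [Field F'] [Algebra K F'] [Algebra F F']
    [IsScalarTower K F F'] [FiniteDimensional F F'] (S : Submodule (F ⊗[K] A) (F ⊗[K] A))
    [IsSimpleModule (F ⊗[K] A) S] (h : Splits (algebraMap K F') n A) :
    Module.finrank F S ∣ n * Module.finrank F F' := by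
  have := tensor_simple K A F
  obtain ⟨Φ⟩ := (splits_algebraMap_iff n A).mp h
  let f : (F ⊗[K] A) →ₐ[F] Matrix (Fin n) (Fin n) F' :=
    Algebra.TensorProduct.lift (Algebra.ofId F _) Φ (fun x y => Algebra.commutes _ _)
  let V := Fin n → F'
  let g : (F ⊗[K] A) →+* Module.End F' V :=
    (Matrix.toLinAlgEquiv' (R := F') (n := Fin n)).toAlgHom.toRingHom.comp f.toRingHom
  let : Module (F ⊗[K] A) V := Module.compHom V g
  have : IsScalarTower F (F ⊗[K] A) V := ⟨fun a d v => by
    change g (a • d) v = a • (g d v)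
    have : g (a • d) = (algebraMap F F' a) • g d := by
      simp only [g, RingHom.comp_apply]
      change Matrix.toLinAlgEquiv' (f (a • d)) = _ • Matrix.toLinAlgEquiv' (f d)
      rw [map_smul, ← algebraMap_smul F' a (f d), map_smul]
    rw [this, LinearMap.smul_apply, algebraMap_smul]⟩
  obtain ⟨a, _, ha⟩ := iso_pow F S V
  have h2 : Module.finrank F V = n * Module.finrank F F' := by
    rw [Module.finrank_pi_fintype]; simp
  rw [← h2, ha]; exact dvd_mul_left _ _

theorem splits_of_simple_dvd {F : Type*} [Field F] [Algebra K F]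
    (S : Submodule (F ⊗[K] A) (F ⊗[K] A))
    (h : Module.finrank F S ∣ n) : Splits (algebraMap K F) n A := by
  obtain ⟨b, hb⟩ := h
  let V := Fin b → S
  have hV : Module.finrank F V = n := by
    rw [Module.finrank_pi_fintype]; simp [hb, mul_comm]
  let φ : (F ⊗[K] A) →ₐ[F] Module.End F V := Algebra.lsmul F F V
  refine splits_of_end hV (φ.toRingHom.comp (Algebra.TensorProduct.includeRight (R := K) (A := F) (B := A)).toRingHom)
    (fun a => ?_)
  rw [← φ.commutes]
  change φ (1 ⊗ₜ (algebraMap K A a)) = φ _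
  congr 1
  rw [Algebra.TensorProduct.algebraMap_apply]
  rw [Algebra.algebraMap_eq_smul_one, Algebra.algebraMap_eq_smul_one, TensorProduct.tmul_smul, TensorProduct.smul_tmul', algebraMap_smul]

/-- odd degree extensions do not help splitting -/
theorem splits_of_odd {F F' : Type*} [Field F] [Algebra K F] [Field F'] [Algebra K F'] [Algebra F F']
    [IsScalarTower K F F'] [FiniteDimensional F F'] (hn : Module.finrank K A = n ^ 2) {r : ℕ} (hr : n = 2 ^ r)
    (hodd : Odd (Module.finrank F F')) (h : Splits (algebraMap K F') n A) :
    Splits (algebraMap K F) n A := by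
  have := tensor_simple K A F
  obtain ⟨S, hS⟩ := exists_simple_ideal F (R := F ⊗[K] A)
  apply splits_of_simple_dvd S
  have h1 := simple_dvd_of_splits S h
  have h2 : Module.finrank F S ∣ n ^ 2 := by
    obtain ⟨a, _, ha⟩ := iso_pow F S (F ⊗[K] A)
    rw [Module.finrank_baseChange, hn] at ha
    rw [ha]; exact dvd_mul_left _ _
  refine (Nat.Coprime.dvd_of_dvd_mul_right ?_ h1)
  apply Nat.Coprime.coprime_dvd_left h2
  rw [hr, ← pow_mul]
  exact Nat.Coprime.pow_left _ (Nat.coprime_two_left.mpr hodd)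

end

end SG
end

section
open TensorProduct

namespace SG

theorem pos_of_sq {K D : Type*} [Field K] [Ring D] [Nontrivial D] [Algebra K D] [FiniteDimensional K D]
    {n : ℕ} (hn : Module.finrank K D = n ^ 2) : 0 < n := by
  have : 0 < Module.finrank K D := Module.finrank_pos
  rcases Nat.eq_zero_or_pos n with h | h
  · subst h; omega
  · exact h

section
variable {K : Type*} [Field K] {A : Type*} [Ring A] [Algebra K A]

theorem tensor_central (K A E : Type*) [Field K] [Ring A] [Algebra K A] [Algebra.IsCentral K A]
    [Field E] [Algebra K E] : Algebra.IsCentral E (E ⊗[K] A) := by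
  refine ⟨fun x hx => ?_⟩
  rw [Subalgebra.mem_center_iff] at hx
  have h1 : x ∈ Subalgebra.centralizer K
      ((Algebra.TensorProduct.includeRight : A →ₐ[K] E ⊗[K] A).range : Set (E ⊗[K] A)) := by
    rw [Subalgebra.mem_centralizer_iff]
    intro g _
    exact hx g
  rw [Subalgebra.centralizer_range_includeRight_eq_center_tensorProduct] at h1
  obtain ⟨y, rfl⟩ := h1
  clear hx
  induction y using TensorProduct.induction_on with
  | zero => simp
  | tmul e c =>
    obtain ⟨c, hc⟩ := c
    have := Algebra.IsCentral.out (K := K) (D := A) hc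
    rw [Algebra.mem_bot] at this
    obtain ⟨d, rfl⟩ := this
    rw [Algebra.mem_bot]
    refine ⟨e * algebraMap K E d, ?_⟩
    simp only [Algebra.TensorProduct.algebraMap_apply]
    change _ = e ⊗ₜ (algebraMap K A d)
    rw [Algebra.algebraMap_eq_smul_one d, Algebra.algebraMap_eq_smul_one d, TensorProduct.tmul_smul,
      TensorProduct.smul_tmul']
    simp [Algebra.smul_def, mul_comm]
  | add x y hx hy => simpa using add_mem hx hy

theorem splits_tensor_iff {n : ℕ} {F E : Type*} [Field F] [Algebra K F] [Field E] [Algebra K E] [Algebra F E]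
    [IsScalarTower K F E] :
    Splits (algebraMap F E) n (F ⊗[K] A) ↔ Splits (algebraMap K E) n A := by
  rw [splits_algebraMap_iff, splits_algebraMap_iff]
  constructor
  · rintro ⟨Φ⟩
    exact ⟨(Φ.restrictScalars K).comp Algebra.TensorProduct.includeRight⟩
  · rintro ⟨Φ⟩
    exact ⟨Algebra.TensorProduct.lift (Algebra.ofId F _) Φ (fun x y => Algebra.commutes _ _)⟩

/-- odd degree base change of a 2-power degree division algebra is division -/
theorem odd_baseChange_isUnit {F D : Type*} [DivisionRing D] [Algebra K D] [Algebra.IsCentral K D]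
    [FiniteDimensional K D] [Field F] [Algebra K F] [FiniteDimensional K F] {n r : ℕ}
    (hn : Module.finrank K D = n ^ 2) (hr : n = 2 ^ r) (hodd : Odd (Module.finrank K F))
    (x : F ⊗[K] D) : IsUnit x ∨ x = 0 := by
  have := tensor_simple K D F
  obtain ⟨S, hS⟩ := exists_simple_ideal F (R := F ⊗[K] D)
  have hnt : Nontrivial S := IsSimpleModule.nontrivial (F ⊗[K] D) S
  let : Module D S := Module.compHom S (Algebra.TensorProduct.includeRight : D →ₐ[K] F ⊗[K] D).toRingHom
  have hsm : ∀ (d : D) (s : S), d • s = ((1 : F) ⊗ₜ[K] d) • s := fun _ _ => rfl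
  have : IsScalarTower K D S := ⟨fun a d v => by
    rw [hsm, hsm, TensorProduct.tmul_smul, smul_assoc]⟩
  have h1 := Module.finrank_mul_finrank K D S
  have h2 := Module.finrank_mul_finrank K F S
  have h3 : n ^ 2 ∣ Module.finrank F S := by
    refine Nat.Coprime.dvd_of_dvd_mul_left (m := Module.finrank K F) ?_ ?_
    · rw [hr, ← pow_mul]
      exact Nat.Coprime.pow_left _ (Nat.coprime_two_left.mpr hodd)
    · rw [h2, ← h1, hn]; exact dvd_mul_right _ _
  have h4 : Module.finrank F (F ⊗[K] D) = n ^ 2 := by rw [Module.finrank_baseChange, hn]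
  have h5 : S.restrictScalars F = ⊤ := by
    apply Submodule.eq_top_of_finrank_eq
    rw [h4]
    have : Module.finrank F S ≤ Module.finrank F (F ⊗[K] D) :=
      Submodule.finrank_le (S.restrictScalars F)
    rw [h4] at this
    have hp : 0 < Module.finrank F S := Module.finrank_pos
    exact le_antisymm this (Nat.le_of_dvd hp h3)
  have h6 : S = ⊤ := by
    rw [eq_top_iff]; intro y _
    have : y ∈ S.restrictScalars F := by rw [h5]; trivial
    exact this
  subst h6
  have hs : IsSimpleModule (F ⊗[K] D) (F ⊗[K] D) := IsSimpleModule.congr Submodule.topEquiv.symm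
  rw [or_iff_not_imp_right]
  intro hx
  have hinv : ∀ y : F ⊗[K] D, y ≠ 0 → ∃ z, z * y = 1 := fun y hy => by
    obtain ⟨z, hz⟩ := IsSimpleModule.toSpanSingleton_surjective (F ⊗[K] D) hy 1
    exact ⟨z, hz⟩
  obtain ⟨y, hy⟩ := hinv x hx
  have hy0 : y ≠ 0 := by rintro rfl; simp at hy
  obtain ⟨z, hz⟩ := hinv y hy0
  have : z = x := left_inv_eq_right_inv hz hy
  subst this
  exact ⟨⟨z, y, hz, hy⟩, rfl⟩
end

section
variable {K : Type*} [Field K] {D : Type*} [DivisionRing D] [Algebra K D] [Algebra.IsCentral K D]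
    [FiniteDimensional K D]

/-- self-centralizing subfields are maximal -/
theorem selfCentralizing_finrank {F : Type*} [Field F] [Algebra K F] (f : F →ₐ[K] D)
    (hf : ∀ u : D, (∀ s, u * f s = f s * u) → ∃ s, u = f s) :
    Module.finrank K F ^ 2 = Module.finrank K D := by
  let g : F →+* Dᵐᵒᵖ := f.toRingHom.toOpposite (fun x y => by
    change f x * f y = f y * f x
    rw [← map_mul, mul_comm, map_mul])
  let : Module F D := Module.compHom D g
  have hsm : ∀ (x : F) (d : D), x • d = d * f x := fun _ _ => rfl
  have : IsScalarTower K F D := ⟨fun a x d => by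
    rw [hsm, hsm, map_smul, Algebra.mul_smul_comm]⟩
  have : FiniteDimensional K F := FiniteDimensional.of_injective f.toLinearMap f.toRingHom.injective
  have : FiniteDimensional F D := Module.Finite.of_restrictScalars_finite K F D
  let φ : D →ₐ[K] Module.End F D :=
    { toFun := fun d => { toFun := fun x => d * x, map_add' := mul_add d, map_smul' := fun x y => by
                            simp [hsm, mul_assoc] }
      map_one' := by ext; simp
      map_mul' := fun x y => by ext; simp [mul_assoc]
      map_zero' := by ext; simp
      map_add' := fun x y => by ext; simp [add_mul]
      commutes' := fun a => by
        ext x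
        change algebraMap K D a * x = a • x
        rw [Algebra.smul_def] }
  let q : (F ⊗[K] D) →ₐ[F] Module.End F D :=
    Algebra.TensorProduct.lift (Algebra.ofId F _) φ (fun x y => Algebra.commutes _ _)
  have hq : Function.Injective q := algHom_inj q
  have hqt : ∀ s d x, q (s ⊗ₜ d) x = d * x * f s := by
    intro s d x
    have h0 : q (s ⊗ₜ d) = (Algebra.ofId F (Module.End F D) s) * φ d := Algebra.TensorProduct.lift_tmul _ _ _ s d
    rw [h0]
    rfl
  let : Module (F ⊗[K] D) D := Module.compHom D q.toRingHom
  have hsm' : ∀ (r : F ⊗[K] D) (x : D), r • x = q r x := fun _ _ => rfl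
  have : IsSimpleModule (F ⊗[K] D) D := by
    rw [isSimpleModule_iff_toSpanSingleton_surjective]
    refine ⟨inferInstance, fun m hm x => ⟨1 ⊗ₜ (x * m⁻¹), ?_⟩⟩
    simp [hsm', hqt, hm]
  have hend : ∀ h : Module.End (F ⊗[K] D) D, ∃ c : F, ∀ x, h x = c • x := by
    intro h
    have hl : ∀ x, h x = x * h 1 := by
      intro x
      have := h.map_smul (1 ⊗ₜ[K] x : F ⊗[K] D) 1
      simpa [hsm', hqt] using this
    obtain ⟨c, hc⟩ := hf (h 1) (fun s => by
      have := h.map_smul (s ⊗ₜ[K] 1 : F ⊗[K] D) 1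
      simp only [hsm', hqt, one_mul] at this
      rw [← this, hl])
    exact ⟨c, fun x => by rw [hl, hsm, hc]⟩
  have hsurj : Function.Surjective q := by
    intro T
    let G : Module.End (Module.End (F ⊗[K] D) D) D :=
      { toFun := T
        map_add' := T.map_add
        map_smul' := by
          intro g x
          obtain ⟨c, hc⟩ := hend g
          simp [hc] }
    obtain ⟨s, hs⟩ := Module.Finite.fg_top (R := K) (M := D)
    obtain ⟨r, hr⟩ := jacobson_density G s
    refine ⟨r, ?_⟩
    have : (q r).restrictScalars K = T.restrictScalars K :=
      LinearMap.ext_on hs (fun m hm => (hr m hm).symm)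
    ext x
    exact LinearMap.congr_fun this x
  have e := LinearEquiv.ofBijective q.toLinearMap ⟨hq, hsurj⟩
  have h1 := e.finrank_eq
  rw [Module.finrank_baseChange, Module.finrank_linearMap] at h1
  have h2 := Module.finrank_mul_finrank K F D
  have hpos : 0 < Module.finrank F D := Module.finrank_pos
  rw [h1] at h2
  have := Nat.eq_of_mul_eq_mul_right hpos h2
  rw [h1, this, sq]

/-- maximal commutative subalgebras of a subalgebra -/
theorem exists_max_comm (C : Subalgebra K D) : ∃ S : Subalgebra K D, S ≤ C ∧
    (∀ x ∈ S, ∀ y ∈ S, x * y = y * x) ∧ ∀ u ∈ C, (∀ s ∈ S, u * s = s * u) → u ∈ S := by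
  let P : ℕ → Prop := fun m => ∃ S : Subalgebra K D, S ≤ C ∧
    (∀ x ∈ S, ∀ y ∈ S, x * y = y * x) ∧ m = Module.finrank K S
  have hP0 : P (Module.finrank K (⊥ : Subalgebra K D)) := by
    refine ⟨⊥, bot_le, ?_, rfl⟩
    intro x hx y hy
    rw [Algebra.mem_bot] at hx
    obtain ⟨a, rfl⟩ := hx
    exact Algebra.commutes _ _
  have hb : ∀ m, P m → m ≤ Module.finrank K D := by
    rintro m ⟨S, _, _, rfl⟩
    exact Submodule.finrank_le (Subalgebra.toSubmodule S)
  classical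
  have hfin := Nat.findGreatest_spec (P := P) (hb _ hP0) hP0
  obtain ⟨S, hSC, hcomm, hdim⟩ := hfin
  refine ⟨S, hSC, hcomm, fun u hu hus => ?_⟩
  let T := Algebra.adjoin K ((S : Set D) ∪ {u})
  have hT : ∀ x ∈ T, ∀ y ∈ T, x * y = y * x := by
    have hset : ∀ x ∈ ((S : Set D) ∪ {u}), ∀ y ∈ ((S : Set D) ∪ {u}), x * y = y * x := by
      rintro x (hx | hx) y (hy | hy)
      · exact hcomm x hx y hy
      · rw [Set.mem_singleton_iff.mp hy]; exact (hus x hx).symm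
      · rw [Set.mem_singleton_iff.mp hx]; exact (hus y hy)
      · rw [Set.mem_singleton_iff.mp hx, Set.mem_singleton_iff.mp hy]
    have := Algebra.isMulCommutative_adjoin K hset
    intro x hx y hy
    exact congrArg Subtype.val (this.is_comm.comm (⟨x, hx⟩ : T) ⟨y, hy⟩)
  have hST : S ≤ T := fun x hx => Algebra.subset_adjoin (Or.inl hx)
  have hTC : T ≤ C := by
    apply Algebra.adjoin_le
    rintro x (hx | hx)
    · exact hSC hx
    · rw [Set.mem_singleton_iff.mp hx]; exact hu
  have hle : Module.finrank K T ≤ Module.finrank K S := by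
    rw [← hdim]
    exact Nat.le_findGreatest (hb _ ⟨T, hTC, hT, rfl⟩) ⟨T, hTC, hT, rfl⟩
  have heq : Subalgebra.toSubmodule S = Subalgebra.toSubmodule T :=
    Submodule.eq_of_le_of_finrank_le (fun x hx => hST hx) hle
  have : u ∈ Subalgebra.toSubmodule T := Algebra.subset_adjoin (Or.inr rfl)
  rw [← heq] at this
  exact this

end

/-- a commutative subalgebra of a f.d. division algebra is a field -/
@[reducible] noncomputable def subField {K D : Type*} [Field K] [DivisionRing D] [Algebra K D] [FiniteDimensional K D]
    (S : Subalgebra K D) (hS : ∀ x ∈ S, ∀ y ∈ S, x * y = y * x) : Field S :=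
  let i1 : CommRing S := { (inferInstance : Ring S) with mul_comm := fun x y => Subtype.ext (hS x x.2 y y.2) }
  let i2 : IsDomain S := inferInstance
  let i3 : Algebra K S := { (inferInstance : Algebra K S) with }
  fieldOfFiniteDimensional K S

theorem exists_field_of_comm {K : Type*} {D : Type u} [Field K] [DivisionRing D] [Algebra K D] [FiniteDimensional K D]
    (S : Subalgebra K D) (hS : ∀ x ∈ S, ∀ y ∈ S, x * y = y * x) :
    ∃ (P : Type u) (_ : Field P) (_ : Algebra K P) (f : P →ₐ[K] D), ∀ x, x ∈ S ↔ ∃ y, f y = x :=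
  ⟨S, subField S hS, inferInstance, S.val, fun x => ⟨fun h => ⟨⟨x, h⟩, rfl⟩, fun ⟨y, hy⟩ => hy ▸ y.2⟩⟩

theorem exists_max_subfield {K : Type*} {D : Type u} [Field K] [DivisionRing D] [Algebra K D] [Algebra.IsCentral K D]
    [FiniteDimensional K D] {n : ℕ} (hn : Module.finrank K D = n ^ 2) :
    ∃ (P : Type u) (_ : Field P) (_ : Algebra K P),
      Module.finrank K P = n ∧ Splits (algebraMap K P) n D := by
  obtain ⟨S, _, h1, h2⟩ := exists_max_comm (⊤ : Subalgebra K D)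
  obtain ⟨P, i1, i2, f, hf⟩ := exists_field_of_comm S h1
  refine ⟨P, i1, i2, ?_⟩
  have h3 := selfCentralizing_finrank f (fun u hu => by
    have := h2 u trivial (fun s hs => by
      obtain ⟨y, rfl⟩ := (hf s).mp hs
      exact hu y)
    obtain ⟨y, rfl⟩ := (hf u).mp this
    exact ⟨y, rfl⟩)
  have h4 : Module.finrank K P = n := by
    rw [hn] at h3
    exact Nat.pow_left_injective (n := 2) (by norm_num) h3
  exact ⟨h4, splits_of_embed hn h4 f⟩

end SG
end

section
open TensorProduct Polynomial

namespace SG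

set_option maxHeartbeats 2000000 in
/-- quadratic refinement of splitting fields -/
theorem quad_refine {K : Type u} [Field K] (h2 : (2 : K) ≠ 0) {D : Type u} [DivisionRing D] [Algebra K D]
    [Algebra.IsCentral K D] [FiniteDimensional K D] {n : ℕ} (hn : Module.finrank K D = n ^ 2)
    (a : K) (ha : ¬ ∃ c : K, c ^ 2 = a) {Q : Type u} [Field Q] [Algebra K Q] [FiniteDimensional K Q]
    (hQ : Splits (algebraMap K Q) n D) {s : ℕ} (hs : Module.finrank K Q = 2 ^ s)
    (haQ : ∃ c : Q, c ^ 2 = algebraMap K Q a) :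
    ∃ (P : Type u) (_ : Field P) (_ : Algebra K P), FiniteDimensional K P ∧
      (¬ ∃ c : P, c ^ 2 = algebraMap K P a) ∧ 2 * Module.finrank K P ∣ Module.finrank K Q ∧
      ∀ (P' : Type u) [Field P'] [Algebra K P'] [Algebra P P'] [IsScalarTower K P P'],
        (∃ c : P', c ^ 2 = algebraMap K P' a) → Splits (algebraMap K P') n D := by
  have hdvd := finrank_dvd_of_splits hn hQ
  by_cases hD : ∃ c : D, c ^ 2 = algebraMap K D a
  · obtain ⟨α, hα⟩ := hD
    have h2D : (2 : D) ≠ 0 := by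
      have := (algebraMap K D).injective.ne h2
      rwa [map_ofNat, map_zero] at this
    have hx : ∃ x, x * α ≠ α * x := by
      by_contra! hcon
      have : α ∈ Subalgebra.center K D := by rw [Subalgebra.mem_center_iff]; exact hcon
      have := Algebra.IsCentral.out (K := K) (D := D) this
      rw [Algebra.mem_bot] at this
      obtain ⟨c, hc⟩ := this
      apply ha
      refine ⟨c, (algebraMap K D).injective ?_⟩
      rw [map_pow, hc, hα]
    obtain ⟨x, hx⟩ := hx
    have hα0 : α ≠ 0 := by rintro rfl; simp at hx
    have hαc : ∀ y, α ^ 2 * y = y * α ^ 2 := fun y => by rw [hα, Algebra.commutes]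
    obtain ⟨z, hz0, hz⟩ : ∃ z : D, z ≠ 0 ∧ α * z = - (z * α) := by
      refine ⟨x * α - α * x, sub_ne_zero.mpr hx, ?_⟩
      have := hαc x
      simp only [sq, mul_sub, sub_mul, ← mul_assoc] at this ⊢
      rw [this]
      abel
    have hz' : z * α = - (α * z) := by rw [hz, neg_neg]
    let C := Subalgebra.centralizer K ({α, z} : Set D)
    have hC : ∀ u, u ∈ C ↔ α * u = u * α ∧ z * u = u * z := by
      intro u
      rw [Subalgebra.mem_centralizer_iff]
      simp
    obtain ⟨P0, hPC, hPcomm, hPmax⟩ := exists_max_comm C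
    have hz2 : z ^ 2 ∈ P0 := by
      apply hPmax
      · rw [hC]
        constructor
        · rw [sq, ← mul_assoc, hz, neg_mul, mul_assoc z α z, hz]; noncomm_ring
        · noncomm_ring
      · intro s hs
        have := ((hC s).mp (hPC hs)).2
        rw [sq, mul_assoc, this, ← mul_assoc, this, mul_assoc]
    obtain ⟨P, i1, i2, f, hf⟩ := exists_field_of_comm P0 hPcomm
    have hfα : ∀ p, α * f p = f p * α := fun p => ((hC _).mp (hPC ((hf _).mpr ⟨p, rfl⟩))).1
    have hfz : ∀ p, z * f p = f p * z := fun p => ((hC _).mp (hPC ((hf _).mpr ⟨p, rfl⟩))).2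
    have hfd : FiniteDimensional K P := FiniteDimensional.of_injective f.toLinearMap f.toRingHom.injective
    have hnr : ¬ ∃ c : P, c ^ 2 = algebraMap K P a := by
      rintro ⟨c, hc⟩
      have h1 : (f c - α) * (f c + α) = 0 := by
        have : f c ^ 2 = α ^ 2 := by rw [← map_pow, hc, hα]; exact f.commutes a
        rw [sub_mul, mul_add, mul_add, hfα c, ← sq, ← sq, this]; abel
      have h3 : α * z = z * α := by
        rcases mul_eq_zero.mp h1 with h | h
        · rw [← sub_eq_zero.mp h]; exact (hfz c).symm
        · have : α = - f c := (neg_eq_of_add_eq_zero_right h).symm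
          rw [this, neg_mul, mul_neg, hfz c]
      rw [h3] at hz
      have : (2 : D) * (z * α) = 0 := by rw [two_mul]; nth_rewrite 2 [hz]; simp
      simp [h2D, hz0, hα0] at this
    -- the quadratic extension
    let p : P[X] := X ^ 2 - Polynomial.C (algebraMap K P a)
    have hirr : Irreducible p := by
      apply X_pow_sub_C_irreducible_of_prime Nat.prime_two
      intro b hb; exact hnr ⟨b, hb⟩
    have : Fact (Irreducible p) := ⟨hirr⟩
    let T := AdjoinRoot p
    have hp0 : p ≠ 0 := hirr.ne_zero
    have hpm : p.Monic := monic_X_pow_sub_C _ two_ne_zero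
    have hpd : p.natDegree = 2 := natDegree_X_pow_sub_C
    have hTd : Module.finrank P T = 2 := by
      have := (AdjoinRoot.powerBasis' hpm).finrank
      rw [this]; exact hpd
    have : FiniteDimensional P T := FiniteDimensional.of_finrank_pos (by omega)
    have hTK : Module.finrank K T = 2 * Module.finrank K P := by
      rw [← Module.finrank_mul_finrank K P T, hTd, mul_comm]
    have : FiniteDimensional K T := FiniteDimensional.trans K P T
    -- embedding of T in D
    let Tα : Subalgebra K D := Algebra.adjoin K ((P0 : Set D) ∪ {α})
    have hset : ∀ x ∈ ((P0 : Set D) ∪ {α}), ∀ y ∈ ((P0 : Set D) ∪ {α}), x * y = y * x := by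
      rintro x (hx | hx) y (hy | hy)
      · exact hPcomm x hx y hy
      · rw [Set.mem_singleton_iff.mp hy]; exact ((hC x).mp (hPC hx)).1.symm
      · rw [Set.mem_singleton_iff.mp hx]; exact ((hC y).mp (hPC hy)).1
      · rw [Set.mem_singleton_iff.mp hx, Set.mem_singleton_iff.mp hy]
    have hTcomm := Algebra.isMulCommutative_adjoin K hset
    obtain ⟨R, j1, j2, g, hg⟩ := exists_field_of_comm Tα
      (fun x hx y hy => congrArg Subtype.val (hTcomm.is_comm.comm (⟨x, hx⟩ : Tα) ⟨y, hy⟩))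
    have hlift : ∀ p, ∃ r, g r = f p := fun p => (hg _).mp (Algebra.subset_adjoin (Or.inl ((hf _).mpr ⟨p, rfl⟩)))
    obtain ⟨rα, hrα⟩ : ∃ r, g r = α := (hg _).mp (Algebra.subset_adjoin (Or.inr rfl))
    choose l hl using hlift
    have ginj : Function.Injective g := g.toRingHom.injective
    let lh : P →ₐ[K] R := AlgHom.ofLinearMap
      { toFun := l
        map_add' := fun x y => ginj (by rw [map_add, hl, hl, hl, map_add])
        map_smul' := fun c x => ginj (by rw [hl, map_smul, map_smul]; simp [hl]) }
      (ginj (by change g (l 1) = _; rw [hl, map_one, map_one]))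
      (fun x y => ginj (by change g (l _) = g (l _ * l _); rw [map_mul, hl, hl, hl, map_mul]))
    have hlh : ∀ p, g (lh p) = f p := hl
    let : Algebra P R := lh.toRingHom.toAlgebra
    have hev : (p.eval₂ (algebraMap P R) rα) = 0 := by
      apply ginj
      simp only [p, eval₂_sub, eval₂_pow, eval₂_X, eval₂_C, map_sub, map_pow, hrα, map_zero, hα]
      have : g (algebraMap P R (algebraMap K P a)) = f (algebraMap K P a) := hl _
      rw [this, f.commutes, sub_self]
    -- self-centralizing T
    let m : T →+* R := AdjoinRoot.lift (algebraMap P R) rα hev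
    let gm : T →ₐ[K] D :=
      { (g.toRingHom.comp m) with
        commutes' := fun c => by
          change g (m (algebraMap K T c)) = _
          rw [IsScalarTower.algebraMap_apply K P T]
          have : m (algebraMap P T (algebraMap K P c)) = algebraMap P R (algebraMap K P c) :=
            AdjoinRoot.lift_of _
          rw [this]
          have : g (algebraMap P R (algebraMap K P c)) = f (algebraMap K P c) := hl _
          rw [this, f.commutes] }
    have hgm1 : ∀ q : P, gm (algebraMap P T q) = f q := by
      intro q
      change g (m (algebraMap P T q)) = _
      have : m (algebraMap P T q) = algebraMap P R q :=
            AdjoinRoot.lift_of _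
      rw [this]; exact hl _
    have hgm2 : gm (AdjoinRoot.root p) = α := by
      change g (m (AdjoinRoot.root p)) = _
      have : m (AdjoinRoot.root p) = rα := AdjoinRoot.lift_root _
      rw [this, hrα]
    have hsc := selfCentralizing_finrank gm (fun u hu => by
      have huα : u * α = α * u := by have := hu (AdjoinRoot.root p); rwa [hgm2] at this
      have huf : ∀ q, u * f q = f q * u := fun q => by
        have := hu (algebraMap P T q); rwa [hgm1] at this
      have hz2u : z * z * u = u * (z * z) := by
        obtain ⟨q, hq⟩ := (hf _).mp hz2
        rw [← sq, ← hq]; exact (huf q).symm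
      have hzi : z⁻¹ * α = - (α * z⁻¹) := by
        have h := congrArg (fun w => z⁻¹ * w * z⁻¹) hz
        rw [mul_neg, ← mul_assoc z⁻¹ z α, inv_mul_cancel₀ hz0, one_mul, ← mul_assoc, mul_assoc (z⁻¹ * α) z z⁻¹,
          mul_inv_cancel₀ hz0, mul_one] at h
        rw [h, neg_mul]
      have hzif : ∀ q, z⁻¹ * f q = f q * z⁻¹ := fun q => by
        have h := congrArg (fun w => z⁻¹ * w * z⁻¹) (hfz q)
        rw [← mul_assoc z⁻¹ z, inv_mul_cancel₀ hz0, one_mul, ← mul_assoc, mul_assoc (z⁻¹ * f q) z z⁻¹,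
          mul_inv_cancel₀ hz0, mul_one] at h
        exact h.symm
      -- v = z u z⁻¹
      obtain ⟨v, hv⟩ : ∃ v, v = z * u * z⁻¹ := ⟨_, rfl⟩
      have hzu : z * u = v * z := by rw [hv, mul_assoc, inv_mul_cancel₀ hz0, mul_one]
      have hzv : z * v = u * z := by
        rw [hv, ← mul_assoc, ← mul_assoc, hz2u, mul_assoc, mul_assoc, mul_inv_cancel₀ hz0, mul_one]
      have hvα : α * v = v * α := by
        apply mul_right_cancel₀ hz0
        calc α * v * z = (α * z) * u := by rw [mul_assoc, ← hzu, mul_assoc]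
          _ = - (z * (u * α)) := by rw [hz, huα]; noncomm_ring
          _ = - (v * (z * α)) := by rw [← mul_assoc, hzu, mul_assoc]
          _ = v * α * z := by rw [hz']; noncomm_ring
      have hvf : ∀ q, v * f q = f q * v := by
        intro q
        apply mul_right_cancel₀ hz0
        calc v * f q * z = v * z * f q := by rw [mul_assoc, ← hfz, mul_assoc]
          _ = z * (f q * u) := by rw [← hzu, mul_assoc, huf]
          _ = f q * (z * u) := by rw [← mul_assoc, hfz, mul_assoc]
          _ = f q * v * z := by rw [hzu, mul_assoc]
      have hA : u + v ∈ P0 := by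
        apply hPmax
        · rw [hC]
          refine ⟨by rw [mul_add, add_mul, hvα, huα], by rw [mul_add, add_mul, hzu, hzv, add_comm]⟩
        · intro s hs
          obtain ⟨q, rfl⟩ := (hf s).mp hs
          rw [add_mul, mul_add, huf, hvf]
      have hB : α * (u - v) ∈ P0 := by
        apply hPmax
        · rw [hC]
          refine ⟨by rw [mul_assoc, sub_mul, mul_sub, mul_sub, huα, hvα, mul_sub], ?_⟩
          rw [← mul_assoc, hz', neg_mul, mul_assoc α z, mul_sub, hzu, hzv, mul_assoc, sub_mul]
          rw [← mul_neg, neg_sub]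
        · intro s hs
          obtain ⟨q, rfl⟩ := (hf s).mp hs
          rw [mul_assoc, sub_mul, huf, hvf, ← mul_sub, ← mul_assoc, hfα, mul_assoc]
      obtain ⟨qA, hqA⟩ := (hf _).mp hA
      obtain ⟨qB, hqB⟩ := (hf _).mp hB
      have ha0 : a ≠ 0 := by rintro rfl; exact ha ⟨0, by simp⟩
      refine ⟨algebraMap K T (1/2) * (algebraMap P T qA + algebraMap K T (a⁻¹) * AdjoinRoot.root p * algebraMap P T qB), ?_⟩
      rw [map_mul, map_add, map_mul, map_mul, hgm1, hgm1, hgm2, gm.commutes, gm.commutes, hqA, hqB]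
      have h5 : algebraMap K D a⁻¹ * α * (α * (u - v)) = u - v := by
        rw [← mul_assoc, mul_assoc _ α α, ← sq, hα, ← map_mul, inv_mul_cancel₀ ha0, map_one, one_mul]
      rw [h5]
      have h6 : u + v + (u - v) = algebraMap K D 2 * u := by rw [map_ofNat, two_mul]; abel
      rw [h6, ← mul_assoc, ← map_mul]
      simp [h2])
    have hTn : Module.finrank K T = n := by
      rw [hn] at hsc
      exact Nat.pow_left_injective (n := 2) (by norm_num) hsc
    refine ⟨P, i1, i2, hfd, hnr, by rw [← hTK, hTn]; exact hdvd, ?_⟩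
    intro P' _ _ _ _ ⟨c, hc⟩
    have hsT := splits_of_embed hn hTn gm
    let m' : T →+* P' := AdjoinRoot.lift (algebraMap P P') c (by
      simp only [p, eval₂_sub, eval₂_pow, eval₂_X, eval₂_C, hc]
      rw [← IsScalarTower.algebraMap_apply K P P', sub_self])
    refine (hsT.comp m').of_eq ?_
    ext b
    rw [RingHom.comp_apply, IsScalarTower.algebraMap_apply K P T, IsScalarTower.algebraMap_apply K P P']
    exact AdjoinRoot.lift_of _
  · obtain ⟨P, i1, i2, hP, hsP⟩ := exists_max_subfield hn
    have hn0 := pos_of_sq hn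
    have hfd : FiniteDimensional K P := FiniteDimensional.of_finrank_pos (by omega)
    obtain ⟨f⟩ := embed_of_splits hn hP hsP
    refine ⟨P, i1, i2, hfd, ?_, ?_, ?_⟩
    · rintro ⟨c, hc⟩
      exact hD ⟨f c, by rw [← map_pow, hc, f.commutes]⟩
    · rw [hP]
      have hne : Module.finrank K Q ≠ n := by
        intro h
        obtain ⟨g⟩ := embed_of_splits hn h hQ
        obtain ⟨c, hc⟩ := haQ
        exact hD ⟨g c, by rw [← map_pow, hc, g.commutes]⟩
      obtain ⟨e, he⟩ := hdvd
      have : e ∣ 2 ^ s := by rw [← hs, he]; exact dvd_mul_left _ _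
      obtain ⟨i, _, hi⟩ := (Nat.dvd_prime_pow Nat.prime_two).mp this
      rcases i with _ | i
      · exfalso; apply hne; rw [he, hi]; simp
      · rw [he, hi, pow_succ]; exact ⟨2 ^ i, by ring⟩
    · intro P' _ _ _ _ _
      refine (hsP.comp (algebraMap P P')).of_eq ?_
      ext b
      rw [RingHom.comp_apply, ← IsScalarTower.algebraMap_apply]

end SG
end

section
open TensorProduct

namespace SG

/-- a finite group acting faithfully on `E` with fixed field `F` -/
structure IsGal (F : Type*) {E G : Type*} [Field F] [Field E] [Algebra F E] [Group G]
    (a : G →* (E →+* E)) : Prop where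
  inj : Function.Injective a
  fixed : ∀ σ y, a σ (algebraMap F E y) = algebraMap F E y
  mem : ∀ x, (∀ σ, a σ x = x) → ∃ y, algebraMap F E y = x

section
variable {F E G : Type*} [Field F] [Field E] [Algebra F E] [Group G]
  {a : G →* (E →+* E)}

theorem act_mul (a : G →* (E →+* E)) (σ τ : G) (x : E) : a (σ * τ) x = a σ (a τ x) := by
  rw [map_mul]; rfl

theorem act_one (a : G →* (E →+* E)) (x : E) : a 1 x = x := by
  rw [map_one]; rfl

theorem indep_act [Fintype G] (ha : Function.Injective a) (g : G → E) (h : ∀ x, ∑ σ, g σ * a σ x = 0) (σ : G) :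
    g σ = 0 := by
  have hli : LinearIndependent E (fun σ : G => ((a σ : E →* E) : E → E)) := by
    have := linearIndependent_monoidHom E E
    refine this.comp (fun σ : G => (a σ : E →* E)) ?_
    intro s t hst
    apply ha
    ext x
    exact DFunLike.congr_fun hst x
  refine (Fintype.linearIndependent_iff.mp hli) g ?_ σ
  ext x
  simpa using h x

variable [Finite G] {V : Type*} [AddCommGroup V] [Module E V] [Module F V] [IsScalarTower F E V]

/-- fixed vectors of a semilinear action -/
def fixedVec (a : G →* (E →+* E)) (hg : IsGal F a) (T : G → V →+ V)
    (hs : ∀ σ (x : E) v, T σ (x • v) = a σ x • T σ v) : Submodule F V where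
  carrier := {v | ∀ σ, T σ v = v}
  zero_mem' := fun σ => map_zero _
  add_mem' := fun hx hy σ => by rw [map_add, hx, hy]
  smul_mem' := fun c x hx σ => by
    rw [← algebraMap_smul E c x, hs, hg.fixed, hx]

theorem fixedVec_span (hg : IsGal F a) (T : G → V →+ V)
    (hs : ∀ σ (x : E) v, T σ (x • v) = a σ x • T σ v) (h1 : ∀ v, T 1 v = v)
    (hm : ∀ σ τ v, T (σ * τ) v = T σ (T τ v)) :
    Submodule.span E (fixedVec a hg T hs : Set V) = ⊤ := by
  have := Fintype.ofFinite G
  by_contra hne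
  obtain ⟨f, hf0, hf⟩ := Submodule.exists_le_ker_of_lt_top _ (lt_top_iff_ne_top.mpr hne)
  apply hf0
  ext v
  have key : ∀ x : E, ∑ σ, f (T σ v) * a σ x = 0 := by
    intro x
    have hw : (∑ σ, T σ (x • v)) ∈ fixedVec a hg T hs := by
      intro τ
      rw [map_sum]
      simp_rw [← hm]
      exact Fintype.sum_equiv (Equiv.mulLeft τ) _ _ (fun σ => rfl)
    have := hf (Submodule.subset_span hw)
    rw [LinearMap.mem_ker, map_sum] at this
    rw [← this]
    refine Finset.sum_congr rfl (fun σ _ => ?_)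
    rw [hs, map_smul, smul_eq_mul, mul_comm]
  have := indep_act hg.inj _ key 1
  rw [h1] at this
  simpa using this

theorem fixedVec_indep (hg : IsGal F a) (T : G → V →+ V)
    (hs : ∀ σ (x : E) v, T σ (x • v) = a σ x • T σ v)
    {ι : Type*} (v : ι → V) (hv : ∀ i σ, T σ (v i) = v i) (hli : LinearIndependent F v) :
    LinearIndependent E v := by
  have := Fintype.ofFinite G
  rw [linearIndependent_iff'] at hli ⊢
  intro s g hsum
  have htr : ∀ x : E, ∃ y : F, algebraMap F E y = ∑ σ, a σ x := by
    intro x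
    apply hg.mem
    intro τ
    rw [map_sum]
    simp_rw [← act_mul]
    exact Fintype.sum_equiv (Equiv.mulLeft τ) _ _ (fun σ => rfl)
  choose tr htr using htr
  have key : ∀ x : E, ∀ i ∈ s, tr (x * g i) = 0 := by
    intro x
    apply hli
    have : ∑ σ, T σ (x • ∑ i ∈ s, g i • v i) = 0 := by
      rw [hsum, smul_zero]; simp
    rw [← this]
    simp_rw [Finset.smul_sum, map_sum, smul_smul, hs, hv]
    rw [Finset.sum_comm]
    refine Finset.sum_congr rfl (fun i _ => ?_)
    rw [← Finset.sum_smul, ← htr, algebraMap_smul]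
  intro i hi
  have h2 : ∀ x : E, ∑ σ, a σ (g i) * a σ x = 0 := by
    intro x
    have := htr (x * g i)
    rw [key x i hi, map_zero] at this
    rw [this]
    refine Finset.sum_congr rfl (fun σ _ => by rw [map_mul, mul_comm])
  have := indep_act hg.inj _ h2 1
  rwa [act_one] at this

theorem fixedVec_finrank (hg : IsGal F a) (T : G → V →+ V)
    (hs : ∀ σ (x : E) v, T σ (x • v) = a σ x • T σ v) (h1 : ∀ v, T 1 v = v)
    (hm : ∀ σ τ v, T (σ * τ) v = T σ (T τ v)) [FiniteDimensional E V] :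
    FiniteDimensional F (fixedVec a hg T hs) ∧
    Module.finrank F (fixedVec a hg T hs) = Module.finrank E V := by
  let W := fixedVec a hg T hs
  let b := Module.Basis.ofVectorSpace F W
  have hli : LinearIndependent E (fun i => (b i : V)) := by
    apply fixedVec_indep hg T hs
    · exact fun i => (b i).2
    · exact b.linearIndependent.map' W.subtype (Submodule.ker_subtype W)
  have hsp : ⊤ ≤ Submodule.span E (Set.range fun i => (b i : V)) := by
    rw [← fixedVec_span hg T hs h1 hm, Submodule.span_le]
    intro w hw
    have : (⟨w, hw⟩ : W) ∈ Submodule.span F (Set.range b) := by rw [b.span_eq]; trivial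
    have h2 := Submodule.apply_mem_span_image_of_mem_span W.subtype this
    rw [← Set.range_comp] at h2
    exact Submodule.span_subset_span F E _ h2
  let B := Module.Basis.mk hli hsp
  have hfin : Finite (Module.Basis.ofVectorSpaceIndex F W) := Module.Finite.finite_basis B
  refine ⟨Module.Finite.of_basis b, ?_⟩
  rw [Module.finrank_eq_nat_card_basis b, Module.finrank_eq_nat_card_basis B]

end

/-- twisted representation with cocycle `c` -/
structure Tw {E G : Type*} [Field E] [Group G] (a : G →* (E →+* E)) (c : G → G → E) {n : ℕ}
    (ρ : G → Matrix (Fin n) (Fin n) E) : Prop where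
  unit : ∀ σ, IsUnit (ρ σ)
  mul : ∀ σ τ, ρ σ * (ρ τ).map (a σ) = c σ τ • ρ (σ * τ)

section
variable {F E G : Type*} [Field F] [Field E] [Algebra F E] [Group G]
  {a : G →* (E →+* E)} {c : G → G → E} {m n : ℕ} {ρ' : G → Matrix (Fin m) (Fin m) E}
  {ρ : G → Matrix (Fin n) (Fin n) E}

theorem Tw.ne_zero (h : Tw a c ρ) (hn : 0 < n) (σ τ : G) : c σ τ ≠ 0 := by
  intro h0
  have hu : IsUnit (ρ σ * (ρ τ).map (a σ)) := (h.unit σ).mul ((h.unit τ).map (a σ).mapMatrix)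
  rw [h.mul, h0, zero_smul] at hu
  have : Nonempty (Fin n) := ⟨⟨0, hn⟩⟩
  exact not_isUnit_zero hu

theorem map_act_one (a : G →* (E →+* E)) {ι κ : Type*} (X : Matrix ι κ E) : X.map (a 1) = X := by
  ext i j; simp

theorem map_act_mul (a : G →* (E →+* E)) {ι κ : Type*} (σ τ : G) (X : Matrix ι κ E) :
    X.map (a (σ * τ)) = (X.map (a τ)).map (a σ) := by
  ext i j; simp

theorem map_smul_act (a : G →* (E →+* E)) {ι κ : Type*} (σ : G) (x : E) (X : Matrix ι κ E) :
    (x • X).map (a σ) = a σ x • X.map (a σ) := by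
  ext i j; simp

theorem map_inv_act (a : G →* (E →+* E)) (σ : G) {X : Matrix (Fin n) (Fin n) E} (hX : IsUnit X) :
    (X⁻¹).map (a σ) = (X.map (a σ))⁻¹ := by
  have hd := (Matrix.isUnit_iff_isUnit_det _).mp hX
  symm
  apply Matrix.inv_eq_right_inv
  rw [← Matrix.map_mul, Matrix.mul_nonsing_inv _ hd, Matrix.map_one _ (map_zero _) (map_one _)]

theorem Tw.one (h : Tw a c ρ) : ρ 1 = c 1 1 • 1 := by
  have h1 := h.mul 1 1
  rw [map_act_one, mul_one] at h1
  have hd := (Matrix.isUnit_iff_isUnit_det _).mp (h.unit 1)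
  have := congrArg (fun M => M * (ρ 1)⁻¹) h1
  simpa [Matrix.mul_assoc, Matrix.mul_nonsing_inv _ hd] using this

/-- intertwiners -/
def Form (F : Type*) {E G : Type*} [Field F] [Field E] [Algebra F E] [Group G]
  {a : G →* (E →+* E)} (hg : IsGal F a) {m n : ℕ} (ρ' : G → Matrix (Fin m) (Fin m) E)
  (ρ : G → Matrix (Fin n) (Fin n) E) : Submodule F (Matrix (Fin m) (Fin n) E) where
  carrier := {X | ∀ σ, ρ' σ * X.map (a σ) = X * ρ σ}
  zero_mem' := fun σ => by simp
  add_mem' := fun {X Y} hx hy σ => by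
    have hx := hx σ
    have hy := hy σ
    rw [Matrix.map_add _ (map_add _), Matrix.mul_add, hx, hy, Matrix.add_mul]
  smul_mem' := fun r X hx σ => by
    have hx := hx σ
    rw [← algebraMap_smul E r X, map_smul_act, hg.fixed, Matrix.mul_smul, hx, Matrix.smul_mul]

theorem mem_Form {hg : IsGal F a} {X : Matrix (Fin m) (Fin n) E} :
    X ∈ Form F hg ρ' ρ ↔ ∀ σ, ρ' σ * X.map (a σ) = X * ρ σ := Iff.rfl

theorem form_main [Finite G] (hg : IsGal F a) (h' : Tw a c ρ') (h : Tw a c ρ) (hn : 0 < n) :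
    FiniteDimensional F (Form F hg ρ' ρ) ∧ Module.finrank F (Form F hg ρ' ρ) = m * n ∧
    Submodule.span E (Form F hg ρ' ρ : Set (Matrix (Fin m) (Fin n) E)) = ⊤ := by
  let V := Matrix (Fin m) (Fin n) E
  have hd := fun σ => (Matrix.isUnit_iff_isUnit_det _).mp (h.unit σ)
  let T : G → V →+ V := fun σ =>
    { toFun := fun X => ρ' σ * X.map (a σ) * (ρ σ)⁻¹
      map_zero' := by simp
      map_add' := fun X Y => by rw [Matrix.map_add _ (map_add _), Matrix.mul_add, Matrix.add_mul] }
  have hT : ∀ σ X, T σ X = ρ' σ * X.map (a σ) * (ρ σ)⁻¹ := fun _ _ => rfl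
  have hs : ∀ σ (x : E) v, T σ (x • v) = a σ x • T σ v := by
    intro σ x X
    rw [hT, hT, map_smul_act, Matrix.mul_smul, Matrix.smul_mul]
  have h1 : ∀ v, T 1 v = v := by
    intro X
    rw [hT, map_act_one, h'.one, h.one]
    have hc := h.ne_zero hn 1 1
    have hi : (c 1 1 • (1 : Matrix (Fin n) (Fin n) E))⁻¹ = (c 1 1)⁻¹ • 1 := by
      apply Matrix.inv_eq_right_inv
      simp [smul_smul, hc]
    rw [hi]
    simp [smul_smul, hc]
  have hm : ∀ σ τ v, T (σ * τ) v = T σ (T τ v) := by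
    intro σ τ X
    have hc := h.ne_zero hn σ τ
    have hρ' : ρ' (σ * τ) = (c σ τ)⁻¹ • (ρ' σ * (ρ' τ).map (a σ)) := by
      rw [h'.mul, smul_smul, inv_mul_cancel₀ hc, one_smul]
    have hρ : (ρ (σ * τ))⁻¹ = c σ τ • (((ρ τ)⁻¹).map (a σ) * (ρ σ)⁻¹) := by
      apply Matrix.inv_eq_right_inv
      rw [Matrix.mul_smul, ← Matrix.smul_mul, ← h.mul, Matrix.mul_assoc, ← Matrix.mul_assoc ((ρ τ).map _),
        ← Matrix.map_mul, Matrix.mul_nonsing_inv _ (hd τ), Matrix.map_one _ (map_zero _) (map_one _), Matrix.one_mul,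
        Matrix.mul_nonsing_inv _ (hd σ)]
    rw [hT, hT, hT, hρ, hρ', map_act_mul, Matrix.map_mul, Matrix.map_mul, Matrix.smul_mul, Matrix.smul_mul, Matrix.mul_smul,
      smul_smul, inv_mul_cancel₀ hc, one_smul]
    simp only [Matrix.mul_assoc]
  have heq : Form F hg ρ' ρ = fixedVec a hg T hs := by
    ext X
    rw [mem_Form]
    change _ ↔ ∀ σ, T σ X = X
    refine forall_congr' (fun σ => ?_)
    rw [hT]
    constructor
    · intro hX
      rw [hX, Matrix.mul_assoc, Matrix.mul_nonsing_inv _ (hd σ), Matrix.mul_one]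
    · intro hX
      conv_rhs => rw [← hX]
      rw [Matrix.mul_assoc, Matrix.nonsing_inv_mul _ (hd σ), Matrix.mul_one]
  rw [heq]
  obtain ⟨h3, h4⟩ := fixedVec_finrank hg T hs h1 hm
  refine ⟨h3, ?_, fixedVec_span hg T hs h1 hm⟩
  rw [h4, Module.finrank_matrix]; simp

end

end SG
end

section
open TensorProduct

namespace SG

theorem scalar_eq_smul {n : ℕ} {E : Type*} [Field E] (x : E) : Matrix.scalar (Fin n) x = x • (1 : Matrix (Fin n) (Fin n) E) := by
  rw [Matrix.smul_one_eq_diagonal]; rfl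

section
variable {K D E : Type*} [Field K] [Ring D] [Algebra K D] [IsSimpleRing D]
    [Algebra.IsCentral K D] [FiniteDimensional K D] [Field E] {n : ℕ} (hn : Module.finrank K D = n ^ 2)
    (i : K →+* E) (Φ Ψ : D →+* Matrix (Fin n) (Fin n) E)
    (hΦ : ∀ y, Φ (algebraMap K D y) = Matrix.scalar (Fin n) (i y))

include hn hΦ in
theorem rh_conj (hΨ : ∀ y, Ψ (algebraMap K D y) = Matrix.scalar (Fin n) (i y)) :
    ∃ X : Matrix (Fin n) (Fin n) E, IsUnit X ∧ ∀ d, Ψ d * X = X * Φ d := by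
  let := i.toAlgebra
  exact split_conj (K := K) hn { Φ with commutes' := hΦ } { Ψ with commutes' := hΨ }

include hn hΦ in
theorem rh_span : Submodule.span E (Set.range Φ) = ⊤ := by
  let := i.toAlgebra
  exact split_span (K := K) hn { Φ with commutes' := hΦ }

include hn hΦ in
theorem rh_comm (Y : Matrix (Fin n) (Fin n) E)
    (hY : ∀ d, Y * Φ d = Φ d * Y) : ∃ c : E, Y = c • 1 := by
  let := i.toAlgebra
  exact split_comm (K := K) hn { Φ with commutes' := hΦ } Y hY

include hn hΦ in
/-- two intertwiners are proportional -/
theorem rh_prop (X Y : Matrix (Fin n) (Fin n) E) (s : E →+* E) (hX : IsUnit X) (hY : IsUnit Y)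
    (h1 : ∀ d, X * (Φ d).map s = Φ d * X) (h2 : ∀ d, Y * (Φ d).map s = Φ d * Y) :
    ∃ c : E, c ≠ 0 ∧ Y = c • X := by
  have hd := (Matrix.isUnit_iff_isUnit_det _).mp hX
  obtain ⟨c, hc⟩ := rh_comm hn i Φ hΦ (Y * X⁻¹) (fun d => by
    have h3 : (Φ d).map s * X⁻¹ = X⁻¹ * Φ d := by
      calc (Φ d).map s * X⁻¹ = X⁻¹ * (X * (Φ d).map s) * X⁻¹ := by
            rw [← Matrix.mul_assoc, Matrix.nonsing_inv_mul _ hd, Matrix.one_mul]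
        _ = X⁻¹ * Φ d := by rw [h1, Matrix.mul_assoc, Matrix.mul_assoc, Matrix.mul_nonsing_inv _ hd, Matrix.mul_one]
    rw [Matrix.mul_assoc, ← h3, ← Matrix.mul_assoc, h2, Matrix.mul_assoc])
  have h4 : Y = c • X := by
    have := congrArg (fun M => M * X) hc
    simpa [Matrix.mul_assoc, Matrix.nonsing_inv_mul _ hd] using this
  refine ⟨c, ?_, h4⟩
  rintro rfl
  rw [zero_smul] at h4
  have hn0 := pos_of_sq hn
  have : Nonempty (Fin n) := ⟨⟨0, hn0⟩⟩
  rw [h4] at hY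
  exact not_isUnit_zero hY
end

/-- descent datum of a split algebra -/
structure Desc {K D E G : Type*} [Field K] [Ring D] [Algebra K D] [Field E] [Group G] (i : K →+* E)
    (a : G →* (E →+* E)) {n : ℕ} (Φ : D →+* Matrix (Fin n) (Fin n) E)
    (ρ : G → Matrix (Fin n) (Fin n) E) (c : G → G → E) : Prop where
  tw : Tw a c ρ
  alg : ∀ y, Φ (algebraMap K D y) = Matrix.scalar (Fin n) (i y)
  inter : ∀ σ d, ρ σ * (Φ d).map (a σ) = Φ d * ρ σ

/-- cohomologous cochains -/
def Coh {E G : Type*} [Field E] [Group G] (a : G →* (E →+* E)) (c c' : G → G → E) : Prop :=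
  ∃ f : G → E, (∀ σ, f σ ≠ 0) ∧ ∀ σ τ, c' σ τ * f (σ * τ) = f σ * a σ (f τ) * c σ τ

section
variable {E G : Type*} [Field E] [Group G] {a : G →* (E →+* E)}

theorem Coh.refl (c : G → G → E) : Coh a c c := ⟨fun _ => 1, fun _ => one_ne_zero, fun σ τ => by simp⟩

theorem Coh.symm {c c' : G → G → E} (h : Coh a c c') : Coh a c' c := by
  obtain ⟨f, hf, h⟩ := h
  refine ⟨fun σ => (f σ)⁻¹, fun σ => inv_ne_zero (hf σ), fun σ τ => ?_⟩
  have h1 := hf σ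
  have h2 := (map_ne_zero (a σ)).mpr (hf τ)
  have h3 := hf (σ * τ)
  rw [map_inv₀]
  field_simp
  linear_combination -(h σ τ)

theorem Coh.trans {c c' c'' : G → G → E} (h : Coh a c c') (h' : Coh a c' c'') : Coh a c c'' := by
  obtain ⟨f, hf, h⟩ := h
  obtain ⟨f', hf', h'⟩ := h'
  refine ⟨fun σ => f σ * f' σ, fun σ => mul_ne_zero (hf σ) (hf' σ), fun σ τ => ?_⟩
  simp only [map_mul]
  linear_combination (f (σ*τ)) * h' σ τ + (f' σ * a σ (f' τ)) * h σ τ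

theorem Coh.mul {c c' d d' : G → G → E} (h : Coh a c c') (h' : Coh a d d') :
    Coh a (fun σ τ => c σ τ * d σ τ) (fun σ τ => c' σ τ * d' σ τ) := by
  obtain ⟨f, hf, h⟩ := h
  obtain ⟨f', hf', h'⟩ := h'
  refine ⟨fun σ => f σ * f' σ, fun σ => mul_ne_zero (hf σ) (hf' σ), fun σ τ => ?_⟩
  rw [map_mul]
  linear_combination (d' σ τ * f' (σ * τ)) * h σ τ + (f σ * a σ (f τ) * c σ τ) * h' σ τ

theorem Tw.rescale {n : ℕ} {c c' : G → G → E} {ρ : G → Matrix (Fin n) (Fin n) E} (h : Tw a c ρ) (f : G → E)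
    (hf : ∀ σ, f σ ≠ 0) (hc : ∀ σ τ, c' σ τ * f (σ * τ) = f σ * a σ (f τ) * c σ τ) :
    Tw a c' (fun σ => f σ • ρ σ) := by
  refine ⟨fun σ => ?_, fun σ τ => ?_⟩
  · exact (h.unit σ).smul (Units.mk0 _ (hf σ))
  · rw [map_smul_act, Matrix.smul_mul, Matrix.mul_smul, h.mul, smul_smul, smul_smul, smul_smul, hc]

end

section
variable {K D E G : Type*} [Field K] [Ring D] [Algebra K D] [Field E] [Group G] {i : K →+* E}
    {a : G →* (E →+* E)} {n : ℕ} {Φ : D →+* Matrix (Fin n) (Fin n) E}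
    {ρ : G → Matrix (Fin n) (Fin n) E} {c : G → G → E}

theorem Desc.splits (h : Desc i a Φ ρ c) : Splits i n D := ⟨Φ, h.alg⟩

theorem Desc.rescale (h : Desc i a Φ ρ c) {c' : G → G → E} (f : G → E)
    (hf : ∀ σ, f σ ≠ 0) (hc : ∀ σ τ, c' σ τ * f (σ * τ) = f σ * a σ (f τ) * c σ τ) :
    Desc i a Φ (fun σ => f σ • ρ σ) c' :=
  ⟨h.tw.rescale f hf hc, h.alg, fun σ d => by rw [Matrix.smul_mul, h.inter, Matrix.mul_smul]⟩

/-- functoriality -/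
theorem Desc.map (h : Desc i a Φ ρ c) {E' G' : Type*} [Field E'] [Group G'] (a' : G' →* (E' →+* E'))
    (j : E →+* E') (r : G' →* G) (hj : ∀ ν x, a' ν (j x) = j (a (r ν) x)) :
    Desc (j.comp i) a' (j.mapMatrix.comp Φ) (fun ν => (ρ (r ν)).map j) (fun ν μ => j (c (r ν) (r μ))) := by
  have hm : ∀ ν (X : Matrix (Fin n) (Fin n) E), (X.map j).map (a' ν) = (X.map (a (r ν))).map j := by
    intro ν X; ext x y; simp [hj]
  refine ⟨⟨fun ν => (h.tw.unit _).map j.mapMatrix, fun ν μ => ?_⟩, fun y => ?_, fun ν d => ?_⟩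
  · rw [hm, ← Matrix.map_mul, h.tw.mul, map_mul]
    ext x y; simp
  · simp [h.alg, Matrix.diagonal_map]
  · simp only [RingHom.comp_apply, RingHom.mapMatrix_apply]
    rw [hm, ← Matrix.map_mul, h.inter, Matrix.map_mul]

theorem Desc.comp_alg (h : Desc i a Φ ρ c) {D' : Type*} [Ring D'] [Algebra K D'] (e : D' →ₐ[K] D) :
    Desc i a (Φ.comp e.toRingHom) ρ c :=
  ⟨h.tw, fun y => by
    change Φ (e (algebraMap K D' y)) = _
    rw [e.commutes, h.alg], fun σ d => h.inter σ (e d)⟩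

/-- conjugation of the splitting -/
theorem Desc.op (h : Desc i a Φ ρ c) (hn : 0 < n) : ∃ Φ' : Dᵐᵒᵖ →+* Matrix (Fin n) (Fin n) E,
    Desc i a Φ' (fun σ => ((ρ σ)⁻¹).transpose) (fun σ τ => (c σ τ)⁻¹) := by
  let Φ' : Dᵐᵒᵖ →+* Matrix (Fin n) (Fin n) E :=
    { toFun := fun d => (Φ d.unop).transpose
      map_one' := by simp
      map_mul' := fun x y => by simp
      map_zero' := by simp
      map_add' := fun x y => by simp }
  have hd := fun σ => (Matrix.isUnit_iff_isUnit_det _).mp (h.tw.unit σ)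
  refine ⟨Φ', ⟨fun σ => ?_, fun σ τ => ?_⟩, fun y => ?_, fun σ d => ?_⟩
  · rw [Matrix.isUnit_transpose, Matrix.isUnit_nonsing_inv_iff]; exact h.tw.unit σ
  · have hc := h.tw.ne_zero hn σ τ
    rw [Matrix.transpose_map, ← Matrix.transpose_mul, ← Matrix.transpose_smul]
    congr 1
    symm
    have hρ : (ρ (σ * τ))⁻¹ = c σ τ • (((ρ τ)⁻¹).map (a σ) * (ρ σ)⁻¹) := by
      apply Matrix.inv_eq_right_inv
      rw [Matrix.mul_smul, ← Matrix.smul_mul, ← h.tw.mul, Matrix.mul_assoc, ← Matrix.mul_assoc ((ρ τ).map _),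
        ← Matrix.map_mul, Matrix.mul_nonsing_inv _ (hd τ), Matrix.map_one _ (map_zero _) (map_one _), Matrix.one_mul,
        Matrix.mul_nonsing_inv _ (hd σ)]
    rw [hρ, smul_smul, inv_mul_cancel₀ hc, one_smul]
  · change (Φ (algebraMap K D y)).transpose = _
    rw [h.alg]; simp
  · change _ * ((Φ d.unop).transpose).map (a σ) = (Φ d.unop).transpose * _
    rw [Matrix.transpose_map, ← Matrix.transpose_mul, ← Matrix.transpose_mul]
    congr 1
    calc (Φ d.unop).map (a σ) * (ρ σ)⁻¹ = (ρ σ)⁻¹ * (ρ σ * (Φ d.unop).map (a σ)) * (ρ σ)⁻¹ := by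
          rw [← Matrix.mul_assoc, Matrix.nonsing_inv_mul _ (hd σ), Matrix.one_mul]
      _ = _ := by rw [h.inter, Matrix.mul_assoc, Matrix.mul_assoc, Matrix.mul_nonsing_inv _ (hd σ), Matrix.mul_one]

variable [IsSimpleRing D] [Algebra.IsCentral K D] [FiniteDimensional K D]

theorem exists_cocycle (hn : Module.finrank K D = n ^ 2)
    (halg : ∀ y, Φ (algebraMap K D y) = Matrix.scalar (Fin n) (i y))
    (hu : ∀ σ, IsUnit (ρ σ)) (hin : ∀ σ d, ρ σ * (Φ d).map (a σ) = Φ d * ρ σ) :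
    ∃ c, Desc i a Φ ρ c := by
  have : ∀ σ τ, ∃ c : E, c ≠ 0 ∧ ρ σ * (ρ τ).map (a σ) = c • ρ (σ * τ) := by
    intro σ τ
    refine rh_prop hn i Φ halg _ _ (a (σ * τ)) (hu _) ((hu σ).mul ((hu τ).map (a σ).mapMatrix)) (hin _) ?_
    intro d
    rw [map_act_mul, Matrix.mul_assoc, ← Matrix.map_mul, hin, Matrix.map_mul, ← Matrix.mul_assoc, hin, Matrix.mul_assoc]
  choose c hc0 hc using this
  exact ⟨c, ⟨hu, hc⟩, halg, hin⟩

theorem exists_desc (hn : Module.finrank K D = n ^ 2)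
    (halg : ∀ y, Φ (algebraMap K D y) = Matrix.scalar (Fin n) (i y))
    (hfix : ∀ σ y, a σ (i y) = i y) : ∃ ρ c, Desc i a Φ ρ c := by
  have : ∀ σ, ∃ X : Matrix (Fin n) (Fin n) E, IsUnit X ∧ ∀ d, Φ d * X = X * (Φ d).map (a σ) := by
    intro σ
    refine rh_conj hn i ((a σ).mapMatrix.comp Φ) Φ (fun y => ?_) halg
    rw [RingHom.comp_apply, halg]
    simp [Matrix.diagonal_map, hfix]
  choose ρ hu hin using this
  obtain ⟨c, hc⟩ := exists_cocycle (ρ := ρ) hn halg hu (fun σ d => (hin σ d).symm)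
  exact ⟨ρ, c, hc⟩

/-- explicit comparison of two descent data -/
theorem Desc.compare (hn : Module.finrank K D = n ^ 2) (h : Desc i a Φ ρ c)
    {Φ' : D →+* Matrix (Fin n) (Fin n) E}
    {ρ' : G → Matrix (Fin n) (Fin n) E} {c' : G → G → E} (h' : Desc i a Φ' ρ' c') :
    ∃ (X : Matrix (Fin n) (Fin n) E) (f : G → E), IsUnit X ∧ (∀ σ, f σ ≠ 0) ∧
      (∀ σ, ρ' σ * X.map (a σ) = f σ • (X * ρ σ)) ∧
      ∀ σ τ, c' σ τ * f (σ * τ) = f σ * a σ (f τ) * c σ τ := by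
  obtain ⟨X, hX, hXi⟩ := rh_conj hn i Φ Φ' h.alg h'.alg
  have hd := (Matrix.isUnit_iff_isUnit_det _).mp hX
  have hXu := fun σ => hX.map (a σ).mapMatrix
  simp only [RingHom.mapMatrix_apply] at hXu
  have hds := fun σ => (Matrix.isUnit_iff_isUnit_det _).mp (hXu σ)
  have : ∀ σ, ∃ f : E, f ≠ 0 ∧ ρ' σ = f • (X * ρ σ * (X.map (a σ))⁻¹) := by
    intro σ
    refine rh_prop hn i Φ' h'.alg _ _ (a σ) ((hX.mul (h.tw.unit σ)).mul (Matrix.isUnit_nonsing_inv_iff.mpr (hXu σ)))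
      (h'.tw.unit σ) (fun d => ?_) (h'.inter σ)
    have h1 : (X.map (a σ))⁻¹ * (Φ' d).map (a σ) = (Φ d).map (a σ) * (X.map (a σ))⁻¹ := by
      calc _ = (X.map (a σ))⁻¹ * ((Φ' d * X).map (a σ)) * (X.map (a σ))⁻¹ := by
            rw [Matrix.map_mul, Matrix.mul_assoc, Matrix.mul_assoc, Matrix.mul_nonsing_inv _ (hds σ), Matrix.mul_one]
        _ = _ := by
            rw [hXi, Matrix.map_mul, ← Matrix.mul_assoc, Matrix.nonsing_inv_mul _ (hds σ), Matrix.one_mul]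
    rw [Matrix.mul_assoc, h1, ← Matrix.mul_assoc, Matrix.mul_assoc X, h.inter, ← Matrix.mul_assoc, ← hXi, Matrix.mul_assoc,
      Matrix.mul_assoc, Matrix.mul_assoc]
  choose f hf0 hf using this
  have hmain : ∀ σ, ρ' σ * X.map (a σ) = f σ • (X * ρ σ) := by
    intro σ
    rw [hf, Matrix.smul_mul, Matrix.mul_assoc, Matrix.nonsing_inv_mul _ (hds σ), Matrix.mul_one]
  refine ⟨X, f, hX, hf0, hmain, fun σ τ => ?_⟩
  have h3 : ρ' σ * (ρ' τ).map (a σ) * X.map (a (σ * τ)) = (f σ * a σ (f τ) * c σ τ) • (X * ρ (σ * τ)) := by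
    rw [Matrix.mul_assoc, map_act_mul, ← Matrix.map_mul, hmain, map_smul_act, Matrix.map_mul, Matrix.mul_smul,
      ← Matrix.mul_assoc, hmain, Matrix.smul_mul, Matrix.mul_assoc, h.tw.mul, Matrix.mul_smul, smul_smul, smul_smul]
    congr 1; ring
  rw [h'.tw.mul, Matrix.smul_mul, hmain, smul_smul] at h3
  have hn0 := pos_of_sq hn
  have : Nonempty (Fin n) := ⟨⟨0, hn0⟩⟩
  have hu : X * ρ (σ * τ) ≠ 0 := (hX.mul (h.tw.unit _)).ne_zero
  exact smul_left_injective E hu h3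

theorem Desc.coh (hn : Module.finrank K D = n ^ 2) (h : Desc i a Φ ρ c)
    {Φ' : D →+* Matrix (Fin n) (Fin n) E}
    {ρ' : G → Matrix (Fin n) (Fin n) E} {c' : G → G → E} (h' : Desc i a Φ' ρ' c') : Coh a c c' := by
  obtain ⟨X, f, _, hf, _, h⟩ := h.compare hn h'
  exact ⟨f, hf, h⟩

theorem Desc.coh_inv (hn : Module.finrank K D = n ^ 2) (h : Desc i a Φ ρ c) (e : D ≃ₐ[K] Dᵐᵒᵖ) :
    Coh a c (fun σ τ => (c σ τ)⁻¹) := by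
  obtain ⟨Φ', h'⟩ := h.op (pos_of_sq hn)
  exact h.coh hn (h'.comp_alg e.toAlgHom)

end

end SG
end

section
open TensorProduct

namespace SG

theorem lift_inj {A B C : Type*} [Ring A] [Ring B] [Ring C] (f : A →+* C) (j : B →+* C)
    (hj : Function.Injective j) (h : ∀ x, ∃ y, j y = f x) : ∃ g : A →+* B, ∀ x, j (g x) = f x := by
  choose g hg using h
  refine ⟨{ toFun := g, map_one' := hj ?_, map_mul' := fun x y => hj ?_, map_zero' := hj ?_, map_add' := fun x y => hj ?_ }, hg⟩ <;>
  simp [hg]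

theorem mapMatrix_inj {F E : Type*} [Field F] [Field E] (j : F →+* E) (n : ℕ) :
    Function.Injective (j.mapMatrix (m := Fin n)) := by
  intro X Y h
  ext x y
  exact j.injective (congrFun (congrFun h x) y)

section
variable {K F D E G : Type*} [Field K] [Ring D] [Algebra K D] [Field E] [Field F] [Group G] [Algebra F E] {i : K →+* F}
    {a : G →* (E →+* E)} {n : ℕ} {Φ : D →+* Matrix (Fin n) (Fin n) E}
    {ρ : G → Matrix (Fin n) (Fin n) E} {c : G → G → E}

/-- Hilbert 90 -/
theorem hilbert90 [Finite G] (hg : IsGal F a) (h : Tw a (fun _ _ => 1) ρ) :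
    ∃ X : Matrix (Fin n) (Fin n) E, IsUnit X ∧ ∀ σ, ρ σ * X.map (a σ) = X := by
  have h1 : Tw a (fun _ _ => (1 : E)) (fun _ => (1 : Matrix (Fin 1) (Fin 1) E)) :=
    ⟨fun _ => isUnit_one, fun σ τ => by simp [Matrix.map_one _ (map_zero _) (map_one _)]⟩
  obtain ⟨hfd, hfr, hsp⟩ := form_main hg h h1 one_pos
  rw [mul_one] at hfr
  let b := Module.finBasisOfFinrankEq F _ hfr
  let X : Matrix (Fin n) (Fin n) E := Matrix.of fun x y => (b y : Matrix (Fin n) (Fin 1) E) x 0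
  refine ⟨X, ?_, fun σ => ?_⟩
  · rw [← Matrix.linearIndependent_cols_iff_isUnit]
    apply linearIndependent_of_top_le_span_of_card_eq_finrank
    · let L : Matrix (Fin n) (Fin 1) E →ₗ[E] (Fin n → E) :=
        { toFun := fun M x => M x 0, map_add' := fun _ _ => rfl, map_smul' := fun _ _ => rfl }
      have hL : Function.Surjective L := fun v => ⟨Matrix.of fun x _ => v x, rfl⟩
      have h2 : Submodule.span E (Set.range fun y => (b y : Matrix (Fin n) (Fin 1) E)) = ⊤ := by
        rw [eq_top_iff, ← hsp, Submodule.span_le]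
        intro w hw
        have : (⟨w, hw⟩ : Form F hg ρ _) ∈ Submodule.span F (Set.range b) := by rw [b.span_eq]; trivial
        have h2 := Submodule.apply_mem_span_image_of_mem_span (Form F hg ρ _).subtype this
        rw [← Set.range_comp] at h2
        exact Submodule.span_subset_span F E _ h2
      have h3 := congrArg (Submodule.map L) h2
      rw [Submodule.map_span, Submodule.map_top, LinearMap.range_eq_top.mpr hL, ← Set.range_comp] at h3
      exact h3.ge
    · simp
  · ext x y
    have := (mem_Form.mp (b y).2) σ
    rw [Matrix.mul_one] at this
    have := congrFun (congrFun this x) 0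
    simpa [Matrix.mul_apply, X] using this

theorem splits_of_coh [Finite G] (hg : IsGal F a) (h : Desc ((algebraMap F E).comp i) a Φ ρ c)
    (hc : Coh a c (fun _ _ => 1)) : Splits i n D := by
  obtain ⟨f, hf, hc⟩ := hc
  have h := h.rescale f hf hc
  generalize hρ1 : (fun σ => f σ • ρ σ) = ρ1 at *
  obtain ⟨X, hX, hXρ⟩ := hilbert90 hg h.tw
  have hd := (Matrix.isUnit_iff_isUnit_det _).mp hX
  let Ψ : D →+* Matrix (Fin n) (Fin n) E :=
    { toFun := fun d => X⁻¹ * Φ d * X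
      map_one' := by simp [Matrix.nonsing_inv_mul _ hd]
      map_mul' := fun x y => by
        rw [map_mul]
        calc _ = X⁻¹ * Φ x * 1 * Φ y * X := by simp [Matrix.mul_assoc]
          _ = _ := by rw [← Matrix.mul_nonsing_inv _ hd]; simp only [Matrix.mul_assoc]
      map_zero' := by simp
      map_add' := fun x y => by rw [map_add, Matrix.mul_add, Matrix.add_mul] }
  have hΨ : ∀ d, Ψ d = X⁻¹ * Φ d * X := fun _ => rfl
  have hfix : ∀ d σ, (Ψ d).map (a σ) = Ψ d := by
    intro d σ
    have hu : IsUnit (X.map (a σ)) := hX.map (a σ).mapMatrix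
    have h1 : X⁻¹ * ρ1 σ = (X.map (a σ))⁻¹ := by
      symm
      apply Matrix.inv_eq_left_inv
      rw [Matrix.mul_assoc, hXρ, Matrix.nonsing_inv_mul _ hd]
    rw [hΨ, Matrix.map_mul, Matrix.map_mul, map_inv_act a σ hX, ← h1, Matrix.mul_assoc X⁻¹, h.inter,
      ← Matrix.mul_assoc, Matrix.mul_assoc _ (ρ1 σ), hXρ]
  obtain ⟨Φ0, hΦ0⟩ := lift_inj Ψ ((algebraMap F E).mapMatrix (m := Fin n)) (mapMatrix_inj _ _) (fun d => by
    have : ∀ x y, ∃ z, algebraMap F E z = Ψ d x y := by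
      intro x y
      apply hg.mem
      intro σ
      exact congrFun (congrFun (hfix d σ) x) y
    choose M hM using this
    exact ⟨Matrix.of M, by ext x y; exact hM x y⟩)
  refine ⟨Φ0, fun y => mapMatrix_inj (algebraMap F E) n ?_⟩
  rw [hΦ0, hΨ, h.alg, scalar_eq_smul, Matrix.mul_smul, mul_one, Matrix.smul_mul, Matrix.nonsing_inv_mul _ hd]
  rw [Matrix.smul_one_eq_diagonal]
  simp [Matrix.diagonal_map]

theorem coh_of_splits [IsSimpleRing D] [Algebra.IsCentral K D] [FiniteDimensional K D]
    (hn : Module.finrank K D = n ^ 2)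
    (hfix : ∀ σ y, a σ (algebraMap F E y) = algebraMap F E y) (h : Desc ((algebraMap F E).comp i) a Φ ρ c)
    (hs : Splits i n D) : Coh a c (fun _ _ => 1) := by
  obtain ⟨Φ0, h0⟩ := hs
  have : Desc ((algebraMap F E).comp i) a ((algebraMap F E).mapMatrix.comp Φ0) (fun _ => 1) (fun _ _ => 1) := by
    refine ⟨⟨fun _ => isUnit_one, fun σ τ => by simp [Matrix.map_one _ (map_zero _) (map_one _)]⟩, fun y => ?_, fun σ d => ?_⟩
    · simp [h0, Matrix.diagonal_map]
    · rw [one_mul, mul_one]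
      ext x y
      simp [hfix]
  exact h.coh hn this

end

section
variable {K D D' E G : Type*} [Field K] [DivisionRing D] [Algebra K D] [Field E] [Group G] [Algebra K E]
    {a : G →* (E →+* E)} {n : ℕ} {Φ : D →+* Matrix (Fin n) (Fin n) E}
    {ρ : G → Matrix (Fin n) (Fin n) E} {c : G → G → E}
    [Ring D'] [Algebra K D'] {Φ' : D' →+* Matrix (Fin n) (Fin n) E}
    {ρ' : G → Matrix (Fin n) (Fin n) E} {c' : G → G → E}

theorem Desc.range_eq {D : Type*} [Ring D] [IsSimpleRing D] [Algebra K D] {Φ : D →+* Matrix (Fin n) (Fin n) E}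
    [Finite G] [FiniteDimensional K D] (hg : IsGal K a) (hn : Module.finrank K D = n ^ 2)
    (h : Desc (algebraMap K E) a Φ ρ c) (X : Matrix (Fin n) (Fin n) E) :
    (∀ σ, ρ σ * X.map (a σ) = X * ρ σ) ↔ ∃ d, Φ d = X := by
  have hn0 := pos_of_sq hn
  have : Nonempty (Fin n) := ⟨⟨0, hn0⟩⟩
  let L : D →ₗ[K] Matrix (Fin n) (Fin n) E :=
    { toFun := Φ, map_add' := map_add _, map_smul' := fun r d => by
        rw [Algebra.smul_def, map_mul, h.alg, scalar_eq_smul, Matrix.smul_mul, one_mul, algebraMap_smul]; rfl }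
  have hL : Function.Injective L := Φ.injective
  obtain ⟨hfd, hfr, -⟩ := form_main hg h.tw h.tw hn0
  have hle : L.range ≤ Form K hg ρ ρ := by
    rintro _ ⟨d, rfl⟩ σ
    exact h.inter σ d
  have := Submodule.eq_of_le_of_finrank_eq hle (by
    rw [LinearMap.finrank_range_of_inj hL, hn, hfr, sq])
  rw [← mem_Form (hg := hg), ← this]
  rfl

theorem formIso [Finite G] [FiniteDimensional K D] [FiniteDimensional K D'] [IsSimpleRing D']
    (hg : IsGal K a) (hn : Module.finrank K D = n ^ 2)
    (hn' : Module.finrank K D' = n ^ 2) (h : Desc (algebraMap K E) a Φ ρ c) (h' : Desc (algebraMap K E) a Φ' ρ' c')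
    (hc : Coh a c c') : Nonempty (D ≃ₐ[K] D') := by
  obtain ⟨f, hf, hc⟩ := hc
  have h := h.rescale f hf hc
  generalize hρ1 : (fun σ => f σ • ρ σ) = ρ1 at *
  have hn0 := pos_of_sq hn
  have : Nonempty (Fin n) := ⟨⟨0, hn0⟩⟩
  obtain ⟨-, -, hsp⟩ := form_main hg h'.tw h.tw hn0
  obtain ⟨-, -, hsp'⟩ := form_main hg h.tw h'.tw hn0
  obtain ⟨X, hX, hX0⟩ : ∃ X ∈ Form K hg ρ' ρ1, X ≠ 0 := by
    by_contra hcon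
    push Not at hcon
    have : Submodule.span E (Form K hg ρ' ρ1 : Set (Matrix (Fin n) (Fin n) E)) = ⊥ := by
      rw [Submodule.span_eq_bot]; exact hcon
    rw [this] at hsp
    exact bot_ne_top hsp
  obtain ⟨Y, hY, hYX⟩ : ∃ Y ∈ Form K hg ρ1 ρ', Y * X ≠ 0 := by
    by_contra hcon
    push Not at hcon
    apply hX0
    have h1 : (1 : Matrix (Fin n) (Fin n) E) ∈ Submodule.span E (Form K hg ρ1 ρ' : Set (Matrix (Fin n) (Fin n) E)) := by
      rw [hsp']; trivial
    have : ∀ Z ∈ Submodule.span E (Form K hg ρ1 ρ' : Set (Matrix (Fin n) (Fin n) E)), Z * X = 0 := by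
      intro Z hZ
      induction hZ using Submodule.span_induction with
      | mem Z hZ => exact hcon Z hZ
      | zero => simp
      | add Z W _ _ hz hw => rw [Matrix.add_mul, hz, hw, add_zero]
      | smul r Z _ hz => rw [Matrix.smul_mul, hz, smul_zero]
    simpa using this 1 h1
  have hX := mem_Form.mp hX
  have hY := mem_Form.mp hY
  obtain ⟨d, hd⟩ := (h.range_eq hg hn (Y * X)).mp (fun σ => by
    rw [Matrix.map_mul, ← Matrix.mul_assoc, hY, Matrix.mul_assoc, hX, Matrix.mul_assoc])
  have hd0 : d ≠ 0 := by rintro rfl; rw [map_zero] at hd; exact hYX hd.symm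
  have hXu : IsUnit X := by
    have : Φ d⁻¹ * Y * X = 1 := by
      rw [Matrix.mul_assoc, ← hd, ← map_mul, inv_mul_cancel₀ hd0, map_one]
    exact IsUnit.of_mul_eq_one_right _ this
  have hXd := (Matrix.isUnit_iff_isUnit_det _).mp hXu
  let Ψ : D →+* Matrix (Fin n) (Fin n) E :=
    { toFun := fun d => X * Φ d * X⁻¹
      map_one' := by simp [Matrix.mul_nonsing_inv _ hXd]
      map_mul' := fun x y => by
        rw [map_mul]
        calc _ = X * Φ x * 1 * Φ y * X⁻¹ := by simp [Matrix.mul_assoc]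
          _ = _ := by rw [← Matrix.nonsing_inv_mul _ hXd]; simp only [Matrix.mul_assoc]
      map_zero' := by simp
      map_add' := fun x y => by rw [map_add, Matrix.mul_add, Matrix.add_mul] }
  have hΨ : ∀ d, Ψ d = X * Φ d * X⁻¹ := fun _ => rfl
  obtain ⟨g, hgΨ⟩ := lift_inj Ψ Φ' Φ'.injective (fun d => by
    rw [← h'.range_eq hg hn']
    intro σ
    have hu : IsUnit (X.map (a σ)) := hXu.map (a σ).mapMatrix
    have hud := (Matrix.isUnit_iff_isUnit_det _).mp hu
    have h1 : ρ1 σ * (X.map (a σ))⁻¹ = X⁻¹ * ρ' σ := by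
      calc _ = X⁻¹ * (X * ρ1 σ) * (X.map (a σ))⁻¹ := by
            rw [← Matrix.mul_assoc, Matrix.nonsing_inv_mul _ hXd, Matrix.one_mul]
        _ = _ := by rw [← hX, Matrix.mul_assoc, Matrix.mul_assoc, Matrix.mul_nonsing_inv _ hud, mul_one]
    rw [hΨ, Matrix.map_mul, Matrix.map_mul, map_inv_act a σ hXu, ← Matrix.mul_assoc, ← Matrix.mul_assoc, hX,
      Matrix.mul_assoc X, h.inter, ← Matrix.mul_assoc, Matrix.mul_assoc _ (ρ1 σ), h1, Matrix.mul_assoc, Matrix.mul_assoc,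
      Matrix.mul_assoc])
  have hcomm : ∀ r, g (algebraMap K D r) = algebraMap K D' r := by
    intro r
    apply Φ'.injective
    rw [hgΨ, hΨ, h.alg, h'.alg, scalar_eq_smul, Matrix.mul_smul, mul_one, Matrix.smul_mul,
      Matrix.mul_nonsing_inv _ hXd]
  let g' : D →ₐ[K] D' := { g with commutes' := hcomm }
  have hinj : Function.Injective g' := g.injective
  refine ⟨AlgEquiv.ofBijective g' ⟨hinj, ?_⟩⟩
  exact (LinearMap.injective_iff_surjective_of_finrank_eq_finrank (f := g'.toLinearMap) (by rw [hn, hn'])).mp hinj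

end

end SG
end

section
open TensorProduct

namespace SG

theorem rank_fact {E : Type*} [Field E] {d r : ℕ} (X : Matrix (Fin d) (Fin r) E) :
    ∃ (s : ℕ) (B : Matrix (Fin d) (Fin s) E) (Z : Matrix (Fin s) (Fin r) E) (Z' : Matrix (Fin r) (Fin s) E)
      (L : Matrix (Fin s) (Fin d) E), s ≤ d ∧ X = B * Z ∧ Z * Z' = 1 ∧ L * B = 1 := by
  let f := Matrix.toLin' X
  let C := f.range
  let s := Module.finrank E C
  have hs : s ≤ d := by
    have := Submodule.finrank_le C
    simpa using this
  let e : C ≃ₗ[E] (Fin s → E) := (Module.finBasis E C).equivFun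
  obtain ⟨z', hz'⟩ := (e.toLinearMap ∘ₗ f.rangeRestrict).exists_rightInverse_of_surjective (by
    rw [LinearMap.range_eq_top]
    exact e.surjective.comp f.surjective_rangeRestrict)
  obtain ⟨l, hl⟩ := (C.subtype ∘ₗ e.symm.toLinearMap).exists_leftInverse_of_injective (by
    rw [LinearMap.ker_eq_bot]
    exact C.injective_subtype.comp e.symm.injective)
  refine ⟨s, LinearMap.toMatrix' (C.subtype ∘ₗ e.symm.toLinearMap), LinearMap.toMatrix' (e.toLinearMap ∘ₗ f.rangeRestrict),
    LinearMap.toMatrix' z', LinearMap.toMatrix' l, hs, ?_, ?_, ?_⟩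
  · rw [← LinearMap.toMatrix'_comp]
    have : (C.subtype ∘ₗ e.symm.toLinearMap) ∘ₗ e.toLinearMap ∘ₗ f.rangeRestrict = f := by
      ext; simp
    rw [this]; simp [f]
  · rw [← LinearMap.toMatrix'_comp, hz', LinearMap.toMatrix'_id]
  · rw [← LinearMap.toMatrix'_comp, hl, LinearMap.toMatrix'_id]

section
variable {F E G : Type*} [Field F] [Field E] [Algebra F E] [Group G]
  {a : G →* (E →+* E)} {c : G → G → E} {m n : ℕ}
  {ρ : G → Matrix (Fin n) (Fin n) E}

theorem Tw.cocycle (h : Tw a c ρ) (hn : 0 < n) (σ τ υ : G) :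
    a σ (c τ υ) * c σ (τ * υ) = c σ τ * c (σ * τ) υ := by
  have : Nonempty (Fin n) := ⟨⟨0, hn⟩⟩
  have h1 : ρ σ * (ρ τ * (ρ υ).map (a τ)).map (a σ) = (a σ (c τ υ) * c σ (τ * υ)) • ρ (σ * τ * υ) := by
    rw [h.mul, map_smul_act, Matrix.mul_smul, h.mul, smul_smul, mul_assoc σ]
  have h2 : ρ σ * (ρ τ * (ρ υ).map (a τ)).map (a σ) = (c σ τ * c (σ * τ) υ) • ρ (σ * τ * υ) := by
    rw [Matrix.map_mul, ← map_act_mul, ← Matrix.mul_assoc, h.mul, Matrix.smul_mul, h.mul, smul_smul]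
  exact smul_left_injective E (h.unit _).ne_zero (h1.symm.trans h2)

/-- a semilinear system with unit at one is a twisted representation -/
theorem Tw.mk' {c0 : E} (hc0 : c0 ≠ 0) (hc : ∀ σ τ, c σ τ ≠ 0) (h1 : ρ 1 = c0 • 1)
    (hm : ∀ σ τ, ρ σ * (ρ τ).map (a σ) = c σ τ • ρ (σ * τ)) : Tw a c ρ := by
  refine ⟨fun σ => ?_, hm⟩
  have h2 := hm σ σ⁻¹
  rw [mul_inv_cancel, h1, smul_smul] at h2
  have hne : c σ σ⁻¹ * c0 ≠ 0 := mul_ne_zero (hc _ _) hc0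
  refine IsUnit.of_mul_eq_one ((c σ σ⁻¹ * c0)⁻¹ • (ρ σ⁻¹).map (a σ)) ?_
  rw [Matrix.mul_smul, h2, smul_smul, inv_mul_cancel₀ hne, one_smul]

/-- regular twisted representation -/
theorem exists_tw [Finite G] (hc : ∀ σ τ, c σ τ ≠ 0)
    (hco : ∀ σ τ υ, a σ (c τ υ) * c σ (τ * υ) = c σ τ * c (σ * τ) υ) :
    ∃ n, 0 < n ∧ ∃ ρ : G → Matrix (Fin n) (Fin n) E, Tw a c ρ := by
  classical
  have := Fintype.ofFinite G
  let e := Fintype.equivFin G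
  let n := Fintype.card G
  let R : G → Matrix G G E := fun σ => Matrix.of fun x y => if x = σ * y then c σ y else 0
  have hR1 : R 1 = c 1 1 • 1 := by
    ext x y
    by_cases hxy : x = y
    · subst hxy
      simp only [R, Matrix.of_apply, one_mul, if_true, Matrix.smul_apply, Matrix.one_apply_eq, smul_eq_mul, mul_one]
      have h1 := hco 1 1 x
      simp only [one_mul, map_one, RingHom.one_def, RingHom.id_apply] at h1
      exact mul_right_cancel₀ (hc 1 x) h1
    · simp [R, hxy]
  have hR : ∀ σ τ, R σ * (R τ).map (a σ) = c σ τ • R (σ * τ) := by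
    intro σ τ
    ext x y
    rw [Matrix.mul_apply, Finset.sum_eq_single (τ * y)]
    · by_cases hxy : x = σ * τ * y
      · have h2 : x = σ * (τ * y) := by rw [hxy, mul_assoc]
        simp only [R, Matrix.of_apply, Matrix.map_apply, if_true, Matrix.smul_apply, smul_eq_mul, if_pos h2, if_pos hxy]
        rw [← hco, mul_comm]
      · have h2 : x ≠ σ * (τ * y) := by rwa [← mul_assoc]
        simp only [R, Matrix.of_apply, Matrix.map_apply, if_true, Matrix.smul_apply, smul_eq_mul, if_neg h2, if_neg hxy]
        simp
    · intro z _ hz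
      simp [R, hz]
    · simp
  refine ⟨n, Fintype.card_pos, fun σ => (R σ).submatrix e.symm e.symm, Tw.mk' (hc 1 1) hc ?_ ?_⟩
  · rw [hR1]; ext x y; simp [Matrix.one_apply]
  · intro σ τ
    have : ((R τ).submatrix e.symm e.symm).map (a σ) = ((R τ).map (a σ)).submatrix e.symm e.symm := rfl
    rw [this, Matrix.submatrix_mul_equiv, hR]; rfl

/-- simple twisted representations -/
def SimpleTw (a : G →* (E →+* E)) (ρ : G → Matrix (Fin n) (Fin n) E) : Prop :=
  ∀ (r : ℕ) (X : Matrix (Fin n) (Fin r) E), X ≠ 0 → (∀ σ, ∃ A : Matrix (Fin r) (Fin r) E, ρ σ * X.map (a σ) = X * A) →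
    ∃ Y : Matrix (Fin r) (Fin n) E, X * Y = 1

theorem exists_simpleTw [Finite G] (hc : ∀ σ τ, c σ τ ≠ 0)
    (hco : ∀ σ τ υ, a σ (c τ υ) * c σ (τ * υ) = c σ τ * c (σ * τ) υ) :
    ∃ n, 0 < n ∧ ∃ ρ : G → Matrix (Fin n) (Fin n) E, Tw a c ρ ∧ SimpleTw a ρ := by
  classical
  have hex := exists_tw hc hco
  obtain ⟨hn0, ρ, hρ⟩ := Nat.find_spec hex
  have hmin : ∀ m, 0 < m → (∃ ρ : G → Matrix (Fin m) (Fin m) E, Tw a c ρ) → Nat.find hex ≤ m :=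
    fun m h1 h2 => Nat.find_min' hex ⟨h1, h2⟩
  generalize Nat.find hex = n at *
  refine ⟨n, hn0, ρ, hρ, ?_⟩
  intro r X hX hA
  obtain ⟨s, B, Z, Z', L, hs, hXB, hZ, hL⟩ := rank_fact X
  choose A hA using hA
  have hBX : B = X * Z' := by rw [hXB, Matrix.mul_assoc, hZ, Matrix.mul_one]
  let P : G → Matrix (Fin s) (Fin s) E := fun σ => Z * A σ * Z'.map (a σ)
  have hP : ∀ σ, ρ σ * B.map (a σ) = B * P σ := by
    intro σ
    conv_lhs => rw [hBX]
    rw [Matrix.map_mul, ← Matrix.mul_assoc, hA, hXB]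
    simp only [P, Matrix.mul_assoc]
  have hcan : ∀ M N : Matrix (Fin s) (Fin s) E, B * M = B * N → M = N := by
    intro M N hMN
    have := congrArg (fun Q => L * Q) hMN
    simpa only [← Matrix.mul_assoc, hL, Matrix.one_mul] using this
  have hTw : Tw a c P := by
    refine Tw.mk' (hc 1 1) hc (hcan _ _ ?_) (fun σ τ => hcan _ _ ?_)
    · rw [← hP, map_act_one, hρ.one]; simp
    · rw [← Matrix.mul_assoc, ← hP, Matrix.mul_assoc, ← Matrix.map_mul, ← hP, Matrix.map_mul, ← Matrix.mul_assoc, hρ.mul,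
        ← map_act_mul, Matrix.smul_mul, hP, Matrix.mul_smul]
  have hs0 : 0 < s := by
    rcases Nat.eq_zero_or_pos s with h | h
    · subst h
      exfalso; apply hX
      rw [hXB]; ext x y; simp [Matrix.mul_apply]
    · exact h
  have : s = n := le_antisymm hs (hmin s hs0 ⟨P, hTw⟩)
  subst this
  refine ⟨Z' * L, ?_⟩
  rw [← Matrix.mul_assoc, ← hBX]
  exact mul_eq_one_comm.mp hL

/-- the algebra of self intertwiners -/
def FormAlg (F : Type*) {E G : Type*} [Field F] [Field E] [Algebra F E] [Group G]
  {a : G →* (E →+* E)} (hg : IsGal F a) {n : ℕ}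
  (ρ : G → Matrix (Fin n) (Fin n) E) : Subalgebra F (Matrix (Fin n) (Fin n) E) where
  carrier := {X | ∀ σ, ρ σ * X.map (a σ) = X * ρ σ}
  zero_mem' := (Form F hg ρ ρ).zero_mem
  add_mem' := (Form F hg ρ ρ).add_mem
  one_mem' := fun σ => by rw [Matrix.map_one _ (map_zero _) (map_one _), one_mul, mul_one]
  mul_mem' := fun {X Y} hx hy σ => by
    have hx := hx σ
    have hy := hy σ
    rw [Matrix.map_mul, ← Matrix.mul_assoc, hx, Matrix.mul_assoc, hy, Matrix.mul_assoc]
  algebraMap_mem' := fun r => by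
    rw [Algebra.algebraMap_eq_smul_one]
    apply (Form F hg ρ ρ).smul_mem
    intro σ
    rw [Matrix.map_one _ (map_zero _) (map_one _), one_mul, mul_one]

theorem mem_FormAlg {hg : IsGal F a} {X : Matrix (Fin n) (Fin n) E} :
    X ∈ FormAlg F hg ρ ↔ ∀ σ, ρ σ * X.map (a σ) = X * ρ σ := Iff.rfl

theorem formAlg_finrank [Finite G] (hg : IsGal F a) (h : Tw a c ρ) (hn : 0 < n) :
    FiniteDimensional F (FormAlg F hg ρ) ∧ Module.finrank F (FormAlg F hg ρ) = n ^ 2 := by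
  obtain ⟨h1, h2, -⟩ := form_main hg h h hn
  rw [sq]
  exact ⟨h1, h2⟩

theorem formAlg_central [Finite G] (hg : IsGal F a) (h : Tw a c ρ) (hn : 0 < n) :
    Algebra.IsCentral F (FormAlg F hg ρ) := by
  have : Nonempty (Fin n) := ⟨⟨0, hn⟩⟩
  obtain ⟨-, -, hsp⟩ := form_main hg h h hn
  refine ⟨fun x hx => ?_⟩
  rw [Subalgebra.mem_center_iff] at hx
  have h1 : ∀ Y : Matrix (Fin n) (Fin n) E, Y * x.1 = x.1 * Y := by
    intro Y
    have hY : Y ∈ Submodule.span E (Form F hg ρ ρ : Set (Matrix (Fin n) (Fin n) E)) := by rw [hsp]; trivial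
    induction hY using Submodule.span_induction with
    | mem Z hZ => exact congrArg Subtype.val (hx ⟨Z, hZ⟩)
    | zero => simp
    | add Z W _ _ hz hw => rw [Matrix.add_mul, hz, hw, Matrix.mul_add]
    | smul r Z _ hz => rw [Matrix.smul_mul, hz, Matrix.mul_smul]
  obtain ⟨y, hy⟩ := Matrix.mem_range_scalar_iff_commute_single'.mpr (fun i j => h1 _)
  rw [scalar_eq_smul] at hy
  obtain ⟨z, hz⟩ := hg.mem y (fun σ => by
    have h2 := mem_FormAlg.mp x.2 σ
    rw [← hy, map_smul_act, Matrix.map_one _ (map_zero _) (map_one _), Matrix.mul_smul, Matrix.smul_mul, one_mul, mul_one] at h2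
    exact smul_left_injective E (h.unit σ).ne_zero h2)
  refine ⟨z, Subtype.ext ?_⟩
  rw [← hy, ← hz]
  change algebraMap F (Matrix (Fin n) (Fin n) E) z = _
  rw [Algebra.algebraMap_eq_smul_one, algebraMap_smul]

theorem formAlg_domain (hg : IsGal F a) (hn : 0 < n) (hu : ∀ A ∈ FormAlg F hg ρ, A ≠ 0 → IsUnit A) :
    IsDomain (FormAlg F hg ρ) := by
  have : Nonempty (Fin n) := ⟨⟨0, hn⟩⟩
  have : NoZeroDivisors (FormAlg F hg ρ) := by
    refine ⟨fun {x y} hxy => ?_⟩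
    by_contra hcon
    push Not at hcon
    have h1 := hu x.1 x.2 (fun h => hcon.1 (Subtype.ext h))
    have h2 := hu y.1 y.2 (fun h => hcon.2 (Subtype.ext h))
    have h3 := h1.mul h2
    have h4 : x.1 * y.1 = 0 := congrArg Subtype.val hxy
    rw [h4] at h3
    exact not_isUnit_zero h3
  exact NoZeroDivisors.to_isDomain _

theorem simpleTw_isUnit (hs : SimpleTw a ρ) {X : Matrix (Fin n) (Fin n) E} (hX0 : X ≠ 0)
    (hX : ∀ σ, ∃ A, ρ σ * X.map (a σ) = X * A) : IsUnit X := by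
  obtain ⟨Y, hY⟩ := hs n X hX0 hX
  exact IsUnit.of_mul_eq_one _ hY

/-- divisibility of dimensions of twisted representations -/
theorem tw_dvd [Finite G] (hg : IsGal F a) {ρ' : G → Matrix (Fin m) (Fin m) E} (h : Tw a c ρ) (hn : 0 < n) (hm : 0 < m)
    (h' : Tw a c ρ') (hu : ∀ A ∈ FormAlg F hg ρ, A ≠ 0 → IsUnit A) : n ∣ m := by
  have := formAlg_domain hg hn hu
  obtain ⟨hfd, hfr⟩ := formAlg_finrank hg h hn
  let : DivisionRing (FormAlg F hg ρ) := divisionRingOfFiniteDimensional F _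
  let : SMul (FormAlg F hg ρ) (Form F hg ρ ρ') := ⟨fun A X => ⟨A.1 * X.1, fun σ => by
    have hx := X.2 σ
    have hA := A.2 σ
    rw [Matrix.map_mul, ← Matrix.mul_assoc, hA, Matrix.mul_assoc, hx, Matrix.mul_assoc]⟩⟩
  have hsm : ∀ (A : FormAlg F hg ρ) (X : Form F hg ρ ρ'), (A • X).1 = A.1 * X.1 := fun _ _ => rfl
  let : Module (FormAlg F hg ρ) (Form F hg ρ ρ') :=
    { one_smul := fun X => Subtype.ext (by rw [hsm]; exact Matrix.one_mul _)
      mul_smul := fun A B X => Subtype.ext (by rw [hsm, hsm, hsm]; exact Matrix.mul_assoc _ _ _)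
      smul_zero := fun A => Subtype.ext (by rw [hsm]; exact Matrix.mul_zero _)
      smul_add := fun A X Y => Subtype.ext (by rw [hsm]; exact Matrix.mul_add _ _ _)
      add_smul := fun A B X => Subtype.ext (by rw [hsm]; exact Matrix.add_mul _ _ _)
      zero_smul := fun X => Subtype.ext (by rw [hsm]; exact Matrix.zero_mul _) }
  have : IsScalarTower F (FormAlg F hg ρ) (Form F hg ρ ρ') :=
    ⟨fun r A X => Subtype.ext (by rw [hsm]; exact Matrix.smul_mul _ _ _)⟩
  obtain ⟨-, h2, -⟩ := form_main hg h h' hm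
  have h3 := Module.finrank_mul_finrank F (FormAlg F hg ρ) (Form F hg ρ ρ')
  rw [hfr, h2, sq, mul_assoc] at h3
  exact ⟨_, (Nat.eq_of_mul_eq_mul_left hn h3).symm⟩

end

/-- division algebra of a cocycle -/
theorem exists_Delta {F : Type*} {E : Type u} {G : Type*} [Field F] [Field E] [Algebra F E] [Group G] [Finite G]
    {a : G →* (E →+* E)} (hg : IsGal F a) {c : G → G → E} (hc : ∀ σ τ, c σ τ ≠ 0)
    (hco : ∀ σ τ υ, a σ (c τ υ) * c σ (τ * υ) = c σ τ * c (σ * τ) υ) :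
    ∃ (d : ℕ) (ρ : G → Matrix (Fin d) (Fin d) E) (D : Type u) (_ : DivisionRing D) (_ : Algebra F D)
      (Φ : D →+* Matrix (Fin d) (Fin d) E), 0 < d ∧ FiniteDimensional F D ∧ Algebra.IsCentral F D ∧
      Module.finrank F D = d ^ 2 ∧ Desc (algebraMap F E) a Φ ρ c ∧ SimpleTw a ρ := by
  obtain ⟨n, hn, ρ, h, hs⟩ := exists_simpleTw hc hco
  have := formAlg_domain hg hn (fun A hA hA0 => simpleTw_isUnit hs hA0 (fun σ => ⟨_, mem_FormAlg.mp hA σ⟩))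
  obtain ⟨hfd, hfr⟩ := formAlg_finrank hg h hn
  have hcen := formAlg_central hg h hn
  refine ⟨n, ρ, FormAlg F hg ρ, divisionRingOfFiniteDimensional F _, inferInstance, (FormAlg F hg ρ).val.toRingHom,
    hn, hfd, hcen, hfr, ⟨h, fun y => ?_, fun σ d => d.2 σ⟩, hs⟩
  change algebraMap F (Matrix (Fin n) (Fin n) E) y = _
  rw [Algebra.algebraMap_eq_smul_one, ← algebraMap_smul E, scalar_eq_smul]

end SG
end

section
open TensorProduct

namespace SG
open MvPolynomial in
theorem common_zero {Ω : Type*} [Field Ω] [IsAlgClosed Ω] {n : ℕ} (s : Finset (MvPolynomial (Fin n) Ω))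
    (hs : s.card < n) (h0 : ∀ f ∈ s, eval 0 f = 0) : ∃ v : Fin n → Ω, v ≠ 0 ∧ ∀ f ∈ s, eval v f = 0 := by
  by_contra hcon
  push Not at hcon
  let φ : ℕ → MvPolynomial (Fin n) Ω →ₐ[Ω] MvPolynomial (Fin n) Ω :=
    fun j => aeval (fun i => if i.1 < j then 0 else X i)
  let P : ℕ → Ideal (MvPolynomial (Fin n) Ω) := fun j => RingHom.ker (φ j)
  have hP : ∀ j, (P j).IsPrime := fun j => RingHom.ker_isPrime _
  have hle : ∀ j, P j ≤ P (j + 1) := by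
    intro j f hf
    have hcomp : (φ (j + 1)).comp (φ j) = φ (j + 1) := by
      ext1 i
      simp only [φ, AlgHom.comp_apply, aeval_X]
      split_ifs with h1 h2 h2
      · simp
      · omega
      · rw [aeval_X, if_pos h2]
      · rw [aeval_X, if_neg h2]
    have hf : φ j f = 0 := hf
    change φ (j + 1) f = 0
    rw [← hcomp, AlgHom.comp_apply, hf, map_zero]
  have hlt : ∀ j < n, P j < P (j + 1) := by
    intro j hj
    refine lt_of_le_of_ne (hle j) ?_
    intro heq
    have h1 : (X ⟨j, hj⟩ : MvPolynomial (Fin n) Ω) ∈ P (j + 1) := by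
      change φ (j + 1) _ = 0
      simp [φ]
    rw [← heq] at h1
    have h2 : φ j (X ⟨j, hj⟩) = 0 := h1
    simp only [φ, aeval_X, lt_irrefl, if_false] at h2
    exact X_ne_zero _ h2
  have hht : ∀ j ≤ n, (j : ℕ∞) ≤ (P j).height := by
    intro j
    induction j with
    | zero => intro _; simp
    | succ j ih =>
      intro hj
      have h1 := Ideal.height_add_one_le_of_lt_of_isPrime (hlt j (by omega))
      have h2 := ih (by omega)
      push_cast
      exact (add_le_add_left h2 1).trans h1
  have hPn : ∀ f, f ∈ P n ↔ eval 0 f = 0 := by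
    intro f
    have : φ n = (Algebra.ofId Ω _).comp (aeval (0 : Fin n → Ω)) := by
      ext1 i
      simp [φ]
    change φ n f = 0 ↔ _
    rw [this]
    simp [Algebra.ofId_apply, aeval_eq_eval]
  have hmin : P n ∈ (Ideal.span (s : Set (MvPolynomial (Fin n) Ω))).minimalPrimes := by
    refine ⟨⟨hP n, Ideal.span_le.mpr fun f hf => (hPn f).mpr (h0 f hf)⟩, ?_⟩
    rintro Q ⟨hQ, hIQ⟩ hQP f hf
    have hrad : f ∈ (Ideal.span (s : Set (MvPolynomial (Fin n) Ω))).radical := by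
      rw [← vanishingIdeal_zeroLocus_eq_radical (K := Ω)]
      rw [mem_vanishingIdeal_iff]
      intro x hx
      rw [mem_zeroLocus_iff] at hx
      have hx0 : x = 0 := by
        by_contra hx0
        obtain ⟨g, hg, hgx⟩ := hcon x hx0
        exact hgx (hx g (Ideal.subset_span hg))
      subst hx0
      exact (hPn f).mp hf
    exact (hQ.radical_le_iff.mpr hIQ) hrad
  have h1 := Ideal.height_le_card_of_mem_minimalPrimes_span_finset hmin
  have h2 := (hht n le_rfl).trans h1
  have h3 : n ≤ s.card := by exact_mod_cast h2
  omega

open MvPolynomial in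
theorem tsen_form {Ω : Type*} [Field Ω] [IsAlgClosed Ω] {N m : ℕ} (hm : m < N)
    (ν : MvPolynomial (Fin N) (Polynomial Ω)) (hν : ν.totalDegree ≤ m) (h0 : eval 0 ν = 0) :
    ∃ v : Fin N → Polynomial Ω, v ≠ 0 ∧ eval v ν = 0 := by
  let C0 : ℕ := ν.support.sup (fun d => (ν.coeff d).natDegree)
  let s := C0 + 1
  let T := MvPolynomial (Fin (N * (s + 1))) Ω
  let gX : Fin N → Polynomial T := fun i => ∑ j : Fin (s + 1), Polynomial.C (X (finProdFinEquiv (i, j))) * Polynomial.X ^ j.1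
  let θ : MvPolynomial (Fin N) (Polynomial Ω) →+* Polynomial T := eval₂Hom (Polynomial.mapRingHom C) gX
  have hgX : ∀ i, (gX i).natDegree ≤ s := by
    intro i
    refine Polynomial.natDegree_sum_le_of_forall_le _ _ (fun j _ => ?_)
    refine (Polynomial.natDegree_C_mul_X_pow_le _ _).trans ?_
    omega
  have hdeg : (θ ν).natDegree ≤ C0 + m * s := by
    change Polynomial.natDegree (eval₂ (Polynomial.mapRingHom C) gX ν) ≤ _
    rw [eval₂_eq]
    refine Polynomial.natDegree_sum_le_of_forall_le _ _ (fun d hd => ?_)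
    refine Polynomial.natDegree_mul_le.trans (add_le_add ?_ ?_)
    · refine Polynomial.natDegree_map_le.trans ?_
      exact Finset.le_sup (f := fun d => (ν.coeff d).natDegree) hd
    · refine (Polynomial.natDegree_prod_le _ _).trans ?_
      have h1 : ∑ i ∈ d.support, d i ≤ m := (le_totalDegree hd).trans hν
      refine le_trans ?_ (Nat.mul_le_mul_right s h1)
      rw [Finset.sum_mul]
      refine Finset.sum_le_sum (fun i _ => ?_)
      exact Polynomial.natDegree_pow_le.trans (Nat.mul_le_mul_left _ (hgX i))
  let vy : (Fin (N * (s + 1)) → Ω) → Fin N → Polynomial Ω := fun y i =>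
    ∑ j : Fin (s + 1), Polynomial.C (y (finProdFinEquiv (i, j))) * Polynomial.X ^ j.1
  have hev : ∀ y, Polynomial.map (eval y) (θ ν) = eval (vy y) ν := by
    intro y
    have : (Polynomial.mapRingHom (eval y)).comp θ = eval (vy y) := by
      apply MvPolynomial.ringHom_ext
      · intro p
        simp only [θ, RingHom.comp_apply, coe_eval₂Hom, eval₂_C, eval_C, Polynomial.coe_mapRingHom, Polynomial.map_map]
        have : (eval y).comp C = RingHom.id Ω := by ext1; simp
        rw [this, Polynomial.map_id]
      · intro i
        simp [θ, gX, vy, Polynomial.map_sum]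
    exact congrArg (fun f => f ν) this
  classical
  obtain ⟨y, hy0, hy⟩ := common_zero ((Finset.range (C0 + m * s + 1)).image (fun e => (θ ν).coeff e)) (by
    refine lt_of_le_of_lt Finset.card_image_le ?_
    rw [Finset.card_range]
    have : (m + 1) * (s + 1) ≤ N * (s + 1) := Nat.mul_le_mul_right _ hm
    refine lt_of_lt_of_le ?_ this
    ring_nf
    omega) (by
    intro f hf
    obtain ⟨e, -, rfl⟩ := Finset.mem_image.mp hf
    rw [← Polynomial.coeff_map, hev]
    have : vy 0 = 0 := by ext1 i; simp [vy]
    rw [this, h0, Polynomial.coeff_zero])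
  refine ⟨vy y, ?_, ?_⟩
  · intro h
    apply hy0
    ext t
    have h1 := congrFun h (finProdFinEquiv.symm t).1
    have h2 := congrArg (fun p => Polynomial.coeff p (finProdFinEquiv.symm t).2.1) h1
    simp only [vy, Polynomial.finsetSum_coeff, Polynomial.coeff_C_mul, Polynomial.coeff_X_pow] at h2
    rw [Finset.sum_eq_single (finProdFinEquiv.symm t).2] at h2
    · rw [Prod.mk.eta, Equiv.apply_symm_apply] at h2
      simpa using h2
    · intro b _ hb
      rw [if_neg (fun h => hb (Fin.ext h.symm)), mul_zero]
    · simp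
  · rw [← hev]
    ext1 e
    rw [Polynomial.coeff_map, Polynomial.coeff_zero]
    by_cases he : e < C0 + m * s + 1
    · exact hy _ (Finset.mem_image_of_mem _ (Finset.mem_range.mpr he))
    · rw [Polynomial.coeff_eq_zero_of_natDegree_lt (by omega), map_zero]

end SG
end

section
open TensorProduct

namespace SG

theorem splits_of_entries {K E E' D ι : Type*} [Field K] [Field E] [Field E'] [Ring D] [Algebra K D] [Fintype ι]
    {i : K →+* E} {n : ℕ} (b : Module.Basis ι K D) (Φ : D →+* Matrix (Fin n) (Fin n) E)
    (hΦ : ∀ y, Φ (algebraMap K D y) = Matrix.scalar (Fin n) (i y)) (j : E' →+* E) (i' : K →+* E')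
    (hij : j.comp i' = i) (h : ∀ t x y, ∃ z, j z = Φ (b t) x y) : Splits i' n D := by
  obtain ⟨Φ0, hΦ0⟩ := lift_inj Φ (j.mapMatrix (m := Fin n)) (mapMatrix_inj _ _) (fun d => by
    have : ∀ x y, ∃ z, j z = Φ d x y := by
      intro x y
      choose z hz using h
      refine ⟨∑ t, i' (b.repr d t) * z t x y, ?_⟩
      conv_rhs => rw [← b.sum_repr d]
      rw [map_sum, map_sum, Matrix.sum_apply]
      refine Finset.sum_congr rfl (fun t _ => ?_)
      rw [Algebra.smul_def, map_mul, map_mul, hΦ, hz, ← hij, scalar_eq_smul, Matrix.smul_mul, one_mul]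
      rfl
    choose M hM using this
    exact ⟨Matrix.of M, by ext x y; exact hM x y⟩)
  refine ⟨Φ0, fun y => mapMatrix_inj j n ?_⟩
  rw [hΦ0, hΦ, ← hij]
  simp [Matrix.diagonal_map]

theorem splits_of_brauer {K : Type u} {E : Type u} {D : Type u} [Field K] [Field E] [Algebra K E] [Ring D] [Algebra K D]
    [IsSimpleRing D] [Algebra.IsCentral K D] [FiniteDimensional K D] {n : ℕ} (hn : Module.finrank K D = n ^ 2)
    (hE : ∀ (B : Type u) [DivisionRing B] [Algebra E B] [Algebra.IsCentral E B] [FiniteDimensional E B],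
      (⊥ : Subalgebra E B) = ⊤) : Splits (algebraMap K E) n D := by
  have := tensor_simple K D E
  have hc := tensor_central K D E
  have : IsArtinianRing (E ⊗[K] D) := IsArtinianRing.of_finite E _
  obtain ⟨r, hr, B, _, _, hfd, ⟨e⟩⟩ := IsSimpleRing.exists_algEquiv_matrix_divisionRing_finite E (E ⊗[K] D)
  have hBc : Algebra.IsCentral E B := by
    have hM : Algebra.IsCentral E (Matrix (Fin r) (Fin r) B) := Algebra.IsCentral.of_algEquiv E _ _ e
    refine ⟨fun x hx => ?_⟩
    rw [Subalgebra.mem_center_iff] at hx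
    have h1 : Matrix.scalar (Fin r) x ∈ Subalgebra.center E (Matrix (Fin r) (Fin r) B) := by
      rw [Subalgebra.mem_center_iff]
      intro M
      ext i j
      simp [hx]
    obtain ⟨y, hy⟩ := hM.out h1
    refine ⟨y, ?_⟩
    have h2 := congrFun (congrFun hy 0) 0
    simpa [Matrix.algebraMap_matrix_apply] using h2
  have htop := hE B
  have hsurj : Function.Surjective (algebraMap E B) := by
    intro x
    have : x ∈ (⊥ : Subalgebra E B) := by rw [htop]; trivial
    exact this
  let e0 : E ≃ₐ[E] B := AlgEquiv.ofBijective (Algebra.ofId E B) ⟨(algebraMap E B).injective, hsurj⟩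
  let e1 : (E ⊗[K] D) ≃ₐ[E] Matrix (Fin r) (Fin r) E := e.trans e0.symm.mapMatrix
  have hrn : r = n := by
    have h1 := e1.toLinearEquiv.finrank_eq
    rw [Module.finrank_baseChange, hn, Module.finrank_matrix] at h1
    simp only [Fintype.card_fin, Module.finrank_self, mul_one] at h1
    rw [← sq] at h1
    exact (Nat.pow_left_injective (n := 2) (by norm_num) h1).symm
  subst hrn
  rw [splits_algebraMap_iff]
  exact ⟨(e1.toAlgHom.restrictScalars K).comp Algebra.TensorProduct.includeRight⟩

theorem brauer_sepClosed {E : Type*} [Field E] [IsSepClosed E] (B : Type*) [DivisionRing B] [Algebra E B]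
    [Algebra.IsCentral E B] [FiniteDimensional E B] : (⊥ : Subalgebra E B) = ⊤ := by
  by_contra hne
  obtain ⟨x, hx, hs⟩ := JacobsonNoether.exists_separable_and_not_isCentral' hne
  apply hx
  have hint : IsIntegral E x := Algebra.IsIntegral.isIntegral x
  have hdeg := IsSepClosed.degree_eq_one_of_irreducible E (minpoly.irreducible hint) hs
  have := minpoly.mem_range_of_degree_eq_one E x hdeg
  obtain ⟨y, hy⟩ := this
  exact ⟨y, hy⟩

theorem exists_galois_split {K : Type u} {D : Type u} [Field K] [Ring D] [Algebra K D]
    [IsSimpleRing D] [Algebra.IsCentral K D] [FiniteDimensional K D] {n : ℕ} (hn : Module.finrank K D = n ^ 2) :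
    ∃ (L : Type u) (_ : Field L) (_ : Algebra K L), FiniteDimensional K L ∧ IsGalois K L ∧
      Splits (algebraMap K L) n D := by
  have hs : Splits (algebraMap K (SeparableClosure K)) n D := splits_of_brauer hn (fun B => by
    intro _ _ _ _
    exact brauer_sepClosed B)
  obtain ⟨Φ, hΦ⟩ := hs
  let b := Module.finBasis K D
  let S : Set (SeparableClosure K) := Set.range (fun p : Fin (Module.finrank K D) × Fin n × Fin n => Φ (b p.1) p.2.1 p.2.2)
  have hS : S.Finite := Set.finite_range _
  let M := IntermediateField.adjoin K S
  have hM : FiniteDimensional K M := by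
    have : Finite S := hS
    exact IntermediateField.finiteDimensional_adjoin (fun x _ => Algebra.IsIntegral.isIntegral x)
  let L := IntermediateField.normalClosure K M (SeparableClosure K)
  have hML : M ≤ L := IntermediateField.le_normalClosure M
  have : FiniteDimensional K L := normalClosure.is_finiteDimensional K M _
  have : IsGalois K L := { }
  refine ⟨L, inferInstance, inferInstance, inferInstance, inferInstance, ?_⟩
  refine splits_of_entries b Φ hΦ (algebraMap L (SeparableClosure K)) _ rfl (fun t x y => ?_)
  exact ⟨⟨Φ (b t) x y, hML (IntermediateField.subset_adjoin K S ⟨(t, x, y), rfl⟩)⟩, rfl⟩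

end SG
end

section
open TensorProduct

namespace SG

theorem Coh.pow {E G : Type*} [Field E] [Group G] {a : G →* (E →+* E)} {c c' : G → G → E} (h : Coh a c c') (j : ℕ) :
    Coh a (fun σ τ => c σ τ ^ j) (fun σ τ => c' σ τ ^ j) := by
  induction j with
  | zero => simpa using Coh.refl (a := a) (fun _ _ => 1)
  | succ j ih => simpa [pow_succ] using ih.mul h

theorem coh_card {E G : Type*} [Field E] [Group G] [Fintype G] {a : G →* (E →+* E)} {c : G → G → E}
    (hc0 : ∀ σ τ, c σ τ ≠ 0)
    (hc : ∀ σ τ υ, a σ (c τ υ) * c σ (τ*υ) = c σ τ * c (σ*τ) υ) :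
    Coh a (fun _ _ => 1) (fun σ τ => c σ τ ^ Fintype.card G) := by
  refine ⟨fun σ => ∏ υ, c σ υ, fun σ => Finset.prod_ne_zero_iff.mpr (fun υ _ => hc0 _ _), fun σ τ => ?_⟩
  have h1 : ∏ υ, (a σ (c τ υ) * c σ (τ*υ)) = ∏ υ, (c σ τ * c (σ*τ) υ) := Finset.prod_congr rfl (fun υ _ => hc _ _ _)
  rw [Finset.prod_mul_distrib, Finset.prod_mul_distrib, Finset.prod_const, Finset.card_univ,
    Fintype.prod_equiv (Equiv.mulLeft τ) (fun υ => c σ (τ * υ)) (fun υ => c σ υ) (fun _ => rfl)] at h1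
  rw [map_prod, mul_one, ← h1, mul_comm]

/-- the Galois action on a Galois extension -/
def galAct (K L : Type*) [Field K] [Field L] [Algebra K L] : (L ≃ₐ[K] L) →* (L →+* L) where
  toFun σ := (σ : L →+* L)
  map_one' := rfl
  map_mul' _ _ := rfl

@[simp] theorem galAct_apply (K L : Type*) [Field K] [Field L] [Algebra K L] (σ : L ≃ₐ[K] L) (x : L) :
    galAct K L σ x = σ x := rfl

theorem galAct_isGal (K L : Type*) [Field K] [Field L] [Algebra K L] [FiniteDimensional K L] [IsGalois K L] :
    IsGal K (galAct K L) where
  inj := fun σ τ h => by ext x; exact congrArg (fun f : L →+* L => f x) h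
  fixed := fun σ y => σ.commutes y
  mem := fun x hx => by
    have := (IsGalois.mem_range_algebraMap_iff_fixed (F := K) (x := x)).mpr (fun σ => hx σ)
    exact this

theorem galAct_sub_isGal (K L : Type*) [Field K] [Field L] [Algebra K L] [FiniteDimensional K L]
    (S : Subgroup (L ≃ₐ[K] L)) :
    IsGal (IntermediateField.fixedField S) ((galAct K L).comp S.subtype) where
  inj := fun σ τ h => by
    apply Subtype.ext
    ext x; exact congrArg (fun f : L →+* L => f x) h
  fixed := fun σ y => y.2 σ
  mem := fun x hx => ⟨⟨x, fun σ => hx σ⟩, rfl⟩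

theorem two_power {K D : Type u} [Field K] [DivisionRing D] [Algebra K D]
    [Algebra.IsCentral K D] [FiniteDimensional K D] {n : ℕ} (hn : Module.finrank K D = n ^ 2)
    (e : D ≃ₐ[K] Dᵐᵒᵖ) : ∃ r, n = 2 ^ r := by
  refine ⟨_, Nat.eq_prime_pow_of_unique_prime_dvd (p := 2) (pos_of_sq hn).ne' ?_⟩
  intro p hp hpn
  by_contra hp2
  haveI := Fact.mk hp
  obtain ⟨L, _, _, _, _, Φ, hΦ⟩ := exists_galois_split hn
  obtain ⟨S⟩ : Nonempty (Sylow p (L ≃ₐ[K] L)) := inferInstance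
  let F := IntermediateField.fixedField (S : Subgroup (L ≃ₐ[K] L))
  have hg := galAct_sub_isGal K L (S : Subgroup (L ≃ₐ[K] L))
  have hi : (algebraMap F L).comp (algebraMap K F) = algebraMap K L := rfl
  obtain ⟨ρ, c, hd⟩ := exists_desc (i := algebraMap K L) (a := (galAct K L).comp (S : Subgroup (L ≃ₐ[K] L)).subtype) hn hΦ
    (fun σ y => (σ : L ≃ₐ[K] L).commutes y)
  have hc0 := fun σ τ => hd.tw.ne_zero (pos_of_sq hn) σ τ
  have h2 := (Coh.refl (a := (galAct K L).comp (S : Subgroup (L ≃ₐ[K] L)).subtype) c).mul (hd.coh_inv hn e)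
  have := Fintype.ofFinite (S : Subgroup (L ≃ₐ[K] L))
  have hN := coh_card hc0 (fun σ τ υ => hd.tw.cocycle (pos_of_sq hn) σ τ υ)
  have hodd : Odd (Fintype.card (S : Subgroup (L ≃ₐ[K] L))) := by
    obtain ⟨j, hj⟩ := IsPGroup.iff_card.mp S.isPGroup'
    rw [← Nat.card_eq_fintype_card, hj]
    exact (hp.odd_of_ne_two hp2).pow
  obtain ⟨j, hj⟩ := hodd
  have h3 := (h2.pow j).mul (Coh.refl c)
  have h4 : Coh ((galAct K L).comp (S : Subgroup (L ≃ₐ[K] L)).subtype) c (fun _ _ => 1) := by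
    refine (hN.trans ?_).symm
    convert h3 using 3 with σ τ σ τ
    · rw [hj]; ring
    · rw [mul_inv_cancel₀ (hc0 _ _)]; simp
  have hs := splits_of_coh (i := algebraMap K F) hg hd h4
  have hdvd := finrank_dvd_of_splits hn hs
  have hfr : Module.finrank K F = (S : Subgroup (L ≃ₐ[K] L)).index := by
    exact (IntermediateField.finrank_eq_fixingSubgroup_index L F).trans (by rw [IntermediateField.fixingSubgroup_fixedField])
  rw [hfr] at hdvd
  exact S.not_dvd_index (hpn.trans hdvd)

end SG
end

section
open TensorProduct

namespace SG

theorem exists_sq {K : Type*} {D : Type u} [Field K] [DivisionRing D] [Algebra K D] [Algebra.IsCentral K D]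
    [FiniteDimensional K D] : ∃ n, Module.finrank K D = n ^ 2 := by
  obtain ⟨S, _, h1, h2⟩ := exists_max_comm (⊤ : Subalgebra K D)
  obtain ⟨P, i1, i2, f, hf⟩ := exists_field_of_comm S h1
  have h3 := selfCentralizing_finrank f (fun u hu => by
    have := h2 u trivial (fun s hs => by
      obtain ⟨y, rfl⟩ := (hf s).mp hs
      exact hu y)
    obtain ⟨y, rfl⟩ := (hf u).mp this
    exact ⟨y, rfl⟩)
  exact ⟨_, h3.symm⟩

open MvPolynomial in
/-- the reduced norm form -/
theorem exists_norm_form {K : Type u} {D : Type u} [Field K] [DivisionRing D] [Algebra K D] [Algebra.IsCentral K D]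
    [FiniteDimensional K D] {n : ℕ} (hn : Module.finrank K D = n ^ 2) :
    ∃ ν : MvPolynomial (Fin (n ^ 2)) K, ν.totalDegree ≤ n ∧ ∀ v, eval v ν = 0 ↔ v = 0 := by
  obtain ⟨L, _, _, _, _, Φ, hΦ⟩ := exists_galois_split hn
  have hg := galAct_isGal K L
  obtain ⟨ρ, c, hd⟩ := exists_desc (i := algebraMap K L) (a := galAct K L) hn hΦ (fun σ y => σ.commutes y)
  let b : Module.Basis (Fin (n ^ 2)) K D := Module.finBasisOfFinrankEq K D hn
  let M : Matrix (Fin n) (Fin n) (MvPolynomial (Fin (n ^ 2)) L) :=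
    ∑ t, (X t : MvPolynomial (Fin (n ^ 2)) L) • (Φ (b t)).map C
  have hMd : M.det.totalDegree ≤ n := by
    rw [Matrix.det_apply]
    refine totalDegree_finsetSum_le (fun σ _ => ?_)
    rw [Units.smul_def, zsmul_eq_mul]
    refine (totalDegree_mul _ _).trans ?_
    have h1 : totalDegree (((Equiv.Perm.sign σ : ℤˣ) : ℤ) : MvPolynomial (Fin (n ^ 2)) L) = 0 := by
      rw [show (((Equiv.Perm.sign σ : ℤˣ) : ℤ) : MvPolynomial (Fin (n ^ 2)) L) = C (((Equiv.Perm.sign σ : ℤˣ) : ℤ) : L) by simp]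
      exact totalDegree_C _
    rw [h1, zero_add]
    refine (totalDegree_finsetProd _ _).trans ?_
    refine (Finset.sum_le_card_nsmul _ _ 1 (fun x _ => ?_)).trans (by simp)
    simp only [M, Matrix.sum_apply, Matrix.smul_apply, Matrix.map_apply, smul_eq_mul]
    refine totalDegree_finsetSum_le (fun t _ => ?_)
    refine (totalDegree_mul _ _).trans ?_
    simp
  have hfix : ∀ σ, map (galAct K L σ) M.det = M.det := by
    intro σ
    have h1 : (ρ σ).map C * (M.map (map (galAct K L σ))) = M * (ρ σ).map C := by
      have h2 : M.map (map (galAct K L σ)) = ∑ t, (X t : MvPolynomial (Fin (n ^ 2)) L) • ((Φ (b t)).map (galAct K L σ)).map C := by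
        ext1 x y
        simp [M, Matrix.sum_apply]
      rw [h2, Finset.mul_sum, Finset.sum_mul]
      refine Finset.sum_congr rfl (fun t _ => ?_)
      rw [Matrix.mul_smul, Matrix.smul_mul, ← Matrix.map_mul, hd.inter, Matrix.map_mul]
    have h3 := congrArg Matrix.det h1
    rw [Matrix.det_mul, Matrix.det_mul, mul_comm] at h3
    have h4 : ((ρ σ).map C).det ≠ (0 : MvPolynomial (Fin (n ^ 2)) L) := by
      have h5 := (hd.tw.unit σ).map (C (σ := Fin (n ^ 2)) (R := L)).mapMatrix
      exact ((Matrix.isUnit_iff_isUnit_det _).mp h5).ne_zero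
    have h6 := mul_right_cancel₀ h4 h3
    exact (RingHom.map_det (map (galAct K L σ)) M).trans h6
  have hcoef : ∀ m, ∃ y, algebraMap K L y = M.det.coeff m := fun m => hg.mem _ (fun σ => by
    conv_rhs => rw [← hfix σ, coeff_map])
  obtain ⟨ν, hν⟩ : ∃ ν : MvPolynomial (Fin (n ^ 2)) K, map (algebraMap K L) ν = M.det := by
    choose y hy using hcoef
    refine ⟨∑ m ∈ M.det.support, monomial m (y m), ?_⟩
    rw [map_sum]
    conv_rhs => rw [M.det.as_sum]
    exact Finset.sum_congr rfl (fun m _ => by rw [map_monomial, hy])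
  refine ⟨ν, ?_, fun v => ?_⟩
  · have h2 : ν.support = (map (algebraMap K L) ν).support :=
      (support_map_of_injective _ (algebraMap K L).injective).symm
    have h3 : ν.totalDegree = (map (algebraMap K L) ν).totalDegree := by
      unfold totalDegree; rw [h2]
    rw [h3, hν]; exact hMd
  · have h1 : algebraMap K L (eval v ν) = (Φ (∑ t, v t • b t)).det := by
      have h2 : algebraMap K L (eval v ν) = eval (fun t => algebraMap K L (v t)) M.det := by
        rw [← hν, eval_map]
        exact eval₂_comp _ _ _
      rw [h2, RingHom.map_det]
      congr 1
      rw [map_sum]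
      ext x y
      simp only [M, RingHom.mapMatrix_apply, Matrix.map_apply, Matrix.sum_apply, map_sum, Matrix.smul_apply, smul_eq_mul, map_mul, eval_X, eval_C]
      refine Finset.sum_congr rfl (fun t _ => ?_)
      rw [Algebra.smul_def, map_mul, hΦ, scalar_eq_smul, Matrix.smul_mul, one_mul, Matrix.smul_apply, smul_eq_mul]
    constructor
    · intro h0
      rw [h0, map_zero] at h1
      by_contra hv
      have hy : (∑ t, v t • b t) ≠ 0 := by
        intro h
        apply hv
        funext t
        exact Fintype.linearIndependent_iff.mp b.linearIndependent v h t
      have := ((Matrix.isUnit_iff_isUnit_det _).mp ((isUnit_iff_ne_zero.mpr hy).map Φ)).ne_zero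
      exact this h1.symm
    · rintro rfl
      have : NeZero n := ⟨(pos_of_sq hn).ne'⟩
      simp only [Pi.zero_apply, zero_smul, Finset.sum_const_zero, map_zero] at h1
      rw [Matrix.det_zero] at h1
      exact (map_eq_zero _).mp h1

open MvPolynomial in
theorem tsen {Ω : Type u} [Field Ω] [IsAlgClosed Ω] (B : Type u) [DivisionRing B] [Algebra (RatFunc Ω) B]
    [Algebra.IsCentral (RatFunc Ω) B] [FiniteDimensional (RatFunc Ω) B] : (⊥ : Subalgebra (RatFunc Ω) B) = ⊤ := by
  obtain ⟨n, hn⟩ := exists_sq (K := RatFunc Ω) (D := B)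
  have h0 := pos_of_sq hn
  obtain ⟨ν, hν, hz⟩ := exists_norm_form hn
  by_cases h1 : n = 1
  · apply Subalgebra.bot_eq_top_of_finrank_eq_one
    rw [hn, h1]; rfl
  exfalso
  have hlt : n < n ^ 2 := by
    have : 2 ≤ n := by omega
    nlinarith
  let := algebraMvPolynomial (σ := Fin (n ^ 2)) (R := Polynomial Ω) (S := RatFunc Ω)
  obtain ⟨⟨p, ⟨_, d, hd, rfl⟩⟩, hp⟩ := IsLocalization.surj ((nonZeroDivisors (Polynomial Ω)).map (C (σ := Fin (n^2)))) ν
  have hd0 : d ≠ 0 := nonZeroDivisors.ne_zero hd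
  simp only [RingHom.coe_coe, algebraMap_def, map_C] at hp
  have hpd : p.totalDegree ≤ n := by
    have h2 : p.support = (map (algebraMap (Polynomial Ω) (RatFunc Ω)) p).support :=
      (support_map_of_injective _ (IsFractionRing.injective _ _)).symm
    have h3 : p.totalDegree = (map (algebraMap (Polynomial Ω) (RatFunc Ω)) p).totalDegree := by
      unfold totalDegree; rw [h2]
    rw [h3, ← hp]
    refine (totalDegree_mul _ _).trans ?_
    rw [totalDegree_C, add_zero]; exact hν
  have hev : ∀ v : Fin (n^2) → Polynomial Ω, algebraMap (Polynomial Ω) (RatFunc Ω) (eval v p) =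
      eval (fun t => algebraMap (Polynomial Ω) (RatFunc Ω) (v t)) ν * algebraMap _ _ d := by
    intro v
    have h2 : eval (fun t => algebraMap (Polynomial Ω) (RatFunc Ω) (v t)) ν * algebraMap _ _ d =
      eval (fun t => algebraMap (Polynomial Ω) (RatFunc Ω) (v t)) (ν * C (algebraMap _ _ d)) := by simp
    rw [h2, hp, eval_map]
    exact eval₂_comp _ _ _
  obtain ⟨v, hv0, hv⟩ := tsen_form hlt p hpd (by
    have := hev 0
    apply IsFractionRing.injective (Polynomial Ω) (RatFunc Ω)
    rw [this, map_zero]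
    have h5 : (fun t => algebraMap (Polynomial Ω) (RatFunc Ω) ((0 : Fin (n^2) → Polynomial Ω) t)) = 0 := by
      funext t; simp
    rw [h5, (hz 0).mpr rfl, zero_mul])
  have h6 := hev v
  rw [hv, map_zero] at h6
  have h7 : algebraMap (Polynomial Ω) (RatFunc Ω) d ≠ 0 := by
    rwa [Ne, IsFractionRing.to_map_eq_zero_iff]
  have h8 := (hz _).mp ((mul_eq_zero.mp h6.symm).resolve_right h7)
  apply hv0
  funext t
  apply IsFractionRing.injective (Polynomial Ω) (RatFunc Ω)
  have := congrFun h8 t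
  simpa using this

end SG
end

section
open TensorProduct

namespace SG

/-- coefficientwise map of rational functions -/
noncomputable def rmap {k ℓ : Type*} [Field k] [Field ℓ] (f : k →+* ℓ) : RatFunc k →+* RatFunc ℓ :=
  RatFunc.mapRingHom (Polynomial.mapRingHom f) (by
    intro p hp
    rw [Submonoid.mem_comap, mem_nonZeroDivisors_iff_ne_zero]
    have := nonZeroDivisors.ne_zero hp
    exact (Polynomial.map_ne_zero_iff f.injective).mpr this)

section
variable {k ℓ m : Type*} [Field k] [Field ℓ] [Field m] (f : k →+* ℓ)

@[simp] theorem rmap_algebraMap (p : Polynomial k) :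
    rmap f (algebraMap _ (RatFunc k) p) = algebraMap _ (RatFunc ℓ) (p.map f) := by
  have := RatFunc.map_apply_div (R := ℓ) (φ := Polynomial.mapRingHom f) (K := k) (by
    intro p hp
    rw [Submonoid.mem_comap, mem_nonZeroDivisors_iff_ne_zero]
    have := nonZeroDivisors.ne_zero hp
    exact (Polynomial.map_ne_zero_iff f.injective).mpr this) p 1
  simp at this
  exact this

@[simp] theorem rmap_C (c : k) : rmap f (RatFunc.C c) = RatFunc.C (f c) := by
  rw [← RatFunc.algebraMap_C, rmap_algebraMap, Polynomial.map_C, RatFunc.algebraMap_C]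

@[simp] theorem rmap_X : rmap f RatFunc.X = RatFunc.X := by
  rw [← RatFunc.algebraMap_X, rmap_algebraMap, Polynomial.map_X, RatFunc.algebraMap_X]

theorem rat_ext {E : Type*} [Field E] {f g : RatFunc k →+* E} (hC : ∀ c, f (RatFunc.C c) = g (RatFunc.C c))
    (hX : f RatFunc.X = g RatFunc.X) : f = g := by
  apply IsFractionRing.ringHom_ext (A := Polynomial k)
  intro p
  have : f.comp (algebraMap (Polynomial k) (RatFunc k)) = g.comp (algebraMap (Polynomial k) (RatFunc k)) := by
    apply Polynomial.ringHom_ext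
    · intro c; simpa using hC c
    · simpa using hX
  exact congrArg (fun φ : Polynomial k →+* E => φ p) this

theorem rmap_comp (g : ℓ →+* m) : (rmap g).comp (rmap f) = rmap (g.comp f) :=
  rat_ext (fun c => by simp) (by simp)

theorem rmap_id : rmap (RingHom.id k) = RingHom.id _ := rat_ext (fun c => by simp) (by simp)

theorem rat_div (x : RatFunc k) : ∃ p q : Polynomial k, q ≠ 0 ∧ q.Monic ∧ x = algebraMap _ _ p / algebraMap _ _ q :=
  ⟨x.num, x.denom, x.denom_ne_zero, x.monic_denom, (x.num_div_denom).symm⟩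

theorem rmap_range (x : RatFunc ℓ) (h : ∀ j, (∃ y, f y = x.num.coeff j) ∧ ∃ y, f y = x.denom.coeff j) :
    ∃ y, rmap f y = x := by
  obtain ⟨p, hp⟩ : ∃ p : Polynomial k, p.map f = x.num := by
    have : x.num ∈ (Polynomial.mapRingHom f).rangeS := by
      rw [Polynomial.mem_map_rangeS]; exact fun j => (h j).1
    exact this
  obtain ⟨q, hq⟩ : ∃ p : Polynomial k, p.map f = x.denom := by
    have : x.denom ∈ (Polynomial.mapRingHom f).rangeS := by
      rw [Polynomial.mem_map_rangeS]; exact fun j => (h j).2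
    exact this
  refine ⟨algebraMap _ _ p / algebraMap _ _ q, ?_⟩
  rw [map_div₀, rmap_algebraMap, rmap_algebraMap, hp, hq, RatFunc.num_div_denom]

theorem rat_mem_subfield (S : Subfield (RatFunc ℓ)) (hC : ∀ c, RatFunc.C c ∈ S) (hX : RatFunc.X ∈ S) (x : RatFunc ℓ) :
    x ∈ S := by
  have : ∀ p : Polynomial ℓ, algebraMap _ (RatFunc ℓ) p ∈ S := by
    intro p
    induction p using Polynomial.induction_on' with
    | add p q hp hq => rw [map_add]; exact add_mem hp hq
    | monomial n c =>
      rw [← Polynomial.C_mul_X_pow_eq_monomial, map_mul, map_pow, RatFunc.algebraMap_C, RatFunc.algebraMap_X]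
      exact mul_mem (hC c) (pow_mem hX n)
  rw [← x.num_div_denom]
  exact div_mem (this _) (this _)

end

theorem rmap_finite {k ℓ : Type*} [Field k] [Field ℓ] [Algebra k ℓ] [FiniteDimensional k ℓ]
    [Algebra (RatFunc k) (RatFunc ℓ)] (h : algebraMap (RatFunc k) (RatFunc ℓ) = rmap (algebraMap k ℓ)) :
    FiniteDimensional (RatFunc k) (RatFunc ℓ) := by
  let b := Module.finBasis k ℓ
  let S : Set (RatFunc ℓ) := Set.range (fun j => RatFunc.C (b j))
  have hint : ∀ c : ℓ, IsIntegral (RatFunc k) (RatFunc.C c : RatFunc ℓ) := by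
    intro c
    obtain ⟨p, hp, hpc⟩ := Algebra.IsIntegral.isIntegral (R := k) c
    refine ⟨p.map RatFunc.C, hp.map _, ?_⟩
    rw [Polynomial.eval₂_map]
    have : (algebraMap (RatFunc k) (RatFunc ℓ)).comp RatFunc.C = RatFunc.C.comp (algebraMap k ℓ) := by
      ext c; simp [h]
    rw [this, ← Polynomial.hom_eval₂, hpc, map_zero]
  have : Finite S := Set.finite_range _
  have hfd : FiniteDimensional (RatFunc k) (IntermediateField.adjoin (RatFunc k) S) :=
    IntermediateField.finiteDimensional_adjoin (by rintro _ ⟨j, rfl⟩; exact hint _)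
  have htop : IntermediateField.adjoin (RatFunc k) S = ⊤ := by
    rw [eq_top_iff]
    intro x _
    refine rat_mem_subfield (IntermediateField.adjoin (RatFunc k) S).toSubfield (fun c => ?_) ?_ x
    · rw [← b.sum_repr c, map_sum]
      refine sum_mem (fun j _ => ?_)
      rw [Algebra.smul_def, map_mul]
      refine mul_mem ?_ (IntermediateField.subset_adjoin _ _ ⟨j, rfl⟩)
      have : RatFunc.C (algebraMap k ℓ (b.repr c j)) = algebraMap (RatFunc k) (RatFunc ℓ) (RatFunc.C (b.repr c j)) := by
        simp [h]
      rw [this]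
      exact IntermediateField.algebraMap_mem _ _
    · have : (RatFunc.X : RatFunc ℓ) = algebraMap (RatFunc k) (RatFunc ℓ) RatFunc.X := by simp [h]
      rw [this]
      exact IntermediateField.algebraMap_mem _ _
  rw [htop] at hfd
  exact Module.Finite.equiv (IntermediateField.topEquiv (F := RatFunc k) (E := RatFunc ℓ)).toLinearEquiv

theorem odd_of_pi {k ℓ : Type*} [Field k] [Field ℓ] [Algebra k ℓ] [FiniteDimensional k ℓ] [IsPurelyInseparable k ℓ]
    (h2 : (2 : k) ≠ 0) : Odd (Module.finrank k ℓ) := by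
  obtain ⟨q, hq⟩ := ExpChar.exists k
  obtain ⟨n, hn⟩ := IsPurelyInseparable.finrank_eq_pow k ℓ q
  rw [hn]
  apply Odd.pow
  cases hq with
  | zero => exact odd_one
  | prime hp =>
    refine hp.odd_of_ne_two ?_
    rintro rfl
    exact h2 (CharP.cast_eq_zero k 2)

theorem rmap_pi {k ℓ : Type*} [Field k] [Field ℓ] [Algebra k ℓ] [FiniteDimensional k ℓ] [IsPurelyInseparable k ℓ]
    [Algebra (RatFunc k) (RatFunc ℓ)] (h : algebraMap (RatFunc k) (RatFunc ℓ) = rmap (algebraMap k ℓ)) :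
    IsPurelyInseparable (RatFunc k) (RatFunc ℓ) := by
  obtain ⟨q, hq⟩ := ExpChar.exists k
  have : ExpChar (RatFunc k) q := expChar_of_injective_algebraMap (algebraMap k (RatFunc k)).injective q
  have : ExpChar (RatFunc ℓ) q := expChar_of_injective_algebraMap (algebraMap (RatFunc k) (RatFunc ℓ)).injective q
  have : ExpChar ℓ q := expChar_of_injective_algebraMap (algebraMap k ℓ).injective q
  rw [isPurelyInseparable_iff_pow_mem _ q]
  intro x
  let S : Subfield (RatFunc ℓ) := (perfectClosure (RatFunc k) (RatFunc ℓ)).toSubfield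
  have hx : x ∈ S := by
    refine rat_mem_subfield S (fun c => ?_) ?_ x
    · change RatFunc.C c ∈ perfectClosure (RatFunc k) (RatFunc ℓ)
      rw [mem_perfectClosure_iff_pow_mem q]
      obtain ⟨n, y, hy⟩ := IsPurelyInseparable.pow_mem k q c
      refine ⟨n, RatFunc.C y, ?_⟩
      rw [h, rmap_C, hy, map_pow]
    · change RatFunc.X ∈ perfectClosure (RatFunc k) (RatFunc ℓ)
      have : (RatFunc.X : RatFunc ℓ) = algebraMap (RatFunc k) (RatFunc ℓ) RatFunc.X := by simp [h]
      rw [this]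
      exact IntermediateField.algebraMap_mem _ _
  exact (mem_perfectClosure_iff_pow_mem q).mp hx

theorem rmap_odd {k ℓ : Type*} [Field k] [Field ℓ] [Algebra k ℓ] [FiniteDimensional k ℓ] [IsPurelyInseparable k ℓ]
    [Algebra (RatFunc k) (RatFunc ℓ)] (h : algebraMap (RatFunc k) (RatFunc ℓ) = rmap (algebraMap k ℓ))
    (h2 : (2 : k) ≠ 0) : Odd (Module.finrank (RatFunc k) (RatFunc ℓ)) := by
  have := rmap_finite h
  have := rmap_pi h
  refine odd_of_pi ?_
  rw [← map_ofNat (RatFunc.C (K := k)) 2]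
  simpa using h2

end SG
end

section
open TensorProduct

namespace SG

theorem const_split_pi {k ℓ N D : Type*} [Field k] [Field ℓ] [Field N] [Algebra k ℓ] [Algebra k N] [Algebra ℓ N]
    [IsScalarTower k ℓ N] [FiniteDimensional ℓ N] [IsPurelyInseparable ℓ N] (h2 : (2 : k) ≠ 0)
    [Ring D] [Algebra (RatFunc k) D]
    [IsSimpleRing D] [Algebra.IsCentral (RatFunc k) D] [FiniteDimensional (RatFunc k) D] {n r : ℕ}
    (hn : Module.finrank (RatFunc k) D = n ^ 2) (hr : n = 2 ^ r) (h : Splits (rmap (algebraMap k N)) n D) :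
    Splits (rmap (algebraMap k ℓ)) n D := by
  let : Algebra (RatFunc k) (RatFunc ℓ) := (rmap (algebraMap k ℓ)).toAlgebra
  let : Algebra (RatFunc k) (RatFunc N) := (rmap (algebraMap k N)).toAlgebra
  let : Algebra (RatFunc ℓ) (RatFunc N) := (rmap (algebraMap ℓ N)).toAlgebra
  have : IsScalarTower (RatFunc k) (RatFunc ℓ) (RatFunc N) := IsScalarTower.of_algebraMap_eq' (by
    change rmap (algebraMap k N) = (rmap (algebraMap ℓ N)).comp (rmap (algebraMap k ℓ))
    rw [rmap_comp, ← IsScalarTower.algebraMap_eq])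
  have : FiniteDimensional (RatFunc ℓ) (RatFunc N) := rmap_finite rfl
  have h20 : (2 : ℓ) ≠ 0 := by
    rw [← map_ofNat (algebraMap k ℓ) 2]; simpa using h2
  have hodd := rmap_odd (k := ℓ) (ℓ := N) rfl h20
  exact splits_of_odd hn hr hodd h

theorem exists_const_split {k D : Type u} [Field k] (h2 : (2 : k) ≠ 0) [Ring D] [Algebra (RatFunc k) D]
    [IsSimpleRing D] [Algebra.IsCentral (RatFunc k) D] [FiniteDimensional (RatFunc k) D] {n r : ℕ}
    (hn : Module.finrank (RatFunc k) D = n ^ 2) (hr : n = 2 ^ r) :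
    ∃ ℓ : IntermediateField k (AlgebraicClosure k), FiniteDimensional k ℓ ∧ IsGalois k ℓ ∧
      Splits (rmap (algebraMap k ℓ)) n D := by
  let Ω := AlgebraicClosure k
  obtain ⟨Φ, hΦ⟩ : Splits (rmap (algebraMap k Ω)) n D := by
    let := (rmap (algebraMap k Ω)).toAlgebra
    exact splits_of_brauer hn (fun B => by
      intro _ _ _ _
      exact tsen B)
  let b := Module.finBasis (RatFunc k) D
  let ent : Fin (Module.finrank (RatFunc k) D) × Fin n × Fin n → RatFunc Ω := fun p => Φ (b p.1) p.2.1 p.2.2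
  let S : Set Ω := ⋃ p, (((ent p).num.coeffs : Set Ω) ∪ ((ent p).denom.coeffs : Set Ω))
  have hS : S.Finite := Set.finite_iUnion (fun p => (Finset.finite_toSet _).union (Finset.finite_toSet _))
  let M := IntermediateField.adjoin k S
  have hM : FiniteDimensional k M := by
    have : Finite S := hS
    exact IntermediateField.finiteDimensional_adjoin (fun x _ => Algebra.IsIntegral.isIntegral x)
  let N := IntermediateField.normalClosure k M Ω
  have hMN : M ≤ N := IntermediateField.le_normalClosure M
  have : FiniteDimensional k N := normalClosure.is_finiteDimensional k M _
  have : Normal k N := inferInstance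
  have hNs : Splits (rmap (algebraMap k N)) n D := by
    refine splits_of_entries b Φ hΦ (rmap (algebraMap N Ω)) _ (rmap_comp _ _) (fun t x y => ?_)
    have hmem : ∀ z ∈ S, z ∈ N := fun z hz => hMN (IntermediateField.subset_adjoin k S hz)
    refine rmap_range _ _ (fun j => ⟨?_, ?_⟩)
    · by_cases h0 : (ent (t, x, y)).num.coeff j = 0
      · exact ⟨0, by rw [map_zero]; exact h0.symm⟩
      · exact ⟨⟨_, hmem _ (Set.mem_iUnion.mpr ⟨(t, x, y), Or.inl (Polynomial.coeff_mem_coeffs h0)⟩)⟩, rfl⟩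
    · by_cases h0 : (ent (t, x, y)).denom.coeff j = 0
      · exact ⟨0, by rw [map_zero]; exact h0.symm⟩
      · exact ⟨⟨_, hmem _ (Set.mem_iUnion.mpr ⟨(t, x, y), Or.inr (Polynomial.coeff_mem_coeffs h0)⟩)⟩, rfl⟩
  let ℓ0 := separableClosure k N
  have : IsGalois k ℓ0 := inferInstance
  have hs0 : Splits (rmap (algebraMap k ℓ0)) n D := const_split_pi h2 hn hr hNs
  let e := IntermediateField.liftAlgEquiv ℓ0
  refine ⟨IntermediateField.lift ℓ0, Module.Finite.equiv e.toLinearEquiv, IsGalois.of_algEquiv e, ?_⟩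
  refine (hs0.comp (rmap (e : ℓ0 →+* IntermediateField.lift ℓ0))).of_eq ?_
  rw [rmap_comp]
  congr 1

theorem exists_common_split {k D D' : Type u} [Field k] (h2 : (2 : k) ≠ 0) [Ring D] [Algebra (RatFunc k) D]
    [IsSimpleRing D] [Algebra.IsCentral (RatFunc k) D] [FiniteDimensional (RatFunc k) D] {n r : ℕ}
    (hn : Module.finrank (RatFunc k) D = n ^ 2) (hr : n = 2 ^ r)
    [Ring D'] [Algebra (RatFunc k) D']
    [IsSimpleRing D'] [Algebra.IsCentral (RatFunc k) D'] [FiniteDimensional (RatFunc k) D']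
    (hn' : Module.finrank (RatFunc k) D' = n ^ 2) :
    ∃ (ℓ : Type u) (_ : Field ℓ) (_ : Algebra k ℓ), FiniteDimensional k ℓ ∧ IsGalois k ℓ ∧
      Splits (rmap (algebraMap k ℓ)) n D ∧ Splits (rmap (algebraMap k ℓ)) n D' := by
  obtain ⟨ℓ1, _, _, h1⟩ := exists_const_split h2 hn hr
  obtain ⟨ℓ2, _, _, h2⟩ := exists_const_split h2 hn' hr
  refine ⟨(ℓ1 ⊔ ℓ2 : IntermediateField k (AlgebraicClosure k)), inferInstance, inferInstance, inferInstance, inferInstance, ?_, ?_⟩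
  · exact (h1.comp (rmap (IntermediateField.inclusion (le_sup_left : ℓ1 ≤ ℓ1 ⊔ ℓ2)).toRingHom)).of_eq (rmap_comp _ _)
  · exact (h2.comp (rmap (IntermediateField.inclusion (le_sup_right : ℓ2 ≤ ℓ1 ⊔ ℓ2)).toRingHom)).of_eq (rmap_comp _ _)

/-- action on coefficients -/
noncomputable def ratAct {ℓ G : Type*} [Field ℓ] [Group G] (a : G →* (ℓ →+* ℓ)) : G →* (RatFunc ℓ →+* RatFunc ℓ) where
  toFun σ := rmap (a σ)
  map_one' := by rw [map_one]; exact rmap_id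
  map_mul' σ τ := by rw [map_mul]; exact (rmap_comp _ _).symm

theorem ratAct_isGal {k ℓ G : Type*} [Field k] [Field ℓ] [Group G] [Algebra k ℓ] {a : G →* (ℓ →+* ℓ)} (hg : IsGal k a)
    [Algebra (RatFunc k) (RatFunc ℓ)] (h : algebraMap (RatFunc k) (RatFunc ℓ) = rmap (algebraMap k ℓ)) :
    IsGal (RatFunc k) (ratAct a) where
  inj := fun σ τ hst => hg.inj (by
    ext c
    have := congrArg (fun f : RatFunc ℓ →+* RatFunc ℓ => f (RatFunc.C c)) hst
    simp only [ratAct, MonoidHom.coe_mk, OneHom.coe_mk, rmap_C] at this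
    exact RatFunc.C.injective this)
  fixed := fun σ y => by
    rw [h]
    change (rmap (a σ)).comp (rmap (algebraMap k ℓ)) y = _
    rw [rmap_comp]
    congr 2
    ext c; exact hg.fixed σ c
  mem := fun x hx => by
    rw [h]
    have key : ∀ σ, x.num.map (a σ) = x.num ∧ x.denom.map (a σ) = x.denom := by
      intro σ
      have h1 := hx σ
      change rmap (a σ) x = x at h1
      have hcop : IsCoprime (x.num.map (a σ)) (x.denom.map (a σ)) := by
        exact (x.isCoprime_num_denom).map (Polynomial.mapRingHom (a σ))
      have h3 : algebraMap _ (RatFunc ℓ) (x.num.map (a σ)) / algebraMap _ (RatFunc ℓ) (x.denom.map (a σ)) = x := by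
        rw [← rmap_algebraMap, ← rmap_algebraMap, ← map_div₀, x.num_div_denom, h1]
      have hm := x.monic_denom.map (a σ)
      have h4 : x.num * (x.denom.map (a σ)) = (x.num.map (a σ)) * x.denom := by
        conv_rhs at h3 => rw [← x.num_div_denom]
        rw [div_eq_div_iff (by simpa using hm.ne_zero) (by simp [x.denom_ne_zero]), ← map_mul, ← map_mul] at h3
        exact (IsFractionRing.injective _ (RatFunc ℓ) h3).symm
      have h5 : x.denom.map (a σ) = x.denom := by
        refine Polynomial.eq_of_monic_of_associated hm x.monic_denom ?_
        apply associated_of_dvd_dvd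
        · exact hcop.symm.dvd_of_dvd_mul_left (Dvd.intro_left _ h4)
        · exact x.isCoprime_num_denom.symm.dvd_of_dvd_mul_left (Dvd.intro_left _ h4.symm)
      refine ⟨?_, h5⟩
      rw [h5] at h4
      exact (mul_right_cancel₀ x.denom_ne_zero h4).symm
    exact rmap_range _ x (fun j => ⟨hg.mem _ (fun σ => by conv_rhs => rw [← (key σ).1, Polynomial.coeff_map]),
      hg.mem _ (fun σ => by conv_rhs => rw [← (key σ).2, Polynomial.coeff_map])⟩)

end SG
end

section
open TensorProduct

namespace SG

section lmap
variable {A B C : Type*} [Field A] [Field B] [Field C]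

/-- coefficientwise map of Laurent series -/
noncomputable def lmap (f : A →+* B) : LaurentSeries A →+* LaurentSeries B where
  toFun x := x.map f
  map_one' := by
    ext i
    simp only [HahnSeries.map_coeff, HahnSeries.coeff_one]
    split_ifs <;> simp
  map_zero' := by ext i; simp
  map_add' x y := by ext i; simp
  map_mul' x y := by
    ext i
    have h1 : (x.map f).support = x.support := by
      ext j; simp [HahnSeries.mem_support]
    have h2 : (y.map f).support = y.support := by
      ext j; simp [HahnSeries.mem_support]
    rw [HahnSeries.map_coeff, HahnSeries.coeff_mul, HahnSeries.coeff_mul, map_sum]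
    refine Finset.sum_congr ?_ (fun j _ => by simp)
    ext j
    simp only [Finset.mem_addAntidiagonal, h1, h2]

@[simp] theorem lmap_coeff (f : A →+* B) (x : LaurentSeries A) (i : ℤ) : (lmap f x).coeff i = f (x.coeff i) := rfl

theorem lmap_comp (f : A →+* B) (g : B →+* C) : (lmap g).comp (lmap f) = lmap (g.comp f) := by
  ext x i; simp

theorem lmap_comp_apply (f : A →+* B) (g : B →+* C) (x) : lmap g (lmap f x) = lmap (g.comp f) x := by
  ext i; simp

theorem lmap_id : lmap (RingHom.id A) = RingHom.id _ := by ext x i; simp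

theorem lmap_C (f : A →+* B) (c : A) : lmap f (HahnSeries.C c) = HahnSeries.C (f c) := by
  ext i
  simp only [lmap_coeff, HahnSeries.C_apply, HahnSeries.coeff_single]
  split_ifs <;> simp

theorem lmap_single (f : A →+* B) (i : ℤ) (c : A) : lmap f (HahnSeries.single i c) = HahnSeries.single i (f c) := by
  ext i
  simp only [lmap_coeff, HahnSeries.coeff_single]
  split_ifs <;> simp

theorem lmap_order (f : A →+* B) (x : LaurentSeries A) : (lmap f x).order = x.order := by
  by_cases hx : x = 0
  · simp [hx]
  have h1 : lmap f x ≠ 0 := by simpa using hx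
  apply le_antisymm
  · apply HahnSeries.order_le_of_coeff_ne_zero
    simpa [HahnSeries.coeff_order_eq_zero] using hx
  · apply HahnSeries.order_le_of_coeff_ne_zero
    have : (lmap f x).coeff (lmap f x).order ≠ 0 := by simpa only [ne_eq, HahnSeries.coeff_order_eq_zero] using h1
    intro h; apply this; simp [h]

theorem lmap_leadingCoeff (f : A →+* B) (x : LaurentSeries A) : (lmap f x).leadingCoeff = f x.leadingCoeff := by
  by_cases hx : x = 0
  · simp [hx]
  have h1 : lmap f x ≠ 0 := by simpa using hx
  rw [HahnSeries.leadingCoeff_eq, HahnSeries.leadingCoeff_eq, lmap_order, lmap_coeff]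

/-- action on coefficients -/
noncomputable def lact {G : Type*} [Group G] (a : G →* (A →+* A)) : G →* (LaurentSeries A →+* LaurentSeries A) where
  toFun σ := lmap (a σ)
  map_one' := by rw [map_one]; exact lmap_id
  map_mul' σ τ := by rw [map_mul]; exact (lmap_comp _ _).symm

@[simp] theorem lact_apply {G : Type*} [Group G] (a : G →* (A →+* A)) (σ : G) : lact a σ = lmap (a σ) := rfl

theorem lact_isGal {G : Type*} [Group G] [Algebra A B] {a : G →* (B →+* B)} (hg : IsGal A a)
    [Algebra (LaurentSeries A) (LaurentSeries B)] (h : algebraMap (LaurentSeries A) (LaurentSeries B) = lmap (algebraMap A B)) :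
    IsGal (LaurentSeries A) (lact a) where
  inj := fun σ τ hst => hg.inj (by
    ext c
    have := congrArg (fun f : LaurentSeries B →+* LaurentSeries B => (f (HahnSeries.C c)).coeff 0) hst
    simpa [lmap_C] using this)
  fixed := fun σ y => by
    rw [h]; ext i
    simpa using hg.fixed σ _
  mem := fun x hx => by
    rw [h]
    have h1 : ∀ i, ∃ y, algebraMap A B y = x.coeff i := fun i => hg.mem _ (fun σ => by
      have := congrArg (fun z : LaurentSeries B => z.coeff i) (hx σ)
      simpa using this)
    choose y hy using h1
    refine ⟨⟨y, x.isPWO_support.mono (fun i hi => ?_)⟩, ?_⟩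
    · rw [HahnSeries.mem_support, ← hy]
      simpa using hi
    · ext i; exact hy i

/-- twist -/
noncomputable def ltw (b : A) (hb : b ≠ 0) : LaurentSeries A →+* LaurentSeries A where
  toFun x := ⟨fun i => b ^ i * x.coeff i, x.isPWO_support.mono (fun i hi => by
    rw [HahnSeries.mem_support]; intro h; apply hi; simp [h])⟩
  map_one' := by
    ext i
    simp only [HahnSeries.coeff_one]
    split_ifs with h <;> simp [h]
  map_zero' := by ext i; simp
  map_add' x y := by ext i; simp [mul_add]
  map_mul' x y := by
    ext i
    have h1 : ∀ (x : LaurentSeries A) p, HahnSeries.support (⟨fun i => b ^ i * x.coeff i, p⟩ : HahnSeries ℤ A) = x.support := by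
      intro x p
      ext j; simp [HahnSeries.mem_support, zpow_ne_zero _ hb]
    change b ^ i * (x * y).coeff i = _
    rw [HahnSeries.coeff_mul, HahnSeries.coeff_mul, Finset.mul_sum]
    refine Finset.sum_congr ?_ (fun j hj => ?_)
    · ext j
      simp only [Finset.mem_addAntidiagonal, h1]
    · have := (Finset.mem_addAntidiagonal.mp hj).2.2
      rw [← this, zpow_add₀ hb]; ring

@[simp] theorem ltw_coeff (b : A) (hb : b ≠ 0) (x : LaurentSeries A) (i : ℤ) : (ltw b hb x).coeff i = b ^ i * x.coeff i := rfl

/-- t ↦ t^2 -/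
noncomputable def ldbl : LaurentSeries A →+* LaurentSeries A :=
  HahnSeries.embDomainRingHom (AddMonoidHom.mulLeft (2:ℤ)) (fun i j h => by simpa using h)
    (fun i j => by simp)

theorem ldbl_coeff (x : LaurentSeries A) (i : ℤ) : (ldbl x).coeff (2 * i) = x.coeff i := by
  unfold ldbl
  exact HahnSeries.embDomain_coeff (f := ⟨⟨fun i : ℤ => 2 * i, fun i j h => by simpa using h⟩, by intro i j; change 2 * i ≤ 2 * j ↔ _; omega⟩) (a := i)

theorem ldbl_coeff_odd (x : LaurentSeries A) (i : ℤ) (hi : ∀ j, 2 * j ≠ i) : (ldbl x).coeff i = 0 := by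
  unfold ldbl
  exact HahnSeries.embDomain_notin_range (f := ⟨⟨fun i : ℤ => 2 * i, fun i j h => by simpa using h⟩, by intro i j; change 2 * i ≤ 2 * j ↔ _; omega⟩) (by
    rintro ⟨j, hj⟩; exact hi j hj)

/-- t ↦ b t^2 -/
noncomputable def lsub (b : A) (hb : b ≠ 0) : LaurentSeries A →+* LaurentSeries A := ldbl.comp (ltw b hb)

theorem lsub_coeff (b : A) (hb : b ≠ 0) (x : LaurentSeries A) (i : ℤ) : (lsub b hb x).coeff (2 * i) = b ^ i * x.coeff i :=
  ldbl_coeff _ _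

theorem lsub_coeff_odd (b : A) (hb : b ≠ 0) (x : LaurentSeries A) (i : ℤ) (hi : ∀ j, 2 * j ≠ i) : (lsub b hb x).coeff i = 0 :=
  ldbl_coeff_odd _ _ hi

theorem lsub_lmap (f : A →+* B) (b : A) (hb : b ≠ 0) (hb' : f b ≠ 0) (x : LaurentSeries A) :
    lsub (f b) hb' (lmap f x) = lmap f (lsub b hb x) := by
  ext i
  by_cases hi : ∃ j, 2 * j = i
  · obtain ⟨j, rfl⟩ := hi
    rw [lmap_coeff, lsub_coeff, lsub_coeff]; simp
  · push Not at hi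
    rw [lmap_coeff, lsub_coeff_odd _ _ _ _ hi, lsub_coeff_odd _ _ _ _ hi, map_zero]

theorem lsub_single (b : A) (hb : b ≠ 0) (i : ℤ) (c : A) :
    lsub b hb (HahnSeries.single i c) = HahnSeries.single (2 * i) (b ^ i * c) := by
  ext j
  by_cases hj : ∃ m, 2 * m = j
  · obtain ⟨m, rfl⟩ := hj
    rw [lsub_coeff]
    simp only [HahnSeries.coeff_single]
    by_cases h : m = i
    · simp [h]
    · simp [h]
  · push Not at hj
    rw [lsub_coeff_odd _ _ _ _ hj, HahnSeries.coeff_single_of_ne (fun h => hj i h.symm)]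

theorem lsub_C (b : A) (hb : b ≠ 0) (c : A) : lsub b hb (HahnSeries.C c) = HahnSeries.C c := by
  rw [HahnSeries.C_apply, lsub_single]; simp

end lmap

end SG
end

section
open TensorProduct

namespace SG

section low
variable {A B : Type*} [Field A] [Field B]

/-- coefficients below `v` vanish -/
def Low (v : ℤ) (x : LaurentSeries A) : Prop := ∀ w < v, x.coeff w = 0

theorem Low.mono {v w : ℤ} {x : LaurentSeries A} (h : Low v x) (hw : w ≤ v) : Low w x := fun z hz => h z (hz.trans_le hw)

theorem Low.zero (v : ℤ) : Low v (0 : LaurentSeries A) := fun _ _ => rfl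

theorem Low.add {v : ℤ} {x y : LaurentSeries A} (h : Low v x) (h' : Low v y) : Low v (x + y) := fun z hz => by
  rw [HahnSeries.coeff_add, h z hz, h' z hz, add_zero]

theorem Low.neg {v : ℤ} {x : LaurentSeries A} (h : Low v x) : Low v (-x) := fun z hz => by
  rw [HahnSeries.coeff_neg, h z hz, neg_zero]

theorem Low.sub {v : ℤ} {x y : LaurentSeries A} (h : Low v x) (h' : Low v y) : Low v (x - y) := by
  rw [sub_eq_add_neg]; exact h.add h'.neg

theorem Low.sum {ι : Type*} {v : ℤ} {s : Finset ι} {x : ι → LaurentSeries A} (h : ∀ i ∈ s, Low v (x i)) :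
    Low v (∑ i ∈ s, x i) := fun z hz => by
  rw [HahnSeries.coeff_sum]
  exact Finset.sum_eq_zero (fun i hi => h i hi z hz)

theorem Low.mul {v w : ℤ} {x y : LaurentSeries A} (h : Low v x) (h' : Low w y) : Low (v + w) (x * y) := fun z hz => by
  rw [HahnSeries.coeff_mul]
  refine Finset.sum_eq_zero (fun i hi => ?_)
  have := (Finset.mem_addAntidiagonal.mp hi).2.2
  rcases lt_or_ge i.1 v with h1 | h1
  · rw [h _ h1, zero_mul]
  · rw [h' _ (by omega), mul_zero]

theorem Low.coeff_mul {v w : ℤ} {x y : LaurentSeries A} (h : Low v x) (h' : Low w y) :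
    (x * y).coeff (v + w) = x.coeff v * y.coeff w := by
  rw [HahnSeries.coeff_mul]
  refine (Finset.sum_eq_single (v, w) (fun i hi hne => ?_) (fun hi => ?_))
  · have := (Finset.mem_addAntidiagonal.mp hi).2.2
    rcases lt_trichotomy i.1 v with h1 | h1 | h1
    · rw [h _ h1, zero_mul]
    · exact absurd (Prod.ext h1 (by simp only; omega)) hne
    · rw [h' _ (by omega), mul_zero]
  · by_contra hx
    apply hi
    simp only [Finset.mem_addAntidiagonal, HahnSeries.mem_support, and_true]
    exact ⟨left_ne_zero_of_mul hx, right_ne_zero_of_mul hx⟩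

theorem low_order (x : LaurentSeries A) : Low x.order x := fun _ hz => HahnSeries.coeff_eq_zero_of_lt_order hz

theorem low_C (c : A) : Low 0 (HahnSeries.C c) := fun z hz => by
  rw [HahnSeries.C_apply, HahnSeries.coeff_single_of_ne hz.ne]

theorem low_one : Low 0 (1 : LaurentSeries A) := fun z hz => by
  rw [HahnSeries.coeff_one, if_neg hz.ne]

theorem coeff_C_zero (c : A) : (HahnSeries.C c : LaurentSeries A).coeff 0 = c := by
  rw [HahnSeries.C_apply, HahnSeries.coeff_single_same]

theorem low_single (i : ℤ) (c : A) : Low i (HahnSeries.single i c : LaurentSeries A) := fun z hz => by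
  rw [HahnSeries.coeff_single_of_ne hz.ne]

theorem Low.lmap {v : ℤ} {x : LaurentSeries A} (h : Low v x) (f : A →+* B) : Low v (lmap f x) := fun z hz => by
  rw [lmap_coeff, h z hz, map_zero]

theorem Low.order_eq {v : ℤ} {x : LaurentSeries A} (h : Low v x) (h' : x.coeff v ≠ 0) : x.order = v := by
  apply le_antisymm
  · exact HahnSeries.order_le_of_coeff_ne_zero h'
  · by_contra hlt
    push Not at hlt
    have hx : x ≠ 0 := by rintro rfl; simp at h'
    exact (mt HahnSeries.coeff_order_eq_zero.mp hx) (h _ hlt)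

theorem Low.prod {ι : Type*} {s : Finset ι} {v : ι → ℤ} {x : ι → LaurentSeries A} (h : ∀ i ∈ s, Low (v i) (x i)) :
    Low (∑ i ∈ s, v i) (∏ i ∈ s, x i) ∧ (∏ i ∈ s, x i).coeff (∑ i ∈ s, v i) = ∏ i ∈ s, (x i).coeff (v i) := by
  classical
  induction s using Finset.induction_on with
  | empty => simpa using low_one
  | insert a s ha ih =>
    obtain ⟨h1, h2⟩ := ih (fun i hi => h i (Finset.mem_insert_of_mem hi))
    have h3 := h a (Finset.mem_insert_self _ _)
    rw [Finset.sum_insert ha, Finset.prod_insert ha, Finset.prod_insert ha, ← h2]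
    exact ⟨h3.mul h1, h3.coeff_mul h1⟩

theorem Low.pow {v : ℤ} {x : LaurentSeries A} (h : Low v x) (j : ℕ) : Low (j * v) (x ^ j) ∧ (x ^ j).coeff (j * v) = (x.coeff v) ^ j := by
  have := Low.prod (s := Finset.range j) (v := fun _ => v) (x := fun _ => x) (fun _ _ => h)
  simpa using this

theorem order_pow' {x : LaurentSeries A} (hx : x ≠ 0) (j : ℕ) : (x ^ j).order = j * x.order := by
  refine ((low_order x).pow j).1.order_eq ?_
  rw [((low_order x).pow j).2]
  exact pow_ne_zero _ (mt HahnSeries.coeff_order_eq_zero.mp hx)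

theorem order_mul' {x y : LaurentSeries A} (hx : x ≠ 0) (hy : y ≠ 0) : (x * y).order = x.order + y.order := by
  refine ((low_order x).mul (low_order y)).order_eq ?_
  rw [(low_order x).coeff_mul (low_order y)]
  exact mul_ne_zero (mt HahnSeries.coeff_order_eq_zero.mp hx) (mt HahnSeries.coeff_order_eq_zero.mp hy)

theorem low_powerSeries (p : PowerSeries A) : Low 0 (HahnSeries.ofPowerSeries ℤ A p) := fun z hz => by
  rw [PowerSeries.coeff_coe, if_pos hz]

theorem coeff_zero_powerSeries (p : PowerSeries A) : (HahnSeries.ofPowerSeries ℤ A p).coeff 0 = PowerSeries.constantCoeff p := by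
  rw [PowerSeries.coeff_coe]; simp

theorem Low.exists_powerSeries {x : LaurentSeries A} (h : Low 0 x) : ∃ p : PowerSeries A, HahnSeries.ofPowerSeries ℤ A p = x := by
  refine ⟨PowerSeries.mk (fun i => x.coeff i), ?_⟩
  ext i
  rw [PowerSeries.coeff_coe]
  split_ifs with hi
  · exact (h i hi).symm
  · rw [PowerSeries.coeff_mk]; congr 1; omega

/-- matrix coefficient -/
def mcoef {m n : ℕ} (v : ℤ) (M : Matrix (Fin m) (Fin n) (LaurentSeries A)) : Matrix (Fin m) (Fin n) A :=
  M.map (fun x => x.coeff v)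

def MLow {m n : ℕ} (v : ℤ) (M : Matrix (Fin m) (Fin n) (LaurentSeries A)) : Prop := ∀ i j, Low v (M i j)

variable {m n p : ℕ}

theorem MLow.mul {v w : ℤ} {M : Matrix (Fin m) (Fin n) (LaurentSeries A)} {N : Matrix (Fin n) (Fin p) (LaurentSeries A)}
    (h : MLow v M) (h' : MLow w N) : MLow (v + w) (M * N) ∧ mcoef (v + w) (M * N) = mcoef v M * mcoef w N := by
  refine ⟨fun i j => Low.sum (fun k _ => (h i k).mul (h' k j)), ?_⟩
  ext i j
  simp only [mcoef, Matrix.map_apply, Matrix.mul_apply, HahnSeries.coeff_sum]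
  exact Finset.sum_congr rfl (fun k _ => (h i k).coeff_mul (h' k j))

theorem MLow.map {v : ℤ} {M : Matrix (Fin m) (Fin n) (LaurentSeries A)} (h : MLow v M) (f : A →+* B) :
    MLow v (M.map (lmap f)) ∧ mcoef v (M.map (lmap f)) = (mcoef v M).map f :=
  ⟨fun i j => (h i j).lmap f, rfl⟩

theorem MLow.smul {v w : ℤ} {M : Matrix (Fin m) (Fin n) (LaurentSeries A)} (h : MLow v M) {x : LaurentSeries A} (hx : Low w x) :
    MLow (w + v) (x • M) ∧ mcoef (w + v) (x • M) = x.coeff w • mcoef v M := by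
  refine ⟨fun i j => hx.mul (h i j), ?_⟩
  ext i j
  exact hx.coeff_mul (h i j)

theorem exists_mlow {M : Matrix (Fin m) (Fin n) (LaurentSeries A)} (hM : M ≠ 0) : ∃ v, MLow v M ∧ mcoef v M ≠ 0 := by
  have hne : ∃ ij : Fin m × Fin n, M ij.1 ij.2 ≠ 0 := by
    by_contra h
    push Not at h
    exact hM (by ext1 i j; exact h (i, j))
  classical
  obtain ⟨ij, hij⟩ := hne
  obtain ⟨q, hq, hmin⟩ := Finset.exists_min_image (Finset.univ.filter (fun ij : Fin m × Fin n => M ij.1 ij.2 ≠ 0))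
    (fun ij => (M ij.1 ij.2).order) ⟨ij, by simpa using hij⟩
  simp only [Finset.mem_filter, Finset.mem_univ, true_and] at hq hmin
  refine ⟨(M q.1 q.2).order, fun i j => ?_, fun h => ?_⟩
  · by_cases h : M i j = 0
    · rw [h]; exact Low.zero _
    · exact (low_order _).mono (hmin (i, j) h)
  · have := congrFun (congrFun h q.1) q.2
    exact hq (HahnSeries.coeff_order_eq_zero.mp this)

theorem MLow.det {v : ℤ} {M : Matrix (Fin n) (Fin n) (LaurentSeries A)} (h : MLow v M) :
    Low (n * v) M.det ∧ M.det.coeff (n * v) = (mcoef v M).det := by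
  have hp : ∀ s : Equiv.Perm (Fin n), Low (n * v) (∏ i, M (s i) i) ∧ (∏ i, M (s i) i).coeff (n * v) = ∏ i, mcoef v M (s i) i := by
    intro s
    have := Low.prod (s := Finset.univ) (v := fun _ : Fin n => v) (x := fun i => M (s i) i) (fun i _ => h _ _)
    simpa [mcoef] using this
  rw [Matrix.det_apply, Matrix.det_apply]
  constructor
  · refine Low.sum (fun s _ => ?_)
    rcases Int.units_eq_one_or (Equiv.Perm.sign s) with hs | hs
    · rw [hs, one_smul]; exact (hp s).1
    · rw [hs, Units.neg_smul, one_smul]; exact (hp s).1.neg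
  · rw [HahnSeries.coeff_sum]
    refine Finset.sum_congr rfl (fun s _ => ?_)
    rcases Int.units_eq_one_or (Equiv.Perm.sign s) with hs | hs
    · rw [hs, one_smul, one_smul]; exact (hp s).2
    · rw [hs, Units.neg_smul, one_smul, Units.neg_smul, one_smul, HahnSeries.coeff_neg, (hp s).2]

theorem MLow.isUnit {v : ℤ} {M : Matrix (Fin n) (Fin n) (LaurentSeries A)} (h : MLow v M) (hu : IsUnit (mcoef v M)) :
    IsUnit M ∧ M.det.order = n * v := by
  rw [Matrix.isUnit_iff_isUnit_det, isUnit_iff_ne_zero] at hu ⊢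
  rw [← h.det.2] at hu
  refine ⟨fun h0 => by simp [h0] at hu, h.det.1.order_eq hu⟩

/-- square roots of one-units -/
theorem exists_sqrt (h2 : (2:A) ≠ 0) {x : LaurentSeries A} (h : Low 0 x) (h1 : x.coeff 0 = 1) :
    ∃ y, y ^ 2 = x ∧ Low 0 y ∧ y.coeff 0 = 1 := by
  obtain ⟨p, rfl⟩ := h.exists_powerSeries
  rw [coeff_zero_powerSeries] at h1
  let f : Polynomial (PowerSeries A) := Polynomial.X ^ 2 - Polynomial.C p
  have hf : f.Monic := Polynomial.monic_X_pow_sub_C p (by norm_num)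
  have hI : Ideal.span {(PowerSeries.X : PowerSeries A)} = RingHom.ker (PowerSeries.constantCoeff (R := A)) := by
    ext q
    rw [Ideal.mem_span_singleton, PowerSeries.X_dvd_iff, RingHom.mem_ker]
  obtain ⟨y, hy, hy1⟩ := HenselianRing.is_henselian (I := Ideal.span {(PowerSeries.X : PowerSeries A)}) f hf 1
    (by rw [hI, RingHom.mem_ker]; simp [f, h1])
    (by
      have : IsUnit ((Polynomial.derivative f).eval 1) := by
        rw [PowerSeries.isUnit_iff_constantCoeff]
        simp only [f, Polynomial.derivative_sub, Polynomial.derivative_X_pow, Polynomial.derivative_C, sub_zero]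
        simp
        rw [map_ofNat]; exact h2
      exact this.map _)
  refine ⟨HahnSeries.ofPowerSeries ℤ A y, ?_, low_powerSeries _, ?_⟩
  · rw [← map_pow]
    congr 1
    simpa [f, sub_eq_zero] using hy
  · rw [coeff_zero_powerSeries]
    rw [hI, RingHom.mem_ker] at hy1
    simpa [sub_eq_zero] using hy1

theorem exists_root (h2 : (2:A) ≠ 0) (r : ℕ) : ∀ {x : LaurentSeries A}, Low 0 x → x.coeff 0 = 1 →
    ∃ y, y ^ (2 ^ r) = x ∧ Low 0 y ∧ y.coeff 0 = 1 := by
  induction r with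
  | zero => exact fun {x} h h1 => ⟨x, by simp, h, h1⟩
  | succ r ih =>
    intro x h h1
    obtain ⟨y, rfl, hy, hy1⟩ := exists_sqrt h2 h h1
    obtain ⟨z, rfl, hz, hz1⟩ := ih hy hy1
    exact ⟨z, by rw [← pow_mul, pow_succ], hz, hz1⟩

/-- if a power (invertible exponent) is constant, so is the series -/
theorem const_of_pow {N : ℕ} (hN : (N:A) ≠ 0) {x : LaurentSeries A} {d : A} (hd : d ≠ 0) (h : x ^ N = HahnSeries.C d) :
    ∃ c, c ≠ 0 ∧ x = HahnSeries.C c := by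
  have hN0 : N ≠ 0 := by rintro rfl; simp at hN
  have hx : x ≠ 0 := by
    rintro rfl
    rw [zero_pow hN0] at h
    exact hd (HahnSeries.C_injective (h.symm.trans (map_zero _).symm))
  have ho : x.order = 0 := by
    have := order_pow' hx N
    rw [h, HahnSeries.order_C] at this
    rcases mul_eq_zero.mp this.symm with h | h
    · exact absurd (by exact_mod_cast h) hN0
    · exact h
  have hl : Low 0 x := ho ▸ low_order x
  have h0 : x.coeff 0 ≠ 0 := by
    have := mt HahnSeries.coeff_order_eq_zero.mp hx
    rwa [ho] at this
  refine ⟨x.coeff 0, h0, ?_⟩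
  set c := x.coeff 0 with hc
  have hd' : d = c ^ N := by
    have := (hl.pow N).2
    rw [mul_zero, h, coeff_C_zero] at this
    exact this
  have hgeom := (Commute.all x (HahnSeries.C c)).mul_geom_sum₂ N
  rw [h, hd', map_pow, sub_self] at hgeom
  rcases mul_eq_zero.mp hgeom with h3 | h3
  · exact sub_eq_zero.mp h3
  · exfalso
    have h4 := congrArg (fun z : LaurentSeries A => z.coeff 0) h3
    simp only [HahnSeries.coeff_sum, HahnSeries.coeff_zero] at h4
    have h5 : ∀ i ∈ Finset.range N, (x ^ i * (HahnSeries.C c) ^ (N - 1 - i)).coeff 0 = c ^ (N - 1) := by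
      intro i hi
      have e1 := hl.pow i
      have e2 := (low_C c).pow (N - 1 - i)
      rw [mul_zero] at e1 e2
      have e3 := e1.1.coeff_mul e2.1
      rw [add_zero, e1.2, e2.2, coeff_C_zero, ← hc, ← pow_add] at e3
      rw [e3]; congr 1
      have := Finset.mem_range.mp hi
      omega
    rw [Finset.sum_congr rfl h5, Finset.sum_const, Finset.card_range, nsmul_eq_mul] at h4
    exact mul_ne_zero hN (pow_ne_zero _ h0) h4

end low

end SG
end

section
open TensorProduct

namespace SG

theorem compositum (κ : Type*) (ℓ P : Type u) [Field κ] [Field ℓ] [Field P] [Algebra κ ℓ] [FiniteDimensional κ ℓ] [IsGalois κ ℓ]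
    [Algebra κ P] : ∃ (E : Type u) (_ : Field E) (_ : Algebra P E) (_ : FiniteDimensional P E) (_ : IsGalois P E)
      (ι : ℓ →+* E) (r : (E ≃ₐ[P] E) →* (ℓ ≃ₐ[κ] ℓ)),
      (∀ x, ι (algebraMap κ ℓ x) = algebraMap P E (algebraMap κ P x)) ∧ ∀ ν x, ν (ι x) = ι (r ν x) := by
  obtain ⟨f, hf, hs⟩ := IsGalois.is_separable_splitting_field κ ℓ
  let f' := f.map (algebraMap κ P)
  have hf' : f'.Separable := hf.map
  let E := f'.SplittingField
  have hsp : (f.map (algebraMap κ E)).Splits := by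
    have := Polynomial.SplittingField.splits f'
    rwa [Polynomial.map_map, ← IsScalarTower.algebraMap_eq] at this
  let ι : ℓ →ₐ[κ] E := Polynomial.IsSplittingField.lift ℓ f hsp
  let : Algebra ℓ E := ι.toRingHom.toAlgebra
  have : IsScalarTower κ ℓ E := IsScalarTower.of_algebraMap_eq (fun x => (ι.commutes x).symm)
  refine ⟨E, inferInstance, inferInstance, inferInstance, IsGalois.of_separable_splitting_field hf', ι.toRingHom,
    (AlgEquiv.restrictNormalHom ℓ).comp (AlgEquiv.restrictScalarsHom κ), fun x => ?_, fun ν x => ?_⟩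
  · refine (ι.commutes x).trans ?_
    exact IsScalarTower.algebraMap_apply κ P E x
  · exact (AlgEquiv.restrictNormal_commutes (ν.restrictScalars κ) ℓ x).symm

section chi
variable {ℓ G : Type*} [Field ℓ] [Group G] {a : G →* (ℓ →+* ℓ)} {n : ℕ} {ρ : G → Matrix (Fin n) (Fin n) (LaurentSeries ℓ)}
  {c : G → G → LaurentSeries ℓ}

/-- ramification of a matrix -/
noncomputable def chi {n : ℕ} (M : Matrix (Fin n) (Fin n) (LaurentSeries ℓ)) : ZMod n := ((M.det.order : ℤ) : ZMod n)

theorem det_ne_zero_of_isUnit {A : Type*} [Field A] {M : Matrix (Fin n) (Fin n) A} (h : IsUnit M) : M.det ≠ 0 := by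
  rw [Matrix.isUnit_iff_isUnit_det] at h
  exact h.ne_zero

theorem chi_one : chi (1 : Matrix (Fin n) (Fin n) (LaurentSeries ℓ)) = 0 := by
  simp [chi]

theorem chi_mul {M N : Matrix (Fin n) (Fin n) (LaurentSeries ℓ)} (hM : IsUnit M) (hN : IsUnit N) :
    chi (M * N) = chi M + chi N := by
  rw [chi, Matrix.det_mul, order_mul' (det_ne_zero_of_isUnit hM) (det_ne_zero_of_isUnit hN)]
  simp [chi]

theorem chi_map {E : Type*} [Field E] (M : Matrix (Fin n) (Fin n) (LaurentSeries ℓ)) (f : ℓ →+* E) :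
    chi (M.map (lmap f)) = chi M := by
  rw [chi, chi]
  have := (RingHom.map_det (lmap f) M).symm
  rw [RingHom.mapMatrix_apply] at this
  rw [this, lmap_order]

theorem chi_smul {M : Matrix (Fin n) (Fin n) (LaurentSeries ℓ)} (hM : IsUnit M) {x : LaurentSeries ℓ} (hx : x ≠ 0) :
    chi (x • M) = chi M := by
  rw [chi, Matrix.det_smul, Fintype.card_fin, order_mul' (pow_ne_zero _ hx) (det_ne_zero_of_isUnit hM), order_pow' hx]
  simp [chi]

theorem isUnit_map {A B : Type*} [Field A] [Field B] {M : Matrix (Fin n) (Fin n) A} (h : IsUnit M) (f : A →+* B) : IsUnit (M.map f) :=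
  h.map f.mapMatrix

theorem chi_tw (h : Tw (lact a) c ρ) (hn : 0 < n) (σ τ : G) : chi (ρ (σ * τ)) = chi (ρ σ) + chi (ρ τ) := by
  rw [← chi_smul (h.unit _) (h.ne_zero hn σ τ), ← h.mul, lact_apply, chi_mul (h.unit _) (isUnit_map (h.unit _) _), chi_map]

variable {K D : Type*} [Field K] [Ring D] [Algebra K D] [IsSimpleRing D] [Algebra.IsCentral K D] [FiniteDimensional K D]
  {i : K →+* LaurentSeries ℓ} {Φ Φ' : D →+* Matrix (Fin n) (Fin n) (LaurentSeries ℓ)}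

theorem chi_unique (hn : Module.finrank K D = n ^ 2) (h : Desc i (lact a) Φ ρ c)
    {ρ' : G → Matrix (Fin n) (Fin n) (LaurentSeries ℓ)}
    {c' : G → G → LaurentSeries ℓ} (h' : Desc i (lact a) Φ' ρ' c') (σ : G) : chi (ρ σ) = chi (ρ' σ) := by
  obtain ⟨X, f, hX, hf, hXf, -⟩ := h.compare hn h'
  have h1 := congrArg chi (hXf σ)
  rw [lact_apply, chi_mul (h'.tw.unit _) (isUnit_map hX _), chi_map, chi_smul (hX.mul (h.tw.unit _)) (hf _),
    chi_mul hX (h.tw.unit _), add_comm] at h1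
  exact (add_left_cancel h1).symm

theorem chi_zero_of_splits {F : Type*} [Field F] (hn : Module.finrank K D = n ^ 2) {i0 : K →+* F} {j : F →+* LaurentSeries ℓ}
    (h : Desc (j.comp i0) (lact a) Φ ρ c) (hfix : ∀ σ x, lact a σ (j x) = j x) (hs : Splits i0 n D) (σ : G) :
    chi (ρ σ) = 0 := by
  obtain ⟨Φ0, h0⟩ := hs
  have : Desc (j.comp i0) (lact a) (j.mapMatrix.comp Φ0) (fun _ => 1) (fun _ _ => 1) := by
    refine ⟨⟨fun _ => isUnit_one, fun σ τ => by simp [Matrix.map_one _ (map_zero _) (map_one _)]⟩, fun y => ?_, fun σ d => ?_⟩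
    · simp [h0, Matrix.diagonal_map]
    · rw [one_mul, mul_one]
      ext1 x y
      exact hfix σ _
  rw [chi_unique hn h this, chi_one]

theorem chi_two (hn : Module.finrank K D = n ^ 2) (h : Desc i (lact a) Φ ρ c) (e : D ≃ₐ[K] Dᵐᵒᵖ) (σ : G) :
    2 * chi (ρ σ) = 0 := by
  obtain ⟨Φ', h'⟩ := h.op (pos_of_sq hn)
  have h1 := chi_unique hn h (h'.comp_alg e.toAlgHom) σ
  have h2 : chi (((ρ σ)⁻¹).transpose) = chi ((ρ σ)⁻¹) := by
    rw [chi, chi, Matrix.det_transpose]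
  have hu := Matrix.isUnit_nonsing_inv_iff.mpr (h.tw.unit σ)
  have h3 := chi_mul (h.tw.unit σ) hu
  rw [Matrix.mul_nonsing_inv _ ((Matrix.isUnit_iff_isUnit_det _).mp (h.tw.unit σ)), chi_one] at h3
  rw [h2] at h1
  rw [two_mul]
  nth_rw 2 [h1]
  exact h3.symm

end chi

theorem coh_C_iff {ℓ G : Type*} [Field ℓ] [Group G] {a : G →* (ℓ →+* ℓ)} {c c' : G → G → ℓ} :
    Coh (lact a) (fun σ τ => HahnSeries.C (c σ τ)) (fun σ τ => HahnSeries.C (c' σ τ)) ↔ Coh a c c' := by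
  constructor
  · rintro ⟨f, hf, h⟩
    refine ⟨fun σ => (f σ).leadingCoeff, fun σ => by simpa using hf σ, fun σ τ => ?_⟩
    have := congrArg HahnSeries.leadingCoeff (h σ τ)
    rw [HahnSeries.leadingCoeff_mul, HahnSeries.leadingCoeff_mul, HahnSeries.leadingCoeff_mul, lact_apply, lmap_leadingCoeff] at this
    simpa using this
  · rintro ⟨f, hf, h⟩
    refine ⟨fun σ => HahnSeries.C (f σ), fun σ => by simpa using hf σ, fun σ τ => ?_⟩
    rw [lact_apply, lmap_C, ← map_mul, h, map_mul, map_mul]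

/-- normalisation of an unramified cocycle -/
theorem unram_const {ℓ G : Type*} [Field ℓ] [Group G] {a : G →* (ℓ →+* ℓ)} {n r : ℕ} (hr : n = 2 ^ r)
    (h2 : (2 : ℓ) ≠ 0) {ρ : G → Matrix (Fin n) (Fin n) (LaurentSeries ℓ)}
    {c : G → G → LaurentSeries ℓ} (h : Tw (lact a) c ρ) (hχ : ∀ σ, chi (ρ σ) = 0) :
    ∃ (f : G → LaurentSeries ℓ) (c0 : G → G → ℓ), (∀ σ, f σ ≠ 0) ∧ (∀ σ τ, c0 σ τ ≠ 0) ∧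
      ∀ σ τ, HahnSeries.C (c0 σ τ) * f (σ * τ) = f σ * lact a σ (f τ) * c σ τ := by
  have hn : 0 < n := by rw [hr]; positivity
  have hN : (n : ℓ) ≠ 0 := by rw [hr]; push_cast; exact pow_ne_zero _ h2
  have key : ∀ σ, ∃ f : LaurentSeries ℓ, f ≠ 0 ∧ ∃ u : ℓ, u ≠ 0 ∧ (f • ρ σ).det = HahnSeries.C u := by
    intro σ
    have hd := det_ne_zero_of_isUnit (h.unit σ)
    have h1 := hχ σ
    rw [chi, ZMod.intCast_zmod_eq_zero_iff_dvd] at h1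
    obtain ⟨m, hm⟩ := h1
    have hl := mt HahnSeries.coeff_order_eq_zero.mp hd
    set x := (ρ σ).det
    set u := x.coeff x.order
    have hs : (HahnSeries.single (-x.order) (u⁻¹) : LaurentSeries ℓ) ≠ 0 := by
      simpa using hl
    let y := HahnSeries.single (-x.order) (u⁻¹) * x
    have hy1 := (low_single (-x.order) (u⁻¹)).mul (low_order x)
    have hy2 := (low_single (-x.order) (u⁻¹)).coeff_mul (low_order x)
    rw [neg_add_cancel] at hy1 hy2
    obtain ⟨z, hz, hz1, hz2⟩ := exists_root h2 r hy1 (by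
      rw [hy2, HahnSeries.coeff_single_same]; exact inv_mul_cancel₀ hl)
    have hz0 : z ≠ 0 := by rintro rfl; simp at hz2
    refine ⟨HahnSeries.single (-m) 1 * z⁻¹, mul_ne_zero (by simp) (inv_ne_zero hz0), u, hl, ?_⟩
    rw [Matrix.det_smul, Fintype.card_fin, mul_pow, inv_pow]
    nth_rw 2 [hr]
    rw [hz, HahnSeries.single_pow]
    have h3 : (n • -m) = -x.order := by rw [hm]; simp
    rw [h3, one_pow, mul_inv]
    have h4 : (HahnSeries.single (-x.order) (1:ℓ)) = HahnSeries.C u * HahnSeries.single (-x.order) (u⁻¹) := by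
      rw [HahnSeries.C_mul_eq_smul]
      ext i; simp only [HahnSeries.coeff_smul, HahnSeries.coeff_single, smul_eq_mul]
      split_ifs <;> simp [hl]
    change _ * x = _
    rw [h4]
    generalize (HahnSeries.single (-x.order) (u⁻¹) : LaurentSeries ℓ) = s at *
    field_simp
  choose f hf u hu hfu using key
  have hc : ∀ σ τ, ∃ d, d ≠ 0 ∧ f σ * lact a σ (f τ) * c σ τ * (f (σ * τ))⁻¹ = HahnSeries.C d := by
    intro σ τ
    have h1 := (h.rescale (c' := fun σ τ => f σ * lact a σ (f τ) * c σ τ * (f (σ * τ))⁻¹) f hf (fun σ τ => by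
      rw [inv_mul_cancel_right₀ (hf _)])).mul σ τ
    have h2 := congrArg Matrix.det h1
    rw [Matrix.det_smul, Matrix.det_mul, hfu, hfu, Fintype.card_fin] at h2
    have h3 := (RingHom.map_det (lact a σ) (f τ • ρ τ)).symm
    rw [RingHom.mapMatrix_apply, hfu, lact_apply, lmap_C] at h3
    rw [lact_apply] at h2
    rw [h3, ← map_mul] at h2
    refine const_of_pow (d := u σ * a σ (u τ) * (u (σ * τ))⁻¹) hN ?_ ?_
    · exact mul_ne_zero (mul_ne_zero (hu _) ((map_ne_zero _).mpr (hu _))) (inv_ne_zero (hu _))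
    · rw [map_mul, map_inv₀, h2, mul_inv_cancel_right₀]
      · rfl
      · simpa using hu _
  choose c0 hc0 hc using hc
  exact ⟨f, c0, hf, hc0, fun σ τ => by rw [← hc, inv_mul_cancel_right₀ (hf _)]⟩

end SG
end

section
open TensorProduct

namespace SG

theorem mlow_C {A : Type*} [Field A] {m n : ℕ} (M : Matrix (Fin m) (Fin n) A) :
    MLow 0 (M.map (HahnSeries.C : A →+* LaurentSeries A)) ∧ mcoef 0 (M.map (HahnSeries.C : A →+* LaurentSeries A)) = M :=
  ⟨fun i j => low_C _, by ext i j; exact coeff_C_zero _⟩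

theorem tw_C {ℓ G : Type*} [Field ℓ] [Group G] {a : G →* (ℓ →+* ℓ)} {d : ℕ} {W : G → Matrix (Fin d) (Fin d) ℓ} {c0 : G → G → ℓ}
    (h : Tw a c0 W) : Tw (lact a) (fun σ τ => HahnSeries.C (c0 σ τ)) (fun σ => (W σ).map (HahnSeries.C : ℓ →+* LaurentSeries ℓ)) := by
  refine ⟨fun σ => isUnit_map (h.unit σ) _, fun σ τ => ?_⟩
  have h1 : ((W τ).map (HahnSeries.C : ℓ →+* LaurentSeries ℓ)).map (lact a σ) = ((W τ).map (a σ)).map HahnSeries.C := by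
    ext1 x y; exact lmap_C _ _
  rw [h1, ← Matrix.map_mul, h.mul]
  ext1 x y
  simp

theorem formAlg_C_unit {κ ℓ G : Type*} [Field κ] [Field ℓ] [Algebra κ ℓ] [Group G] {a : G →* (ℓ →+* ℓ)} {d : ℕ} {W : G → Matrix (Fin d) (Fin d) ℓ}
    (hs : SimpleTw a W) [Algebra (LaurentSeries κ) (LaurentSeries ℓ)] (hg : IsGal (LaurentSeries κ) (lact a))
    {X : Matrix (Fin d) (Fin d) (LaurentSeries ℓ)}
    (hX : X ∈ FormAlg (LaurentSeries κ) hg (fun σ => (W σ).map (HahnSeries.C : ℓ →+* LaurentSeries ℓ))) (hX0 : X ≠ 0) : IsUnit X := by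
  rw [mem_FormAlg] at hX
  obtain ⟨v, hv, hv0⟩ := exists_mlow hX0
  refine (hv.isUnit (simpleTw_isUnit hs hv0 (fun σ => ⟨W σ, ?_⟩))).1
  have h1 := (mlow_C (W σ)).1.mul (hv.map (a σ)).1
  have h2 := hv.mul (mlow_C (W σ)).1
  rw [(mlow_C (W σ)).2, (hv.map (a σ)).2, zero_add] at h1
  rw [(mlow_C (W σ)).2, add_zero] at h2
  rw [← h1.2, ← h2.2]
  congr 1
  exact hX σ

theorem const_split_iff {K D κ ℓ P : Type u} [Field K] [Ring D] [Algebra K D] [IsSimpleRing D] [Algebra.IsCentral K D]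
    [FiniteDimensional K D] [Field κ] [Field ℓ] [Field P] [Algebra κ ℓ] [FiniteDimensional κ ℓ] [IsGalois κ ℓ] [Algebra κ P]
    {n : ℕ} (hn : Module.finrank K D = n ^ 2) {i : K →+* LaurentSeries κ} {c0 : (ℓ ≃ₐ[κ] ℓ) → (ℓ ≃ₐ[κ] ℓ) → ℓ} {ρ}
    {Φ : D →+* Matrix (Fin n) (Fin n) (LaurentSeries ℓ)}
    (h : Desc ((lmap (algebraMap κ ℓ)).comp i) (lact (galAct κ ℓ)) Φ ρ (fun σ τ => HahnSeries.C (c0 σ τ)))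
    {Δ : Type u} [Ring Δ] [Algebra κ Δ] [IsSimpleRing Δ] [Algebra.IsCentral κ Δ] [FiniteDimensional κ Δ]
    {d : ℕ} (hd : Module.finrank κ Δ = d ^ 2) {Ψ : Δ →+* Matrix (Fin d) (Fin d) ℓ} {W}
    (hW : Desc (algebraMap κ ℓ) (galAct κ ℓ) Ψ W c0) (j : LaurentSeries P →+* LaurentSeries P)
    (hJ : ∀ (E : Type u) [Field E] [Algebra P E], ∃ J : LaurentSeries E →+* LaurentSeries E,
      (∀ x, J (lmap (algebraMap P E) x) = lmap (algebraMap P E) (j x)) ∧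
      (∀ (ν : E ≃ₐ[P] E) x, lmap (ν : E →+* E) (J x) = J (lmap (ν : E →+* E) x)) ∧ ∀ c, J (HahnSeries.C c) = HahnSeries.C c) :
    Splits (j.comp ((lmap (algebraMap κ P)).comp i)) n D ↔ Splits (algebraMap κ P) d Δ := by
  obtain ⟨E, _, _, _, _, ι, r, hι, hr⟩ := compositum κ ℓ P
  obtain ⟨J, hJ1, hJ2, hJ3⟩ := hJ E
  let : Algebra (LaurentSeries P) (LaurentSeries E) := (lmap (algebraMap P E)).toAlgebra
  have hg := lact_isGal (galAct_isGal P E) (rfl : algebraMap (LaurentSeries P) (LaurentSeries E) = lmap (algebraMap P E))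
  have h1 := h.map (lact (galAct P E)) (J.comp (lmap ι)) r (fun ν x => by
    rw [lact_apply, lact_apply]
    change lmap (ν : E →+* E) (J _) = J _
    rw [hJ2]
    congr 1
    ext m
    exact hr ν _)
  have e1 : (J.comp (lmap ι)).comp ((lmap (algebraMap κ ℓ)).comp i) =
      (algebraMap (LaurentSeries P) (LaurentSeries E)).comp (j.comp ((lmap (algebraMap κ P)).comp i)) := by
    refine RingHom.ext (fun x => ?_)
    change J (lmap ι (lmap (algebraMap κ ℓ) (i x))) = lmap (algebraMap P E) (j (lmap (algebraMap κ P) (i x)))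
    rw [← hJ1]
    congr 1
    ext m
    exact hι _
  rw [e1] at h1
  have e2 : (fun ν μ => (J.comp (lmap ι)) (HahnSeries.C (c0 (r ν) (r μ)))) =
      (fun ν μ => HahnSeries.C (ι (c0 (r ν) (r μ)))) := by
    funext ν μ
    rw [RingHom.comp_apply, lmap_C, hJ3]
  rw [e2] at h1
  have h2 := hW.map (galAct P E) ι r hr
  have e3 : ι.comp (algebraMap κ ℓ) = (algebraMap P E).comp (algebraMap κ P) := RingHom.ext hι
  rw [e3] at h2
  have hC := coh_C_iff (a := galAct P E) (c := fun ν μ => ι (c0 (r ν) (r μ))) (c' := fun _ _ => 1)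
  simp only [map_one] at hC
  constructor
  · intro hs
    exact splits_of_coh (galAct_isGal P E) h2 (hC.mp (coh_of_splits hn hg.fixed h1 hs))
  · intro hs
    exact splits_of_coh hg h1 (hC.mpr (coh_of_splits hd (galAct_isGal P E).fixed h2 hs))

/-- the residue algebra of an unramified algebra -/
theorem lcDelta {K D κ ℓ : Type u} [Field K] [Ring D] [Algebra K D] [IsSimpleRing D] [Algebra.IsCentral K D]
    [FiniteDimensional K D] [Field κ] [Field ℓ] [Algebra κ ℓ] [FiniteDimensional κ ℓ] [IsGalois κ ℓ] (h2 : (2:κ) ≠ 0)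
    {n r : ℕ} (hr : n = 2 ^ r) (hn : Module.finrank K D = n ^ 2) {i : K →+* LaurentSeries κ} {c : (ℓ ≃ₐ[κ] ℓ) → (ℓ ≃ₐ[κ] ℓ) → LaurentSeries ℓ} {ρ}
    {Φ : D →+* Matrix (Fin n) (Fin n) (LaurentSeries ℓ)}
    (h : Desc ((lmap (algebraMap κ ℓ)).comp i) (lact (galAct κ ℓ)) Φ ρ c) (hχ : ∀ σ, chi (ρ σ) = 0) :
    ∃ (f : (ℓ ≃ₐ[κ] ℓ) → LaurentSeries ℓ) (c0 : (ℓ ≃ₐ[κ] ℓ) → (ℓ ≃ₐ[κ] ℓ) → ℓ) (d : ℕ) (W : (ℓ ≃ₐ[κ] ℓ) → Matrix (Fin d) (Fin d) ℓ)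
      (Δ : Type u) (_ : DivisionRing Δ) (_ : Algebra κ Δ) (Ψ : Δ →+* Matrix (Fin d) (Fin d) ℓ),
      (∀ σ, f σ ≠ 0) ∧ (∀ σ τ, c0 σ τ ≠ 0) ∧
      (∀ σ τ, HahnSeries.C (c0 σ τ) * f (σ * τ) = f σ * lact (galAct κ ℓ) σ (f τ) * c σ τ) ∧
      FiniteDimensional κ Δ ∧ Algebra.IsCentral κ Δ ∧ Module.finrank κ Δ = d ^ 2 ∧ Desc (algebraMap κ ℓ) (galAct κ ℓ) Ψ W c0 ∧
      SimpleTw (galAct κ ℓ) W ∧ d ∣ n ∧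
      ∀ (P : Type u) [Field P] [Algebra κ P],
        (Splits ((lmap (algebraMap κ P)).comp i) n D ↔ Splits (algebraMap κ P) d Δ) ∧
        ∀ (b : P) (hb : b ≠ 0), (Splits ((lsub b hb).comp ((lmap (algebraMap κ P)).comp i)) n D ↔ Splits (algebraMap κ P) d Δ) := by
  have h2' : (2:ℓ) ≠ 0 := by
    have := (algebraMap κ ℓ).injective.ne h2
    rwa [map_ofNat, map_zero] at this
  obtain ⟨f, c0, hf, hc0, hfc⟩ := unram_const hr h2' h.tw hχ
  have h1 := h.rescale f hf hfc
  have hn0 := pos_of_sq hn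
  have hco : ∀ σ τ υ, galAct κ ℓ σ (c0 τ υ) * c0 σ (τ * υ) = c0 σ τ * c0 (σ * τ) υ := by
    intro σ τ υ
    have := h1.tw.cocycle hn0 σ τ υ
    rw [lact_apply, lmap_C, ← map_mul, ← map_mul] at this
    exact HahnSeries.C_injective this
  obtain ⟨d, W, Δ, _, _, Ψ, hd0, hfd, hcen, hd, hW, hs⟩ := exists_Delta (galAct_isGal κ ℓ) hc0 hco
  refine ⟨f, c0, d, W, Δ, inferInstance, inferInstance, Ψ, hf, hc0, hfc, hfd, hcen, hd, hW, hs, ?_, ?_⟩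
  · let : Algebra (LaurentSeries κ) (LaurentSeries ℓ) := (lmap (algebraMap κ ℓ)).toAlgebra
    have hg := lact_isGal (galAct_isGal κ ℓ) (rfl : algebraMap (LaurentSeries κ) (LaurentSeries ℓ) = lmap (algebraMap κ ℓ))
    exact tw_dvd hg (tw_C hW.tw) hd0 hn0 h1.tw (fun A hA hA0 => formAlg_C_unit hs hg hA hA0)
  · intro P _ _
    constructor
    · exact const_split_iff hn h1 hd hW (RingHom.id _) (fun E _ _ => ⟨RingHom.id _, fun x => rfl, fun _ _ => rfl, fun _ => rfl⟩)
    · intro b hb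
      refine const_split_iff hn h1 hd hW (lsub b hb) (fun E _ _ => ?_)
      have hb' : algebraMap P E b ≠ 0 := by simpa using hb
      refine ⟨lsub (algebraMap P E b) hb', fun x => lsub_lmap _ b hb hb' x, fun ν x => ?_, fun c => lsub_C _ _ c⟩
      have h3 : (ν : E →+* E) (algebraMap P E b) = algebraMap P E b := ν.commutes b
      have h4 := lsub_lmap (ν : E →+* E) (algebraMap P E b) hb' (by rw [h3]; exact hb') x
      rw [← h4]
      congr 2

end SG
end

section
open TensorProduct

namespace SG

theorem ram_lead {ℓ H H2 : Type*} [Field ℓ] [Group H] [Group H2] {a : H →* (ℓ →+* ℓ)} {n : ℕ} (hn : 0 < n)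
    {ρ : H → Matrix (Fin n) (Fin n) (LaurentSeries ℓ)} {c} (h : Tw (lact a) c ρ) (r2 : H2 →* H)
    {W : H2 → Matrix (Fin n) (Fin n) ℓ} (hs : SimpleTw (a.comp r2) W) (hW : ∀ h, IsUnit (W h))
    {X : Matrix (Fin n) (Fin n) (LaurentSeries ℓ)} (hX : IsUnit X) {f : H2 → LaurentSeries ℓ} (hf : ∀ h, f h ≠ 0)
    (hXf : ∀ g, (W g).map (HahnSeries.C : ℓ →+* LaurentSeries ℓ) * X.map (lmap (a (r2 g))) = f g • (X * ρ (r2 g)))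
    (s : H) (hsn : ∀ h', ∃ g, r2 h' * s = s * r2 g) : chi (ρ s) = 0 := by
  have : Nonempty (Fin n) := ⟨⟨0, hn⟩⟩
  have hXs := isUnit_map hX (lmap (a s))
  set T := X * ρ s * (X.map (lmap (a s)))⁻¹ with hT
  have hTX : T * X.map (lmap (a s)) = X * ρ s := by
    rw [hT, Matrix.mul_assoc, Matrix.nonsing_inv_mul _ ((Matrix.isUnit_iff_isUnit_det _).mp hXs), Matrix.mul_one]
  have hTu : IsUnit T := (hX.mul (h.unit s)).mul (Matrix.isUnit_nonsing_inv_iff.mpr hXs)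
  have hTchi : chi T = chi (ρ s) := by
    have := congrArg chi hTX
    rw [chi_mul hTu hXs, chi_map, chi_mul hX (h.unit s), add_comm] at this
    exact add_left_cancel this
  obtain ⟨v, hv, hv0⟩ := exists_mlow hTu.ne_zero
  have hmul : ∀ (g g' : H) (M : Matrix (Fin n) (Fin n) (LaurentSeries ℓ)), (M.map (lmap (a g'))).map (lmap (a g)) = M.map (lmap (a (g * g'))) := by
    intro g g' M
    exact (map_act_mul (lact a) g g' M).symm
  have key : ∀ h', ∃ A, W h' * (mcoef v T).map (a (r2 h')) = mcoef v T * A := by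
    intro h'
    obtain ⟨g, hg⟩ := hsn h'
    have hx : ∃ x : LaurentSeries ℓ, (W h').map (HahnSeries.C : ℓ →+* LaurentSeries ℓ) * T.map (lmap (a (r2 h'))) =
        x • (T * ((W g).map (HahnSeries.C : ℓ →+* LaurentSeries ℓ)).map (lmap (a s))) := by
      refine ⟨f h' * c (r2 h') s * (lmap (a s) (f g) * c s (r2 g))⁻¹, ?_⟩
      have hXss := isUnit_map hX (lmap (a (r2 h' * s)))
      refine hXss.mul_right_cancel ?_
      have hne : lmap (a s) (f g) * c s (r2 g) ≠ 0 := mul_ne_zero ((map_ne_zero _).mpr (hf g)) (h.ne_zero hn _ _)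
      have e1 := h.mul (r2 h') s
      have e2 := h.mul s (r2 g)
      rw [lact_apply] at e1 e2
      have l1 : (W h').map (HahnSeries.C : ℓ →+* LaurentSeries ℓ) * T.map (lmap (a (r2 h'))) * X.map (lmap (a (r2 h' * s)))
          = (f h' * c (r2 h') s) • (X * ρ (r2 h' * s)) := by
        rw [← hmul, Matrix.mul_assoc, ← Matrix.map_mul, hTX, Matrix.map_mul, ← Matrix.mul_assoc, hXf, Matrix.smul_mul,
          Matrix.mul_assoc, e1, Matrix.mul_smul, smul_smul]
      have l2 : T * ((W g).map (HahnSeries.C : ℓ →+* LaurentSeries ℓ)).map (lmap (a s)) * X.map (lmap (a (r2 h' * s)))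
          = (lmap (a s) (f g) * c s (r2 g)) • (X * ρ (r2 h' * s)) := by
        rw [hg, ← hmul, Matrix.mul_assoc, ← Matrix.map_mul, hXf, ← lact_apply, map_smul_act, lact_apply, Matrix.map_mul, Matrix.mul_smul,
          ← Matrix.mul_assoc, hTX, Matrix.mul_assoc, e2, Matrix.mul_smul, smul_smul]
      rw [Matrix.smul_mul, l1, l2, smul_smul, inv_mul_cancel_right₀ hne]
    obtain ⟨x, hx⟩ := hx
    have e1 := (mlow_C (W h')).1.mul (hv.map (a (r2 h'))).1
    rw [(mlow_C (W h')).2, (hv.map (a _)).2, zero_add] at e1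
    have e0 := hv.mul ((mlow_C (W g)).1.map (a s)).1
    rw [((mlow_C (W g)).1.map (a s)).2, (mlow_C (W g)).2, add_zero] at e0
    have e2 := e0.1.smul (low_order x)
    rw [hx] at e1
    rcases lt_or_ge x.order 0 with hlt | hge
    · exfalso
      have h0 : mcoef (x.order + v) (x • (T * ((W g).map (HahnSeries.C : ℓ →+* LaurentSeries ℓ)).map (lmap (a s)))) = 0 := by
        ext p q
        exact e1.1 p q _ (by omega)
      rw [e2.2, e0.2] at h0
      have hx0 : x ≠ 0 := by rintro rfl; simp at hlt
      rcases smul_eq_zero.mp h0 with h1 | h1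
      · exact hx0 (HahnSeries.coeff_order_eq_zero.mp h1)
      · exact hv0 ((isUnit_map (hW g) (a s)).mul_left_eq_zero.mp h1)
    · have e3 := e0.1.smul ((low_order x).mono hge)
      rw [zero_add, e1.2, e0.2] at e3
      exact ⟨x.coeff 0 • (W g).map (a s), by rw [Matrix.mul_smul]; exact e3.2⟩
  have hu := simpleTw_isUnit hs hv0 key
  rw [← hTchi, chi, (hv.isUnit hu).2]
  simp

section pull
variable {K D κ ℓ : Type u} [Field K] [Ring D] [Algebra K D] [Field κ] [Field ℓ] [Algebra κ ℓ] {n : ℕ}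
    {i : K →+* LaurentSeries κ} {c : (ℓ ≃ₐ[κ] ℓ) → (ℓ ≃ₐ[κ] ℓ) → LaurentSeries ℓ} {ρ}
    {Φ : D →+* Matrix (Fin n) (Fin n) (LaurentSeries ℓ)}

theorem desc_pull (h : Desc ((lmap (algebraMap κ ℓ)).comp i) (lact (galAct κ ℓ)) Φ ρ c)
    (Z : Type u) [Field Z] [Algebra κ Z] [Algebra Z ℓ] [IsScalarTower κ Z ℓ] :
    Desc ((lmap (algebraMap Z ℓ)).comp ((lmap (algebraMap κ Z)).comp i)) (lact (galAct Z ℓ)) Φ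
      (fun σ => ρ (σ.restrictScalars κ)) (fun σ τ => c (σ.restrictScalars κ) (τ.restrictScalars κ)) := by
  have h1 := h.map (lact (galAct Z ℓ)) (RingHom.id _) (AlgEquiv.restrictScalarsHom κ) (fun ν x => rfl)
  have e1 : (lmap (algebraMap Z ℓ)).comp ((lmap (algebraMap κ Z)).comp i) = (RingHom.id _).comp ((lmap (algebraMap κ ℓ)).comp i) := by
    rw [← RingHom.comp_assoc, lmap_comp, ← IsScalarTower.algebraMap_eq]; rfl
  rw [e1]
  convert h1 using 1
  · ext; simp
  · funext σ; ext; simp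
  · rfl

theorem lmap_tower {κ Z P : Type*} [Field κ] [Field Z] [Field P] [Algebra κ Z] [Algebra Z P] [Algebra κ P] [IsScalarTower κ Z P]
    (i : K →+* LaurentSeries κ) : (lmap (algebraMap Z P)).comp ((lmap (algebraMap κ Z)).comp i) = (lmap (algebraMap κ P)).comp i := by
  rw [← RingHom.comp_assoc, lmap_comp, ← IsScalarTower.algebraMap_eq]

end pull
end SG
end

section
open TensorProduct

namespace SG

theorem exists_fixed {κ ℓ : Type u} [Field κ] [Field ℓ] [Algebra κ ℓ] [FiniteDimensional κ ℓ] [IsGalois κ ℓ] (S : Subgroup (ℓ ≃ₐ[κ] ℓ)) :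
    ∃ (Z : Type u) (_ : Field Z) (_ : Algebra κ Z) (_ : Algebra Z ℓ) (_ : IsScalarTower κ Z ℓ) (_ : FiniteDimensional κ Z)
      (_ : FiniteDimensional Z ℓ) (_ : IsGalois Z ℓ), Module.finrank κ Z = S.index ∧ (∀ τ : ℓ ≃ₐ[Z] ℓ, τ.restrictScalars κ ∈ S) ∧
      (∀ σ ∈ S, ∃ τ : ℓ ≃ₐ[Z] ℓ, τ.restrictScalars κ = σ) ∧ ∀ x : ℓ, (∀ σ ∈ S, σ x = x) → ∃ z, algebraMap Z ℓ z = x := by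
  refine ⟨IntermediateField.fixedField S, inferInstance, inferInstance, inferInstance, inferInstance, inferInstance, inferInstance, inferInstance,
    ?_, ?_, ?_, ?_⟩
  · rw [IntermediateField.finrank_eq_fixingSubgroup_index, IntermediateField.fixingSubgroup_fixedField]
  · intro τ
    have : τ.restrictScalars κ ∈ (IntermediateField.fixedField S).fixingSubgroup := by
      rw [IntermediateField.mem_fixingSubgroup_iff]
      intro x hx
      exact τ.commutes ⟨x, hx⟩
    rwa [IntermediateField.fixingSubgroup_fixedField S] at this
  · intro σ hσ
    refine ⟨AlgEquiv.ofRingEquiv (f := σ.toRingEquiv) (fun x => ?_), ?_⟩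
    · exact x.2 ⟨σ, hσ⟩
    · ext x; rfl
  · intro x hx
    exact ⟨⟨x, fun σ => hx σ.1 σ.2⟩, rfl⟩

theorem zmod_two_tors {n r : ℕ} (hr : n = 2 ^ r) {x y : ZMod n} (hx : 2 * x = 0) (hy : 2 * y = 0) (hx0 : x ≠ 0) (hy0 : y ≠ 0) : x = y := by
  have : NeZero n := ⟨by rw [hr]; positivity⟩
  have key : ∀ z : ZMod n, 2 * z = 0 → z ≠ 0 → 2 * z.val = n := by
    intro z hz hz0
    have h1 : ((2 * z.val : ℕ) : ZMod n) = 0 := by push_cast; rw [ZMod.natCast_zmod_val]; exact hz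
    rw [ZMod.natCast_eq_zero_iff] at h1
    have h2 := z.val_lt
    have h3 : z.val ≠ 0 := fun h => hz0 ((ZMod.val_eq_zero z).mp h)
    obtain ⟨q, hq⟩ := h1
    have : q = 1 := by
      have : q < 2 := by by_contra h; nlinarith
      have : q ≠ 0 := by rintro rfl; omega
      omega
    rw [hq, this, mul_one]
  apply ZMod.val_injective
  have := key x hx hx0
  have := key y hy hy0
  omega

/-- kernel of an additive character -/
def kerC {H A : Type*} [Group H] [AddGroup A] (χ : H → A) (hχ : ∀ σ τ, χ (σ * τ) = χ σ + χ τ) : Subgroup H :=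
  (MonoidHom.mk' (fun σ => Multiplicative.ofAdd (χ σ)) (fun σ τ => by rw [hχ, ofAdd_add])).ker

theorem mem_kerC {H A : Type*} [Group H] [AddGroup A] {χ : H → A} {hχ : ∀ σ τ, χ (σ * τ) = χ σ + χ τ} {σ : H} :
    σ ∈ kerC χ hχ ↔ χ σ = 0 := by
  rw [kerC, MonoidHom.mem_ker]; rfl

theorem kerC_index {H : Type*} [Group H] {n r : ℕ} (hr : n = 2 ^ r) {χ : H → ZMod n} (hχ : ∀ σ τ, χ (σ * τ) = χ σ + χ τ)
    (h2 : ∀ σ, 2 * χ σ = 0) {s : H} (hs : χ s ≠ 0) : (kerC χ hχ).index = 2 := by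
  rw [Subgroup.index_eq_two_iff]
  refine ⟨s, fun b => ?_⟩
  rw [mem_kerC, mem_kerC, hχ]
  by_cases hb : χ b = 0
  · right; rw [hb, zero_add]; exact ⟨rfl, hs⟩
  · left; rw [zmod_two_tors hr (h2 b) (h2 s) hb hs, ← two_mul]; exact ⟨h2 s, hs⟩

theorem exists_unit_form {κ ℓ G : Type*} [Field κ] [Field ℓ] [Algebra κ ℓ] [Group G] [Finite G] {a : G →* (ℓ →+* ℓ)} {n : ℕ} (hn : 0 < n) {W : G → Matrix (Fin n) (Fin n) ℓ}
    (hs : SimpleTw a W) [Algebra (LaurentSeries κ) (LaurentSeries ℓ)] (hg : IsGal (LaurentSeries κ) (lact a))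
    {c0 : G → G → ℓ} (hW : Tw a c0 W) {ρ : G → Matrix (Fin n) (Fin n) (LaurentSeries ℓ)} (hρ : Tw (lact a) (fun σ τ => HahnSeries.C (c0 σ τ)) ρ) :
    ∃ X : Matrix (Fin n) (Fin n) (LaurentSeries ℓ), IsUnit X ∧ ∀ σ, (W σ).map (HahnSeries.C : ℓ →+* LaurentSeries ℓ) * X.map (lact a σ) = X * ρ σ := by
  have hW' := tw_C hW
  obtain ⟨-, -, h1⟩ := form_main hg hW' hρ hn
  obtain ⟨-, -, h3⟩ := form_main hg hρ hW' hn
  have : Nonempty (Fin n) := ⟨⟨0, hn⟩⟩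
  have : ∃ X ∈ Form (LaurentSeries κ) hg (fun σ => (W σ).map (HahnSeries.C : ℓ →+* LaurentSeries ℓ)) ρ, X ≠ 0 := by
    by_contra hcon
    push Not at hcon
    have : Submodule.span (LaurentSeries ℓ) (Form (LaurentSeries κ) hg (fun σ => (W σ).map (HahnSeries.C : ℓ →+* LaurentSeries ℓ)) ρ : Set (Matrix (Fin n) (Fin n) (LaurentSeries ℓ))) = ⊥ :=
      Submodule.span_eq_bot.mpr hcon
    rw [h1] at this
    exact top_ne_bot this
  obtain ⟨X, hX, hX0⟩ := this
  have : ∃ Y ∈ Form (LaurentSeries κ) hg ρ (fun σ => (W σ).map (HahnSeries.C : ℓ →+* LaurentSeries ℓ)), X * Y ≠ 0 := by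
    by_contra hcon
    push Not at hcon
    have h4 : Submodule.span (LaurentSeries ℓ) (Form (LaurentSeries κ) hg ρ (fun σ => (W σ).map (HahnSeries.C : ℓ →+* LaurentSeries ℓ)) : Set (Matrix (Fin n) (Fin n) (LaurentSeries ℓ)))
       ≤ LinearMap.ker (LinearMap.mulLeft (LaurentSeries ℓ) X) := Submodule.span_le.mpr (fun Y hY => hcon Y hY)
    rw [h3] at h4
    have h5 : X * 1 = 0 := h4 (Submodule.mem_top (x := (1 : Matrix (Fin n) (Fin n) (LaurentSeries ℓ))))
    exact hX0 (by rwa [mul_one] at h5)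
  obtain ⟨Y, hY, hXY⟩ := this
  rw [mem_Form] at hX hY
  have hu : IsUnit (X * Y) := by
    refine formAlg_C_unit hs hg ?_ hXY
    rw [mem_FormAlg]
    intro σ
    rw [Matrix.map_mul, ← Matrix.mul_assoc, hX, Matrix.mul_assoc, hY, Matrix.mul_assoc]
  refine ⟨X, ?_, hX⟩
  rw [Matrix.isUnit_iff_isUnit_det] at hu ⊢
  rw [Matrix.det_mul] at hu
  exact isUnit_of_mul_isUnit_left hu

/-- existence of an unramified splitting field of small degree -/
theorem exists_Q0 {K D κ ℓ : Type u} [Field K] [Ring D] [Algebra K D] [IsSimpleRing D] [Algebra.IsCentral K D]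
    [FiniteDimensional K D] [Field κ] [Field ℓ] [Algebra κ ℓ] [FiniteDimensional κ ℓ] [IsGalois κ ℓ] (h2 : (2:κ) ≠ 0)
    {n r : ℕ} (hr : n = 2 ^ r) (hn : Module.finrank K D = n ^ 2) {i : K →+* LaurentSeries κ} {c : (ℓ ≃ₐ[κ] ℓ) → (ℓ ≃ₐ[κ] ℓ) → LaurentSeries ℓ} {ρ}
    {Φ : D →+* Matrix (Fin n) (Fin n) (LaurentSeries ℓ)}
    (h : Desc ((lmap (algebraMap κ ℓ)).comp i) (lact (galAct κ ℓ)) Φ ρ c) (hχ : ∀ σ, 2 * chi (ρ σ) = 0) :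
    ∃ (Q : Type u) (_ : Field Q) (_ : Algebra κ Q), FiniteDimensional κ Q ∧ Module.finrank κ Q ∣ n ∧
      Splits ((lmap (algebraMap κ Q)).comp i) n D := by
  have hn0 := pos_of_sq hn
  by_cases hχ0 : ∀ σ, chi (ρ σ) = 0
  · obtain ⟨f, c0, d, W, Δ, _, _, Ψ, hf, hc0, hfc, hfd, hcen, hd, hW, hs, hdn, hP⟩ := lcDelta h2 hr hn h hχ0
    obtain ⟨P, _, _, hP1, hP2⟩ := exists_max_subfield hd
    refine ⟨P, inferInstance, inferInstance, ?_, by rwa [hP1], (hP P).1.mpr hP2⟩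
    exact FiniteDimensional.of_finrank_pos (by rw [hP1]; exact pos_of_sq hd)
  · push Not at hχ0
    obtain ⟨s, hs0⟩ := hχ0
    have hχm : ∀ σ τ : ℓ ≃ₐ[κ] ℓ, chi (ρ (σ * τ)) = chi (ρ σ) + chi (ρ τ) := fun σ τ => chi_tw h.tw hn0 σ τ
    obtain ⟨Z, _, _, _, _, _, _, _, hZ, hZ1, hZ2, -⟩ := exists_fixed (kerC (fun σ : ℓ ≃ₐ[κ] ℓ => chi (ρ σ)) hχm)
    rw [kerC_index hr _ hχ hs0] at hZ
    have h2Z : (2:Z) ≠ 0 := by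
      have := (algebraMap κ Z).injective.ne h2
      rwa [map_ofNat, map_zero] at this
    have h1 := desc_pull h Z
    have hχZ : ∀ σ : ℓ ≃ₐ[Z] ℓ, chi (ρ (σ.restrictScalars κ)) = 0 := by
      intro σ; have := hZ1 σ; rw [mem_kerC] at this; exact this
    obtain ⟨f, c0, d, W, Δ, _, _, Ψ, hf, hc0, hfc, hfd, hcen, hd, hW, hs, hdn, hP⟩ := lcDelta h2Z hr hn h1 hχZ
    have hdn' : d ≠ n := by
      rintro rfl
      let : Algebra (LaurentSeries Z) (LaurentSeries ℓ) := (lmap (algebraMap Z ℓ)).toAlgebra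
      have hg := lact_isGal (galAct_isGal Z ℓ) (rfl : algebraMap (LaurentSeries Z) (LaurentSeries ℓ) = lmap (algebraMap Z ℓ))
      obtain ⟨X, hX, hXe⟩ := exists_unit_form hn0 hs hg hW.tw (h1.tw.rescale f hf hfc)
      refine hs0 (ram_lead hn0 h.tw (AlgEquiv.restrictScalarsHom κ : (ℓ ≃ₐ[Z] ℓ) →* (ℓ ≃ₐ[κ] ℓ)) (W := W) ?_ hW.tw.unit hX hf ?_ s ?_)
      · exact hs
      · intro g
        have := hXe g
        rw [Matrix.mul_smul] at this
        exact this
      · intro h'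
        obtain ⟨g, hg'⟩ := hZ2 (s⁻¹ * (h'.restrictScalars κ) * s) (by
          rw [mem_kerC, chi_tw h.tw hn0, chi_tw h.tw hn0, hχZ, add_zero, ← chi_tw h.tw hn0, inv_mul_cancel]
          have := chi_tw h.tw hn0 1 1
          rw [mul_one] at this
          exact left_eq_add.mp this)
        refine ⟨g, ?_⟩
        change h'.restrictScalars κ * s = s * g.restrictScalars κ
        rw [hg']; group
    obtain ⟨P, _, _, hP1, hP2⟩ := exists_max_subfield hd
    let : Algebra κ P := ((algebraMap Z P).comp (algebraMap κ Z)).toAlgebra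
    have : IsScalarTower κ Z P := IsScalarTower.of_algebraMap_eq (fun _ => rfl)
    have hf1 : FiniteDimensional Z P := FiniteDimensional.of_finrank_pos (by rw [hP1]; exact pos_of_sq hd)
    have hf2 : FiniteDimensional κ P := FiniteDimensional.trans κ Z P
    refine ⟨P, inferInstance, inferInstance, hf2, ?_, ?_⟩
    · rw [← Module.finrank_mul_finrank κ Z P, hZ, hP1]
      subst hr
      obtain ⟨m, hm, rfl⟩ := (Nat.dvd_prime_pow Nat.prime_two).mp hdn
      have : m ≠ r := fun h => hdn' (by rw [h])
      rw [← pow_succ']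
      exact pow_dvd_pow _ (by omega)
    · have := (hP P).1.mpr hP2
      rwa [lmap_tower] at this

end SG
end

section
open TensorProduct

namespace SG

theorem two_ne_map {κ P : Type*} [Field κ] [Field P] (f : κ →+* P) (h2 : (2:κ) ≠ 0) : (2:P) ≠ 0 := by
  have := f.injective.ne h2
  rwa [map_ofNat, map_zero] at this

theorem exists_sqrt_char {κ ℓ : Type u} [Field κ] [Field ℓ] [Algebra κ ℓ] [FiniteDimensional κ ℓ] [IsGalois κ ℓ] (h2 : (2:κ) ≠ 0)
    {n r : ℕ} (hr : n = 2 ^ r) {χ : (ℓ ≃ₐ[κ] ℓ) → ZMod n} (hχ : ∀ σ τ, χ (σ * τ) = χ σ + χ τ)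
    (hχ2 : ∀ σ, 2 * χ σ = 0) {s : ℓ ≃ₐ[κ] ℓ} (hs : χ s ≠ 0) :
    ∃ (α : ℓ) (a : κ), α ^ 2 = algebraMap κ ℓ a ∧ ∀ σ : ℓ ≃ₐ[κ] ℓ, σ α = α ↔ χ σ = 0 := by
  have h1 : χ 1 = 0 := by
    have := hχ 1 1
    rw [mul_one] at this
    exact left_eq_add.mp this
  have hinv : ∀ σ, χ σ⁻¹ = - χ σ := by
    intro σ
    have := hχ σ⁻¹ σ
    rw [inv_mul_cancel, h1] at this
    exact eq_neg_of_add_eq_zero_left this.symm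
  have hz : ∃ z : ℓ, (∀ σ, χ σ = 0 → σ z = z) ∧ s z ≠ z := by
    by_contra hcon
    push Not at hcon
    have h3 : s ∈ (IntermediateField.fixedField (kerC χ hχ)).fixingSubgroup := by
      rw [IntermediateField.mem_fixingSubgroup_iff]
      intro x hx
      exact hcon x (fun σ hσ => hx ⟨σ, mem_kerC.mpr hσ⟩)
    rw [IntermediateField.fixingSubgroup_fixedField, mem_kerC] at h3
    exact hs h3
  obtain ⟨z, hz, hsz⟩ := hz
  have hfix : ∀ σ, χ σ = 0 → σ (z - s z) = z - s z := by
    intro σ hσ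
    have h3 := hz (s⁻¹ * σ * s) (by rw [hχ, hχ, hσ, hinv]; simp)
    have h4 : σ (s z) = s ((s⁻¹ * σ * s) z) := by
      change _ = (s * (s⁻¹ * σ * s)) z
      rw [mul_assoc, mul_inv_cancel_left]; rfl
    rw [map_sub, h4, h3, hz σ hσ]
  have hneg : ∀ σ, χ σ ≠ 0 → σ (z - s z) = -(z - s z) := by
    intro σ hσ
    have hσs : χ σ = χ s := zmod_two_tors hr (hχ2 σ) (hχ2 s) hσ hs
    have h3 := hz (s⁻¹ * σ) (by rw [hχ, hinv, hσs]; simp)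
    have h4 := hz (σ * s) (by rw [hχ, hσs, ← two_mul, hχ2])
    have h5 : σ z = s z := by
      have : σ z = s ((s⁻¹ * σ) z) := by
        change _ = (s * (s⁻¹ * σ)) z
        rw [mul_inv_cancel_left]
      rw [this, h3]
    rw [map_sub, h5]
    change s z - (σ * s) z = _
    rw [h4]; ring
  have hne : z - s z ≠ 0 := sub_ne_zero.mpr hsz.symm
  have hsq : ∀ σ : ℓ ≃ₐ[κ] ℓ, σ ((z - s z) ^ 2) = (z - s z) ^ 2 := by
    intro σ
    rw [map_pow]
    by_cases h : χ σ = 0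
    · rw [hfix σ h]
    · rw [hneg σ h]; ring
  obtain ⟨a, ha⟩ := (galAct_isGal κ ℓ).mem ((z - s z)^2) hsq
  refine ⟨z - s z, a, ha.symm, fun σ => ⟨fun h => ?_, hfix σ⟩⟩
  by_contra h3
  rw [hneg σ h3] at h
  have h5 : (2:ℓ) * (z - s z) = 0 := by linear_combination -h
  exact mul_ne_zero (two_ne_map (algebraMap κ ℓ) h2) hne h5

theorem exists_quad {P : Type u} [Field P] (h2 : (2:P) ≠ 0) (a : P) (ha : ¬ ∃ c : P, c ^ 2 = a) :
    ∃ (P' : Type u) (_ : Field P') (_ : Algebra P P'), FiniteDimensional P P' ∧ IsGalois P P' ∧ Module.finrank P P' = 2 ∧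
      (∃ β : P', β ^ 2 = algebraMap P P' a) ∧
      ∀ (E : Type u) [Field E] [Algebra P E] (y : E), y ^ 2 = algebraMap P E a → Nonempty (P' →ₐ[P] E) := by
  let p : Polynomial P := Polynomial.X ^ 2 - Polynomial.C a
  have hirr : Irreducible p := X_pow_sub_C_irreducible_of_prime Nat.prime_two (fun b hb => ha ⟨b, hb⟩)
  have : Fact (Irreducible p) := ⟨hirr⟩
  have hmon : p.Monic := Polynomial.monic_X_pow_sub_C a two_ne_zero
  have hdeg : p.natDegree = 2 := Polynomial.natDegree_X_pow_sub_C
  have hfin : FiniteDimensional P (AdjoinRoot p) := hmon.finite_adjoinRoot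
  have hroot : (AdjoinRoot.root p) ^ 2 = algebraMap P (AdjoinRoot p) a := by
    have := AdjoinRoot.eval₂_root p
    simp only [p, Polynomial.eval₂_sub, Polynomial.eval₂_pow, Polynomial.eval₂_X, Polynomial.eval₂_C] at this
    exact sub_eq_zero.mp this
  have hζ : (primitiveRoots 2 P).Nonempty := by
    refine ⟨-1, (mem_primitiveRoots two_pos).mpr ?_⟩
    obtain ⟨q, hq⟩ := CharP.exists P
    refine IsPrimitiveRoot.neg_one q ?_
    rintro rfl
    exact h2 (by exact_mod_cast CharP.cast_eq_zero P 2)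
  have hsp : Polynomial.IsSplittingField P (AdjoinRoot p) (Polynomial.X ^ 2 - Polynomial.C a) :=
    isSplittingField_AdjoinRoot_X_pow_sub_C hζ hirr
  refine ⟨AdjoinRoot p, inferInstance, inferInstance, hfin, isGalois_of_isSplittingField_X_pow_sub_C hζ hirr _,
    finrank_of_isSplittingField_X_pow_sub_C hζ hirr _, ⟨_, hroot⟩, ?_⟩
  intro E _ _ y hy
  refine ⟨AdjoinRoot.liftAlgHom p (Algebra.ofId P E) y ?_⟩
  simp only [p, Polynomial.eval₂_sub, Polynomial.eval₂_pow, Polynomial.eval₂_X, Polynomial.eval₂_C]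
  rw [hy]; exact sub_self _

theorem lsub_sq {P : Type*} [Field P] (h2 : (2:P) ≠ 0) {x : LaurentSeries P} (hx : x ≠ 0) (ho : Odd x.order) :
    ∃ (b : P) (hb : b ≠ 0) (β : LaurentSeries P), lsub b hb x = β ^ 2 := by
  obtain ⟨m, hm⟩ := ho
  set b0 := x.coeff x.order with hb0
  have hb : b0 ≠ 0 := fun h => hx (HahnSeries.coeff_order_eq_zero.mp h)
  have hy1 : Low 0 (HahnSeries.single (-x.order) b0⁻¹ * x) := by
    have := (low_single (A := P) (-x.order) b0⁻¹).mul (low_order x)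
    rwa [neg_add_cancel] at this
  have hy2 : (HahnSeries.single (-x.order) b0⁻¹ * x).coeff 0 = 1 := by
    have := (low_single (A := P) (-x.order) b0⁻¹).coeff_mul (low_order x)
    rw [neg_add_cancel] at this
    rw [this, HahnSeries.coeff_single_same, inv_mul_cancel₀ hb]
  obtain ⟨v, hv, -, -⟩ := exists_sqrt h2 hy1 hy2
  refine ⟨b0⁻¹, inv_ne_zero hb, HahnSeries.single x.order (b0 ^ (-m)) * lsub b0⁻¹ (inv_ne_zero hb) v, ?_⟩
  have hxe : x = HahnSeries.single x.order b0 * v ^ 2 := by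
    rw [hv, ← mul_assoc, HahnSeries.single_mul_single, add_neg_cancel, mul_inv_cancel₀ hb]
    exact (one_mul x).symm
  conv_lhs => rw [hxe]
  rw [map_mul, map_pow, lsub_single, mul_pow, sq (HahnSeries.single _ _), HahnSeries.single_mul_single, ← two_mul]
  congr 2
  rw [hm, ← zpow_add₀ hb, inv_zpow', ← zpow_add_one₀ hb]
  congr 1; ring

theorem Tw.cocycle_one {E G : Type*} [Field E] [Group G] {a : G →* (E →+* E)} {n : ℕ} {c : G → G → E} {ρ : G → Matrix (Fin n) (Fin n) E}
    (h : Tw a c ρ) (hn : 0 < n) (σ : G) : c 1 σ = c 1 1 ∧ c σ 1 = a σ (c 1 1) := by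
  have h1 := h.cocycle hn 1 1 σ
  have h2 := h.cocycle hn σ 1 1
  rw [act_one, one_mul, one_mul] at h1
  rw [mul_one, mul_one] at h2
  exact ⟨mul_right_cancel₀ (h.ne_zero hn _ _) h1, (mul_right_cancel₀ (h.ne_zero hn _ _) h2).symm⟩

theorem coh_of_two {E G : Type*} [Field E] [Group G] {a : G →* (E →+* E)} {n : ℕ} {c : G → G → E} {ρ : G → Matrix (Fin n) (Fin n) E}
    (h : Tw a c ρ) (hn : 0 < n) {s : G} (hs : s * s = 1) (hG : ∀ g, g = 1 ∨ g = s) (hs1 : s ≠ 1) {β : E} (hβ : a s β = β)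
    (hc : c s s * c 1 1 = β ^ 2) : Coh a c (fun _ _ => 1) := by
  classical
  have hc0 := h.ne_zero hn
  have hβ0 : β ≠ 0 := by
    rintro rfl
    exact mul_ne_zero (hc0 s s) (hc0 1 1) (by rw [hc]; simp)
  refine ⟨fun g => if g = 1 then (c 1 1)⁻¹ else β⁻¹, fun g => ?_, fun σ τ => ?_⟩
  · dsimp only
    split_ifs
    · exact inv_ne_zero (hc0 _ _)
    · exact inv_ne_zero hβ0
  · dsimp only
    rcases hG σ with rfl | rfl
    · rw [one_mul, (h.cocycle_one hn τ).1, act_one, if_pos rfl, one_mul, mul_right_comm, inv_mul_cancel₀ (hc0 1 1), one_mul]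
    · rcases hG τ with rfl | rfl
      · rw [mul_one, (h.cocycle_one hn σ).2, if_neg hs1, if_pos rfl, map_inv₀, inv_mul_cancel_right₀ ((map_ne_zero _).mpr (hc0 1 1)), one_mul]
      · rw [hs, if_pos rfl, if_neg hs1, map_inv₀, hβ, one_mul]
        field_simp [hc0 1 1]
        rw [← hc]; ring

end SG
end

section
open TensorProduct

namespace SG

section
variable {K D κ ℓ : Type u} [Field K] [Ring D] [Algebra K D] [IsSimpleRing D] [Algebra.IsCentral K D]
    [FiniteDimensional K D] [Field κ] [Field ℓ] [Algebra κ ℓ] [FiniteDimensional κ ℓ] [IsGalois κ ℓ]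
    {n : ℕ} {i : K →+* LaurentSeries κ} {c : (ℓ ≃ₐ[κ] ℓ) → (ℓ ≃ₐ[κ] ℓ) → LaurentSeries ℓ} {ρ : (ℓ ≃ₐ[κ] ℓ) → Matrix (Fin n) (Fin n) (LaurentSeries ℓ)}
    {Φ : D →+* Matrix (Fin n) (Fin n) (LaurentSeries ℓ)}

theorem desc_comp (h : Desc ((lmap (algebraMap κ ℓ)).comp i) (lact (galAct κ ℓ)) Φ ρ c) {P E : Type u} [Field P] [Field E] [Algebra κ P]
    [Algebra P E] (ι : ℓ →+* E) (r : (E ≃ₐ[P] E) →* (ℓ ≃ₐ[κ] ℓ)) (hι : ∀ x, ι (algebraMap κ ℓ x) = algebraMap P E (algebraMap κ P x))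
    (hr : ∀ (ν : E ≃ₐ[P] E) x, ν (ι x) = ι (r ν x)) :
    Desc ((lmap (algebraMap P E)).comp ((lmap (algebraMap κ P)).comp i)) (lact (galAct P E)) ((lmap ι).mapMatrix.comp Φ)
      (fun ν => (ρ (r ν)).map (lmap ι)) (fun ν μ => lmap ι (c (r ν) (r μ))) := by
  have h1 := h.map (lact (galAct P E)) (lmap ι) r (fun ν x => by
    rw [lact_apply, lact_apply]
    ext m
    exact hr ν _)
  have e1 : (lmap ι).comp ((lmap (algebraMap κ ℓ)).comp i) =
      (lmap (algebraMap P E)).comp ((lmap (algebraMap κ P)).comp i) := by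
    refine RingHom.ext (fun x => ?_)
    ext m
    exact hι _
  rw [e1] at h1
  exact h1

theorem square_of_splits (hn : Module.finrank K D = n ^ 2)
    (h : Desc ((lmap (algebraMap κ ℓ)).comp i) (lact (galAct κ ℓ)) Φ ρ c) {α : ℓ} {a : κ} (hα : α ^ 2 = algebraMap κ ℓ a)
    (hαχ : ∀ σ : ℓ ≃ₐ[κ] ℓ, σ α = α ↔ chi (ρ σ) = 0) (P : Type u) [Field P] [Algebra κ P] (hs : Splits ((lmap (algebraMap κ P)).comp i) n D) :
    ∃ c : P, c ^ 2 = algebraMap κ P a := by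
  obtain ⟨E, _, _, _, _, ι, r, hι, hr⟩ := compositum κ ℓ P
  have h1 := desc_comp h ι r hι hr
  have h2 := chi_zero_of_splits hn h1 (fun σ x => by
    rw [lact_apply]; ext m; exact (galAct_isGal P E).fixed σ _) hs
  obtain ⟨z, hz⟩ := (galAct_isGal P E).mem (ι α) (fun σ => by
    have h3 := h2 σ
    rw [chi_map] at h3
    change σ (ι α) = ι α
    rw [hr, (hαχ _).mpr h3])
  refine ⟨z, (algebraMap P E).injective ?_⟩
  rw [map_pow, hz, ← map_pow, hα, hι]

theorem ram_trick (h2 : (2:κ) ≠ 0) (hn : Module.finrank K D = n ^ 2)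
    (h : Desc ((lmap (algebraMap κ ℓ)).comp i) (lact (galAct κ ℓ)) Φ ρ c) {α : ℓ} {a : κ} (hα : α ^ 2 = algebraMap κ ℓ a)
    (hαχ : ∀ σ : ℓ ≃ₐ[κ] ℓ, σ α = α ↔ chi (ρ σ) = 0) (P : Type u) [Field P] [Algebra κ P] (ha : ¬ ∃ c : P, c ^ 2 = algebraMap κ P a)
    (hP : ∀ (P' : Type u) [Field P'] [Algebra κ P'] [Algebra P P'] [IsScalarTower κ P P'], FiniteDimensional P P' → Module.finrank P P' = 2 →
      (∃ c : P', c ^ 2 = algebraMap κ P' a) → Splits ((lmap (algebraMap κ P')).comp i) n D) :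
    ∃ (b : P) (hb : b ≠ 0), Splits ((lsub b hb).comp ((lmap (algebraMap κ P)).comp i)) n D := by
  have hn0 := pos_of_sq hn
  have h2P := two_ne_map (algebraMap κ P) h2
  obtain ⟨P', _, _, _, _, hfr, ⟨β, hβ⟩, hemb⟩ := exists_quad h2P _ ha
  let : Algebra κ P' := ((algebraMap P P').comp (algebraMap κ P)).toAlgebra
  have : IsScalarTower κ P P' := IsScalarTower.of_algebraMap_eq (fun _ => rfl)
  obtain ⟨Φ', hΦ'⟩ := hP P' inferInstance hfr ⟨β, hβ⟩
  rw [← lmap_tower (Z := P)] at hΦ'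
  obtain ⟨ρ', c', h'⟩ := exists_desc (a := lact (galAct P P')) hn hΦ' (fun σ y => by
    rw [lact_apply]; ext m; exact (galAct_isGal P P').fixed σ _)
  obtain ⟨E, _, _, _, _, ι, r, hι, hr⟩ := compositum κ ℓ P
  have h1 := desc_comp h ι r hι hr
  have hια : (ι α) ^ 2 = algebraMap P E (algebraMap κ P a) := by rw [← map_pow, hα, hι]
  obtain ⟨g⟩ := hemb E (ι α) hια
  let : Algebra P' E := g.toRingHom.toAlgebra
  have : IsScalarTower P P' E := IsScalarTower.of_algebraMap_eq (fun x => (g.commutes x).symm)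
  have h3 := h'.map (lact (galAct P E)) (lmap (algebraMap P' E)) (AlgEquiv.restrictNormalHom P') (fun ν x => by
    rw [lact_apply, lact_apply]
    ext m
    exact (AlgEquiv.restrictNormal_commutes ν P' _).symm)
  have e3 : (lmap (algebraMap P' E)).comp ((lmap (algebraMap P P')).comp ((lmap (algebraMap κ P)).comp i)) =
      (lmap (algebraMap P E)).comp ((lmap (algebraMap κ P)).comp i) := by
    rw [lmap_tower]
  rw [e3] at h3
  have hν : ∃ ν : E ≃ₐ[P] E, ν (ι α) ≠ ι α := by
    by_contra hcon
    push Not at hcon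
    obtain ⟨z, hz⟩ := (galAct_isGal P E).mem (ι α) hcon
    refine ha ⟨z, (algebraMap P E).injective ?_⟩
    rw [map_pow, hz, hια]
  obtain ⟨ν, hν⟩ := hν
  have hchi : chi (ρ' (AlgEquiv.restrictNormalHom P' ν)) ≠ 0 := by
    have h4 := chi_unique hn h1 h3 ν
    rw [chi_map, chi_map] at h4
    rw [← h4]
    intro h5
    apply hν
    rw [hr, (hαχ _).mpr h5]
  generalize AlgEquiv.restrictNormalHom P' ν = s at hchi
  have hs1 : s ≠ 1 := by
    rintro rfl
    apply hchi
    rw [h'.tw.one, chi_smul isUnit_one (h'.tw.ne_zero hn0 1 1), chi_one]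
  have hcard : Nat.card (P' ≃ₐ[P] P') = 2 := by rw [IsGalois.card_aut_eq_finrank, hfr]
  have hG : ∀ g : P' ≃ₐ[P] P', g = 1 ∨ g = s := by
    obtain ⟨x, y, hxy, huniv⟩ := Nat.card_eq_two_iff.mp hcard
    intro g
    have hg : ∀ z : P' ≃ₐ[P] P', z = x ∨ z = y := fun z => by
      have : z ∈ ({x, y} : Set _) := by rw [huniv]; trivial
      simpa using this
    rcases hg g with rfl | rfl <;> rcases hg 1 with h1 | h1 <;> rcases hg s with h2 | h2 <;> simp_all
  have hss : s * s = 1 := by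
    rcases hG (s * s) with h | h
    · exact h
    · exact absurd (mul_eq_left.mp h) hs1
  let : Algebra (LaurentSeries P) (LaurentSeries P') := (lmap (algebraMap P P')).toAlgebra
  have hg := lact_isGal (galAct_isGal P P') (rfl : algebraMap (LaurentSeries P) (LaurentSeries P') = lmap (algebraMap P P'))
  have hb1 : ρ' s * (ρ' s).map (lact (galAct P P') s) = (c' s s * c' 1 1) • 1 := by
    rw [h'.tw.mul, hss, h'.tw.one, smul_smul]
  have hb0 : c' s s * c' 1 1 ≠ 0 := mul_ne_zero (h'.tw.ne_zero hn0 _ _) (h'.tw.ne_zero hn0 _ _)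
  have hbf : ∀ σ, lact (galAct P P') σ (c' s s * c' 1 1) = c' s s * c' 1 1 := by
    intro σ
    rcases hG σ with rfl | rfl
    · rw [act_one]
    · have h4 := h'.tw.cocycle hn0 σ σ σ
      rw [hss, (h'.tw.cocycle_one hn0 σ).1, (h'.tw.cocycle_one hn0 σ).2] at h4
      rw [map_mul, h4]
  obtain ⟨b, hb⟩ := hg.mem _ hbf
  have hb' : lmap (algebraMap P P') b = c' s s * c' 1 1 := hb
  have hbne : b ≠ 0 := by
    rintro rfl
    rw [map_zero] at hb'
    exact hb0 hb'.symm
  have hodd : Odd b.order := by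
    rw [← Int.not_even_iff_odd]
    rintro ⟨m, hm⟩
    have h5 := congrArg (fun M => (Matrix.det M).order) hb1
    have h6 : (ρ' s).map (lact (galAct P P') s) = (lact (galAct P P') s).mapMatrix (ρ' s) := rfl
    have hd0 := det_ne_zero_of_isUnit (h'.tw.unit s)
    rw [Matrix.det_mul, h6, ← RingHom.map_det, order_mul' hd0 ((map_ne_zero _).mpr hd0), lact_apply, lmap_order, ← hb', Matrix.det_smul,
      Matrix.det_one, mul_one, Fintype.card_fin, order_pow' ((map_ne_zero _).mpr hbne), lmap_order, hm] at h5
    have h7 : (ρ' s).det.order = n * m := by linarith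
    apply hchi
    rw [chi, h7]; simp
  obtain ⟨b0, hb00, γ, hγ⟩ := lsub_sq h2P hbne hodd
  refine ⟨b0, hb00, ?_⟩
  have hb0' : algebraMap P P' b0 ≠ 0 := (map_ne_zero _).mpr hb00
  have h8 := h'.map (lact (galAct P P')) (lsub (algebraMap P P' b0) hb0') (MonoidHom.id _) (fun ν x => by
    rw [lact_apply, lact_apply]
    have h9 : (galAct P P' ν) (algebraMap P P' b0) = algebraMap P P' b0 := (galAct_isGal P P').fixed ν _
    have h4 := lsub_lmap (galAct P P' ν) (algebraMap P P' b0) hb0' (by rw [h9]; exact hb0') x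
    rw [← h4]
    congr 2)
  have e8 : (lsub (algebraMap P P' b0) hb0').comp ((lmap (algebraMap P P')).comp ((lmap (algebraMap κ P)).comp i)) =
      (algebraMap (LaurentSeries P) (LaurentSeries P')).comp ((lsub b0 hb00).comp ((lmap (algebraMap κ P)).comp i)) :=
    RingHom.ext (fun x => lsub_lmap _ b0 hb00 hb0' _)
  rw [e8] at h8
  refine splits_of_coh hg h8 (coh_of_two h8.tw hn0 hss hG hs1 (β := lmap (algebraMap P P') γ) (hg.fixed _ _) ?_)
  rw [← map_pow, ← hγ, ← lsub_lmap _ b0 hb00 hb0', hb', map_mul]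
  rfl

end
end SG
end

section
open TensorProduct

namespace SG

theorem char_eq {H : Type*} [Group H] {n r : ℕ} (hr : n = 2 ^ r) {χ χ' : H → ZMod n} (hχ : ∀ σ τ, χ (σ * τ) = χ σ + χ τ)
    (hχ' : ∀ σ τ, χ' (σ * τ) = χ' σ + χ' τ) (h2 : ∀ σ, 2 * χ σ = 0) (hA : ∀ σ, χ' σ = 0 → χ σ = 0)
    (hB : ∀ s, 2 * χ' s = 0 → χ' s ≠ 0 → ∃ h, 2 * χ' h = 0 ∧ χ h ≠ 0) (σ : H) : χ' σ = χ σ := by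
  have hpow : ∀ (ψ : H → ZMod n), (∀ σ τ, ψ (σ * τ) = ψ σ + ψ τ) → ∀ g j, ψ (g ^ (2 ^ j)) = 2 ^ j * ψ g := by
    intro ψ hψ g j
    induction j with
    | zero => simp
    | succ j ih => rw [pow_succ, pow_mul, pow_two, hψ, ih]; ring
  have hdesc : ∀ g, χ' g ≠ 0 → ∃ j, χ' (g ^ (2^j)) ≠ 0 ∧ 2 * χ' (g ^ (2^j)) = 0 := by
    intro g hg
    have hex : ∃ j, (2:ZMod n) ^ j * χ' g = 0 := ⟨r, by
      have : ((2 ^ r : ℕ) : ZMod n) = 0 := by rw [← hr]; simp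
      push_cast at this
      rw [this, zero_mul]⟩
    classical
    have h1 := Nat.find_spec hex
    have h0 : Nat.find hex ≠ 0 := by
      intro h
      rw [h, pow_zero, one_mul] at h1
      exact hg h1
    obtain ⟨j, hj⟩ := Nat.exists_eq_succ_of_ne_zero h0
    refine ⟨j, ?_, ?_⟩
    · rw [hpow χ' hχ']
      exact Nat.find_min hex (by omega)
    · rw [hpow χ' hχ', ← mul_assoc, ← pow_succ']
      rw [hj] at h1
      exact h1
  by_cases h0 : ∀ g, χ' g = 0
  · rw [h0, hA _ (h0 σ)]
  push Not at h0
  obtain ⟨g0, hg0⟩ := h0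
  obtain ⟨j0, hj0, hj0'⟩ := hdesc g0 hg0
  obtain ⟨h, hh2, hh⟩ := hB _ hj0' hj0
  have hh' : χ' h ≠ 0 := fun h1 => hh (hA h h1)
  have key : ∀ s, 2 * χ' s = 0 → χ' s ≠ 0 → χ s = χ h := by
    intro s hs hs0
    have h1 := hA (s * h) (by rw [hχ', zmod_two_tors hr hs hh2 hs0 hh', ← two_mul, hh2])
    rw [hχ] at h1
    rw [eq_neg_of_add_eq_zero_left h1]
    have h3 := h2 h
    rw [two_mul] at h3
    exact (eq_neg_of_add_eq_zero_left h3).symm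
  have h2' : ∀ g, 2 * χ' g = 0 := by
    intro g
    by_contra hg
    have hg0 : χ' g ≠ 0 := fun h => hg (by rw [h, mul_zero])
    obtain ⟨j, hj, hj'⟩ := hdesc g hg0
    have h1 := key _ hj' hj
    rw [hpow χ hχ] at h1
    cases j with
    | zero =>
      rw [pow_zero, pow_one] at hj'
      exact hg hj'
    | succ j => rw [pow_succ, mul_assoc, h2, mul_zero] at h1; exact hh h1.symm
  by_cases hσ : χ' σ = 0
  · rw [hσ, hA _ hσ]
  · have h1 := key σ (h2' σ) hσ
    exact zmod_two_tors hr (h2' σ) (h2 σ) hσ (by rw [h1]; exact hh)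

/-- equality of splitting behaviour over local extensions of small degree -/
def THyp {K κ : Type u} [Field K] [Field κ] (i : K →+* LaurentSeries κ) (w n : ℕ) (D D' : Type u) [Ring D] [Algebra K D] [Ring D'] [Algebra K D'] : Prop :=
  (∀ (P : Type u) [Field P] [Algebra κ P], FiniteDimensional κ P → Module.finrank κ P * w ∣ n →
    (Splits ((lmap (algebraMap κ P)).comp i) n D ↔ Splits ((lmap (algebraMap κ P)).comp i) n D')) ∧
  (∀ (P : Type u) [Field P] [Algebra κ P] (b : P) (hb : b ≠ 0), FiniteDimensional κ P → 2 * (Module.finrank κ P * w) ∣ n →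
    (Splits ((lsub b hb).comp ((lmap (algebraMap κ P)).comp i)) n D ↔ Splits ((lsub b hb).comp ((lmap (algebraMap κ P)).comp i)) n D'))

theorem THyp.symm {K κ : Type u} [Field K] [Field κ] {i : K →+* LaurentSeries κ} {w n : ℕ} {D D' : Type u} [Ring D] [Algebra K D] [Ring D'] [Algebra K D']
    (h : THyp i w n D D') : THyp i w n D' D :=
  ⟨fun P _ _ hP hd => (h.1 P hP hd).symm, fun P _ _ b hb hP hd => (h.2 P b hb hP hd).symm⟩

theorem THyp.pull {K κ : Type u} [Field K] [Field κ] {i : K →+* LaurentSeries κ} {n : ℕ} {D D' : Type u} [Ring D] [Algebra K D] [Ring D'] [Algebra K D']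
    (h : THyp i 1 n D D') (Z : Type u) [Field Z] [Algebra κ Z] [FiniteDimensional κ Z] :
    THyp ((lmap (algebraMap κ Z)).comp i) (Module.finrank κ Z) n D D' := by
  constructor
  · intro P _ _ hP hd
    let : Algebra κ P := ((algebraMap Z P).comp (algebraMap κ Z)).toAlgebra
    have : IsScalarTower κ Z P := IsScalarTower.of_algebraMap_eq (fun _ => rfl)
    rw [lmap_tower]
    refine h.1 P (FiniteDimensional.trans κ Z P) ?_
    rwa [mul_one, ← Module.finrank_mul_finrank κ Z P, mul_comm]
  · intro P _ _ b hb hP hd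
    let : Algebra κ P := ((algebraMap Z P).comp (algebraMap κ Z)).toAlgebra
    have : IsScalarTower κ Z P := IsScalarTower.of_algebraMap_eq (fun _ => rfl)
    rw [lmap_tower]
    refine h.2 P b hb (FiniteDimensional.trans κ Z P) ?_
    rwa [mul_one, ← Module.finrank_mul_finrank κ Z P, mul_comm (Module.finrank κ Z)]

section
variable {K D D' κ ℓ : Type u} [Field K] [Ring D] [Algebra K D] [IsSimpleRing D] [Algebra.IsCentral K D]
    [FiniteDimensional K D] [Ring D'] [Algebra K D'] [IsSimpleRing D'] [Algebra.IsCentral K D']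
    [FiniteDimensional K D'] [Field κ] [Field ℓ] [Algebra κ ℓ] [FiniteDimensional κ ℓ] [IsGalois κ ℓ]
    {n r : ℕ} {i : K →+* LaurentSeries κ} {c c' : (ℓ ≃ₐ[κ] ℓ) → (ℓ ≃ₐ[κ] ℓ) → LaurentSeries ℓ} {ρ ρ' : (ℓ ≃ₐ[κ] ℓ) → Matrix (Fin n) (Fin n) (LaurentSeries ℓ)}
    {Φ : D →+* Matrix (Fin n) (Fin n) (LaurentSeries ℓ)} {Φ' : D' →+* Matrix (Fin n) (Fin n) (LaurentSeries ℓ)}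

theorem ram_contra (h2 : (2:κ) ≠ 0) (hr : n = 2 ^ r) (hn : Module.finrank K D = n ^ 2) (hn' : Module.finrank K D' = n ^ 2)
    (h : Desc ((lmap (algebraMap κ ℓ)).comp i) (lact (galAct κ ℓ)) Φ ρ c)
    (h' : Desc ((lmap (algebraMap κ ℓ)).comp i) (lact (galAct κ ℓ)) Φ' ρ' c') (hχ2 : ∀ σ, 2 * chi (ρ σ) = 0) {s} (hs : chi (ρ s) ≠ 0)
    (hχ' : ∀ σ, chi (ρ' σ) = 0) {w : ℕ} (T : THyp i w n D D') (Q : Type u) [Field Q] [Algebra κ Q] [FiniteDimensional κ Q]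
    (hQ : Module.finrank κ Q * w ∣ n) (hQs : Splits ((lmap (algebraMap κ Q)).comp i) n D) : False := by
  have hn0 := pos_of_sq hn
  obtain ⟨α, a, hα, hαχ⟩ := exists_sqrt_char h2 hr (χ := fun σ => chi (ρ σ)) (fun σ τ => chi_tw h.tw hn0 σ τ) hχ2 hs
  have ha : ¬ ∃ c : κ, c ^ 2 = a := by
    rintro ⟨c, rfl⟩
    apply hs
    rw [← hαχ s]
    rw [map_pow, sq_eq_sq_iff_eq_or_eq_neg] at hα
    rcases hα with rfl | rfl
    · exact s.commutes c
    · rw [map_neg, s.commutes c]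
  obtain ⟨f, c0, d, W, Δ, _, _, Ψ, hf, hc0, hfc, hfd, hcen, hd, hW, -, hdn, hP⟩ := lcDelta h2 hr hn' h' hχ'
  have hQΔ := (hP Q).1.mp ((T.1 Q inferInstance hQ).mp hQs)
  have haQ := square_of_splits hn h hα hαχ Q hQs
  have hpow : ∃ t, Module.finrank κ Q = 2 ^ t := by
    obtain ⟨t, -, ht⟩ := (Nat.dvd_prime_pow Nat.prime_two).mp (hr ▸ (Dvd.intro _ rfl).trans hQ)
    exact ⟨t, ht⟩
  obtain ⟨t, ht⟩ := hpow
  obtain ⟨P, _, _, _, haP, hdP, hP'⟩ := quad_refine h2 hd a ha hQΔ ht haQ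
  have hPw : 2 * (Module.finrank κ P * w) ∣ n := by
    rw [← mul_assoc]
    exact (Nat.mul_dvd_mul_right hdP w).trans hQ
  have hPw1 : Module.finrank κ P * w ∣ n := (Dvd.intro_left _ rfl).trans hPw
  obtain ⟨b, hb, hbs⟩ := ram_trick h2 hn h hα hαχ P haP (by
    intro P' _ _ _ _ hfin hfr hc
    refine (T.1 P' (FiniteDimensional.trans κ P P') ?_).mpr ((hP P').1.mpr (hP' P' hc))
    rw [← Module.finrank_mul_finrank κ P P', hfr, mul_comm _ 2, mul_assoc]
    exact hPw)
  have h5 := ((hP P).2 b hb).mp ((T.2 P b hb inferInstance hPw).mp hbs)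
  exact haP (square_of_splits hn h hα hαχ P ((T.1 P inferInstance hPw1).mpr ((hP P).1.mpr h5)))

theorem embed_fixed (hn' : Module.finrank K D' = n ^ 2)
    (h' : Desc ((lmap (algebraMap κ ℓ)).comp i) (lact (galAct κ ℓ)) Φ' ρ' c') {Q Z : Type u} [Field Q] [Algebra κ Q]
    (hQs : Splits ((lmap (algebraMap κ Q)).comp i) n D') [Field Z] [Algebra κ Z] [Algebra Z ℓ] [IsScalarTower κ Z ℓ]
    (hZ : ∀ σ, chi (ρ' σ) = 0 → ∀ z, σ (algebraMap Z ℓ z) = algebraMap Z ℓ z) : Nonempty (Z →ₐ[κ] Q) := by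
  obtain ⟨E, _, _, _, _, ι, r, hι, hr⟩ := compositum κ ℓ Q
  have h1 := desc_comp h' ι r hι hr
  have h2 := chi_zero_of_splits hn' h1 (fun σ x => by
    rw [lact_apply]; ext m; exact (galAct_isGal Q E).fixed σ _) hQs
  have h3 : ∀ z : Z, ∃ y : Q, algebraMap Q E y = ι (algebraMap Z ℓ z) := by
    intro z
    refine (galAct_isGal Q E).mem _ (fun σ => ?_)
    have h3 := h2 σ
    rw [chi_map] at h3
    change σ (ι _) = ι _
    rw [hr, hZ _ h3]
  choose g hg using h3
  have hinj := (algebraMap Q E).injective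
  refine ⟨{ toFun := g, map_one' := hinj ?_, map_mul' := fun x y => hinj ?_, map_zero' := hinj ?_, map_add' := fun x y => hinj ?_, commutes' := fun x => hinj ?_ }⟩
  · rw [hg]; simp
  · rw [map_mul]; simp only [hg]; simp
  · rw [hg]; simp
  · rw [map_add]; simp only [hg]; simp
  · rw [hg, ← IsScalarTower.algebraMap_apply, hι]

theorem LC (h2 : (2:κ) ≠ 0) (hr : n = 2 ^ r) (hn : Module.finrank K D = n ^ 2) (hn' : Module.finrank K D' = n ^ 2)
    (h : Desc ((lmap (algebraMap κ ℓ)).comp i) (lact (galAct κ ℓ)) Φ ρ c)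
    (h' : Desc ((lmap (algebraMap κ ℓ)).comp i) (lact (galAct κ ℓ)) Φ' ρ' c') (hχ2 : ∀ σ, 2 * chi (ρ σ) = 0)
    (T : THyp i 1 n D D') (σ : ℓ ≃ₐ[κ] ℓ) : chi (ρ' σ) = chi (ρ σ) := by
  have hn0 := pos_of_sq hn
  obtain ⟨Q, _, _, _, hQd, hQs⟩ := exists_Q0 h2 hr hn h hχ2
  have hQs' := (T.1 Q inferInstance (by rwa [mul_one])).mp hQs
  have hm : ∀ σ τ : ℓ ≃ₐ[κ] ℓ, chi (ρ (σ * τ)) = chi (ρ σ) + chi (ρ τ) := fun σ τ => chi_tw h.tw hn0 σ τ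
  have hm' : ∀ σ τ : ℓ ≃ₐ[κ] ℓ, chi (ρ' (σ * τ)) = chi (ρ' σ) + chi (ρ' τ) := fun σ τ => chi_tw h'.tw hn0 σ τ
  have hm2 : ∀ σ τ : ℓ ≃ₐ[κ] ℓ, 2 * chi (ρ' (σ * τ)) = 2 * chi (ρ' σ) + 2 * chi (ρ' τ) := fun σ τ => by rw [hm', mul_add]
  refine char_eq hr (χ := fun σ => chi (ρ σ)) (χ' := fun σ => chi (ρ' σ)) hm hm' hχ2 ?_ ?_ σ
  · intro s hs'
    by_contra hs
    obtain ⟨Z, _, _, _, _, _, _, _, hZ, hZ1, hZ2, -⟩ := exists_fixed (kerC (fun σ => chi (ρ' σ)) hm')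
    obtain ⟨g⟩ := embed_fixed (Z := Z) hn' h' hQs' (fun σ hσ z => by
      obtain ⟨τ, rfl⟩ := hZ2 σ (by rw [mem_kerC]; exact hσ)
      exact τ.commutes z)
    let : Algebra Z Q := g.toRingHom.toAlgebra
    have : IsScalarTower κ Z Q := IsScalarTower.of_algebraMap_eq (fun x => (g.commutes x).symm)
    have : FiniteDimensional Z Q := FiniteDimensional.right κ Z Q
    obtain ⟨τ, hτ⟩ := hZ2 s (by rw [mem_kerC]; exact hs')
    refine ram_contra (two_ne_map (algebraMap κ Z) h2) hr hn hn' (desc_pull h Z) (desc_pull h' Z) (fun σ => hχ2 _) (s := τ) (by rw [hτ]; exact hs)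
      (fun σ => by have := hZ1 σ; rw [mem_kerC] at this; exact this) (T.pull Z) Q ?_ (by rwa [lmap_tower])
    rwa [mul_comm, Module.finrank_mul_finrank]
  · intro s hs2 hs
    by_contra hcon
    push Not at hcon
    obtain ⟨Z, _, _, _, _, _, _, _, hZ, hZ1, hZ2, -⟩ := exists_fixed (kerC (fun σ => 2 * chi (ρ' σ)) hm2)
    have hZ1' : ∀ σ : ℓ ≃ₐ[Z] ℓ, 2 * chi (ρ' (σ.restrictScalars κ)) = 0 := fun σ => by have := hZ1 σ; rw [mem_kerC] at this; exact this
    obtain ⟨g⟩ := embed_fixed (Z := Z) hn' h' hQs' (fun σ hσ z => by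
      obtain ⟨τ, rfl⟩ := hZ2 σ (by rw [mem_kerC, hσ, mul_zero])
      exact τ.commutes z)
    let : Algebra Z Q := g.toRingHom.toAlgebra
    have : IsScalarTower κ Z Q := IsScalarTower.of_algebraMap_eq (fun x => (g.commutes x).symm)
    have : FiniteDimensional Z Q := FiniteDimensional.right κ Z Q
    obtain ⟨τ, hτ⟩ := hZ2 s (by rw [mem_kerC]; exact hs2)
    refine ram_contra (two_ne_map (algebraMap κ Z) h2) hr hn' hn (desc_pull h' Z) (desc_pull h Z) hZ1' (s := τ) (by rw [hτ]; exact hs)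
      (fun σ => hcon _ (hZ1' σ)) (T.pull Z).symm Q ?_ (by rwa [lmap_tower])
    rwa [mul_comm, Module.finrank_mul_finrank]

end
end SG
end

section
open TensorProduct

namespace SG

theorem embed_etale {F A M : Type*} [Field F] [Ring A] [Algebra F A] [IsSimpleRing A] [FiniteDimensional F A] {n k : ℕ}
    (hA : Module.finrank F A = n ^ 2) [Field M] [Algebra F M] [FiniteDimensional F M] (Ψ : A →ₐ[F] Matrix (Fin n) (Fin n) M)
    (hk : Module.finrank F M * k = n) : ∃ L : (Fin k → M) →ₐ[F] A, Function.Injective L := by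
  have hn0 : 0 < n := pos_of_sq hA
  let : Module A (Fin n → M) := Module.compHom _ ((Matrix.toLinAlgEquiv' (R := M) (n := Fin n)).toRingEquiv.toRingHom.comp Ψ.toRingHom)
  have hsm : ∀ (a : A) (v : Fin n → M), a • v = (Ψ a).mulVec v := fun a v => rfl
  have : IsScalarTower F A (Fin n → M) := ⟨fun c a v => by rw [hsm, hsm, map_smul, Matrix.smul_mulVec]⟩
  have hfr : Module.finrank F A = Module.finrank F (Fin k → Fin n → M) := by
    rw [hA, Module.finrank_pi_fintype]
    simp only [Module.finrank_pi_fintype, Finset.sum_const, Finset.card_univ, Fintype.card_fin, smul_eq_mul]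
    nlinarith
  obtain ⟨φ⟩ := module_equiv_of_finrank F (R := A) A (Fin k → Fin n → M) hfr
  let B (b : Fin k → M) (w : Fin k → Fin n → M) : Fin k → Fin n → M := fun i => b i • w i
  have hB : ∀ b (a : A) w, B b (a • w) = a • B b w := by
    intro b a w
    funext i
    change b i • ((Ψ a).mulVec (w i)) = (Ψ a).mulVec (b i • w i)
    rw [Matrix.mulVec_smul]
  let L0 (b : Fin k → M) : A := φ.symm (B b (φ 1))
  have hL0 : ∀ b, φ (L0 b) = B b (φ 1) := fun b => φ.apply_symm_apply _
  have hφ : ∀ a a', φ (a * a') = a • φ a' := fun a a' => by rw [← smul_eq_mul, map_smul]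
  have h1 : L0 1 = 1 := by
    apply φ.injective
    rw [hL0]
    funext i; exact one_smul _ _
  have hmul : ∀ b b', L0 (b * b') = L0 b * L0 b' := by
    intro b b'
    apply φ.injective
    rw [hL0, hφ, hL0, ← hB]
    have : L0 b • φ 1 = B b (φ 1) := by rw [← hφ, mul_one, hL0]
    rw [this]
    funext i
    change (b i * b' i) • (φ 1 i) = b' i • b i • φ 1 i
    rw [smul_smul, mul_comm]
  have hadd : ∀ b b', L0 (b + b') = L0 b + L0 b' := by
    intro b b'
    apply φ.injective
    rw [map_add, hL0, hL0, hL0]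
    funext i; exact add_smul _ _ _
  have hzero : L0 0 = 0 := by
    apply φ.injective
    rw [map_zero, hL0]
    funext i; exact zero_smul _ _
  refine ⟨{ toFun := L0, map_one' := h1, map_mul' := hmul, map_zero' := hzero, map_add' := hadd, commutes' := fun c => ?_ }, ?_⟩
  · apply φ.injective
    have h3 : φ (algebraMap F A c) = algebraMap F A c • φ 1 := by rw [← hφ, mul_one]
    rw [hL0, h3]
    funext i
    change algebraMap F M c • (φ 1 i) = (Ψ (algebraMap F A c)).mulVec (φ 1 i)
    rw [AlgHom.commutes, Matrix.algebraMap_eq_diagonal]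
    funext x
    rw [Matrix.mulVec_diagonal]
    rfl
  · intro b b' hbb
    have hb1 : B b (φ 1) = B b' (φ 1) := by rw [← hL0, ← hL0]; exact congrArg φ hbb
    have hb2 : ∀ w, B b w = B b' w := by
      intro w
      obtain ⟨a, rfl⟩ := φ.surjective w
      have h3 : φ a = a • φ 1 := by rw [← hφ, mul_one]
      rw [h3, hB, hB, hb1]
    funext i
    have h4 := congrFun (congrFun (hb2 (fun _ _ => 1)) i) ⟨0, hn0⟩
    change b i • (1:M) = b' i • (1:M) at h4
    simpa using h4

theorem exists_shifts {F : Type*} [Field F] [Infinite F] (B : Finset F) (k : ℕ) : ∃ c : Fin k → F, ∀ i j, i ≠ j → c i - c j ∉ B := by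
  classical
  induction k with
  | zero => exact ⟨fun i => i.elim0, fun i => i.elim0⟩
  | succ k ih =>
    obtain ⟨c, hc⟩ := ih
    obtain ⟨x, hx⟩ := Infinite.exists_notMem_finset ((Finset.univ.image c ×ˢ B).image (fun p => p.1 + p.2) ∪ (Finset.univ.image c ×ˢ B).image (fun p => p.1 - p.2))
    rw [Finset.mem_union, not_or] at hx
    refine ⟨Fin.cons x c, fun i j => ?_⟩
    refine Fin.cases ?_ (fun i => ?_) i <;> refine Fin.cases ?_ (fun j => ?_) j
    · intro h; exact absurd rfl h
    · intro _ hB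
      simp only [Fin.cons_zero, Fin.cons_succ] at hB
      exact hx.1 (Finset.mem_image.mpr ⟨(c j, x - c j), Finset.mem_product.mpr ⟨Finset.mem_image_of_mem _ (Finset.mem_univ _), hB⟩, by simp⟩)
    · intro _ hB
      simp only [Fin.cons_zero, Fin.cons_succ] at hB
      exact hx.2 (Finset.mem_image.mpr ⟨(c i, c i - x), Finset.mem_product.mpr ⟨Finset.mem_image_of_mem _ (Finset.mem_univ _), hB⟩, by simp⟩)
    · intro h
      simp only [Fin.cons_succ]
      exact hc i j (fun h' => h (by rw [h']))

open Polynomial in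
theorem exists_prim {F M : Type*} [Field F] [Infinite F] [Field M] [Algebra F M] [FiniteDimensional F M] [Algebra.IsSeparable F M] (k : ℕ) (hk : 0 < k) :
    ∃ (b : Fin k → M) (G : F[X]), G.Monic ∧ G.natDegree = Module.finrank F M * k ∧ G.Separable ∧ (∀ p : F[X], aeval b p = 0 ↔ G ∣ p) := by
  classical
  obtain ⟨r, hr⟩ := Field.exists_primitive_element F M
  let g := minpoly F r
  have hri : IsIntegral F r := Algebra.IsIntegral.isIntegral r
  have hg0 : g.map (algebraMap F M) ≠ 0 := (Polynomial.map_ne_zero_iff (algebraMap F M).injective).mpr (minpoly.ne_zero hri)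
  let B : Finset F := (((g.map (algebraMap F M)).roots.toFinset.image (fun x => x - r)).preimage (algebraMap F M) (algebraMap F M).injective.injOn)
  obtain ⟨c, hc⟩ := exists_shifts B k
  have hmem : ∀ x : F, aeval (r + algebraMap F M x) g = 0 → x ∈ B := by
    intro x hx
    simp only [B, Finset.mem_preimage, Finset.mem_image, Multiset.mem_toFinset, mem_roots hg0, IsRoot.def, eval_map_algebraMap]
    exact ⟨_, hx, by ring⟩
  let gi (i : Fin k) : F[X] := minpoly F (r + algebraMap F M (c i))
  have hgi : ∀ i, gi i = g.comp (X - C (c i)) := fun i => minpoly.add_algebraMap r (c i)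
  have hirr : ∀ i, Irreducible (gi i) := fun i => minpoly.irreducible (Algebra.IsIntegral.isIntegral _)
  have hmon : ∀ i, (gi i).Monic := fun i => minpoly.monic (Algebra.IsIntegral.isIntegral _)
  have hcop : ∀ i j, i ≠ j → IsCoprime (gi i) (gi j) := by
    intro i j hij
    rw [(hirr i).coprime_iff_not_dvd]
    intro h
    replace h := (minpoly.dvd_iff (A := F) (x := r + algebraMap F M (c i))).mp h
    apply hc i j hij
    apply hmem
    rw [hgi, aeval_comp] at h
    simp only [map_sub, aeval_X, aeval_C] at h
    rw [← h, map_sub]; congr 1; ring_nf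
  refine ⟨fun i => r + algebraMap F M (c i), ∏ i, gi i, monic_prod_of_monic _ _ (fun i _ => hmon i), ?_, ?_, ?_⟩
  · rw [natDegree_prod_of_monic _ _ (fun i _ => hmon i)]
    have : ∀ i, (gi i).natDegree = Module.finrank F M := by
      intro i
      rw [hgi, natDegree_comp, natDegree_X_sub_C, mul_one]
      rw [← (Field.primitive_element_iff_minpoly_natDegree_eq F r).mp hr]
    simp [this, mul_comm]
  · exact separable_prod (fun i j hij => hcop i j hij) (fun i => Algebra.IsSeparable.isSeparable F _)
  · intro p
    have h1 : aeval (fun i => r + algebraMap F M (c i)) p = 0 ↔ ∀ i, gi i ∣ p := by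
      rw [funext_iff]
      refine forall_congr' (fun i => ?_)
      refine Iff.trans ?_ (minpoly.dvd_iff (A := F) (x := r + algebraMap F M (c i))).symm
      have := Polynomial.aeval_algHom_apply (Pi.evalAlgHom F (fun _ : Fin k => M) i) (fun i => r + algebraMap F M (c i)) p
      change _ = (aeval (fun i => r + algebraMap F M (c i)) p) i at this
      rw [← this]; rfl
    rw [h1]
    constructor
    · intro h
      exact Finset.prod_dvd_of_coprime (fun i _ j _ hij => hcop i j hij) (fun i _ => h i)
    · intro h i
      exact (Finset.dvd_prod_of_mem _ (Finset.mem_univ i)).trans h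

end SG
end

section
open TensorProduct

namespace SG

open Polynomial in
theorem poly_zero_of_indep {M R : Type*} [Field M] [Ring R] [Algebra M R] {n : ℕ} {Y : R} (h : LinearIndependent M (fun j : Fin n => Y ^ (j : ℕ)))
    (p : M[X]) (hp : p.degree < n) (h0 : aeval Y p = 0) : p = 0 := by
  by_cases hp0 : p = 0
  · exact hp0
  rw [aeval_eq_sum_range' (n := n) ((natDegree_lt_iff_degree_lt hp0).mpr hp), Finset.sum_range] at h0
  have := Fintype.linearIndependent_iff.mp h (fun j => p.coeff j) h0
  ext j
  by_cases hj : j < n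
  · simpa using this ⟨j, hj⟩
  · rw [coeff_zero]; exact coeff_eq_zero_of_degree_lt (hp.trans_le (by exact_mod_cast (not_lt.mp hj)))

open Polynomial in
theorem exists_yhat {F A M : Type*} [Field F] [Infinite F] [Ring A] [Algebra F A] [IsSimpleRing A] [Algebra.IsCentral F A] [FiniteDimensional F A] {n k : ℕ}
    (hA : Module.finrank F A = n ^ 2) [Field M] [Algebra F M] [FiniteDimensional F M] [Algebra.IsSeparable F M] (Ψ : A →ₐ[F] Matrix (Fin n) (Fin n) M)
    (hk : Module.finrank F M * k = n) : ∃ (y : A) (r : M), LinearIndependent M (fun j : Fin n => (Ψ y) ^ (j : ℕ)) ∧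
      (Matrix.charpoly (Ψ y)).eval r = 0 ∧ (Matrix.charpoly (Ψ y)).derivative.eval r ≠ 0 := by
  have hn0 : 0 < n := pos_of_sq hA
  obtain ⟨L, hL⟩ := embed_etale hA Ψ hk
  have hk0 : 0 < k := Nat.pos_of_ne_zero (by rintro rfl; omega)
  obtain ⟨b, G, hGm, hGd, hGs, hG⟩ := exists_prim (F := F) (M := M) k hk0
  rw [hk] at hGd
  have hy : ∀ p : F[X], aeval (L b) p = 0 ↔ G ∣ p := by
    intro p
    rw [aeval_algHom_apply, ← hG, ← map_zero L, hL.eq_iff]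
  have hyi : LinearIndependent F (fun j : Fin n => (L b) ^ (j : ℕ)) := by
    rw [Fintype.linearIndependent_iff]
    intro g hg
    let p : F[X] := ∑ j : Fin n, monomial j (g j)
    have hp : aeval (L b) p = 0 := by
      rw [map_sum, ← hg]
      refine Finset.sum_congr rfl (fun j _ => ?_)
      rw [aeval_monomial, Algebra.smul_def]
    have hdeg : p.degree < G.degree := by
      rw [degree_eq_natDegree hGm.ne_zero, hGd]
      refine lt_of_le_of_lt (degree_sum_le _ _) ?_
      rw [Finset.sup_lt_iff (by exact_mod_cast WithBot.bot_lt_coe n)]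
      intro j _
      exact (degree_monomial_le _ _).trans_lt (by exact_mod_cast j.2)
    have hp0 : p = 0 := eq_zero_of_dvd_of_degree_lt ((hy p).mp hp) hdeg
    intro j
    have := congrArg (fun q => coeff q j) hp0
    simp only [p, finset_sum_coeff, coeff_monomial, coeff_zero] at this
    rw [Finset.sum_eq_single j] at this
    · simpa using this
    · intro b _ hb
      rw [if_neg]; exact fun h => hb (Fin.ext h)
    · intro h; exact absurd (Finset.mem_univ _) h
  have : Nonempty (Fin n) := ⟨⟨0, hn0⟩⟩
  have hYi := linInd_of_hom (K := F) (E := M) Ψ hyi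
  simp only [map_pow] at hYi
  have hch : Matrix.charpoly (Ψ (L b)) = G.map (algebraMap F M) := by
    rw [← sub_eq_zero]
    apply poly_zero_of_indep hYi
    · have h1 : (Matrix.charpoly (Ψ (L b))).degree = n := by rw [Matrix.charpoly_degree_eq_dim]; simp
      rw [← h1]
      apply degree_sub_lt
      · rw [h1, degree_map, degree_eq_natDegree hGm.ne_zero, hGd]
      · exact (Matrix.charpoly_monic _).ne_zero
      · rw [(Matrix.charpoly_monic _).leadingCoeff, (hGm.map _).leadingCoeff]
    · rw [map_sub, Matrix.aeval_self_charpoly, aeval_map_algebraMap, aeval_algHom_apply, (hy G).mpr dvd_rfl, map_zero, sub_zero]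
  refine ⟨L b, b ⟨0, hk0⟩, hYi, ?_, ?_⟩
  all_goals
    have h0 : aeval (b ⟨0, hk0⟩) G = 0 := by
      have h1 := (hG G).mpr dvd_rfl
      have := Polynomial.aeval_algHom_apply (Pi.evalAlgHom F (fun _ : Fin k => M) ⟨0, hk0⟩) b G
      rw [h1] at this
      exact this
    rw [hch]
  · rw [eval_map_algebraMap, h0]
  · rw [derivative_map, eval_map_algebraMap]
    exact hGs.aeval_derivative_ne_zero h0

theorem sep_of_two_pow {F M : Type*} [Field F] [Field M] [Algebra F M] [FiniteDimensional F M] (h2 : (2 : F) ≠ 0) {r : ℕ} (h : Module.finrank F M ∣ 2 ^ r) :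
    Algebra.IsSeparable F M := by
  have h2' : (2 : separableClosure F M) ≠ 0 := by
    have := (algebraMap F (separableClosure F M)).injective.ne h2
    rwa [map_zero, map_ofNat] at this
  have hodd : Odd (Module.finrank (separableClosure F M) M) := odd_of_pi (k := separableClosure F M) (ℓ := M) h2'
  have hd : Module.finrank (separableClosure F M) M ∣ 2 ^ r := (Dvd.intro_left _ (Module.finrank_mul_finrank F (separableClosure F M) M)).trans h
  have h1 : Module.finrank (separableClosure F M) M = 1 := by
    obtain ⟨s, _, hs⟩ := (Nat.dvd_prime_pow Nat.prime_two).mp hd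
    rcases s with _ | s
    · simpa using hs
    · rw [hs, pow_succ] at hodd; exact absurd hodd (by simp)
  rw [← separableClosure.eq_top_iff]
  exact IntermediateField.finrank_eq_one_iff_eq_top.mp h1

end SG
end

section
open TensorProduct

namespace SG

theorem hensel_root {P : Type*} [Field P] (n : ℕ) (hn : 0 < n) (b : ℕ → LaurentSeries P) (hb : ∀ j, Low 1 (b j)) :
    ∃ v : LaurentSeries P, v ≠ 0 ∧ v ^ n - v ^ (n - 1) + ∑ j ∈ Finset.Icc 2 n, b j * v ^ (n - j) = 0 := by
  have hp : ∀ j, ∃ p : PowerSeries P, HahnSeries.ofPowerSeries ℤ P p = b j ∧ PowerSeries.constantCoeff p = 0 := by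
    intro j
    obtain ⟨p, hp⟩ := ((hb j).mono (by norm_num : (0:ℤ) ≤ 1)).exists_powerSeries
    exact ⟨p, hp, by rw [← coeff_zero_powerSeries, hp]; exact hb j 0 (by norm_num)⟩
  choose p hp hp0 using hp
  let f : Polynomial (PowerSeries P) := Polynomial.X ^ n + (- Polynomial.X ^ (n - 1) + ∑ j ∈ Finset.Icc 2 n, Polynomial.C (p j) * Polynomial.X ^ (n - j))
  have hf : f.Monic := by
    apply Polynomial.monic_X_pow_add
    refine (Polynomial.degree_add_le _ _).trans_lt (max_lt ?_ ?_)
    · rw [Polynomial.degree_neg, Polynomial.degree_X_pow]; exact_mod_cast (by omega)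
    · refine (Polynomial.degree_sum_le _ _).trans_lt ?_
      rw [Finset.sup_lt_iff (by exact_mod_cast WithBot.bot_lt_coe n)]
      intro j hj
      rw [Finset.mem_Icc] at hj
      exact (Polynomial.degree_C_mul_X_pow_le _ _).trans_lt (by exact_mod_cast (by omega))
  have hI : Ideal.span {(PowerSeries.X : PowerSeries P)} = RingHom.ker (PowerSeries.constantCoeff (R := P)) := by
    ext q
    rw [Ideal.mem_span_singleton, PowerSeries.X_dvd_iff, RingHom.mem_ker]
  obtain ⟨y, hy, hy1⟩ := HenselianRing.is_henselian (I := Ideal.span {(PowerSeries.X : PowerSeries P)}) f hf 1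
    (by rw [hI, RingHom.mem_ker]; simp [f, hp0, Polynomial.eval_finset_sum])
    (by
      have : IsUnit ((Polynomial.derivative f).eval 1) := by
        rw [PowerSeries.isUnit_iff_constantCoeff]
        obtain ⟨m, rfl⟩ := Nat.exists_eq_add_of_le' hn
        simp only [f, Polynomial.derivative_add, Polynomial.derivative_neg, Polynomial.derivative_sum, Polynomial.derivative_C_mul, Polynomial.derivative_X_pow, Polynomial.eval_add, Polynomial.eval_neg, Polynomial.eval_finset_sum, Polynomial.eval_mul, Polynomial.eval_C, Polynomial.eval_pow, Polynomial.eval_X, one_pow, mul_one, map_add, map_neg, map_sum, map_mul, hp0, zero_mul, Finset.sum_const_zero]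
        simp
      exact this.map _)
  refine ⟨HahnSeries.ofPowerSeries ℤ P y, ?_, ?_⟩
  · intro h0
    have : y = 0 := by rwa [← map_zero (HahnSeries.ofPowerSeries ℤ P), (HahnSeries.ofPowerSeries_injective).eq_iff] at h0
    rw [this, hI, RingHom.mem_ker] at hy1
    simp at hy1
  · have := congrArg (HahnSeries.ofPowerSeries ℤ P) hy.eq_zero
    simp only [f, Polynomial.eval_add, Polynomial.eval_neg, Polynomial.eval_pow, Polynomial.eval_X, Polynomial.eval_finset_sum, Polynomial.eval_mul, Polynomial.eval_C, map_add, map_neg, map_sum, map_mul, map_pow, map_zero, hp] at this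
    rw [← this]; ring

theorem root_near {P : Type*} [Field P] (n : ℕ) (hn : 0 < n) (p : Polynomial (LaurentSeries P)) (hd : p.natDegree ≤ n) (h1 : p.coeff 1 ≠ 0)
    (hb : ∀ j, 2 ≤ j → j ≤ n → Low 1 (p.coeff j * p.coeff 0 ^ (j - 1) * (-1 / p.coeff 1) ^ j)) : ∃ z, p.eval z = 0 := by
  by_cases h0 : p.coeff 0 = 0
  · exact ⟨0, by rw [← Polynomial.coeff_zero_eq_eval_zero, h0]⟩
  obtain ⟨v, hv, hv0⟩ := hensel_root n hn (fun j => if 2 ≤ j ∧ j ≤ n then p.coeff j * p.coeff 0 ^ (j - 1) * (-1 / p.coeff 1) ^ j else 0) (fun j => by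
    split_ifs with hj
    · exact hb j hj.1 hj.2
    · exact Low.zero _)
  refine ⟨-(p.coeff 0 / p.coeff 1) / v, ?_⟩
  rw [Polynomial.eval_eq_sum_range' (n := n + 1) (by omega)]
  have hr : Finset.range (n + 1) = insert 0 (insert 1 (Finset.Icc 2 n)) := by
    ext x; simp only [Finset.mem_range, Finset.mem_insert, Finset.mem_Icc]; omega
  rw [hr, Finset.sum_insert (by simp), Finset.sum_insert (by simp)]
  have hmul : v ^ n * (p.coeff 0 * (-(p.coeff 0 / p.coeff 1) / v) ^ 0 + (p.coeff 1 * (-(p.coeff 0 / p.coeff 1) / v) ^ 1 +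
    ∑ j ∈ Finset.Icc 2 n, p.coeff j * (-(p.coeff 0 / p.coeff 1) / v) ^ j)) = p.coeff 0 * (v ^ n - v ^ (n - 1) + ∑ j ∈ Finset.Icc 2 n, (if 2 ≤ j ∧ j ≤ n then p.coeff j * p.coeff 0 ^ (j - 1) * (-1 / p.coeff 1) ^ j else 0) * v ^ (n - j)) := by
    rw [mul_add, mul_add, mul_add, Finset.mul_sum, Finset.mul_sum, mul_sub, sub_add_eq_add_sub, add_sub_assoc, ← add_assoc]
    have hs : ∀ j ∈ Finset.Icc 2 n, v ^ n * (p.coeff j * (-(p.coeff 0 / p.coeff 1) / v) ^ j) = p.coeff 0 * ((if 2 ≤ j ∧ j ≤ n then p.coeff j * p.coeff 0 ^ (j - 1) * (-1 / p.coeff 1) ^ j else 0) * v ^ (n - j)) := by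
      intro j hj
      rw [Finset.mem_Icc] at hj
      rw [if_pos hj]
      obtain ⟨m, rfl⟩ := Nat.exists_eq_add_of_le hj.2
      obtain ⟨i, rfl⟩ := Nat.exists_eq_add_of_le' hj.1
      rw [show i + 2 - 1 = i + 1 by omega, Nat.add_sub_cancel_left, pow_add v, div_pow, show -(p.coeff 0 / p.coeff 1) = p.coeff 0 * (-1 / p.coeff 1) by ring, mul_pow]
      field_simp
      ring
    rw [Finset.sum_congr rfl hs]
    obtain ⟨m, rfl⟩ := Nat.exists_eq_add_of_le' hn
    rw [Nat.add_sub_cancel, pow_succ v m]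
    field_simp
    ring
  rw [hv0, mul_zero] at hmul
  exact (mul_eq_zero.mp hmul).resolve_left (pow_ne_zero _ hv)

end SG
end

section
open TensorProduct

namespace SG

open Polynomial in
theorem field_of_near {K D M : Type u} [Field K] [DivisionRing D] [Algebra K D] [Algebra.IsCentral K D] [FiniteDimensional K D] {n : ℕ} (hn : 0 < n)
    [Field M] [Algebra K M] (Φ : D →ₐ[K] Matrix (Fin n) (Fin n) M) (y : D) (hy : LinearIndependent M (fun j : Fin n => (Φ y) ^ (j : ℕ)))
    (z : M) (hz : (Matrix.charpoly (Φ y)).eval z = 0) :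
    ∃ (F : Type u) (_ : Field F) (_ : Algebra K F), Module.finrank K F = n ∧ Nonempty (F →ₐ[K] D) ∧ Nonempty (F →ₐ[K] M) := by
  have hyK : LinearIndependent K (fun j : Fin n => y ^ (j : ℕ)) := by
    have h1 : LinearIndependent K (fun j : Fin n => (Φ y) ^ (j : ℕ)) := hy.restrict_scalars' K
    apply LinearIndependent.of_comp Φ.toLinearMap
    have h2 : (Φ.toLinearMap ∘ fun j : Fin n => y ^ (j : ℕ)) = fun j : Fin n => (Φ y) ^ (j : ℕ) := by
      funext j; simp
    rw [h2]; exact h1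
  have hne0 : Nonempty (Fin n) := ⟨⟨0, hn⟩⟩
  have hint : IsIntegral K y := Algebra.IsIntegral.isIntegral y
  have hne : minpoly K y ≠ 0 := minpoly.ne_zero hint
  have hcd : (Matrix.charpoly (Φ y)).degree = n := by
    have : Nonempty (Fin n) := ⟨⟨0, hn⟩⟩
    rw [Matrix.charpoly_degree_eq_dim]; simp
  have hd : (minpoly K y).natDegree = n := by
    apply le_antisymm
    · by_contra! hlt
      have h1 := linInd_of_hom (K := K) (E := M) Φ (linearIndependent_pow (K := K) y)
      simp only [map_pow] at h1
      have h2 := poly_zero_of_indep h1 (Matrix.charpoly (Φ y)) (by rw [hcd]; exact_mod_cast hlt) (Matrix.aeval_self_charpoly _)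
      exact (Matrix.charpoly_monic _).ne_zero h2
    · by_contra! hlt
      exact hne (poly_zero_of_indep hyK (minpoly K y) ((natDegree_lt_iff_degree_lt hne).mp hlt) (minpoly.aeval _ _))
  have hch : Matrix.charpoly (Φ y) = (minpoly K y).map (algebraMap K M) := by
    rw [← sub_eq_zero]
    apply poly_zero_of_indep hy
    · rw [← hcd]
      apply degree_sub_lt
      · rw [hcd, degree_map, degree_eq_natDegree hne, hd]
      · exact (Matrix.charpoly_monic _).ne_zero
      · rw [(Matrix.charpoly_monic _).leadingCoeff, ((minpoly.monic hint).map _).leadingCoeff]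
    · rw [map_sub, Matrix.aeval_self_charpoly, aeval_map_algebraMap, aeval_algHom_apply, minpoly.aeval, map_zero, sub_zero]
  have : Fact (Irreducible (minpoly K y)) := ⟨minpoly.irreducible hint⟩
  refine ⟨AdjoinRoot (minpoly K y), inferInstance, inferInstance, ?_, ?_, ?_⟩
  · rw [(AdjoinRoot.powerBasis hne).finrank, AdjoinRoot.powerBasis_dim, hd]
  · have h1 : ∀ p ∈ Ideal.span {minpoly K y}, aeval y p = 0 := by
      intro p hp
      obtain ⟨q, rfl⟩ := Ideal.mem_span_singleton.mp hp
      rw [map_mul, minpoly.aeval, zero_mul]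
    exact ⟨Ideal.Quotient.liftₐ _ (aeval y) h1⟩
  · rw [hch, eval_map_algebraMap] at hz
    exact ⟨AdjoinRoot.liftAlgHom _ (Algebra.ofId K M) z (by rw [← hz]; rfl)⟩

section topo
variable {P : Type*} [Field P]

open scoped Topology

theorem ball_mem_nhds {R Γ : Type*} [Field R] [LinearOrderedCommGroupWithZero Γ] [Valued R Γ] (x s : R) (hs : s ≠ 0) :
    {y | (Valued.v (y - x) : Γ) ≤ Valued.v s} ∈ 𝓝 x := by
  have h1 : (Valued.v (R := R) (Γ₀ := Γ)).restrict s ≠ 0 := by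
    rw [Ne, Valuation.restrict_eq_zero_iff]
    exact (Valuation.ne_zero_iff _).mpr hs
  have h2 := (Valued.isOpen_closedBall R h1).mem_nhds (x := 0) (by simp)
  have h3 : Filter.Tendsto (fun y => y - x) (𝓝 x) (𝓝 0) := by
    have : Continuous (fun y : R => y - x) := by fun_prop
    simpa using this.tendsto x
  filter_upwards [h3 h2] with y hy
  have h4 : Valued.v.restrict (y - x) ≤ Valued.v.restrict s := hy
  rw [Valuation.restrict_le_iff] at h4
  exact h4

theorem ball_of_nhds {R Γ : Type*} [Field R] [LinearOrderedCommGroupWithZero Γ] [Valued R Γ] {x : R} {U : Set R} (hU : U ∈ 𝓝 x) :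
    ∃ γ : Γ, γ ≠ 0 ∧ ∀ y, (Valued.v (y - x) : Γ) < γ → y ∈ U := by
  obtain ⟨γ, hU₁⟩ := Valued.mem_nhds.mp hU
  refine ⟨MonoidWithZeroHom.ValueGroup₀.embedding γ.1, by simp, fun y hy => hU₁ ?_⟩
  change Valued.v.restrict (y - x) < γ.1
  rw [Valued.v.restrict_lt_iff_lt_embedding]
  exact hy

theorem low_mem_nhds (N : ℤ) (x : LaurentSeries P) : {y | Low N (y - x)} ∈ 𝓝 x := by
  have hs : (HahnSeries.single N 1 : LaurentSeries P) ≠ 0 := by simp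
  refine Filter.mem_of_superset (ball_mem_nhds x _ hs) (fun y hy => ?_)
  have hs2 := (LaurentSeries.valuation_le_iff_coeff_lt_eq_zero P).mpr (low_single (A := P) N 1)
  exact (LaurentSeries.valuation_le_iff_coeff_lt_eq_zero P).mp (le_trans hy hs2)

theorem exists_low_of_nhds {x : LaurentSeries P} {U : Set (LaurentSeries P)} (hU : U ∈ 𝓝 x) : ∃ N, ∀ y, Low N (y - x) → y ∈ U := by
  obtain ⟨γ, h0, hU₁⟩ := ball_of_nhds hU
  refine ⟨-(WithZero.log γ - 1), fun y hy => hU₁ y ?_⟩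
  refine lt_of_le_of_lt ((LaurentSeries.valuation_le_iff_coeff_lt_eq_zero P).mpr hy) ?_
  rw [← WithZero.lt_log_iff_exp_lt h0]
  simp

theorem charpoly_coeff_cont {M : Type*} [Field M] [TopologicalSpace M] [IsTopologicalRing M] {n : ℕ} (j : ℕ) : Continuous (fun A : Matrix (Fin n) (Fin n) (M) => A.charpoly.coeff j) := by
  have h : ∀ A : Matrix (Fin n) (Fin n) (M), A.charpoly.coeff j = MvPolynomial.eval (fun p : Fin n × Fin n => A p.1 p.2) ((Matrix.charpoly.univ (M) (Fin n)).coeff j) := by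
    intro A
    have := Matrix.charpoly.univ_coeff_eval₂Hom (Fin n) (RingHom.id (M)) (fun p : Fin n × Fin n => A p.1 p.2) j
    exact this.symm
  simp_rw [h]
  refine (MvPolynomial.continuous_eval _).comp ?_
  fun_prop

theorem lin_cont {M : Type*} [Field M] [TopologicalSpace M] [IsTopologicalRing M] {n : ℕ} {ι : Type*} [Fintype ι] (e : ι → Matrix (Fin n) (Fin n) M) :
    Continuous (fun z : ι → M => ∑ i, z i • e i) := by fun_prop

open Polynomial in
theorem near_aux {M : Type*} [Field M] [TopologicalSpace M] [IsTopologicalDivisionRing M] [T1Space M] {n : ℕ} (hn : 0 < n) {ι : Type*} [Fintype ι] (U : Set M) (hU : U ∈ 𝓝 0)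
    (hroot : ∀ p : M[X], p.natDegree ≤ n → p.coeff 1 ≠ 0 → (∀ j, 2 ≤ j → j ≤ n → p.coeff j * p.coeff 0 ^ (j - 1) * (-1 / p.coeff 1) ^ j ∈ U) → ∃ z, p.eval z = 0)
    (Y : (ι → M) → Matrix (Fin n) (Fin n) M) (hYc : Continuous Y) (x : ι → M)
    (hY : LinearIndependent M (fun j : Fin n => (Y x) ^ (j : ℕ))) (r : M)
    (hr : (Matrix.charpoly (Y x)).eval r = 0) (hr' : (Matrix.charpoly (Y x)).derivative.eval r ≠ 0) :
    ∀ᶠ z in 𝓝 x, LinearIndependent M (fun j : Fin n => (Y z) ^ (j : ℕ)) ∧ ∃ s, (Matrix.charpoly (Y z)).eval s = 0 := by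
  classical
  refine Filter.Eventually.and ?_ ?_
  · obtain ⟨g, hg⟩ : ∃ g : Matrix (Fin n) (Fin n) M →ₗ[M] (Fin n → M), ∀ j : Fin n, g (Y x ^ (j : ℕ)) = Pi.single j 1 := by
      obtain ⟨g, hg⟩ := (Fintype.linearCombination M (fun j : Fin n => (Y x) ^ (j : ℕ))).exists_leftInverse_of_injective (by
        rw [LinearMap.ker_eq_bot]
        exact hY.fintypeLinearCombination_injective)
      refine ⟨g, fun j => ?_⟩
      have := LinearMap.congr_fun hg (Pi.single j 1)
      simpa using this
    have hgc : Continuous g := by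
      have h1 : ∀ A, g A = ∑ a, ∑ b, A a b • g (Matrix.single a b 1) := by
        intro A
        conv_lhs => rw [Matrix.matrix_eq_sum_single A]
        rw [map_sum]
        refine Finset.sum_congr rfl (fun a _ => ?_)
        rw [map_sum]
        refine Finset.sum_congr rfl (fun b _ => ?_)
        rw [← map_smul, Matrix.smul_single, smul_eq_mul, mul_one]
      rw [show (g : Matrix (Fin n) (Fin n) M → (Fin n → M)) = fun A => ∑ a, ∑ b, A a b • g (Matrix.single a b 1) from funext h1]
      fun_prop
    let G (z : ι → M) : Matrix (Fin n) (Fin n) M := Matrix.of (fun j => g (Y z ^ (j : ℕ)))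
    have hGc : Continuous (fun z => (G z).det) := by
      apply Continuous.matrix_det
      refine continuous_pi (fun j => ?_)
      exact hgc.comp (hYc.pow _)
    have hG0 : (G x).det ≠ 0 := by
      have : G x = 1 := by
        ext a b
        simp only [G, Matrix.of_apply, hg]
        rw [Matrix.one_apply, Pi.single_apply]; simp [eq_comm]
      rw [this]; simp
    filter_upwards [hGc.continuousAt.eventually_ne hG0] with z hz
    apply LinearIndependent.of_comp g
    exact Matrix.linearIndependent_rows_of_det_ne_zero hz
  · let c (j : ℕ) (z : ι → M) : M := (Matrix.charpoly (Y z - Matrix.scalar (Fin n) r)).coeff j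
    have hc : ∀ j, Continuous (c j) := fun j => (charpoly_coeff_cont j).comp (hYc.sub continuous_const)
    have hshift : ∀ z, Matrix.charpoly (Y z - Matrix.scalar (Fin n) r) = (Matrix.charpoly (Y z)).comp (X + C r) := by
      intro z
      exact Matrix.charpoly_sub_scalar _ _
    have hc0 : c 0 x = 0 := by
      simp only [c]
      rw [hshift, coeff_zero_eq_eval_zero, eval_comp]; simpa using hr
    have hc1 : c 1 x ≠ 0 := by
      simp only [c]
      have h1 : ∀ p : M[X], p.coeff 1 = p.derivative.eval 0 := by
        intro p; rw [← coeff_zero_eq_eval_zero, coeff_derivative]; simp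
      rw [hshift, h1, derivative_comp]
      simpa using hr'
    have e1 : ∀ᶠ z in 𝓝 x, c 1 z ≠ 0 := (hc 1).continuousAt.eventually_ne hc1
    have e2 : ∀ᶠ z in 𝓝 x, ∀ j ∈ Finset.Icc 2 n, c j z * c 0 z ^ (j - 1) * (-1 / c 1 z) ^ j ∈ U := by
      rw [Filter.eventually_all_finset]
      intro j hj
      rw [Finset.mem_Icc] at hj
      have h1 : ContinuousAt (fun z => c j z * c 0 z ^ (j - 1) * (-1 / c 1 z) ^ j) x := by
        refine ((hc j).continuousAt.mul ((hc 0).continuousAt.pow _)).mul (ContinuousAt.pow ?_ _)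
        exact continuousAt_const.div (hc 1).continuousAt hc1
      have h2 : c j x * c 0 x ^ (j - 1) * (-1 / c 1 x) ^ j = 0 := by
        rw [hc0, zero_pow (by omega)]; simp
      refine h1 ?_
      change U ∈ 𝓝 (c j x * c 0 x ^ (j - 1) * (-1 / c 1 x) ^ j)
      rw [h2]; exact hU
    filter_upwards [e1, e2] with z h1 h2
    obtain ⟨w, hw⟩ := hroot (Matrix.charpoly (Y z - Matrix.scalar (Fin n) r)) (by
      have : Nonempty (Fin n) := ⟨⟨0, hn⟩⟩
      rw [Matrix.charpoly_natDegree_eq_dim]; simp) h1 (fun j h3 h4 => h2 j (Finset.mem_Icc.mpr ⟨h3, h4⟩))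
    rw [hshift, eval_comp] at hw
    exact ⟨_, hw⟩

open Polynomial in
theorem near {n : ℕ} (hn : 0 < n) {ι : Type*} [Fintype ι] (e : ι → Matrix (Fin n) (Fin n) (LaurentSeries P)) (x : ι → LaurentSeries P)
    (hY : LinearIndependent (LaurentSeries P) (fun j : Fin n => (∑ i, x i • e i) ^ (j : ℕ))) (r : LaurentSeries P)
    (hr : (Matrix.charpoly (∑ i, x i • e i)).eval r = 0) (hr' : (Matrix.charpoly (∑ i, x i • e i)).derivative.eval r ≠ 0) :
    ∃ N, ∀ z : ι → LaurentSeries P, (∀ i, Low N (z i - x i)) → LinearIndependent (LaurentSeries P) (fun j : Fin n => (∑ i, z i • e i) ^ (j : ℕ)) ∧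
      ∃ s, (Matrix.charpoly (∑ i, z i • e i)).eval s = 0 := by
  classical
  have hYc : Continuous (fun z : ι → LaurentSeries P => ∑ i, z i • e i) := lin_cont e
  have h := near_aux hn {y | Low 1 y} (by simpa using low_mem_nhds (P := P) 1 0) (fun p h1 h2 h3 => root_near n hn p h1 h2 h3) _ hYc x hY r hr hr'
  rw [Filter.Eventually, nhds_pi, Filter.mem_pi] at h
  obtain ⟨I, _, t, ht, hs⟩ := h
  choose N hN using fun i => exists_low_of_nhds (ht i)
  refine ⟨∑ i, max (N i) 0, fun z hz => hs (fun i _ => hN i _ ((hz i).mono ?_))⟩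
  exact (le_max_left _ _).trans (Finset.single_le_sum (f := fun i => max (N i) 0) (fun i _ => le_max_right _ _) (Finset.mem_univ i))

end topo

end SG
end

section
open TensorProduct

namespace SG

/-- the field extension given by a homomorphism has finite degree m -/
def Deg {A B : Type*} [Field A] [Field B] (j : A →+* B) (m : ℕ) : Prop :=
  letI := j.toAlgebra
  FiniteDimensional A B ∧ Module.finrank A B = m

theorem Deg.comp {A B C : Type*} [Field A] [Field B] [Field C] {j : A →+* B} {j' : B →+* C} {m m' : ℕ} (h : Deg j m) (h' : Deg j' m') :
    Deg (j'.comp j) (m * m') := by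
  letI := j.toAlgebra
  letI := j'.toAlgebra
  letI := (j'.comp j).toAlgebra
  haveI : IsScalarTower A B C := IsScalarTower.of_algebraMap_eq (fun _ => rfl)
  obtain ⟨h1, h2⟩ := h
  obtain ⟨h1', h2'⟩ := h'
  refine ⟨FiniteDimensional.trans A B C, ?_⟩
  rw [← h2, ← h2', Module.finrank_mul_finrank]

theorem deg_of_bij {A B ι : Type*} [Field A] [Field B] [Fintype ι] (j : A →+* B) (w : ι → B)
    (hinj : ∀ f : ι → A, ∑ i, j (f i) * w i = 0 → f = 0) (hsurj : ∀ y : B, ∃ f : ι → A, ∑ i, j (f i) * w i = y) : Deg j (Fintype.card ι) := by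
  letI := j.toAlgebra
  have hsm : ∀ (a : A) (b : B), a • b = j a * b := fun a b => rfl
  let b : Module.Basis ι A B := Module.Basis.mk (v := w) (by
    rw [Fintype.linearIndependent_iff]
    intro g hg
    simp only [hsm] at hg
    exact congrFun (hinj g hg)) (by
    intro y _
    obtain ⟨f, rfl⟩ := hsurj y
    exact Submodule.sum_mem _ (fun i _ => Submodule.smul_mem _ (f i) (Submodule.subset_span ⟨i, rfl⟩)))
  exact ⟨Module.Finite.of_basis b, Module.finrank_eq_card_basis b⟩

theorem deg_lmap {κ P : Type*} [Field κ] [Field P] [Algebra κ P] [FiniteDimensional κ P] : Deg (lmap (algebraMap κ P)) (Module.finrank κ P) := by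
  let b := Module.finBasis κ P
  have hc : ∀ (f : Fin (Module.finrank κ P) → LaurentSeries κ) (w : ℤ), (∑ i, lmap (algebraMap κ P) (f i) * HahnSeries.C (b i)).coeff w = ∑ i, (f i).coeff w • b i := by
    intro f w
    rw [HahnSeries.coeff_sum]
    refine Finset.sum_congr rfl (fun i _ => ?_)
    rw [mul_comm, HahnSeries.C_mul_eq_smul, HahnSeries.coeff_smul, lmap_coeff, smul_eq_mul, Algebra.smul_def (R := κ), mul_comm]
  have := deg_of_bij (lmap (algebraMap κ P)) (fun i => HahnSeries.C (b i)) (fun f hf => by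
    funext i
    ext w
    have h1 := hc f w
    rw [hf] at h1
    exact Fintype.linearIndependent_iff.mp b.linearIndependent (fun i => (f i).coeff w) h1.symm i) (fun y => by
    refine ⟨fun i => ⟨fun w => b.repr (y.coeff w) i, y.isPWO_support.mono (fun w hw => ?_)⟩, ?_⟩
    · rw [HahnSeries.mem_support]; intro h; apply hw; simp [h]
    · ext w
      rw [hc]
      exact b.sum_repr (y.coeff w))
  simpa using this

theorem deg_lsub {P : Type*} [Field P] (b : P) (hb : b ≠ 0) : Deg (lsub b hb) 2 := by
  have hs0 : ∀ (x : LaurentSeries P) (w : ℤ), (lsub b hb x * HahnSeries.single 1 1).coeff (2 * w) = 0 := by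
    intro x w
    have := HahnSeries.coeff_mul_single_add (r := (1:P)) (x := lsub b hb x) (a := 2 * w - 1) (b := 1)
    rw [sub_add_cancel, mul_one] at this
    rw [this, lsub_coeff_odd]
    intro j; omega
  have hs1 : ∀ (x : LaurentSeries P) (w : ℤ), (lsub b hb x * HahnSeries.single 1 1).coeff (2 * w + 1) = b ^ w * x.coeff w := by
    intro x w
    have := HahnSeries.coeff_mul_single_add (r := (1:P)) (x := lsub b hb x) (a := 2 * w) (b := 1)
    rw [this, lsub_coeff, mul_one]
  have := deg_of_bij (ι := Fin 2) (lsub b hb) ![1, HahnSeries.single 1 1] (fun f hf => by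
    rw [Fin.sum_univ_two] at hf
    simp only [Matrix.cons_val_zero, Matrix.cons_val_one, mul_one] at hf
    funext i
    fin_cases i
    · ext w
      have h1 := congrArg (fun z => z.coeff (2 * w)) hf
      simp only [HahnSeries.coeff_add, hs0, lsub_coeff, add_zero, HahnSeries.coeff_zero] at h1
      simpa [hb, zpow_ne_zero] using h1
    · ext w
      have h1 := congrArg (fun z => z.coeff (2 * w + 1)) hf
      simp only [HahnSeries.coeff_add, hs1, HahnSeries.coeff_zero] at h1
      rw [lsub_coeff_odd _ _ _ _ (fun j => by omega), zero_add] at h1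
      simpa [hb, zpow_ne_zero] using h1) (fun y => by
    have hbd : ∀ s : ℤ, 0 ≤ s → s ≤ 1 → BddBelow (Function.support (fun w : ℤ => (b ^ w)⁻¹ * y.coeff (2 * w + s))) := by
      intro s hs0 hs1
      refine ⟨-|y.order| - 1, fun w hw => ?_⟩
      by_contra hlt
      apply hw
      have : y.coeff (2 * w + s) = 0 := by
        apply HahnSeries.coeff_eq_zero_of_lt_order
        have := neg_abs_le y.order
        have := abs_nonneg y.order
        omega
      simp [this]
    refine ⟨![HahnSeries.ofSuppBddBelow _ (hbd 0 le_rfl zero_le_one), HahnSeries.ofSuppBddBelow _ (hbd 1 zero_le_one le_rfl)], ?_⟩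
    rw [Fin.sum_univ_two]
    simp only [Matrix.cons_val_zero, Matrix.cons_val_one, mul_one]
    ext w
    rw [HahnSeries.coeff_add]
    rcases Int.even_or_odd' w with ⟨m, rfl | rfl⟩
    · rw [hs0, lsub_coeff, add_zero]
      simp [HahnSeries.ofSuppBddBelow, hb, zpow_ne_zero]
    · rw [hs1, lsub_coeff_odd _ _ _ _ (fun j => by omega), zero_add]
      simp [HahnSeries.ofSuppBddBelow, hb, zpow_ne_zero])
  simpa using this

theorem approx_generic {K Kh M D : Type u} [Field K] [Field Kh] [Field M] [Algebra K Kh] [Algebra Kh M] [Algebra K M] [IsScalarTower K Kh M] [Infinite Kh]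
    [FiniteDimensional Kh M] [Algebra.IsSeparable Kh M] [DivisionRing D] [Algebra K D] [Algebra.IsCentral K D] [FiniteDimensional K D] {n k : ℕ}
    (hn : Module.finrank K D = n ^ 2) (hk : Module.finrank Kh M * k = n) (Φ : D →ₐ[K] Matrix (Fin n) (Fin n) M) {ι : Type*} [Fintype ι] (e : Module.Basis ι K D) :
    ∃ (x : ι → Kh) (r : M), LinearIndependent M (fun j : Fin n => (∑ i, algebraMap Kh M (x i) • Φ (e i)) ^ (j : ℕ)) ∧
      (Matrix.charpoly (∑ i, algebraMap Kh M (x i) • Φ (e i))).eval r = 0 ∧ (Matrix.charpoly (∑ i, algebraMap Kh M (x i) • Φ (e i))).derivative.eval r ≠ 0 := by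
  haveI := tensor_simple K D Kh
  haveI := tensor_central K D Kh
  let Ψ : Kh ⊗[K] D →ₐ[Kh] Matrix (Fin n) (Fin n) M := Algebra.TensorProduct.lift (Algebra.ofId Kh _) Φ (fun a b => Algebra.commutes a (Φ b))
  obtain ⟨y, r, h1, h2, h3⟩ := exists_yhat (F := Kh) (A := Kh ⊗[K] D) (by rw [Module.finrank_baseChange, hn]) Ψ hk
  have hy : Ψ y = ∑ i, algebraMap Kh M ((Algebra.TensorProduct.basis Kh e).repr y i) • Φ (e i) := by
    conv_lhs => rw [← (Algebra.TensorProduct.basis Kh e).sum_repr y]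
    rw [map_sum]
    refine Finset.sum_congr rfl (fun i _ => ?_)
    rw [map_smul, Algebra.TensorProduct.basis_apply, algebraMap_smul]
    congr 1
    exact (Algebra.TensorProduct.lift_tmul _ _ _ _ _).trans (by rw [map_one, one_mul])
  rw [hy] at h1 h2 h3
  exact ⟨_, r, h1, h2, h3⟩

theorem approx_field {K κ P D : Type u} [Field K] [Field κ] [Field P] (i : K →+* LaurentSeries κ) (hd : ∀ (x : LaurentSeries κ) (N : ℤ), ∃ y, Low N (i y - x))
    (j : LaurentSeries κ →+* LaurentSeries P) (hj : ∀ N, ∃ N', ∀ x, Low N' x → Low N (j x)) (h2 : (2 : κ) ≠ 0) {m n r : ℕ} (hr : n = 2 ^ r) (hm : Deg j m) (hmn : m ∣ n)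
    [DivisionRing D] [Algebra K D] [Algebra.IsCentral K D] [FiniteDimensional K D] (hn : Module.finrank K D = n ^ 2) (hs : Splits (j.comp i) n D) :
    ∃ (F : Type u) (_ : Field F) (_ : Algebra K F), Module.finrank K F = n ∧ Splits (algebraMap K F) n D ∧ ∃ g : F →+* LaurentSeries P, g.comp (algebraMap K F) = j.comp i := by
  have hn0 := pos_of_sq hn
  letI := i.toAlgebra
  letI := j.toAlgebra
  letI := (j.comp i).toAlgebra
  haveI : IsScalarTower K (LaurentSeries κ) (LaurentSeries P) := IsScalarTower.of_algebraMap_eq (fun _ => rfl)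
  obtain ⟨hm1, hm2⟩ := hm
  obtain ⟨k, hk⟩ := hmn
  have h2' : (2 : LaurentSeries κ) ≠ 0 := by
    have := (HahnSeries.C_injective (Γ := ℤ) (R := κ)).ne h2
    rwa [map_zero, map_ofNat] at this
  haveI : Algebra.IsSeparable (LaurentSeries κ) (LaurentSeries P) := sep_of_two_pow h2' (r := r) (by rw [hm2, ← hr, hk]; exact dvd_mul_right _ _)
  haveI : Infinite (LaurentSeries κ) := Infinite.of_injective (fun z : ℤ => (HahnSeries.single z 1 : LaurentSeries κ)) (fun a b h => by
    by_contra hab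
    have := congrArg (fun s => HahnSeries.coeff s a) h
    simp [HahnSeries.coeff_single_of_ne hab] at this)
  have hs' : Splits (algebraMap K (LaurentSeries P)) n D := hs
  rw [splits_algebraMap_iff] at hs'
  obtain ⟨Φ⟩ := hs'
  let e := Module.finBasis K D
  obtain ⟨x, ρ, hx1, hx2, hx3⟩ := approx_generic (Kh := LaurentSeries κ) hn (k := k) (by rw [hm2, hk]) Φ e
  obtain ⟨N, hN⟩ := near hn0 (fun i => Φ (e i)) (fun i => j (x i)) hx1 ρ hx2 hx3
  obtain ⟨N', hN'⟩ := hj N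
  choose y hy using fun a => hd (x a) N'
  obtain ⟨hL, z, hz⟩ := hN (fun a => j (i (y a))) (fun a => by rw [← map_sub]; exact hN' _ (hy a))
  have hΦ : Φ (∑ a, y a • e a) = ∑ a, j (i (y a)) • Φ (e a) := by
    rw [map_sum]
    refine Finset.sum_congr rfl (fun a _ => ?_)
    rw [map_smul, ← algebraMap_smul (LaurentSeries P) (y a)]; rfl
  rw [← hΦ] at hL hz
  obtain ⟨F, iF, aF, hF, ⟨f⟩, ⟨g⟩⟩ := field_of_near hn0 Φ _ hL z hz
  refine ⟨F, iF, aF, hF, splits_of_embed hn hF f, g.toRingHom, ?_⟩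
  ext1 a
  exact g.commutes a

end SG
end

section
open TensorProduct

namespace SG

/-- the same degree n extensions split D and D' -/
def SameSplit (K : Type u) [Field K] (n : ℕ) (D D' : Type u) [Ring D] [Algebra K D] [Ring D'] [Algebra K D'] : Prop :=
  ∀ (F : Type u) [Field F] [Algebra K F], Module.finrank K F = n → (Splits (algebraMap K F) n D ↔ Splits (algebraMap K F) n D')

theorem SameSplit.symm {K : Type u} [Field K] {n : ℕ} {D D' : Type u} [Ring D] [Algebra K D] [Ring D'] [Algebra K D'] (h : SameSplit K n D D') : SameSplit K n D' D :=
  fun F _ _ hF => (h F hF).symm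

theorem low_lsub {P : Type*} [Field P] (b : P) (hb : b ≠ 0) (N : ℤ) (x : LaurentSeries P) (hx : Low (max N 0) x) : Low N (lsub b hb x) := by
  intro w hw
  by_cases h : ∃ j, 2 * j = w
  · obtain ⟨j, rfl⟩ := h
    rw [lsub_coeff, hx j (by rw [lt_max_iff]; omega), mul_zero]
  · push Not at h
    exact lsub_coeff_odd _ _ _ _ h

theorem tlemma_half {K κ P D D' : Type u} [Field K] [Field κ] [Field P] (i : K →+* LaurentSeries κ) (hd : ∀ (x : LaurentSeries κ) (N : ℤ), ∃ y, Low N (i y - x))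
    (j : LaurentSeries κ →+* LaurentSeries P) (hj : ∀ N, ∃ N', ∀ x, Low N' x → Low N (j x)) (h2 : (2 : κ) ≠ 0) {m n r : ℕ} (hr : n = 2 ^ r) (hm : Deg j m) (hmn : m ∣ n)
    [DivisionRing D] [Algebra K D] [Algebra.IsCentral K D] [FiniteDimensional K D] (hn : Module.finrank K D = n ^ 2)
    [Ring D'] [Algebra K D'] (h : SameSplit K n D D') (hs : Splits (j.comp i) n D) : Splits (j.comp i) n D' := by
  obtain ⟨F, iF, aF, hF, hsF, g, hg⟩ := approx_field i hd j hj h2 hr hm hmn hn hs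
  exact (((h F hF).mp hsF).comp g).of_eq hg

theorem tlemma {K κ D D' : Type u} [Field K] [Field κ] (i : K →+* LaurentSeries κ) (hd : ∀ (x : LaurentSeries κ) (N : ℤ), ∃ y, Low N (i y - x))
    (h2 : (2 : κ) ≠ 0) {n r : ℕ} (hr : n = 2 ^ r)
    [DivisionRing D] [Algebra K D] [Algebra.IsCentral K D] [FiniteDimensional K D] (hn : Module.finrank K D = n ^ 2)
    [DivisionRing D'] [Algebra K D'] [Algebra.IsCentral K D'] [FiniteDimensional K D'] (hn' : Module.finrank K D' = n ^ 2) (h : SameSplit K n D D') :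
    THyp i 1 n D D' := by
  refine ⟨fun P _ _ hP hdvd => ?_, fun P _ _ b hb hP hdvd => ?_⟩
  · have hj : ∀ N : ℤ, ∃ N' : ℤ, ∀ x : LaurentSeries κ, Low N' x → Low N (lmap (algebraMap κ P) x) := fun N => ⟨N, fun x hx => hx.lmap _⟩
    rw [mul_one] at hdvd
    exact ⟨tlemma_half i hd _ hj h2 hr deg_lmap hdvd hn h, tlemma_half i hd _ hj h2 hr deg_lmap hdvd hn' h.symm⟩
  · have hj : ∀ N : ℤ, ∃ N' : ℤ, ∀ x : LaurentSeries κ, Low N' x → Low N ((lsub b hb).comp (lmap (algebraMap κ P)) x) :=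
      fun N => ⟨max N 0, fun x hx => low_lsub b hb N _ (hx.lmap _)⟩
    have hdeg : Deg ((lsub b hb).comp (lmap (algebraMap κ P))) (Module.finrank κ P * 2) := deg_lmap.comp (deg_lsub b hb)
    have hdvd' : Module.finrank κ P * 2 ∣ n := by rwa [mul_one, mul_comm] at hdvd
    rw [← RingHom.comp_assoc]
    exact ⟨tlemma_half i hd _ hj h2 hr hdeg hdvd' hn h, tlemma_half i hd _ hj h2 hr hdeg hdvd' hn' h.symm⟩

section tay
variable {k κ ℓ : Type*} [Field k] [Field κ] [Field ℓ]

/-- Taylor expansion of polynomials -/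
noncomputable def ptay (f : k →+* κ) (θ : κ) : Polynomial k →+* LaurentSeries κ :=
  (((HahnSeries.ofPowerSeries ℤ κ).comp (Polynomial.coeToPowerSeries.ringHom)).comp (Polynomial.taylorAlgHom θ).toRingHom).comp (Polynomial.mapRingHom f)

theorem ptay_apply (f : k →+* κ) (θ : κ) (p : Polynomial k) : ptay f θ p = HahnSeries.ofPowerSeries ℤ κ ((Polynomial.taylor θ (p.map f) : Polynomial κ) : PowerSeries κ) := rfl

theorem ptay_inj (f : k →+* κ) (θ : κ) : Function.Injective (ptay f θ) := by
  intro p q h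
  rw [ptay_apply, ptay_apply, HahnSeries.ofPowerSeries_injective.eq_iff, Polynomial.coe_inj, (Polynomial.taylor_injective θ).eq_iff] at h
  exact Polynomial.map_injective f f.injective h

/-- Taylor expansion x ↦ θ + t -/
noncomputable def tay (f : k →+* κ) (θ : κ) : RatFunc k →+* LaurentSeries κ := IsFractionRing.lift (ptay_inj f θ)

theorem tay_algebraMap (f : k →+* κ) (θ : κ) (p : Polynomial k) : tay f θ (algebraMap _ _ p) = ptay f θ p := IsFractionRing.lift_algebraMap _ _

theorem ptay_coeff (f : k →+* κ) (θ : κ) (p : Polynomial k) (m : ℕ) : (ptay f θ p).coeff m = (Polynomial.taylor θ (p.map f)).coeff m := by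
  rw [ptay_apply, HahnSeries.ofPowerSeries_apply_coeff, Polynomial.coeff_coe]

theorem ptay_low (f : k →+* κ) (θ : κ) (p : Polynomial k) : Low 0 (ptay f θ p) := low_powerSeries _

theorem ptay_coeff_zero (f : k →+* κ) (θ : κ) (p : Polynomial k) : (ptay f θ p).coeff 0 = p.eval₂ f θ := by
  have := ptay_coeff f θ p 0
  rw [Nat.cast_zero, Polynomial.taylor_coeff_zero, Polynomial.eval_map] at this
  exact this

theorem ptay_coeff_one (f : k →+* κ) (θ : κ) (p : Polynomial k) : (ptay f θ p).coeff 1 = p.derivative.eval₂ f θ := by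
  have := ptay_coeff f θ p 1
  rw [Nat.cast_one, Polynomial.taylor_coeff_one, Polynomial.derivative_map, Polynomial.eval_map] at this
  exact this

theorem tay_C (f : k →+* κ) (θ : κ) (c : k) : tay f θ (RatFunc.C c) = HahnSeries.C (f c) := by
  rw [← RatFunc.algebraMap_C, tay_algebraMap, ptay_apply]
  simp

theorem tay_X (f : k →+* κ) (θ : κ) : tay f θ RatFunc.X = HahnSeries.C θ + HahnSeries.single 1 1 := by
  rw [← RatFunc.algebraMap_X, tay_algebraMap, ptay_apply]
  simp [add_comm]

theorem lmap_tay (f : k →+* κ) (θ : κ) (g : κ →+* ℓ) : (lmap g).comp (tay f θ) = tay (g.comp f) (g θ) := by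
  apply rat_ext
  · intro c; rw [RingHom.comp_apply, tay_C, tay_C, lmap_C]; rfl
  · rw [RingHom.comp_apply, tay_X, tay_X, map_add, lmap_C, lmap_single, map_one]

theorem tay_rmap (g : k →+* ℓ) (f : ℓ →+* κ) (θ : κ) : (tay f θ).comp (rmap g) = tay (f.comp g) θ := by
  apply rat_ext
  · intro c; rw [RingHom.comp_apply, rmap_C, tay_C, tay_C]; rfl
  · rw [RingHom.comp_apply, rmap_X, tay_X, tay_X]

end tay

section dense
variable {k κ : Type*} [Field k] [Field κ] [Algebra k κ]

open Polynomial in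
theorem dense_poly (θ : κ) (q : k[X]) (hq0 : aeval θ q = 0) (hq1 : aeval θ q.derivative ≠ 0) (hgen : ∀ c : κ, ∃ h : k[X], aeval θ h = c) (N : ℕ) (x : LaurentSeries κ) (hx : Low 0 x) :
    ∃ p : k[X], Low N (ptay (algebraMap k κ) θ p - x) := by
  have hL1 : Low 1 (ptay (algebraMap k κ) θ q) := by
    intro w hw
    rcases (by omega : w < 0 ∨ w = 0) with h | rfl
    · exact ptay_low _ _ _ _ h
    · rw [ptay_coeff_zero]; exact hq0
  induction N with
  | zero => exact ⟨0, by rw [map_zero, zero_sub]; exact hx.neg⟩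
  | succ N ih =>
    obtain ⟨p, hp⟩ := ih
    obtain ⟨h, hh⟩ := hgen (((x - ptay (algebraMap k κ) θ p).coeff N) / (aeval θ q.derivative) ^ N)
    refine ⟨p + q ^ N * h, ?_⟩
    have hqN := hL1.pow N
    have hqh := hqN.1.mul (ptay_low (algebraMap k κ) θ h)
    have hqc := hqN.1.coeff_mul (ptay_low (algebraMap k κ) θ h)
    rw [hqN.2, ptay_coeff_zero, ptay_coeff_one] at hqc
    rw [mul_one, add_zero] at hqh hqc
    rw [map_add, map_mul, map_pow]
    intro w hw
    rw [add_sub_right_comm, HahnSeries.coeff_add]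
    push_cast at hw
    rcases (by omega : w < N ∨ w = N) with h' | rfl
    · rw [hp w h', hqh w h', add_zero]
    · rw [hqc]
      change _ + (aeval θ q.derivative) ^ N * (aeval θ h) = 0
      rw [hh, mul_div_cancel₀ _ (pow_ne_zero _ hq1), HahnSeries.coeff_sub, HahnSeries.coeff_sub]
      ring

open Polynomial in
theorem tay_dense (θ : κ) (q : k[X]) (hq0 : aeval θ q = 0) (hq1 : aeval θ q.derivative ≠ 0) (hgen : ∀ c : κ, ∃ h : k[X], aeval θ h = c) (x : LaurentSeries κ) (N : ℤ) :
    ∃ y, Low N (tay (algebraMap k κ) θ y - x) := by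
  have hL1 : Low 1 (ptay (algebraMap k κ) θ q) := by
    intro w hw
    rcases (by omega : w < 0 ∨ w = 0) with h | rfl
    · exact ptay_low _ _ _ _ h
    · rw [ptay_coeff_zero]; exact hq0
  have hc1 : (ptay (algebraMap k κ) θ q).coeff 1 ≠ 0 := by rw [ptay_coeff_one]; exact hq1
  have hne : ptay (algebraMap k κ) θ q ≠ 0 := by intro h; rw [h] at hc1; exact hc1 rfl
  have ho : (ptay (algebraMap k κ) θ q).order = 1 := hL1.order_eq hc1
  let m : ℕ := (-x.order).toNat
  have hqm : Low m (ptay (algebraMap k κ) θ q ^ m) := by simpa using (hL1.pow m).1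
  have hqi : Low (-m) (ptay (algebraMap k κ) θ q ^ m)⁻¹ := by
    have h1 := order_mul' (pow_ne_zero m hne) (inv_ne_zero (pow_ne_zero m hne))
    rw [mul_inv_cancel₀ (pow_ne_zero m hne), order_pow' hne, ho, HahnSeries.order_one] at h1
    have h2 := low_order (ptay (algebraMap k κ) θ q ^ m)⁻¹
    exact h2.mono (by omega)
  have hx : Low 0 (ptay (algebraMap k κ) θ q ^ m * x) := (hqm.mul (low_order x)).mono (by omega)
  obtain ⟨p, hp⟩ := dense_poly θ q hq0 hq1 hgen (N + m).toNat _ hx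
  refine ⟨algebraMap _ _ p / algebraMap _ _ (q ^ m), ?_⟩
  have : tay (algebraMap k κ) θ (algebraMap _ _ p / algebraMap _ _ (q ^ m)) - x = (ptay (algebraMap k κ) θ q ^ m)⁻¹ * (ptay (algebraMap k κ) θ p - ptay (algebraMap k κ) θ q ^ m * x) := by
    rw [map_div₀, tay_algebraMap, tay_algebraMap, map_pow, mul_sub, ← mul_assoc, inv_mul_cancel₀ (pow_ne_zero m hne), one_mul, div_eq_inv_mul]
  rw [this]
  exact (hqi.mul hp).mono (by omega)

end dense

end SG
end

section
open TensorProduct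

namespace SG

theorem splits_tensor_hom {K A F E : Type*} [Field K] [Ring A] [Algebra K A] {n : ℕ} [Field F] [Algebra K F] [Field E]
    (i : F →+* E) : Splits i n (F ⊗[K] A) ↔ Splits (i.comp (algebraMap K F)) n A := by
  let : Algebra F E := i.toAlgebra
  let : Algebra K E := (i.comp (algebraMap K F)).toAlgebra
  have : IsScalarTower K F E := IsScalarTower.of_algebraMap_eq (fun _ => rfl)
  exact splits_tensor_iff (K := K) (F := F) (E := E) (A := A) (n := n)

theorem sameSplit_half {K L F D D' : Type u} [Field K] [Field L] [Algebra K L] [FiniteDimensional K L] [IsPurelyInseparable K L]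
    (h2 : (2 : K) ≠ 0) {n r : ℕ} (hr : n = 2 ^ r)
    [DivisionRing D] [Algebra K D] [Algebra.IsCentral K D] [FiniteDimensional K D] (hn : Module.finrank K D = n ^ 2)
    [DivisionRing D'] [Algebra K D'] (h : SameSplit K n D D') [Field F] [Algebra K F] [Algebra L F] [IsScalarTower K L F] (hF : Module.finrank L F = n)
    (hs : Splits (algebraMap K F) n D) : Splits (algebraMap K F) n D' := by
  have hn0 := pos_of_sq hn
  have : FiniteDimensional L F := FiniteDimensional.of_finrank_pos (by omega)
  have : FiniteDimensional K F := FiniteDimensional.trans K L F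
  have h2L : (2 : L) ≠ 0 := two_ne_map (algebraMap K L) h2
  have : Algebra.IsSeparable L F := sep_of_two_pow h2L (r := r) (by rw [hF, hr])
  have e1 : Field.finSepDegree K F = n := by
    rw [← Field.finSepDegree_mul_finSepDegree_of_isAlgebraic K L F, IsPurelyInseparable.finSepDegree_eq_one K L,
      Field.finSepDegree_eq_finrank_of_isSeparable L F, hF, one_mul]
  have e2 : Module.finrank K (separableClosure K F) = n := by
    rw [← e1, Field.finSepDegree_eq]
    rfl
  have : IsPurelyInseparable (separableClosure K F) F := separableClosure.isPurelyInseparable K F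
  have h2S : (2 : separableClosure K F) ≠ 0 := two_ne_map (algebraMap K _) h2
  have hodd := odd_of_pi (k := separableClosure K F) (ℓ := F) h2S
  have hs1 : Splits (algebraMap K (separableClosure K F)) n D := splits_of_odd hn hr hodd hs
  exact (((h _ e2).mp hs1).comp (algebraMap (separableClosure K F) F)).of_eq (by rw [← IsScalarTower.algebraMap_eq])

theorem thyp_pi {K L κ D D' : Type u} [Field K] [Field L] [Algebra K L] [FiniteDimensional K L] [IsPurelyInseparable K L] [Field κ]
    (h2 : (2 : K) ≠ 0) {n r : ℕ} (hr : n = 2 ^ r)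
    [DivisionRing D] [Algebra K D] [Algebra.IsCentral K D] [FiniteDimensional K D] (hn : Module.finrank K D = n ^ 2)
    [DivisionRing D'] [Algebra K D'] [Algebra.IsCentral K D'] [FiniteDimensional K D'] (hn' : Module.finrank K D' = n ^ 2) (h : SameSplit K n D D')
    (i : L →+* LaurentSeries κ) (hd : ∀ (x : LaurentSeries κ) (N : ℤ), ∃ y, Low N (i y - x)) (h2' : (2 : κ) ≠ 0) :
    THyp (i.comp (algebraMap K L)) 1 n D D' := by
  have hodd : Odd (Module.finrank K L) := odd_of_pi h2
  have : IsSimpleRing (L ⊗[K] D) := tensor_simple K D L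
  have : IsSimpleRing (L ⊗[K] D') := tensor_simple K D' L
  let d1 : DivisionRing (L ⊗[K] D) := DivisionRing.ofIsUnitOrEqZero (odd_baseChange_isUnit hn hr hodd)
  let d2 : DivisionRing (L ⊗[K] D') := DivisionRing.ofIsUnitOrEqZero (odd_baseChange_isUnit hn' hr hodd)
  have c1 : Algebra.IsCentral L (L ⊗[K] D) := tensor_central K D L
  have c2 : Algebra.IsCentral L (L ⊗[K] D') := tensor_central K D' L
  have hS : SameSplit L n (L ⊗[K] D) (L ⊗[K] D') := by
    intro F _ _ hF
    let : Algebra K F := ((algebraMap L F).comp (algebraMap K L)).toAlgebra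
    have : IsScalarTower K L F := IsScalarTower.of_algebraMap_eq (fun _ => rfl)
    have e1 := splits_tensor_hom (K := K) (A := D) (n := n) (algebraMap L F)
    have e2 := splits_tensor_hom (K := K) (A := D') (n := n) (algebraMap L F)
    exact e1.trans (Iff.trans ⟨sameSplit_half h2 hr hn h hF, sameSplit_half h2 hr hn' h.symm hF⟩ e2.symm)
  have key := tlemma i hd h2' hr (D := L ⊗[K] D) (D' := L ⊗[K] D') (by rw [Module.finrank_baseChange, hn]) (by rw [Module.finrank_baseChange, hn']) hS
  refine ⟨fun P _ _ hP hdvd => ?_, fun P _ _ b hb hP hdvd => ?_⟩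
  · have e1 := splits_tensor_hom (K := K) (A := D) (n := n) ((lmap (algebraMap κ P)).comp i)
    have e2 := splits_tensor_hom (K := K) (A := D') (n := n) ((lmap (algebraMap κ P)).comp i)
    exact e1.symm.trans ((key.1 P hP hdvd).trans e2)
  · have e1 := splits_tensor_hom (K := K) (A := D) (n := n) ((lsub b hb).comp ((lmap (algebraMap κ P)).comp i))
    have e2 := splits_tensor_hom (K := K) (A := D') (n := n) ((lsub b hb).comp ((lmap (algebraMap κ P)).comp i))
    exact e1.symm.trans ((key.2 P b hb hP hdvd).trans e2)

/-- the local hypothesis at a place of the rational function field -/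
theorem thyp_tay {k k' κ D D' : Type u} [Field k] [Field k'] [Field κ] [Algebra k k'] [Algebra k κ] [Algebra k' κ] [IsScalarTower k k' κ]
    [FiniteDimensional k k'] [IsPurelyInseparable k k']
    (h2 : (2 : k) ≠ 0) {n r : ℕ} (hr : n = 2 ^ r)
    [DivisionRing D] [Algebra (RatFunc k) D] [Algebra.IsCentral (RatFunc k) D] [FiniteDimensional (RatFunc k) D] (hn : Module.finrank (RatFunc k) D = n ^ 2)
    [DivisionRing D'] [Algebra (RatFunc k) D'] [Algebra.IsCentral (RatFunc k) D'] [FiniteDimensional (RatFunc k) D'] (hn' : Module.finrank (RatFunc k) D' = n ^ 2)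
    (h : SameSplit (RatFunc k) n D D')
    (θ : κ) (q : Polynomial k') (hq0 : Polynomial.aeval θ q = 0) (hq1 : Polynomial.aeval θ q.derivative ≠ 0)
    (hgen : ∀ c : κ, ∃ h : Polynomial k', Polynomial.aeval θ h = c) :
    THyp (tay (algebraMap k κ) θ) 1 n D D' := by
  let : Algebra (RatFunc k) (RatFunc k') := (rmap (algebraMap k k')).toAlgebra
  have e : algebraMap (RatFunc k) (RatFunc k') = rmap (algebraMap k k') := rfl
  have := rmap_finite e
  have := rmap_pi e
  have h2K : (2 : RatFunc k) ≠ 0 := two_ne_map (algebraMap k (RatFunc k)) h2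
  have := thyp_pi h2K hr hn hn' h (tay (algebraMap k' κ) θ) (tay_dense θ q hq0 hq1 hgen) (two_ne_map (algebraMap k κ) h2)
  rw [e, tay_rmap, ← IsScalarTower.algebraMap_eq] at this
  exact this

end SG
end

section
open TensorProduct

namespace SG

theorem fixed_pi (k N : Type*) [Field k] [Field N] [Algebra k N] [FiniteDimensional k N] [Normal k N] :
    IsPurelyInseparable k (IntermediateField.fixedField (⊤ : Subgroup (N ≃ₐ[k] N))) := by
  rw [isPurelyInseparable_iff_natSepDegree_eq_one]
  intro y
  have hmin : minpoly k y = minpoly k (y : N) := (minpoly.algebraMap_eq (FaithfulSMul.algebraMap_injective _ N) y).symm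
  classical
  rw [hmin, Polynomial.natSepDegree_eq_of_splits (E := N) _ (Normal.splits inferInstance (y : N))]
  rw [Finset.card_eq_one]
  refine ⟨(y : N), ?_⟩
  ext z
  rw [Multiset.mem_toFinset, Finset.mem_singleton, Polynomial.mem_aroots]
  constructor
  · rintro ⟨h0, hz⟩
    have : IsConjRoot k (y : N) z := by
      rw [isConjRoot_iff_aeval_eq_zero (Algebra.IsIntegral.isIntegral _)]
      exact hz
    obtain ⟨σ, hσ⟩ := (isConjRoot_iff_exists_algEquiv).mp this
    have hy := y.2 ⟨σ, Subgroup.mem_top _⟩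
    have hy' : σ (y : N) = y := hy
    have hy2 : σ.symm (y : N) = y := by rw [AlgEquiv.symm_apply_eq, hy']
    exact σ.injective (hσ.trans hy'.symm)
  · rintro rfl
    exact ⟨minpoly.ne_zero (Algebra.IsIntegral.isIntegral _), minpoly.aeval _ _⟩

theorem exists_place {k ℓ : Type u} [Field k] [Field ℓ] [Algebra k ℓ] [FiniteDimensional k ℓ] (q : Polynomial ℓ) (hq : Irreducible q) :
    ∃ (N : Type u) (_ : Field N) (_ : Algebra k N) (_ : Algebra ℓ N) (_ : IsScalarTower k ℓ N) (_ : FiniteDimensional k N) (_ : Normal k N) (θ : N),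
      Polynomial.aeval θ q = 0 ∧ ∀ σ : ℓ ≃ₐ[k] ℓ, q.map (σ : ℓ →+* ℓ) = q →
        ∃ s : N ≃ₐ[k] N, s θ = θ ∧ ∀ z, s (algebraMap ℓ N z) = algebraMap ℓ N (σ z) := by
  have : Fact (Irreducible q) := ⟨hq⟩
  let E := AdjoinRoot q
  have : FiniteDimensional ℓ E := (AdjoinRoot.powerBasis hq.ne_zero).finite
  have : FiniteDimensional k E := FiniteDimensional.trans k ℓ E
  let N := IntermediateField.normalClosure k E (AlgebraicClosure E)
  let : Algebra ℓ N := ((algebraMap E N).comp (algebraMap ℓ E)).toAlgebra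
  have t1 : IsScalarTower k ℓ N := IsScalarTower.of_algebraMap_eq (fun x => by
    rw [IsScalarTower.algebraMap_apply k E N, IsScalarTower.algebraMap_apply k ℓ E]; rfl)
  refine ⟨N, inferInstance, inferInstance, inferInstance, t1, inferInstance, inferInstance, algebraMap E N (AdjoinRoot.root q), ?_, ?_⟩
  · rw [Polynomial.aeval_def]
    change Polynomial.eval₂ ((algebraMap E N).comp (algebraMap ℓ E)) _ q = 0
    rw [← Polynomial.hom_eval₂]
    erw [AdjoinRoot.eval₂_root]
    rw [map_zero]
  · intro σ hσ
    have hr : q.eval₂ ((AdjoinRoot.of q).comp (σ : ℓ →+* ℓ)) (AdjoinRoot.root q) = 0 := by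
      rw [← Polynomial.eval₂_map, hσ, AdjoinRoot.eval₂_root]
    let φ : E →+* E := AdjoinRoot.lift ((AdjoinRoot.of q).comp (σ : ℓ →+* ℓ)) (AdjoinRoot.root q) hr
    have hof : ∀ z : ℓ, φ (algebraMap ℓ E z) = algebraMap ℓ E (σ z) := fun z => AdjoinRoot.lift_of hr
    have hcom : ∀ c : k, φ (algebraMap k E c) = algebraMap k E c := fun c => by
      rw [IsScalarTower.algebraMap_apply k ℓ E, hof, σ.commutes]
    let φ' : E →ₐ[k] E := AlgHom.mk φ hcom
    have hφ : Function.Bijective φ' := Algebra.IsAlgebraic.algHom_bijective φ'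
    refine ⟨(AlgEquiv.ofBijective φ' hφ).liftNormal N, ?_, fun z => ?_⟩
    · rw [AlgEquiv.liftNormal_commutes]
      exact congrArg _ (AdjoinRoot.lift_root hr)
    · change AlgEquiv.liftNormal _ N (algebraMap E N (algebraMap ℓ E z)) = _
      rw [AlgEquiv.liftNormal_commutes]
      exact congrArg _ (hof z)

end SG
end

section
open TensorProduct

namespace SG

theorem local_chi {k ℓ D D' : Type u} [Field k] [Field ℓ] [Algebra k ℓ] [FiniteDimensional k ℓ] [IsGalois k ℓ]
    (h2 : (2 : k) ≠ 0) {n r : ℕ} (hr : n = 2 ^ r)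
    [DivisionRing D] [Algebra (RatFunc k) D] [Algebra.IsCentral (RatFunc k) D] [FiniteDimensional (RatFunc k) D] (hn : Module.finrank (RatFunc k) D = n ^ 2)
    [DivisionRing D'] [Algebra (RatFunc k) D'] [Algebra.IsCentral (RatFunc k) D'] [FiniteDimensional (RatFunc k) D'] (hn' : Module.finrank (RatFunc k) D' = n ^ 2)
    (e : D ≃ₐ[RatFunc k] Dᵐᵒᵖ)
    (hS : SameSplit (RatFunc k) n D D')
    {Φ : D →+* Matrix (Fin n) (Fin n) (RatFunc ℓ)} {ρ : (ℓ ≃ₐ[k] ℓ) → Matrix (Fin n) (Fin n) (RatFunc ℓ)} {c : (ℓ ≃ₐ[k] ℓ) → (ℓ ≃ₐ[k] ℓ) → RatFunc ℓ}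
    {Φ' : D' →+* Matrix (Fin n) (Fin n) (RatFunc ℓ)} {ρ' : (ℓ ≃ₐ[k] ℓ) → Matrix (Fin n) (Fin n) (RatFunc ℓ)} {c' : (ℓ ≃ₐ[k] ℓ) → (ℓ ≃ₐ[k] ℓ) → RatFunc ℓ}
    (h : Desc (rmap (algebraMap k ℓ)) (ratAct (galAct k ℓ)) Φ ρ c)
    (h' : Desc (rmap (algebraMap k ℓ)) (ratAct (galAct k ℓ)) Φ' ρ' c') (q : Polynomial ℓ) (hq : Irreducible q) :
    ∃ (N : Type u) (_ : Field N) (_ : Algebra ℓ N) (θ : N), Polynomial.aeval θ q = 0 ∧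
      ∀ σ : ℓ ≃ₐ[k] ℓ, q.map (σ : ℓ →+* ℓ) = q →
        chi ((ρ' σ).map (tay (algebraMap ℓ N) θ)) = chi ((ρ σ).map (tay (algebraMap ℓ N) θ)) := by
  obtain ⟨N, _, _, _, _, _, _, θ, hθ, hext⟩ := exists_place (k := k) q hq
  refine ⟨N, inferInstance, inferInstance, θ, hθ, fun σ hσ => ?_⟩
  obtain ⟨s, hsθ, hsℓ⟩ := hext σ hσ
  have hpi := fixed_pi k N
  let k' := IntermediateField.fixedField (⊤ : Subgroup (N ≃ₐ[k] N))
  have hgal : IsGalois k' N := IsGalois.of_fixed_field N (⊤ : Subgroup (N ≃ₐ[k] N))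
  let κ := IntermediateField.adjoin k' ({θ} : Set N)
  let θ' : κ := IntermediateField.AdjoinSimple.gen k' θ
  have hθ' : algebraMap κ N θ' = θ := IntermediateField.AdjoinSimple.algebraMap_gen k' θ
  have tow : IsScalarTower k κ N := IsScalarTower.of_algebraMap_eq (fun _ => rfl)
  have hint : IsIntegral k' θ := Algebra.IsIntegral.isIntegral θ
  have T : THyp (tay (algebraMap k κ) θ') 1 n D D' := by
    refine thyp_tay (k' := k') h2 hr hn hn' hS θ' (minpoly k' θ') (minpoly.aeval _ _) ?_ ?_
    · exact (Algebra.IsSeparable.isSeparable k' θ').aeval_derivative_ne_zero (minpoly.aeval _ _)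
    · intro c
      obtain ⟨f, hf⟩ := (IntermediateField.adjoin.powerBasis hint).exists_eq_aeval' c
      rw [IntermediateField.adjoin.powerBasis_gen] at hf
      exact ⟨f, hf.symm⟩
  let rr : (N ≃ₐ[κ] N) →* (ℓ ≃ₐ[k] ℓ) := (AlgEquiv.restrictNormalHom ℓ).comp (AlgEquiv.restrictScalarsHom k)
  have hrr : ∀ (ν : N ≃ₐ[κ] N) (x : ℓ), algebraMap ℓ N (rr ν x) = ν (algebraMap ℓ N x) := fun ν x =>
    AlgEquiv.restrictNormal_commutes (ν.restrictScalars k) ℓ x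
  have hj : ∀ (ν : N ≃ₐ[κ] N) (x : RatFunc ℓ), lact (galAct κ N) ν (tay (algebraMap ℓ N) θ x) =
      tay (algebraMap ℓ N) θ (ratAct (galAct k ℓ) (rr ν) x) := by
    intro ν x
    have e1 := lmap_tay (algebraMap ℓ N) θ (galAct κ N ν)
    have e2 := tay_rmap (galAct k ℓ (rr ν)) (algebraMap ℓ N) θ
    have e3 : (galAct κ N ν).comp (algebraMap ℓ N) = (algebraMap ℓ N).comp (galAct k ℓ (rr ν)) := by
      ext y
      exact (hrr ν y).symm
    have e4 : galAct κ N ν θ = θ := by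
      rw [← hθ']
      exact ν.commutes θ'
    rw [e3, e4, ← e2] at e1
    exact RingHom.congr_fun e1 x
  have e5 : (tay (algebraMap ℓ N) θ).comp (rmap (algebraMap k ℓ)) = (lmap (algebraMap κ N)).comp (tay (algebraMap k κ) θ') := by
    rw [tay_rmap, lmap_tay, hθ', ← IsScalarTower.algebraMap_eq, ← IsScalarTower.algebraMap_eq]
  have d1 := h.map (lact (galAct κ N)) (tay (algebraMap ℓ N) θ) rr hj
  have d2 := h'.map (lact (galAct κ N)) (tay (algebraMap ℓ N) θ) rr hj
  rw [e5] at d1 d2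
  have key := LC (two_ne_map (algebraMap k κ) h2) hr hn hn' d1 d2 (fun τ => chi_two hn d1 e τ) T
  have hfix : ∀ z : κ, s (algebraMap κ N z) = algebraMap κ N z := by
    intro z
    obtain ⟨f, hf⟩ := (IntermediateField.adjoin.powerBasis hint).exists_eq_aeval' z
    have hz : algebraMap κ N z = Polynomial.aeval θ f := by
      rw [hf, IntermediateField.adjoin.powerBasis_gen, ← Polynomial.aeval_algebraMap_apply, IntermediateField.AdjoinSimple.algebraMap_gen]
    rw [hz]
    have hk' : ∀ y : k', s (algebraMap k' N y) = algebraMap k' N y := fun y => y.2 ⟨s, Subgroup.mem_top _⟩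
    let s' : N →ₐ[k'] N := AlgHom.mk (s : N →+* N) hk'
    have := Polynomial.aeval_algHom_apply s' θ f
    have e7 : s' θ = θ := hsθ
    rw [e7] at this
    exact this.symm
  let s'' : N ≃ₐ[κ] N := AlgEquiv.ofBijective (AlgHom.mk (s : N →+* N) hfix) s.bijective
  have hss : rr s'' = σ := by
    ext y
    apply (algebraMap ℓ N).injective
    rw [hrr]
    exact hsℓ y
  have := key s''
  rw [hss] at this
  exact this

end SG
end

section
open TensorProduct

namespace SG

open Polynomial

theorem order_ptay {k κ : Type*} [Field k] [Field κ] (f : k →+* κ) (θ : κ) (P : k[X]) (hP : P ≠ 0) :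
    (ptay f θ P).order = ((P.map f).rootMultiplicity θ : ℤ) := by
  have h0 : P.map f ≠ 0 := (Polynomial.map_ne_zero_iff f.injective).mpr hP
  obtain ⟨R, hR, hnd⟩ := Polynomial.exists_eq_pow_rootMultiplicity_mul_and_not_dvd (P.map f) h0 θ
  set m := (P.map f).rootMultiplicity θ
  have e : ptay f θ P = ptay (RingHom.id κ) θ (P.map f) := by rw [ptay_apply, ptay_apply, Polynomial.map_id]
  have e1 : ptay (RingHom.id κ) θ (X - C θ) = HahnSeries.single 1 1 := by
    rw [ptay_apply]
    simp
  have hs : (HahnSeries.single (1:ℤ) (1:κ)) ≠ 0 := HahnSeries.single_ne_zero one_ne_zero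
  have hRc : (ptay (RingHom.id κ) θ R).coeff 0 ≠ 0 := by
    rw [ptay_coeff_zero]
    intro h
    exact hnd (Polynomial.dvd_iff_isRoot.mpr h)
  have hR0 : ptay (RingHom.id κ) θ R ≠ 0 := fun h => hRc (by rw [h]; rfl)
  rw [e, hR, map_mul, map_pow, e1, order_mul' (pow_ne_zero _ hs) hR0, order_pow' hs, (ptay_low _ _ R).order_eq hRc,
    HahnSeries.order_single one_ne_zero]
  simp

theorem root_mult_odd {k κ : Type*} [Field k] [Field κ] (f : k →+* κ) (θ : κ) (h2 : (2 : k) ≠ 0) (q : k[X]) (hq : Irreducible q) (h0 : q.eval₂ f θ = 0) :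
    Odd ((q.map f).rootMultiplicity θ) := by
  obtain ⟨p, hp⟩ := ExpChar.exists k
  have hpκ : ExpChar κ p := expChar_of_injective_ringHom f.injective p
  obtain ⟨g, hg, m, rfl⟩ := hq.hasSeparableContraction p
  rw [Polynomial.map_expand]
  have hg0 : g ≠ 0 := hg.ne_zero
  have e1 : (expand κ (p ^ m) (g.map f)).rootMultiplicity θ = p ^ m * (g.map f).rootMultiplicity (θ ^ p ^ m) := by
    cases hpκ with
    | zero => simp
    | prime hp' =>
      have := Fact.mk hp'
      rw [Polynomial.rootMultiplicity_expand_pow]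
  have e2 : (g.map f).rootMultiplicity (θ ^ p ^ m) = 1 := by
    apply le_antisymm
    · exact Polynomial.rootMultiplicity_le_one_of_separable (hg.map) _
    · rw [Nat.one_le_iff_ne_zero, ← Nat.pos_iff_ne_zero, Polynomial.rootMultiplicity_pos ((Polynomial.map_ne_zero_iff f.injective).mpr hg0)]
      rw [← Polynomial.eval_map, Polynomial.map_expand, Polynomial.expand_eval] at h0
      exact h0
  rw [e1, e2, mul_one]
  apply Odd.pow
  cases hp with
  | zero => exact odd_one
  | prime hp =>
    refine hp.odd_of_ne_two ?_
    rintro rfl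
    exact h2 (CharP.cast_eq_zero k 2)

theorem place_order {k κ : Type*} [Field k] [Field κ] (f : k →+* κ) (θ : κ) (q : k[X]) (hq : Irreducible q) (h0 : q.eval₂ f θ = 0) (P : k[X]) (hP : P ≠ 0) :
    (ptay f θ P).order = multiplicity q P * ((q.map f).rootMultiplicity θ : ℤ) := by
  obtain ⟨R, hR, hnd⟩ := (FiniteMultiplicity.of_prime_left hq.prime hP).exists_eq_pow_mul_and_not_dvd
  have hR0 : R ≠ 0 := by rintro rfl; exact hnd (dvd_zero _)
  have hcop : IsCoprime q R := (Irreducible.coprime_iff_not_dvd hq).mpr hnd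
  have hRc : (ptay f θ R).coeff 0 ≠ 0 := by
    rw [ptay_coeff_zero]
    intro h
    obtain ⟨a, b, hab⟩ := hcop
    have := congrArg (eval₂ f θ) hab
    rw [eval₂_add, eval₂_mul, eval₂_mul, h0, h] at this
    simp at this
  have i1 : ∀ P : k[X], P ≠ 0 → ptay f θ P ≠ 0 := fun P hP h => hP (ptay_inj f θ (by rw [h, map_zero]))
  have e := order_mul' (pow_ne_zero (multiplicity q P) (i1 q hq.ne_zero)) (i1 R hR0)
  rw [order_pow' (i1 q hq.ne_zero), (ptay_low _ _ R).order_eq hRc, order_ptay f θ q hq.ne_zero, ← map_pow, ← map_mul, ← hR] at e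
  rw [e, add_zero]

theorem dvd_mult {k κ : Type*} [Field k] [Field κ] (f : k →+* κ) (θ : κ) (h2 : (2 : k) ≠ 0) (q : k[X]) (hq : Irreducible q) (h0 : q.eval₂ f θ = 0) (P : k[X]) (hP : P ≠ 0)
    {n r : ℕ} (hr : n = 2 ^ r) (hd : (n : ℤ) ∣ (tay f θ (algebraMap _ _ P)).order) : n ∣ multiplicity q P := by
  rw [tay_algebraMap, place_order f θ q hq h0 P hP] at hd
  norm_cast at hd
  refine Nat.Coprime.dvd_of_dvd_mul_right ?_ hd
  rw [hr]
  exact Nat.Coprime.pow_left _ (Nat.coprime_two_left.mpr (root_mult_odd f θ h2 q hq h0))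

theorem npow_of_mult {ℓ : Type*} [Field ℓ] {n : ℕ} (hn : 0 < n) : ∀ (d : ℕ) (P : ℓ[X]), P.natDegree = d → P ≠ 0 → (∀ q : ℓ[X], q.Monic → Irreducible q → n ∣ multiplicity q P) →
    ∃ (u : ℓ) (h : ℓ[X]), u ≠ 0 ∧ h ≠ 0 ∧ P = C u * h ^ n := by
  intro d
  induction d using Nat.strong_induction_on with
  | _ d ih =>
  intro P hPd hP hm
  by_cases hu : IsUnit P
  · obtain ⟨u, hu', rfl⟩ := Polynomial.isUnit_iff.mp hu
    exact ⟨u, 1, hu'.ne_zero, one_ne_zero, by simp⟩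
  obtain ⟨q, hqm, hqi, hqd⟩ := Polynomial.exists_monic_irreducible_factor P hu
  have hmq := hm q hqm hqi
  have hfin := FiniteMultiplicity.of_prime_left hqi.prime hP
  have h1 : n ≤ multiplicity q P := Nat.le_of_dvd (dvd_iff_multiplicity_pos.mpr hqd |> fun h => h) hmq
  obtain ⟨P', rfl⟩ := (pow_dvd_pow q h1).trans (pow_multiplicity_dvd q P)
  have hP' : P' ≠ 0 := right_ne_zero_of_mul hP
  have hqn := pow_ne_zero n hqi.ne_zero
  obtain ⟨u, h, hu0, hh0, hP'e⟩ := ih P'.natDegree (by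
    rw [← hPd, Polynomial.natDegree_mul hqn hP', Polynomial.natDegree_pow]
    have := hqi.natDegree_pos
    have := Nat.mul_pos hn this
    omega) P' rfl hP' (fun q' hq'm hq'i => by
      have e := multiplicity_mul hq'i.prime (FiniteMultiplicity.of_prime_left hq'i.prime hP)
      have e2 := (FiniteMultiplicity.of_prime_left hq'i.prime hqi.ne_zero).multiplicity_pow hq'i.prime (k := n)
      have := hm q' hq'm hq'i
      rw [e, e2] at this
      exact (Nat.dvd_add_right (Dvd.intro _ rfl)).mp this)
  exact ⟨u, q * h, hu0, mul_ne_zero hqi.ne_zero hh0, by rw [hP'e]; ring⟩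

end SG
end

section
open TensorProduct

namespace SG

open Polynomial

noncomputable def vz (n : ℕ) {ℓ : Type*} [Field ℓ] (q P : ℓ[X]) : ZMod n := (multiplicity q P : ZMod n)

variable {n : ℕ} {ℓ : Type*} [Field ℓ]

theorem vz_mul {q P Q : ℓ[X]} (hq : Irreducible q) (hP : P ≠ 0) (hQ : Q ≠ 0) : vz n q (P * Q) = vz n q P + vz n q Q := by
  rw [vz, multiplicity_mul hq.prime (FiniteMultiplicity.of_prime_left hq.prime (mul_ne_zero hP hQ)), Nat.cast_add]; rfl

theorem vz_pow {q P : ℓ[X]} (hq : Irreducible q) (hP : P ≠ 0) (j : ℕ) : vz n q (P ^ j) = j * vz n q P := by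
  rw [vz, (FiniteMultiplicity.of_prime_left hq.prime hP).multiplicity_pow hq.prime, Nat.cast_mul]; rfl

theorem vz_npow {q P : ℓ[X]} (hq : Irreducible q) (hP : P ≠ 0) : vz n q (P ^ n) = 0 := by
  rw [vz_pow hq hP]; simp

theorem vz_map (e : ℓ ≃+* ℓ) (q P : ℓ[X]) : vz n (q.map (e : ℓ →+* ℓ)) (P.map (e : ℓ →+* ℓ)) = vz n q P := by
  have := multiplicity_map_eq (Polynomial.mapEquiv e) (a := q) (b := P)
  rw [Polynomial.mapEquiv_apply, Polynomial.mapEquiv_apply] at this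
  rw [vz, vz, this]

theorem vz_prod {q : ℓ[X]} (hqm : q.Monic) (hq : Irreducible q) (S : Finset ℓ[X]) (hS : ∀ p ∈ S, p.Monic ∧ Irreducible p) (m : ℓ[X] → ℕ) [DecidableEq ℓ[X]] :
    vz n q (∏ p ∈ S, p ^ m p) = if q ∈ S then (m q : ZMod n) else 0 := by
  induction S using Finset.induction_on with
  | empty => simp [vz, multiplicity_of_isUnit_right hq.not_isUnit isUnit_one]
  | insert a S ha ih =>
    have hS' : ∀ p ∈ S, p.Monic ∧ Irreducible p := fun p hp => hS p (Finset.mem_insert_of_mem hp)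
    have haI := hS a (Finset.mem_insert_self _ _)
    rw [Finset.prod_insert ha, vz_mul hq (pow_ne_zero _ haI.2.ne_zero) (Finset.prod_ne_zero_iff.mpr fun p hp => pow_ne_zero _ (hS' p hp).2.ne_zero), ih hS',
      vz_pow hq haI.2.ne_zero]
    by_cases hqa : q = a
    · subst hqa
      simp [vz, multiplicity_self, ha]
    · have : ¬ q ∣ a := fun h => hqa (Polynomial.eq_of_monic_of_associated hqm haI.1 ((hq.dvd_irreducible_iff_associated haI.2).mp h))
      have e : vz n q a = 0 := by rw [vz, multiplicity_eq_zero.mpr this, Nat.cast_zero]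
      rw [e]
      simp [hqa]

/-- a divisor-valued cocycle which is trivial on stabilisers is a coboundary -/
theorem div_glue {k : Type*} [Field k] [Algebra k ℓ] [FiniteDimensional k ℓ] (hn : 0 < n) (P : (ℓ ≃ₐ[k] ℓ) → ℓ[X]) (hP : ∀ σ, P σ ≠ 0)
    (hco : ∀ σ τ : ℓ ≃ₐ[k] ℓ, ∃ R S : ℓ[X], R ≠ 0 ∧ S ≠ 0 ∧ P (σ * τ) * R ^ n = P σ * (P τ).map (σ : ℓ →+* ℓ) * S ^ n)
    (hst : ∀ (q : ℓ[X]) (σ : ℓ ≃ₐ[k] ℓ), q.Monic → Irreducible q → q.map (σ : ℓ →+* ℓ) = q → n ∣ multiplicity q (P σ)) :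
    ∃ m : ℓ[X], m ≠ 0 ∧ ∀ σ : ℓ ≃ₐ[k] ℓ, ∃ (u : ℓ) (h : ℓ[X]), u ≠ 0 ∧ h ≠ 0 ∧ P σ * m.map (σ : ℓ →+* ℓ) * m ^ (n - 1) = C u * h ^ n := by
  classical
  have : NeZero n := ⟨hn.ne'⟩
  have hmap0 : ∀ (σ : ℓ ≃ₐ[k] ℓ) (Q : ℓ[X]), Q ≠ 0 → Q.map (σ : ℓ →+* ℓ) ≠ 0 := fun σ Q hQ => (Polynomial.map_ne_zero_iff σ.injective).mpr hQ
  have hmm : ∀ (σ τ : ℓ ≃ₐ[k] ℓ) (Q : ℓ[X]), (Q.map (τ : ℓ →+* ℓ)).map (σ : ℓ →+* ℓ) = Q.map ((σ * τ : ℓ ≃ₐ[k] ℓ) : ℓ →+* ℓ) := fun σ τ Q => by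
    rw [Polynomial.map_map]; rfl
  have hm1 : ∀ Q : ℓ[X], Q.map ((1 : ℓ ≃ₐ[k] ℓ) : ℓ →+* ℓ) = Q := fun Q => Polynomial.map_id
  have hmonic : ∀ (σ : ℓ ≃ₐ[k] ℓ) (Q : ℓ[X]), Q.Monic → (Q.map (σ : ℓ →+* ℓ)).Monic := fun σ Q h => h.map _
  have hirr : ∀ (σ : ℓ ≃ₐ[k] ℓ) (Q : ℓ[X]), Irreducible Q → Irreducible (Q.map (σ : ℓ →+* ℓ)) := fun σ Q h =>
    (MulEquiv.irreducible_iff (Polynomial.mapEquiv σ.toRingEquiv)).mpr h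
  -- cocycle rule
  have hc : ∀ (σ τ : ℓ ≃ₐ[k] ℓ) (q : ℓ[X]), Irreducible q →
      vz n (q.map (σ : ℓ →+* ℓ)) (P (σ * τ)) = vz n (q.map (σ : ℓ →+* ℓ)) (P σ) + vz n q (P τ) := by
    intro σ τ q hq
    obtain ⟨R, S, hR, hS, he⟩ := hco σ τ
    have h1 := congrArg (vz n (q.map (σ : ℓ →+* ℓ))) he
    have hq' := hirr σ q hq
    rw [vz_mul hq' (hP _) (pow_ne_zero _ hR), vz_npow hq' hR, vz_mul hq' (mul_ne_zero (hP _) (hmap0 _ _ (hP _))) (pow_ne_zero _ hS), vz_npow hq' hS,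
      vz_mul hq' (hP _) (hmap0 _ _ (hP _)), add_zero, add_zero] at h1
    rw [h1]
    congr 1
    exact vz_map σ.toRingEquiv q (P τ)
  let Sd : Setoid ℓ[X] :=
    { r := fun p q => ∃ σ : ℓ ≃ₐ[k] ℓ, p.map (σ : ℓ →+* ℓ) = q
      iseqv := ⟨fun p => ⟨1, hm1 p⟩, fun {p q} h => by
        obtain ⟨σ, rfl⟩ := h
        exact ⟨σ⁻¹, by rw [hmm, inv_mul_cancel, hm1]⟩, fun {p q s} h1 h2 => by
        obtain ⟨σ, rfl⟩ := h1
        obtain ⟨τ, rfl⟩ := h2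
        exact ⟨τ * σ, (hmm _ _ _).symm⟩⟩ }
  let rep : ℓ[X] → ℓ[X] := fun q => (Quotient.mk Sd q).out
  have hrep : ∀ q, ∃ σ : ℓ ≃ₐ[k] ℓ, (rep q).map (σ : ℓ →+* ℓ) = q := fun q => Quotient.exact (Quotient.out_eq (Quotient.mk Sd q))
  have hrep2 : ∀ (σ : ℓ ≃ₐ[k] ℓ) q, rep (q.map (σ : ℓ →+* ℓ)) = rep q := fun σ q => by
    have : Quotient.mk Sd (q.map (σ : ℓ →+* ℓ)) = Quotient.mk Sd q := (Quotient.sound ⟨σ, rfl⟩ : Quotient.mk Sd q = _).symm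
    simp only [rep, this]
  choose g hg using hrep
  have hrepI : ∀ q, Irreducible q → Irreducible (rep q) := fun q hq => by
    have h1 := hirr (g q)⁻¹ q hq
    nth_rewrite 2 [← hg q] at h1
    rwa [hmm, inv_mul_cancel, hm1] at h1
  have hrepM : ∀ q, q.Monic → (rep q).Monic := fun q hq => by
    have h1 := hmonic (g q)⁻¹ q hq
    nth_rewrite 2 [← hg q] at h1
    rwa [hmm, inv_mul_cancel, hm1] at h1
  -- well-definedness
  have hwd : ∀ (p : ℓ[X]) (σ τ : ℓ ≃ₐ[k] ℓ), p.Monic → Irreducible p → p.map (σ : ℓ →+* ℓ) = p.map (τ : ℓ →+* ℓ) →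
      vz n (p.map (σ : ℓ →+* ℓ)) (P σ) = vz n (p.map (σ : ℓ →+* ℓ)) (P τ) := by
    intro p σ τ hpm hp he
    have hs : p.map ((σ⁻¹ * τ : ℓ ≃ₐ[k] ℓ) : ℓ →+* ℓ) = p := by
      rw [← hmm, ← he, hmm, inv_mul_cancel, hm1]
    have h1 := hc σ (σ⁻¹ * τ) p hp
    have h2 : vz n p (P (σ⁻¹ * τ)) = 0 := by
      rw [vz, ZMod.natCast_eq_zero_iff]
      exact hst p _ hpm hp hs
    rw [mul_inv_cancel_left, h2, add_zero] at h1
    exact h1.symm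
  let M : ℓ[X] → ZMod n := fun q => vz n q (P (g q))
  have hM : ∀ (q : ℓ[X]) (σ : ℓ ≃ₐ[k] ℓ), q.Monic → Irreducible q → vz n (q.map (σ : ℓ →+* ℓ)) (P σ) + M q = M (q.map (σ : ℓ →+* ℓ)) := by
    intro q σ hqm hq
    have h1 := hc σ (g q) q hq
    rw [← h1]
    have h2 : (rep q).map ((g (q.map (σ : ℓ →+* ℓ)) : ℓ ≃ₐ[k] ℓ) : ℓ →+* ℓ) = q.map (σ : ℓ →+* ℓ) := by
      have := hg (q.map (σ : ℓ →+* ℓ))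
      rwa [hrep2] at this
    have h3 : (rep q).map ((σ * g q : ℓ ≃ₐ[k] ℓ) : ℓ →+* ℓ) = q.map (σ : ℓ →+* ℓ) := by
      rw [← hmm, hg]
    have := hwd (rep q) (σ * g q) (g (q.map (σ : ℓ →+* ℓ))) (hrepM q hqm) (hrepI q hq) (h3.trans h2.symm)
    rwa [h3] at this
  let Q : ℓ[X] := ∏ σ : ℓ ≃ₐ[k] ℓ, P σ
  have hQ : Q ≠ 0 := Finset.prod_ne_zero_iff.mpr fun σ _ => hP σ
  let S : Finset ℓ[X] := (UniqueFactorizationMonoid.normalizedFactors Q).toFinset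
  have hSmem : ∀ p, p ∈ S ↔ Irreducible p ∧ normalize p = p ∧ p ∣ Q := fun p => by
    rw [Multiset.mem_toFinset, UniqueFactorizationMonoid.mem_normalizedFactors_iff' hQ]
  have hS : ∀ p ∈ S, p.Monic ∧ Irreducible p := fun p hp => by
    rw [hSmem] at hp
    exact ⟨by rw [← hp.2.1]; exact Polynomial.monic_normalize hp.1.ne_zero, hp.1⟩
  have hSM : ∀ p, p.Monic → Irreducible p → p ∉ S → M p = 0 := fun p hpm hp hpS => by
    change vz n p (P (g p)) = 0
    rw [vz, multiplicity_eq_zero.mpr, Nat.cast_zero]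
    intro hd
    exact hpS ((hSmem p).mpr ⟨hp, hpm.normalize_eq_self, hd.trans (Finset.dvd_prod_of_mem P (Finset.mem_univ _))⟩)
  let m : ℓ[X] := ∏ p ∈ S, p ^ (M p).val
  have hm0 : m ≠ 0 := Finset.prod_ne_zero_iff.mpr fun p hp => pow_ne_zero _ (hS p hp).2.ne_zero
  have hvm : ∀ p : ℓ[X], p.Monic → Irreducible p → vz n p m = M p := fun p hpm hp => by
    rw [vz_prod hpm hp S hS]
    split_ifs with h
    · exact ZMod.natCast_zmod_val _
    · exact (hSM p hpm hp h).symm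
  refine ⟨m, hm0, fun σ => npow_of_mult hn _ _ rfl (mul_ne_zero (mul_ne_zero (hP σ) (hmap0 σ m hm0)) (pow_ne_zero _ hm0)) fun q hqm hq => ?_⟩
  rw [← ZMod.natCast_eq_zero_iff]
  change vz n q _ = 0
  let q' := q.map ((σ⁻¹ : ℓ ≃ₐ[k] ℓ) : ℓ →+* ℓ)
  have hqq : q = q'.map (σ : ℓ →+* ℓ) := by
    change q = (q.map ((σ⁻¹ : ℓ ≃ₐ[k] ℓ) : ℓ →+* ℓ)).map (σ : ℓ →+* ℓ)
    rw [hmm, mul_inv_cancel, hm1]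
  have hq'm := hmonic σ⁻¹ q hqm
  have hq'i := hirr σ⁻¹ q hq
  rw [vz_mul hq (mul_ne_zero (hP σ) (hmap0 σ m hm0)) (pow_ne_zero _ hm0), vz_mul hq (hP σ) (hmap0 σ m hm0), vz_pow hq hm0, hvm q hqm hq]
  have e1 : vz n q (m.map (σ : ℓ →+* ℓ)) = M q' := by
    have := vz_map (n := n) σ.toRingEquiv q' m
    rw [hvm q' hq'm hq'i] at this
    rw [hqq]; exact this
  have e2 := hM q' σ hq'm hq'i
  rw [← hqq] at e2
  rw [e1, e2, Nat.cast_sub hn]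
  simp

end SG
end

section
open TensorProduct

namespace SG

open Polynomial

theorem const_of_npow {ℓ : Type*} [Field ℓ] {n : ℕ} (hn : 0 < n) (x : RatFunc ℓ) (w : ℓ) (h : x ^ n = RatFunc.C w) : ∃ y : ℓ, x = RatFunc.C y := by
  have hi : IsIntegral ℓ[X] x := by
    refine IsIntegral.of_pow hn ?_
    rw [h, ← RatFunc.algebraMap_C]
    exact isIntegral_algebraMap
  obtain ⟨p, rfl⟩ := IsIntegrallyClosed.algebraMap_eq_of_integral hi
  rw [← RatFunc.algebraMap_C, ← map_pow, (RatFunc.algebraMap_injective ℓ).eq_iff] at h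
  have h1 := congrArg natDegree h
  rw [natDegree_pow, natDegree_C, mul_eq_zero] at h1
  have h2 : p.natDegree = 0 := h1.resolve_left hn.ne'
  refine ⟨p.coeff 0, ?_⟩
  rw [← RatFunc.algebraMap_C, ← Polynomial.eq_C_of_natDegree_eq_zero h2]

/-- polynomial representative modulo nth powers -/
theorem exists_polyRep {ℓ : Type*} [Field ℓ] {n : ℕ} (hn : 0 < n) (x : RatFunc ℓ) (hx : x ≠ 0) : ∃ P d : ℓ[X], P ≠ 0 ∧ d ≠ 0 ∧
    algebraMap ℓ[X] (RatFunc ℓ) P = x * (algebraMap ℓ[X] (RatFunc ℓ) d) ^ n := by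
  refine ⟨x.num * x.denom ^ (n - 1), x.denom, mul_ne_zero (RatFunc.num_ne_zero hx) (pow_ne_zero _ x.denom_ne_zero), x.denom_ne_zero, ?_⟩
  have hd : algebraMap ℓ[X] (RatFunc ℓ) x.denom ≠ 0 := RatFunc.algebraMap_ne_zero x.denom_ne_zero
  have e := RatFunc.num_div_denom x
  rw [div_eq_iff hd] at e
  rw [map_mul, map_pow, e, mul_assoc, ← pow_succ', Nat.sub_add_cancel hn]

theorem det_map' {A B : Type*} [Field A] [Field B] {n : ℕ} (f : A →+* B) (M : Matrix (Fin n) (Fin n) A) : (M.map f).det = f M.det := by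
  rw [RingHom.map_det, RingHom.mapMatrix_apply]

theorem glue_const {k ℓ : Type*} [Field k] [Field ℓ] [Algebra k ℓ] [FiniteDimensional k ℓ] {n : ℕ} (hn : 0 < n)
    {ρ ρ' : (ℓ ≃ₐ[k] ℓ) → Matrix (Fin n) (Fin n) (RatFunc ℓ)} {c c' : (ℓ ≃ₐ[k] ℓ) → (ℓ ≃ₐ[k] ℓ) → RatFunc ℓ}
    (h : Tw (ratAct (galAct k ℓ)) c ρ) (h' : Tw (ratAct (galAct k ℓ)) c' ρ')
    (hst : ∀ (q : ℓ[X]) (σ : ℓ ≃ₐ[k] ℓ) (P d : ℓ[X]), q.Monic → Irreducible q → q.map (σ : ℓ →+* ℓ) = q → P ≠ 0 → d ≠ 0 →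
      algebraMap ℓ[X] (RatFunc ℓ) P * (ρ σ).det = (ρ' σ).det * (algebraMap ℓ[X] (RatFunc ℓ) d) ^ n → n ∣ multiplicity q P) :
    ∃ γ : (ℓ ≃ₐ[k] ℓ) → (ℓ ≃ₐ[k] ℓ) → ℓ, (∀ σ τ, γ σ τ ≠ 0) ∧ Coh (ratAct (galAct k ℓ)) c' (fun σ τ => RatFunc.C (γ σ τ) * c σ τ) := by
  let A := algebraMap ℓ[X] (RatFunc ℓ)
  let a := ratAct (galAct k ℓ)
  have hA0 : ∀ {p : ℓ[X]}, p ≠ 0 → A p ≠ 0 := fun hp => RatFunc.algebraMap_ne_zero hp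
  have haA : ∀ σ (p : ℓ[X]), a σ (A p) = A (p.map (σ : ℓ →+* ℓ)) := fun σ p => rmap_algebraMap _ _
  have haC : ∀ σ (x : ℓ), a σ (RatFunc.C x) = RatFunc.C (σ x) := fun σ x => rmap_C _ _
  have hmul : ∀ σ τ x, a (σ * τ) x = a σ (a τ x) := fun σ τ x => act_mul a σ τ x
  have hD : ∀ σ, (ρ σ).det ≠ 0 := fun σ => det_ne_zero_of_isUnit (h.unit σ)
  have hD' : ∀ σ, (ρ' σ).det ≠ 0 := fun σ => det_ne_zero_of_isUnit (h'.unit σ)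
  let E : (ℓ ≃ₐ[k] ℓ) → RatFunc ℓ := fun σ => (ρ' σ).det / (ρ σ).det
  have hE : ∀ σ, E σ ≠ 0 := fun σ => div_ne_zero (hD' σ) (hD σ)
  have hc0 : ∀ σ τ, c σ τ ≠ 0 := fun σ τ => h.ne_zero hn σ τ
  have hc0' : ∀ σ τ, c' σ τ ≠ 0 := fun σ τ => h'.ne_zero hn σ τ
  have hEm : ∀ σ τ, E σ * a σ (E τ) = (c' σ τ / c σ τ) ^ n * E (σ * τ) := by
    intro σ τ
    have e1 := congrArg Matrix.det (h.mul σ τ)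
    have e2 := congrArg Matrix.det (h'.mul σ τ)
    rw [Matrix.det_mul, det_map', Matrix.det_smul, Fintype.card_fin] at e1 e2
    change (ρ σ).det * a σ (ρ τ).det = _ at e1
    change (ρ' σ).det * a σ (ρ' τ).det = _ at e2
    change (ρ' σ).det / (ρ σ).det * a σ ((ρ' τ).det / (ρ τ).det) = _ * ((ρ' (σ * τ)).det / (ρ (σ * τ)).det)
    rw [map_div₀, div_mul_div_comm, e1, e2, div_pow, div_mul_div_comm]
  choose P d hP hd hPd using fun σ => exists_polyRep hn (E σ) (hE σ)
  obtain ⟨m, hm, hglue⟩ := div_glue hn P hP (fun σ τ => by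
      let z : RatFunc ℓ := (c' σ τ / c σ τ) * A (d σ) * a σ (A (d τ)) / A (d (σ * τ))
      have hz : z ≠ 0 := div_ne_zero (mul_ne_zero (mul_ne_zero (div_ne_zero (hc0' _ _) (hc0 _ _)) (hA0 (hd _))) (by rw [haA]; exact hA0 ((Polynomial.map_ne_zero_iff σ.injective).mpr (hd τ)))) (hA0 (hd _))
      refine ⟨z.num, z.denom, RatFunc.num_ne_zero hz, z.denom_ne_zero, ?_⟩
      apply RatFunc.algebraMap_injective ℓ
      have hzd : A z.denom ≠ 0 := hA0 z.denom_ne_zero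
      have e0 : A z.num = z * A z.denom := by
        rw [← div_eq_iff hzd]; exact RatFunc.num_div_denom z
      have e1 : z * A (d (σ * τ)) = (c' σ τ / c σ τ) * A (d σ) * a σ (A (d τ)) := div_mul_cancel₀ _ (hA0 (hd _))
      have e2 : A ((P τ).map (σ : ℓ →+* ℓ)) = a σ (E τ) * a σ (A (d τ)) ^ n := by
        rw [← haA, ← map_pow, ← map_mul]; exact congrArg _ (hPd τ)
      rw [map_mul, map_mul, map_mul, map_pow, map_pow]
      change A (P (σ * τ)) * A z.num ^ n = A (P σ) * A ((P τ).map (σ : ℓ →+* ℓ)) * A z.denom ^ n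
      have e3 : A (P (σ * τ)) = E (σ * τ) * A (d (σ * τ)) ^ n := hPd _
      have e4 : A (P σ) = E σ * A (d σ) ^ n := hPd _
      calc A (P (σ * τ)) * A z.num ^ n = E (σ * τ) * (z * A (d (σ * τ))) ^ n * A z.denom ^ n := by rw [e3, e0]; ring
        _ = ((c' σ τ / c σ τ) ^ n * E (σ * τ)) * A (d σ) ^ n * a σ (A (d τ)) ^ n * A z.denom ^ n := by rw [e1]; ring
        _ = _ := by rw [← hEm, e4, e2]; ring)
    (fun q σ hqm hq hqσ => hst q σ (P σ) (d σ) hqm hq hqσ (hP σ) (hd σ) (by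
      rw [hPd]
      change (ρ' σ).det / (ρ σ).det * _ * _ = _
      have := hD σ
      field_simp))
  choose u g hu hg hug using hglue
  have ha0 : ∀ σ {x}, x ≠ 0 → a σ x ≠ 0 := fun σ x hx => (_root_.map_ne_zero (a σ)).mpr hx
  have hC0 : ∀ {x : ℓ}, x ≠ 0 → (RatFunc.C x : RatFunc ℓ) ≠ 0 := fun hx => (_root_.map_ne_zero _).mpr hx
  let f : (ℓ ≃ₐ[k] ℓ) → RatFunc ℓ := fun σ => A (d σ) * A m / A (g σ)
  have hf0 : ∀ σ, f σ ≠ 0 := fun σ => div_ne_zero (mul_ne_zero (hA0 (hd σ)) (hA0 hm)) (hA0 (hg σ))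
  have hf : ∀ σ, f σ ^ n * E σ * a σ (A m) = RatFunc.C (u σ) * A m := by
    intro σ
    have e1 := congrArg A (hug σ)
    rw [map_mul, map_mul, map_mul, map_pow, map_pow, ← haA] at e1
    change _ = RatFunc.C (u σ) * _ at e1
    have e4 : A (P σ) = E σ * A (d σ) ^ n := hPd _
    have hg' := pow_ne_zero n (hA0 (hg σ))
    have hmn : A m ^ n = A m ^ (n - 1) * A m := by rw [← pow_succ, Nat.sub_add_cancel hn]
    change (A (d σ) * A m / A (g σ)) ^ n * E σ * a σ (A m) = _
    rw [div_pow, mul_pow, hmn]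
    rw [e4] at e1
    field_simp
    linear_combination (A m) * e1
  let γ : (ℓ ≃ₐ[k] ℓ) → (ℓ ≃ₐ[k] ℓ) → RatFunc ℓ := fun σ τ => f σ * a σ (f τ) * c' σ τ / (c σ τ * f (σ * τ))
  have hγ0 : ∀ σ τ, γ σ τ ≠ 0 := fun σ τ => div_ne_zero (mul_ne_zero (mul_ne_zero (hf0 _) (ha0 _ (hf0 _))) (hc0' _ _)) (mul_ne_zero (hc0 _ _) (hf0 _))
  have hγn : ∀ σ τ, γ σ τ ^ n = RatFunc.C (u σ * σ (u τ) / u (σ * τ)) := by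
    intro σ τ
    have e1 := hf σ
    have e2 := congrArg (a σ) (hf τ)
    have e3 := hf (σ * τ)
    have e4 := hEm σ τ
    rw [map_mul, map_mul, map_mul, map_pow, haC, ← hmul] at e2
    have n1 := hf0 (σ * τ)
    have n2 := hc0 σ τ
    have n3 := hE (σ * τ)
    have n4 : a (σ * τ) (A m) ≠ 0 := ha0 _ (hA0 hm)
    have n5 : a σ (A m) ≠ 0 := ha0 _ (hA0 hm)
    have n6 : A m ≠ 0 := hA0 hm
    have n7 := hC0 (hu (σ * τ))
    rw [map_div₀, map_mul]
    change (f σ * a σ (f τ) * c' σ τ / (c σ τ * f (σ * τ))) ^ n = _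
    have e5 : (f σ * a σ (f τ) * c' σ τ / (c σ τ * f (σ * τ))) ^ n = f σ ^ n * a σ (f τ) ^ n * (c' σ τ / c σ τ) ^ n / f (σ * τ) ^ n := by
      generalize f σ = x1
      generalize a σ (f τ) = x2
      generalize f (σ * τ) = x3
      rw [div_pow, div_pow, mul_pow, mul_pow, mul_pow, mul_div_assoc', div_div]
    rw [e5, div_eq_div_iff (pow_ne_zero _ n1) n7]
    apply mul_right_cancel₀ (mul_ne_zero (mul_ne_zero n3 n4) (mul_ne_zero n5 n6))
    generalize a (σ * τ) (A m) = y1 at *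
    generalize a σ (A m) = y2 at *
    generalize (c' σ τ / c σ τ) ^ n = y3 at *
    generalize a σ (f τ) ^ n = y4 at *
    generalize f σ ^ n = y5 at *
    generalize f (σ * τ) ^ n = y6 at *
    generalize a σ (E τ) = y7 at *
    generalize E (σ * τ) = y8 at *
    generalize E σ = y9 at *
    generalize A m = y10 at *
    generalize RatFunc.C (u σ) = z1 at *
    generalize RatFunc.C (σ (u τ)) = z2 at *
    generalize RatFunc.C (u (σ * τ)) = z3 at *
    -- y5*y9*y2 = z1*y10 ; y4*y7*y1 = z2*y2 ; y6*y8*y1 = z3*y10 ; y9*y7 = y3*y8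
    calc y5 * y4 * y3 * z3 * (y8 * y1 * (y2 * y10)) = y5 * y4 * (y3 * y8) * y1 * y2 * (z3 * y10) := by ring
      _ = (y5 * y9 * y2) * (y4 * y7 * y1) * (y6 * y8 * y1) := by rw [← e4, ← e3]; ring
      _ = z1 * z2 * y6 * (y8 * y1 * (y2 * y10)) := by rw [e1, e2]; ring
  choose γ0 hγ using fun σ τ => const_of_npow hn (γ σ τ) _ (hγn σ τ)
  refine ⟨γ0, fun σ τ h0 => hγ0 σ τ (by rw [hγ, h0, map_zero]), f, hf0, fun σ τ => ?_⟩
  change RatFunc.C (γ0 σ τ) * c σ τ * f (σ * τ) = f σ * a σ (f τ) * c' σ τ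
  rw [← hγ]
  change f σ * a σ (f τ) * c' σ τ / (c σ τ * f (σ * τ)) * c σ τ * f (σ * τ) = _
  have n1 := hf0 (σ * τ)
  have n2 := hc0 σ τ
  rw [mul_assoc, div_mul_cancel₀ _ (mul_ne_zero n2 n1)]

end SG
end

section
open TensorProduct

namespace SG

theorem hst_of_chi {ℓ N : Type u} [Field ℓ] [Field N] [Algebra ℓ N] (θ : N) (h2 : (2 : ℓ) ≠ 0) {n r : ℕ} (hr : n = 2 ^ r)
    {M M' : Matrix (Fin n) (Fin n) (RatFunc ℓ)} (hM : IsUnit M) (hM' : IsUnit M') (q P d : Polynomial ℓ) (hq : Irreducible q) (h0 : Polynomial.aeval θ q = 0)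
    (hP : P ≠ 0) (hd : d ≠ 0) (hchi : chi (M'.map (tay (algebraMap ℓ N) θ)) = chi (M.map (tay (algebraMap ℓ N) θ)))
    (he : algebraMap (Polynomial ℓ) (RatFunc ℓ) P * M.det = M'.det * algebraMap (Polynomial ℓ) (RatFunc ℓ) d ^ n) : n ∣ multiplicity q P := by
  apply dvd_mult (algebraMap ℓ N) θ h2 q hq h0 P hP hr
  let j := tay (algebraMap ℓ N) θ
  have inj : ∀ x, x ≠ 0 → j x ≠ 0 := fun x hx => (map_ne_zero j).mpr hx
  have hPx : algebraMap (Polynomial ℓ) (RatFunc ℓ) P ≠ 0 := RatFunc.algebraMap_ne_zero hP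
  have hdx : algebraMap (Polynomial ℓ) (RatFunc ℓ) d ≠ 0 := RatFunc.algebraMap_ne_zero hd
  rw [chi, chi, det_map', det_map', ZMod.intCast_eq_intCast_iff_dvd_sub] at hchi
  have h1 := congrArg (fun x => (j x).order) he
  simp only [map_mul, map_pow] at h1
  rw [order_mul' (inj _ hPx) (inj _ (det_ne_zero_of_isUnit hM)), order_mul' (inj _ (det_ne_zero_of_isUnit hM')) (pow_ne_zero _ (inj _ hdx)), order_pow' (inj _ hdx)] at h1
  change (n : ℤ) ∣ (j _).order
  change (n : ℤ) ∣ (j _).order - (j _).order at hchi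
  have h3 : (j (algebraMap (Polynomial ℓ) (RatFunc ℓ) P)).order = (n : ℤ) * (j (algebraMap (Polynomial ℓ) (RatFunc ℓ) d)).order - ((j M.det).order - (j M'.det).order) := by linarith
  rw [h3]
  exact dvd_sub (Dvd.intro _ rfl) hchi

theorem exists_good_point {k ℓ : Type u} [Field k] [Field ℓ] [Algebra k ℓ] [Infinite k] (s : Finset (RatFunc ℓ)) (hs : ∀ x ∈ s, x ≠ 0) :
    ∃ a : k, ∀ x ∈ s, (tay (RingHom.id ℓ) (algebraMap k ℓ a) x).order = 0 := by
  classical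
  let Q : Polynomial ℓ := ∏ x ∈ s, (x.num * x.denom)
  have hQ : Q ≠ 0 := Finset.prod_ne_zero_iff.mpr (fun x hx => mul_ne_zero (RatFunc.num_ne_zero (hs x hx)) (RatFunc.denom_ne_zero x))
  have hfin : ((Q.roots.toFinset : Set ℓ)).Finite := Finset.finite_toSet _
  have hpre : ((algebraMap k ℓ) ⁻¹' (Q.roots.toFinset : Set ℓ)).Finite := hfin.preimage (algebraMap k ℓ).injective.injOn
  obtain ⟨a, ha⟩ := hpre.exists_notMem
  refine ⟨a, fun x hx => ?_⟩
  have hev : Q.eval (algebraMap k ℓ a) ≠ 0 := by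
    intro h
    apply ha
    simp [hQ, h]
  rw [Polynomial.eval_prod, Finset.prod_ne_zero_iff] at hev
  have hx' := hev x hx
  rw [Polynomial.eval_mul] at hx'
  have key : ∀ p : Polynomial ℓ, p.eval (algebraMap k ℓ a) ≠ 0 → (tay (RingHom.id ℓ) (algebraMap k ℓ a) (algebraMap _ _ p)).order = 0 := by
    intro p hp
    rw [tay_algebraMap]
    apply (ptay_low _ _ _).order_eq
    rw [ptay_coeff_zero]
    exact hp
  have h1 := key _ (left_ne_zero_of_mul hx')
  have h2 := key _ (right_ne_zero_of_mul hx')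
  have h3 : algebraMap (Polynomial ℓ) (RatFunc ℓ) x.num = x * algebraMap (Polynomial ℓ) (RatFunc ℓ) x.denom := by
    have hd : algebraMap (Polynomial ℓ) (RatFunc ℓ) x.denom ≠ 0 := RatFunc.algebraMap_ne_zero (RatFunc.denom_ne_zero x)
    have := RatFunc.num_div_denom x
    exact (div_eq_iff hd).mp this
  rw [h3, map_mul, order_mul' ((map_ne_zero _).mpr (hs x hx)) ((map_ne_zero _).mpr (RatFunc.algebraMap_ne_zero (RatFunc.denom_ne_zero x))), h2, add_zero] at h1
  exact h1

/-- over a finite field the Brauer group is trivial -/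
theorem coh_one_finite {k ℓ : Type u} [Field k] [Field ℓ] [Algebra k ℓ] [FiniteDimensional k ℓ] [IsGalois k ℓ] [Finite k]
    {γ : (ℓ ≃ₐ[k] ℓ) → (ℓ ≃ₐ[k] ℓ) → ℓ} (hγ : ∀ σ τ, γ σ τ ≠ 0) (hco : ∀ σ τ υ, galAct k ℓ σ (γ τ υ) * γ σ (τ * υ) = γ σ τ * γ (σ * τ) υ) :
    Coh (galAct k ℓ) (fun _ _ => 1) γ := by
  obtain ⟨d, W, Δ, iΔ, _, Ψ, hd0, hfd, hcen, hd, hW, hs⟩ := exists_Delta (galAct_isGal k ℓ) hγ hco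
  have : Finite Δ := Module.finite_of_finite k
  have hcomm : ∀ x y : Δ, x * y = y * x := (littleWedderburn Δ).mul_comm
  have hd1 : Module.finrank k Δ = 1 := by
    refine finrank_eq_one 1 one_ne_zero (fun w => ?_)
    have : w ∈ Subalgebra.center k Δ := Subalgebra.mem_center_iff.mpr (fun b => hcomm _ _)
    obtain ⟨y, hy⟩ := Algebra.mem_bot.mp (hcen.out this)
    exact ⟨y, by rw [← hy, Algebra.algebraMap_eq_smul_one]⟩
  have hd' : d = 1 := by
    rw [hd1] at hd
    exact (Nat.pow_eq_one.mp hd.symm).resolve_right two_ne_zero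
  subst hd'
  have hdet : ∀ σ, W σ 0 0 ≠ 0 := fun σ => by
    have := det_ne_zero_of_isUnit (hW.tw.unit σ)
    rwa [Matrix.det_fin_one] at this
  refine ⟨fun σ => W σ 0 0, hdet, fun σ τ => ?_⟩
  have := congrFun (congrFun (hW.tw.mul σ τ) 0) 0
  rw [Matrix.mul_apply] at this
  simp at this
  rw [mul_one]
  exact this.symm

end SG
end

section
open TensorProduct

namespace SG

theorem mk_cda {K : Type u} [Field K] {n : ℕ} {D : Type u} [DivisionRing D] [Algebra K D] (h1 : FiniteDimensional K D) (h2 : Algebra.IsCentral K D) (h3 : Module.finrank K D = n ^ 2) :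
    IsCentralDivisionAlgebraOfDegree K n D := ⟨h1, le_bot_iff.mp h2.out, h3⟩

theorem coh_one_infinite {k ℓ D D' : Type u} [Field k] [Field ℓ] [Algebra k ℓ] [FiniteDimensional k ℓ] [IsGalois k ℓ] [Infinite k]
    (hk : HasTrivialGenusExpTwo k)
    (h2 : (2 : k) ≠ 0) {n r : ℕ} (hr : n = 2 ^ r)
    [DivisionRing D] [Algebra (RatFunc k) D] [Algebra.IsCentral (RatFunc k) D] [FiniteDimensional (RatFunc k) D] (hn : Module.finrank (RatFunc k) D = n ^ 2)
    [DivisionRing D'] [Algebra (RatFunc k) D'] [Algebra.IsCentral (RatFunc k) D'] [FiniteDimensional (RatFunc k) D'] (hn' : Module.finrank (RatFunc k) D' = n ^ 2)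
    (e : D ≃ₐ[RatFunc k] Dᵐᵒᵖ)
    (hS : SameSplit (RatFunc k) n D D')
    {Φ : D →+* Matrix (Fin n) (Fin n) (RatFunc ℓ)} {ρ : (ℓ ≃ₐ[k] ℓ) → Matrix (Fin n) (Fin n) (RatFunc ℓ)} {c : (ℓ ≃ₐ[k] ℓ) → (ℓ ≃ₐ[k] ℓ) → RatFunc ℓ}
    {Φ' : D' →+* Matrix (Fin n) (Fin n) (RatFunc ℓ)} {ρ' : (ℓ ≃ₐ[k] ℓ) → Matrix (Fin n) (Fin n) (RatFunc ℓ)} {γ : (ℓ ≃ₐ[k] ℓ) → (ℓ ≃ₐ[k] ℓ) → ℓ}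
    (h : Desc (rmap (algebraMap k ℓ)) (ratAct (galAct k ℓ)) Φ ρ c)
    (h' : Desc (rmap (algebraMap k ℓ)) (ratAct (galAct k ℓ)) Φ' ρ' (fun σ τ => RatFunc.C (γ σ τ) * c σ τ)) :
    Coh (galAct k ℓ) (fun _ _ => 1) γ := by
  classical
  have hn0 := pos_of_sq hn
  obtain ⟨a, ha⟩ := exists_good_point (k := k) (Finset.univ.image (fun σ : ℓ ≃ₐ[k] ℓ => (ρ σ).det) ∪ Finset.univ.image (fun σ : ℓ ≃ₐ[k] ℓ => (ρ' σ).det)) (by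
    intro x hx
    simp only [Finset.mem_union, Finset.mem_image, Finset.mem_univ, true_and] at hx
    rcases hx with ⟨σ, rfl⟩ | ⟨σ, rfl⟩
    · exact det_ne_zero_of_isUnit (h.tw.unit σ)
    · exact det_ne_zero_of_isUnit (h'.tw.unit σ))
  let j := tay (RingHom.id ℓ) (algebraMap k ℓ a)
  have T : THyp (tay (algebraMap k k) a) 1 n D D' := by
    refine thyp_tay (k' := k) h2 hr hn hn' hS a (Polynomial.X - Polynomial.C a) (by simp) (by simp) (fun c => ⟨Polynomial.C c, by simp⟩)
  have hj : ∀ (ν : ℓ ≃ₐ[k] ℓ) (x : RatFunc ℓ), lact (galAct k ℓ) ν (j x) = j (ratAct (galAct k ℓ) (MonoidHom.id _ ν) x) := by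
    intro ν x
    have e1 := lmap_tay (RingHom.id ℓ) (algebraMap k ℓ a) (galAct k ℓ ν)
    have e2 := tay_rmap (galAct k ℓ ν) (RingHom.id ℓ) (algebraMap k ℓ a)
    have e4 : galAct k ℓ ν (algebraMap k ℓ a) = algebraMap k ℓ a := ν.commutes a
    rw [e4, RingHom.comp_id] at e1
    rw [RingHom.id_comp] at e2
    rw [← e2] at e1
    exact RingHom.congr_fun e1 x
  have e5 : j.comp (rmap (algebraMap k ℓ)) = (lmap (algebraMap k ℓ)).comp (tay (algebraMap k k) a) := by
    rw [tay_rmap, lmap_tay, RingHom.id_comp, Algebra.algebraMap_self, RingHom.comp_id]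
  have d1 := h.map (lact (galAct k ℓ)) j (MonoidHom.id _) hj
  have d2 := h'.map (lact (galAct k ℓ)) j (MonoidHom.id _) hj
  rw [e5] at d1 d2
  have x1 : ∀ σ : ℓ ≃ₐ[k] ℓ, chi ((ρ (MonoidHom.id _ σ)).map j) = 0 := by
    intro σ
    rw [chi, det_map', ha _ (Finset.mem_union_left _ (Finset.mem_image_of_mem _ (Finset.mem_univ _))), Int.cast_zero]
  have x2 : ∀ σ : ℓ ≃ₐ[k] ℓ, chi ((ρ' (MonoidHom.id _ σ)).map j) = 0 := by
    intro σ
    rw [chi, det_map', ha _ (Finset.mem_union_right _ (Finset.mem_image_of_mem _ (Finset.mem_univ _))), Int.cast_zero]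
  obtain ⟨f, c0, d, W, Δ, _, _, Ψ, hf, hc0, hfc, hfd, hcen, hd, hW, -, hdn, hsp⟩ := lcDelta h2 hr hn d1 x1
  obtain ⟨f', c0', d', W', Δ', _, _, Ψ', hf', hc0', hfc', hfd', hcen', hd', hW', -, hdn', hsp'⟩ := lcDelta h2 hr hn' d2 x2
  have tr : ∀ (P : Type u) [Field P] [Algebra k P], FiniteDimensional k P → Module.finrank k P ∣ n →
      (Splits (algebraMap k P) d Δ ↔ Splits (algebraMap k P) d' Δ') := by
    intro P _ _ hP hPn
    exact (hsp P).1.symm.trans ((T.1 P hP (by rwa [mul_one])).trans (hsp' P).1)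
  have hd0 := pos_of_sq hd
  have hd0' := pos_of_sq hd'
  have hdd : d = d' := by
    apply Nat.dvd_antisymm
    · obtain ⟨P, _, _, hP, hs⟩ := exists_max_subfield hd'
      have : FiniteDimensional k P := FiniteDimensional.of_finrank_pos (by omega)
      have := finrank_dvd_of_splits hd ((tr P this (by rwa [hP])).mpr hs)
      rwa [hP] at this
    · obtain ⟨P, _, _, hP, hs⟩ := exists_max_subfield hd
      have : FiniteDimensional k P := FiniteDimensional.of_finrank_pos (by omega)
      have := finrank_dvd_of_splits hd' ((tr P this (by rwa [hP])).mp hs)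
      rwa [hP] at this
  subst hdd
  have hsame : SameMaximalSubfields k d Δ Δ' := by
    intro F _ _ hF
    have hFf : FiniteDimensional k F := FiniteDimensional.of_finrank_pos (by omega)
    have := tr F hFf (by rwa [hF])
    exact ⟨fun ⟨g⟩ => embed_of_splits hd' hF (this.mp (splits_of_embed hd hF g)), fun ⟨g⟩ => embed_of_splits hd hF (this.mpr (splits_of_embed hd' hF g))⟩
  have jc : Coh (lact (galAct k ℓ)) (fun σ τ => j (c σ τ)) (fun σ τ => HahnSeries.C (c0 σ τ)) := ⟨f, hf, hfc⟩
  have jc' : Coh (lact (galAct k ℓ)) (fun σ τ => j (RatFunc.C (γ σ τ) * c σ τ)) (fun σ τ => HahnSeries.C (c0' σ τ)) := ⟨f', hf', hfc'⟩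
  have hcne : ∀ σ τ, c σ τ ≠ 0 := h.tw.ne_zero hn0
  -- exponent two
  have hop : Nonempty (Δ ≃ₐ[k] Δᵐᵒᵖ) := by
    obtain ⟨Ψo, hWo⟩ := hW.op hd0
    refine formIso (galAct_isGal k ℓ) hd ?_ hW hWo ?_
    · rw [← hd]
      exact (MulOpposite.opLinearEquiv k).finrank_eq.symm
    · have y1 : Coh (lact (galAct k ℓ)) (fun σ τ => j (c σ τ)) (fun σ τ => (j (c σ τ))⁻¹) := d1.coh_inv hn e
      rw [← coh_C_iff]
      -- invert the relation
      obtain ⟨f1, hf1, hfc1⟩ := jc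
      have y4 : Coh (lact (galAct k ℓ)) (fun σ τ => (j (c σ τ))⁻¹) (fun σ τ => (HahnSeries.C (c0 σ τ) : LaurentSeries ℓ)⁻¹) := by
        refine ⟨fun σ => (f1 σ)⁻¹, fun σ => inv_ne_zero (hf1 σ), fun σ τ => ?_⟩
        have := congrArg (fun x => x⁻¹) (hfc1 σ τ)
        simpa only [mul_inv, map_inv₀] using this
      have y5 := (Coh.symm ⟨f1, hf1, hfc1⟩).trans (y1.trans y4)
      simpa only [map_inv₀] using y5
  obtain ⟨g⟩ := hk d Δ Δ' (mk_cda hfd hcen hd) hop (mk_cda hfd' hcen' hd') hsame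
  have q1 : Coh (galAct k ℓ) c0 c0' := hW.coh hd (hW'.comp_alg g.toAlgHom)
  have q2 := jc.trans ((coh_C_iff.mpr q1).trans jc'.symm)
  rw [← coh_C_iff]
  have q3 := q2.mul (Coh.refl (a := lact (galAct k ℓ)) (c := fun σ τ => (j (c σ τ))⁻¹))
  have z1 : (fun σ τ => j (c σ τ) * (j (c σ τ))⁻¹) = fun σ τ => (HahnSeries.C (1 : ℓ) : LaurentSeries ℓ) := by
    funext σ τ
    rw [mul_inv_cancel₀ ((map_ne_zero j).mpr (hcne σ τ)), map_one]
  have z2 : (fun σ τ => j (RatFunc.C (γ σ τ) * c σ τ) * (j (c σ τ))⁻¹) = fun σ τ => (HahnSeries.C (γ σ τ) : LaurentSeries ℓ) := by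
    funext σ τ
    rw [map_mul, mul_assoc, mul_inv_cancel₀ ((map_ne_zero j).mpr (hcne σ τ)), mul_one, tay_C]
    rfl
  rw [z1, z2] at q3
  exact q3

end SG
end

section
open TensorProduct

namespace SG

theorem iso_of_sameSplit {k D D' : Type u} [Field k] (hk : HasTrivialGenusExpTwo k)
    (h2 : (2 : k) ≠ 0) {n r : ℕ} (hr : n = 2 ^ r)
    [DivisionRing D] [Algebra (RatFunc k) D] [Algebra.IsCentral (RatFunc k) D] [FiniteDimensional (RatFunc k) D] (hn : Module.finrank (RatFunc k) D = n ^ 2)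
    [DivisionRing D'] [Algebra (RatFunc k) D'] [Algebra.IsCentral (RatFunc k) D'] [FiniteDimensional (RatFunc k) D'] (hn' : Module.finrank (RatFunc k) D' = n ^ 2)
    (e : D ≃ₐ[RatFunc k] Dᵐᵒᵖ)
    (hS : SameSplit (RatFunc k) n D D') : Nonempty (D ≃ₐ[RatFunc k] D') := by
  have hn0 := pos_of_sq hn
  obtain ⟨ℓ, _, _, hfd, hgal, ⟨Φ, hΦ⟩, ⟨Φ', hΦ'⟩⟩ := exists_common_split h2 hn hr hn'
  let : Algebra (RatFunc k) (RatFunc ℓ) := (rmap (algebraMap k ℓ)).toAlgebra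
  have hg : IsGal (RatFunc k) (ratAct (galAct k ℓ)) := ratAct_isGal (galAct_isGal k ℓ) rfl
  obtain ⟨ρ, c, h⟩ := exists_desc hn hΦ hg.fixed
  obtain ⟨ρ', c', h'⟩ := exists_desc hn' hΦ' hg.fixed
  obtain ⟨γ, hγ, hcoh⟩ := glue_const hn0 h.tw h'.tw (by
    intro q σ P d _ hq hσ hP hd he
    obtain ⟨N, _, _, θ, hθ, hN⟩ := local_chi h2 hr hn hn' e hS h h' q hq
    exact hst_of_chi θ (two_ne_map (algebraMap k ℓ) h2) hr (h.tw.unit σ) (h'.tw.unit σ) q P d hq hθ hP hd (hN σ hσ) he)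
  have hcoh2 := hcoh
  obtain ⟨f, hf, hfc⟩ := hcoh
  have h'' := h'.rescale f hf hfc
  have hcne := h.tw.ne_zero hn0
  have hone : Coh (galAct k ℓ) (fun _ _ => 1) γ := by
    rcases finite_or_infinite k with hfin | hinf
    · refine coh_one_finite hγ (fun σ τ υ => ?_)
      have c1 := h.tw.cocycle hn0 σ τ υ
      have c2 := h''.tw.cocycle hn0 σ τ υ
      have e1 : ratAct (galAct k ℓ) σ (RatFunc.C (γ τ υ)) = RatFunc.C (galAct k ℓ σ (γ τ υ)) := rmap_C _ _
      rw [map_mul, e1] at c2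
      apply RatFunc.C_injective
      rw [map_mul, map_mul]
      have ne := mul_ne_zero (hcne σ τ) (hcne (σ * τ) υ)
      apply mul_right_cancel₀ ne
      calc _ = RatFunc.C (galAct k ℓ σ (γ τ υ)) * RatFunc.C (γ σ (τ * υ)) * (ratAct (galAct k ℓ) σ (c τ υ) * c σ (τ * υ)) := by rw [c1]
        _ = _ := by rw [mul_mul_mul_comm, c2, mul_mul_mul_comm]
    · exact coh_one_infinite hk h2 hr hn hn' e hS h h''
  have hlift : Coh (ratAct (galAct k ℓ)) (fun _ _ => 1) (fun σ τ => RatFunc.C (γ σ τ)) := by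
    obtain ⟨w, hw, hwc⟩ := hone
    refine ⟨fun σ => RatFunc.C (w σ), fun σ => (map_ne_zero _).mpr (hw σ), fun σ τ => ?_⟩
    have e1 : ratAct (galAct k ℓ) σ (RatFunc.C (w τ)) = RatFunc.C (galAct k ℓ σ (w τ)) := rmap_C _ _
    rw [e1, ← map_mul, hwc σ τ, mul_one, mul_one, map_mul]
  have h3 := hlift.mul (Coh.refl (a := ratAct (galAct k ℓ)) (c := c))
  simp only [one_mul] at h3
  exact formIso hg hn hn' h h' (h3.trans hcoh2.symm)

end SG
end

/-- Stability Theorem: if every central division algebra of exponent 2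
over a field `k` of characteristic `≠ 2` has trivial genus, then the same holds
over the rational function field `k(x)`. -/
theorem stability_theorem_genus_exponent_two
    (k : Type u) [Field k] (hchar : ringChar k ≠ 2)
    (hk : HasTrivialGenusExpTwo k) :
    HasTrivialGenusExpTwo (RatFunc k) := by
  intro n D _ _ D' _ _ hD hop hD' hsame
  obtain ⟨e⟩ := hop
  obtain ⟨_, hc, hn⟩ := hD
  obtain ⟨_, hc', hn'⟩ := hD'
  have : Algebra.IsCentral (RatFunc k) D := ⟨hc.le⟩
  have : Algebra.IsCentral (RatFunc k) D' := ⟨hc'.le⟩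
  have h2 : (2 : k) ≠ 0 := Ring.two_ne_zero hchar
  obtain ⟨r, hr⟩ := SG.two_power hn e
  refine SG.iso_of_sameSplit hk h2 hr hn hn' e ?_
  intro F _ _ hF
  have := hsame F hF
  constructor
  · intro h
    obtain ⟨g⟩ := this.mp (SG.embed_of_splits hn hF h)
    exact SG.splits_of_embed hn' hF g
  · intro h
    obtain ⟨g⟩ := this.mpr (SG.embed_of_splits hn' hF h)
    exact SG.splits_of_embed hn hF g
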